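/- Let S = (X, {(V_i, C_i)}_{i=1}^m) be a constraint system over a finite alphabet Σ, let π be a strictly positive probability distribution on [m], and let G(S,π) be the constraint-variable CS game. If c is a commuting operator correlation for G(S,π) with w_{G(S,π)}(c) ≥ 1 − ε, then there exists a tracial correlation c′ for G(S,π) — i.e. a complex Hilbert space K, a unit vector ξ, and PVMs of orthogonal projections {r^i_φ}_{φ∈C_i} (i ∈ [m]) and {r^x_σ}_{σ∈Σ} (x ∈ X) on K with ⟨ξ, u v ξ⟩ = ⟨ξ, v u ξ⟩ for all u, v in the unital *-subalgebra generated by all these projections, and c′(φ,σ|i,x) = ⟨ξ, r^i_φ r^x_σ ξ⟩ — such that w_{G(S,π)}(c′) ≥ 1 − 148(Lε)^{1/4}, where L = max_{i∈[m]} |V_i|. -/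

import Mathlib

namespace CSGame

open Complex
open scoped InnerProductSpace


section RealSubspace

open ClosedSubmodule

variable {H : Type*} [NormedAddCommGroup H] [InnerProductSpace ℂ H]
  (K : Submodule ℝ H) [K.HasOrthogonalProjection]

/-- Two vectors agree in inner product as soon as the real parts of a family stable under
multiplication by `I` agree. -/
lemma complex_eq_of_re {z w : ℂ} (h1 : z.re = w.re) (h2 : (I * z).re = (I * w).re) : z = w := by
  apply Complex.ext h1
  simpa using h2

lemma starProjection_re_inner (x y : H) :
    (⟪K.starProjection x, y⟫_ℂ).re = (⟪x, K.starProjection y⟫_ℂ).re :=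
  K.inner_starProjection_left_eq_right x y

lemma starProjection_starProjection (x : H) :
    K.starProjection (K.starProjection x) = K.starProjection x :=
  K.starProjection_eq_self_iff.2 (K.starProjection_apply_mem x)

lemma starProjection_re_inner_self (x : H) :
    (⟪K.starProjection x, x⟫_ℂ).re = ‖K.starProjection x‖ ^ 2 := by
  rw [← starProjection_starProjection, starProjection_re_inner, starProjection_starProjection]
  exact (norm_sq_eq_re_inner (𝕜 := ℂ) _).symm

/-- The sum of the orthogonal projections onto `K` and `i K`. -/
noncomputable def sumProj : H →L[ℂ] H :=
  LinearMap.mkContinuous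
    { toFun := fun x => K.starProjection x - I • K.starProjection (I • x)
      map_add' := fun x y => by simp only [smul_add, map_add]; abel
      map_smul' := fun c x => by
        have key : ∀ (r : ℝ) (y : H), K.starProjection ((r : ℂ) • y) =
            (r : ℂ) • K.starProjection y := fun r y => by
          simp
        have hI : ∀ y : H, I • I • y = -y := fun y => by
          rw [smul_smul, I_mul_I, neg_one_smul]
        conv_lhs => rw [← re_add_im c]
        conv_rhs => rw [← re_add_im c]
        simp only [add_smul, smul_add, mul_smul, map_add, key, smul_comm I ((_ : ℝ) : ℂ), hI,
          map_neg, RingHom.id_apply, smul_sub, smul_neg]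
        abel } 2 (fun x => by
      have h1 := K.norm_starProjection_apply_le x
      have h2 := K.norm_starProjection_apply_le (I • x)
      refine (norm_sub_le _ _).trans ?_
      simp only [norm_smul, norm_I, one_mul] at *
      linarith)

/-- The difference of the orthogonal projections onto `K` and `i K`. -/
noncomputable def diffProj : H →SL[starRingEnd ℂ] H :=
  LinearMap.mkContinuous
    { toFun := fun x => K.starProjection x + I • K.starProjection (I • x)
      map_add' := fun x y => by simp only [smul_add, map_add]; abel
      map_smul' := fun c x => by
        have key : ∀ (r : ℝ) (y : H), K.starProjection ((r : ℂ) • y) =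
            (r : ℂ) • K.starProjection y := fun r y => by
          simp
        have hI : ∀ y : H, I • I • y = -y := fun y => by
          rw [smul_smul, I_mul_I, neg_one_smul]
        conv_lhs => rw [← re_add_im c]
        conv_rhs => rw [← re_add_im c]
        simp only [add_smul, smul_add, mul_smul, map_add, key, smul_comm I ((_ : ℝ) : ℂ), hI,
          map_neg, map_mul, conj_ofReal, conj_I, smul_neg, neg_smul]
        abel } 2 (fun x => by
      have h1 := K.norm_starProjection_apply_le x
      have h2 := K.norm_starProjection_apply_le (I • x)
      refine (norm_add_le _ _).trans ?_
      simp only [norm_smul, norm_I, one_mul] at *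
      linarith)

lemma sumProj_apply (x : H) :
    sumProj K x = K.starProjection x - I • K.starProjection (I • x) := rfl

lemma diffProj_apply (x : H) :
    diffProj K x = K.starProjection x + I • K.starProjection (I • x) := rfl

lemma sumProj_inner (x y : H) : ⟪sumProj K x, y⟫_ℂ = ⟪x, sumProj K y⟫_ℂ := by
  have key : ∀ x y : H, (⟪sumProj K x, y⟫_ℂ).re = (⟪x, sumProj K y⟫_ℂ).re := fun x y => by
    simp only [sumProj_apply, inner_sub_left, inner_sub_right, sub_re]
    rw [starProjection_re_inner K x y]
    congr 1
    have h := starProjection_re_inner K (I • x) (I • y)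
    rw [inner_smul_right, inner_smul_left] at h
    rw [inner_smul_right, inner_smul_left]
    simp only [conj_I, neg_mul, neg_re] at h ⊢
    linarith
  refine complex_eq_of_re (key x y) ?_
  have := key x (I • y)
  simpa only [map_smul, inner_smul_right] using this

lemma diffProj_inner (x y : H) : ⟪diffProj K x, y⟫_ℂ = ⟪diffProj K y, x⟫_ℂ := by
  have key : ∀ x y : H, (⟪diffProj K x, y⟫_ℂ).re = (⟪diffProj K y, x⟫_ℂ).re := fun x y => by
    simp only [diffProj_apply, inner_add_left, add_re]
    rw [starProjection_re_inner K x y]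
    have e1 : (⟪x, K.starProjection y⟫_ℂ).re = (⟪K.starProjection y, x⟫_ℂ).re := by
      rw [← inner_conj_symm x, conj_re]
    rw [e1]
    congr 1
    have h := starProjection_re_inner K (I • x) (I • y)
    have e2 : (⟪I • x, K.starProjection (I • y)⟫_ℂ).re =
      (⟪K.starProjection (I • y), I • x⟫_ℂ).re := by rw [← inner_conj_symm, conj_re]
    rw [e2, inner_smul_right, inner_smul_right] at h
    rw [inner_smul_left, inner_smul_left]
    simp only [conj_I, neg_mul, neg_re] at h ⊢
    linarith
  refine complex_eq_of_re (key x y) ?_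
  have := key (I • x) y
  simpa only [map_smulₛₗ, conj_I, neg_smul, inner_smul_right, inner_neg_left, inner_smul_left,
    neg_mul, neg_neg] using this

lemma sumProj_inner_self (x : H) :
    (⟪sumProj K x, x⟫_ℂ).re = ‖K.starProjection x‖ ^ 2 + ‖K.starProjection (I • x)‖ ^ 2 := by
  simp only [sumProj_apply, inner_sub_left, sub_re]
  have h := starProjection_re_inner_self K (I • x)
  rw [starProjection_re_inner_self, ← h, inner_smul_left, inner_smul_right]
  simp [sub_eq_add_neg]

lemma sumProj_sumProj_apply (x : H) :
    diffProj K (diffProj K x) = (2 : ℂ) • sumProj K x - sumProj K (sumProj K x) := by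
  have hI : ∀ y : H, I • I • y = -y := fun y => by rw [smul_smul, I_mul_I, neg_one_smul]
  have h2 : ∀ y : H, (2 : ℂ) • y = y + y := fun y => two_smul _ _
  simp only [sumProj_apply, diffProj_apply, h2, hI, map_add, map_sub, map_neg,
    smul_neg, starProjection_starProjection]
  abel

lemma diffProj_sumProj_apply (x : H) :
    diffProj K (sumProj K x) = (2 : ℂ) • diffProj K x - sumProj K (diffProj K x) := by
  have hI : ∀ y : H, I • I • y = -y := fun y => by rw [smul_smul, I_mul_I, neg_one_smul]
  have h2 : ∀ y : H, (2 : ℂ) • y = y + y := fun y => two_smul _ _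
  simp only [sumProj_apply, diffProj_apply, h2, hI, map_add, map_sub, map_neg,
    smul_neg, starProjection_starProjection]
  abel

end RealSubspace

end CSGame

namespace CSGame

open Complex Filter Topology
open scoped InnerProductSpace


section StrongLimit

variable {H : Type*} [NormedAddCommGroup H] [InnerProductSpace ℂ H] [CompleteSpace H]

/-- A bounded sequence of operators converging on a dense set converges strongly. -/
lemma exists_strong_limit {h : ℕ → H →L[ℂ] H} {c : ℝ} (hc : ∀ n, ‖h n‖ ≤ c) {s : Set H}
    (hs : Dense s) (hlim : ∀ y ∈ s, ∃ z, Tendsto (fun n => h n y) atTop (𝓝 z)) :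
    ∃ T : H →L[ℂ] H, ∀ y, Tendsto (fun n => h n y) atTop (𝓝 (T y)) := by
  have hc0 : 0 ≤ c := (norm_nonneg _).trans (hc 0)
  have hall : ∀ y, ∃ z, Tendsto (fun n => h n y) atTop (𝓝 z) := fun y => by
    refine cauchySeq_tendsto_of_complete (Metric.cauchySeq_iff'.2 fun e he => ?_)
    obtain ⟨x, hxs, hx⟩ := Metric.mem_closure_iff.1 (hs y) (e / (4 * (c + 1))) (by positivity)
    obtain ⟨z, hz⟩ := hlim x hxs
    obtain ⟨N, hN⟩ := Metric.cauchySeq_iff'.1 hz.cauchySeq (e / 2) (by positivity)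
    refine ⟨N, fun n hn => ?_⟩
    have hb : ∀ k, ‖h k (y - x)‖ ≤ e / 4 := fun k => by
      calc ‖h k (y - x)‖ ≤ c * ‖y - x‖ := (h k).le_of_opNorm_le (hc k) _
        _ ≤ (c + 1) * (e / (4 * (c + 1))) := by
          rw [dist_eq_norm] at hx
          gcongr
          linarith
        _ = e / 4 := by field_simp
    have h3 := hN n hn
    rw [dist_eq_norm] at h3 ⊢
    have : h n y - h N y = h n (y - x) + (h n x - h N x) - h N (y - x) := by
      simp only [map_sub]; abel
    rw [this]
    calc _ ≤ ‖h n (y - x)‖ + ‖h n x - h N x‖ + ‖h N (y - x)‖ :=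
          (norm_sub_le _ _).trans (by gcongr; exact norm_add_le _ _)
      _ < e := by linarith [hb n, hb N]
  choose f hf using hall
  refine ⟨LinearMap.mkContinuous
    { toFun := f
      map_add' := fun x y => tendsto_nhds_unique (hf (x + y))
        (by simpa using (hf x).add (hf y))
      map_smul' := fun a x => tendsto_nhds_unique (hf (a • x))
        (by simpa using (hf x).const_smul a) } c (fun x => ?_), hf⟩
  exact le_of_tendsto (hf x).norm (Eventually.of_forall fun n => (h n).le_of_opNorm_le (hc n) x)

end StrongLimit

section Coercive

open ClosedSubmodule

variable {H : Type*} [NormedAddCommGroup H] [InnerProductSpace ℂ H] [CompleteSpace H]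

/-- Multiplication by a scalar of positive real part, followed by projection to a closed real
subspace, is surjective on that subspace. -/
lemma exists_re_inner_smul_eq (K : Submodule ℝ H) (hK : IsClosed (K : Set H)) {ζ : ℂ}
    (hζ : 0 < ζ.re) (u : H) : ∃ w ∈ K, ∀ k ∈ K, (⟪ζ • w, k⟫_ℂ).re = (⟪u, k⟫_ℂ).re := by
  have : CompleteSpace K := hK.completeSpace_coe
  let B : K →L[ℝ] K →L[ℝ] ℝ := LinearMap.mkContinuous₂
    (LinearMap.mk₂ ℝ (fun k l : K => (⟪ζ • (k : H), (l : H)⟫_ℂ).re)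
      (fun a b c => by simp [smul_add])
      (fun r a b => by
        rw [Submodule.coe_smul, smul_comm ζ r (a : H)]
        exact real_inner_smul_left (F := H) _ _ _)
      (fun a b c => by simp)
      (fun r a b => by
        rw [Submodule.coe_smul]
        exact real_inner_smul_right (F := H) _ _ _)) ‖ζ‖ (fun k l => by
          refine (Complex.abs_re_le_norm _).trans ((norm_inner_le_norm _ _).trans ?_)
          rw [norm_smul]; rfl)
  have hBd : ∀ k l : K, B k l = (⟪ζ • (k : H), (l : H)⟫_ℂ).re := fun k l => rfl
  have hB : IsCoercive B := ⟨ζ.re, hζ, fun k => by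
    rw [hBd, inner_smul_left, inner_self_eq_norm_sq_to_K]
    simp only [mul_re, conj_re, conj_im]
    norm_cast
    simp [sq, mul_assoc]⟩
  obtain ⟨w, hw⟩ := hB.continuousLinearEquivOfBilin.surjective (K.orthogonalProjectionOnto u)
  refine ⟨w, w.2, fun k hk => ?_⟩
  have := hB.continuousLinearEquivOfBilin_apply w ⟨k, hk⟩
  rw [hw, hBd] at this
  rw [← this]
  exact K.inner_orthogonalProjectionOnto_eq_of_mem_right ⟨k, hk⟩ u

end Coercive

section SelfAdjointVectors

variable {H : Type*} [NormedAddCommGroup H] [InnerProductSpace ℂ H] [CompleteSpace H]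
  (M : VonNeumannAlgebra H) (ψ : H)

lemma smul_mem_vN {a : H →L[ℂ] H} (ha : a ∈ M) (c : ℂ) : c • a ∈ M :=
  M.toStarSubalgebra.smul_mem ha c

lemma real_smul_mem_vN {a : H →L[ℂ] H} (ha : a ∈ M) (c : ℝ) : c • a ∈ M := by
  have := smul_mem_vN M ha (c : ℂ)
  rwa [Complex.coe_smul] at this

lemma mem_of_commute {a : H →L[ℂ] H} (h : ∀ x ∈ M.commutant, x * a = a * x) : a ∈ M := by
  rw [← M.commutant_commutant, VonNeumannAlgebra.mem_commutant_iff]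
  exact h

lemma commute_of_mem {a x : H →L[ℂ] H} (ha : a ∈ M) (hx : x ∈ M.commutant) : a * x = x * a :=
  VonNeumannAlgebra.mem_commutant_iff.1 hx a ha

lemma cfc_mem_vN {a : H →L[ℂ] H} (ha : a ∈ M) (f : ℝ → ℝ) : cfc f a ∈ M :=
  mem_of_commute M fun x hx =>
    ((Commute.cfc_real (commute_of_mem M ha hx : Commute a x) f).eq).symm

/-- The vectors `a ψ` for `a` a self-adjoint element of `M`. -/
def selfAdjointVectors : Submodule ℝ H where
  carrier := {x | ∃ a ∈ M, IsSelfAdjoint a ∧ a ψ = x}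
  add_mem' := by
    rintro _ _ ⟨a, ha, sa, rfl⟩ ⟨b, hb, sb, rfl⟩
    exact ⟨a + b, add_mem ha hb, sa.add sb, rfl⟩
  zero_mem' := ⟨0, zero_mem _, IsSelfAdjoint.zero _, rfl⟩
  smul_mem' := by
    rintro c _ ⟨a, ha, sa, rfl⟩
    exact ⟨c • a, real_smul_mem_vN M ha c, (IsSelfAdjoint.all c).smul sa, rfl⟩

/-- The vectors `h ψ` with `h ∈ M` and `0 ≤ h ≤ c`. -/
def boundedVectors (c : ℝ) : Set H :=
  {x | ∃ h ∈ M, h.IsPositive ∧ ‖h‖ ≤ c ∧ h ψ = x}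

variable {M ψ}

lemma convex_boundedVectors (c : ℝ) : Convex ℝ (boundedVectors M ψ c) := by
  rintro _ ⟨a, ha, pa, na, rfl⟩ _ ⟨b, hb, pb, nb, rfl⟩ s t hs ht hst
  refine ⟨s • a + t • b, add_mem (real_smul_mem_vN M ha s) (real_smul_mem_vN M hb t), ?_, ?_, rfl⟩
  · have h1 := pa.smul_of_nonneg (c := (s : ℂ)) (by exact_mod_cast hs)
    have h2 := pb.smul_of_nonneg (c := (t : ℂ)) (by exact_mod_cast ht)
    rw [Complex.coe_smul] at h1 h2
    exact h1.add h2
  · calc ‖s • a + t • b‖ ≤ s * ‖a‖ + t * ‖b‖ := by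
          refine (norm_add_le _ _).trans ?_
          rw [norm_smul, norm_smul, Real.norm_of_nonneg hs, Real.norm_of_nonneg ht]
      _ ≤ s * c + t * c := by gcongr
      _ = c := by rw [← add_mul, hst, one_mul]

lemma isClosed_boundedVectors (hd : Dense {x | ∃ y ∈ M.commutant, y ψ = x}) (c : ℝ) :
    IsClosed (boundedVectors M ψ c) := by
  refine IsSeqClosed.isClosed fun x z hx hz => ?_
  choose h hM hpos hnorm hψ using hx
  obtain ⟨T, hT⟩ := exists_strong_limit hnorm hd (by
    rintro _ ⟨y, hy, rfl⟩
    refine ⟨y z, ?_⟩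
    have : (fun n => h n (y ψ)) = fun n => y (x n) := by
      ext n
      rw [← hψ n]
      exact congr($(commute_of_mem M (hM n) hy) ψ)
    rw [this]
    exact (y.continuous.tendsto z).comp hz)
  refine ⟨T, mem_of_commute M fun y hy => ?_, ?_, ?_, ?_⟩
  · ext v
    refine tendsto_nhds_unique ((y.continuous.tendsto _).comp (hT v)) ?_
    refine (hT (y v)).congr fun n => ?_
    exact congr($(commute_of_mem M (hM n) hy) v)
  · rw [ContinuousLinearMap.isPositive_iff_complex]
    intro v
    have hl : Tendsto (fun n => ⟪h n v, v⟫_ℂ) atTop (𝓝 ⟪T v, v⟫_ℂ) :=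
      (hT v).inner tendsto_const_nhds
    have hn := fun n => (ContinuousLinearMap.isPositive_iff_complex _).1 (hpos n) v
    refine ⟨?_, ge_of_tendsto ((Complex.continuous_re.tendsto _).comp hl)
      (Eventually.of_forall fun n => (hn n).2)⟩
    refine tendsto_nhds_unique ?_ hl
    refine (((Complex.continuous_ofReal.comp Complex.continuous_re).tendsto _).comp hl).congr
      fun n => (hn n).1
  · refine T.opNorm_le_bound ((norm_nonneg _).trans (hnorm 0)) fun v => ?_
    exact le_of_tendsto (hT v).norm
      (Eventually.of_forall fun n => (h n).le_of_opNorm_le (hnorm n) v)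
  · refine tendsto_nhds_unique (hT ψ) (hz.congr fun n => (hψ n).symm)

end SelfAdjointVectors

end CSGame

namespace CSGame

open Complex Filter Topology
open scoped InnerProductSpace


section RadonNikodym

variable {H : Type*} [NormedAddCommGroup H] [InnerProductSpace ℂ H] [CompleteSpace H]
  {M : VonNeumannAlgebra H} {ψ : H}

/-- A complex-linear statement about `M` may be checked on self-adjoint elements. -/
lemma vN_induction_selfAdjoint {p : (H →L[ℂ] H) → Prop} (hsa : ∀ a ∈ M, IsSelfAdjoint a → p a)
    (hadd : ∀ a b, p a → p b → p (a + b)) (hsmul : ∀ (c : ℂ) a, p a → p (c • a))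
    {a : H →L[ℂ] H} (ha : a ∈ M) : p a := by
  rw [← realPart_add_I_smul_imaginaryPart a]
  have hR : ((realPart a : selfAdjoint (H →L[ℂ] H)) : H →L[ℂ] H) ∈ M := by
    rw [realPart_apply_coe]
    exact real_smul_mem_vN M (add_mem ha (star_mem ha)) _
  have hI : ((imaginaryPart a : selfAdjoint (H →L[ℂ] H)) : H →L[ℂ] H) ∈ M := by
    rw [imaginaryPart_apply_coe]
    exact smul_mem_vN M (real_smul_mem_vN M (sub_mem ha (star_mem ha)) _) _
  exact hadd _ _ (hsa _ hR (realPart a).2) (hsmul _ _ (hsa _ hI (imaginaryPart a).2))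

/-- A complex-linear statement about `M` may be checked on positive contractions. -/
lemma vN_induction_positive {p : (H →L[ℂ] H) → Prop}
    (hpos : ∀ a ∈ M, 0 ≤ a → a ≤ 1 → p a)
    (hadd : ∀ a b, p a → p b → p (a + b)) (hsmul : ∀ (c : ℂ) a, p a → p (c • a))
    {a : H →L[ℂ] H} (ha : a ∈ M) : p a := by
  refine vN_induction_selfAdjoint (fun a ha sa => ?_) hadd hsmul ha
  have hc : 0 < ‖a‖ + 1 := by positivity
  set c := ‖a‖ + 1 with hcdef
  have h1 : a ≤ algebraMap ℝ _ c :=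
    (IsSelfAdjoint.le_algebraMap_norm_self sa).trans (by
      exact algebraMap_mono _ (by linarith))
  have h2 : -algebraMap ℝ _ c ≤ a :=
    le_trans (neg_le_neg (algebraMap_mono _ (by linarith)))
      (IsSelfAdjoint.neg_algebraMap_norm_le_self sa)
  have h0 : 0 ≤ (2 * c)⁻¹ • (a + algebraMap ℝ _ c) :=
    smul_nonneg (by positivity) (by rwa [← neg_le_iff_add_nonneg])
  have h3 : (2 * c)⁻¹ • (a + algebraMap ℝ _ c) ≤ 1 := by
    have : (1 : H →L[ℂ] H) = (2 * c)⁻¹ • (algebraMap ℝ _ c + algebraMap ℝ _ c) := by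
      rw [← map_add, ← two_mul, Algebra.algebraMap_eq_smul_one, smul_smul,
        inv_mul_cancel₀ (by positivity), one_smul]
    rw [this]
    gcongr
  have hone : p 1 := hpos 1 (one_mem _) zero_le_one le_rfl
  have hm : (2 * c)⁻¹ • (a + algebraMap ℝ _ c) ∈ M := by
    refine real_smul_mem_vN M (add_mem ha ?_) _
    rw [Algebra.algebraMap_eq_smul_one]
    exact real_smul_mem_vN M (one_mem _) _
  have e : a = ((2 * c : ℝ) : ℂ) • ((2 * c)⁻¹ • (a + algebraMap ℝ _ c)) + ((-c : ℝ) : ℂ) • 1 := by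
    rw [Complex.coe_smul, Complex.coe_smul, smul_smul, mul_inv_cancel₀ (by positivity), one_smul,
      Algebra.algebraMap_eq_smul_one, neg_smul]
    abel
  rw [e]
  exact hadd _ _ (hsmul _ _ (hpos _ hm h0 h3)) (hsmul _ _ hone)

lemma inner_apply_comm {a x : H →L[ℂ] H} (ha : a ∈ M) (hx : x ∈ M.commutant) (u v : H) :
    ⟪x u, a v⟫_ℂ = ⟪star a u, star x v⟫_ℂ := by
  have h : star a * x = x * star a := commute_of_mem M (star_mem ha) hx
  simp only [ContinuousLinearMap.star_eq_adjoint] at h ⊢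
  rw [ContinuousLinearMap.adjoint_inner_right, ← ContinuousLinearMap.adjoint_inner_left]
  exact congr(⟪$h u, v⟫_ℂ)

lemma mul_le_cfc_posPart {a x : H →L[ℂ] H} (ha : a ∈ M) (sa : IsSelfAdjoint a)
    (hx : x ∈ M.commutant) (hx0 : 0 ≤ x) (hx1 : x ≤ 1) :
    x * a ≤ cfc (fun t : ℝ => max t 0) a := by
  have cmax : Continuous fun t : ℝ => max t 0 := by fun_prop
  have cmin : Continuous fun t : ℝ => max (-t) 0 := by fun_prop
  have hdec : cfc (fun t : ℝ => max t 0) a - cfc (fun t : ℝ => max (-t) 0) a = a := by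
    rw [← cfc_sub _ _ a cmax.continuousOn cmin.continuousOn]
    conv_rhs => rw [← cfc_id' ℝ a]
    congr 1
    ext t
    rcases le_total t 0 with ht | ht <;> simp [ht]
  have hap : 0 ≤ cfc (fun t : ℝ => max t 0) a := cfc_nonneg fun t _ => le_max_right _ _
  have ham : 0 ≤ cfc (fun t : ℝ => max (-t) 0) a := cfc_nonneg fun t _ => le_max_right _ _
  have hpM := cfc_mem_vN M ha (fun t : ℝ => max t 0)
  have hmM := cfc_mem_vN M ha (fun t : ℝ => max (-t) 0)
  generalize cfc (fun t : ℝ => max t 0) a = ap at *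
  generalize cfc (fun t : ℝ => max (-t) 0) a = am at *
  have h1 : 0 ≤ (1 - x) * ap :=
    Commute.mul_nonneg (sub_nonneg.2 hx1) hap
      (commute_of_mem M hpM (sub_mem (one_mem _) hx)).symm
  have h2 : 0 ≤ x * am := Commute.mul_nonneg hx0 ham (commute_of_mem M hmM hx).symm
  have h3 : ap - x * a = (1 - x) * ap + x * am := by
    rw [← hdec]
    noncomm_ring
  rw [← sub_nonneg, h3]
  exact add_nonneg h1 h2

lemma cfc_posPart_sub_le {a : H →L[ℂ] H} (sa : IsSelfAdjoint a) {f : ℝ → ℝ} (cf : Continuous f)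
    {c e : ℝ} (hf : ∀ t, c * (max t 0 - e) ≤ t * f t) :
    c • (cfc (fun t : ℝ => max t 0) a - algebraMap ℝ _ e) ≤ a * cfc f a := by
  have cmax : Continuous fun t : ℝ => max t 0 := by fun_prop
  have hah : a * cfc f a = cfc (fun t => t * f t) a := by
    rw [cfc_mul (fun t : ℝ => t) f a continuousOn_id cf.continuousOn, cfc_id' ℝ a]
  rw [hah, ← cfc_const e a, ← cfc_sub _ _ a cmax.continuousOn continuousOn_const,
    ← cfc_smul c (fun t : ℝ => max t 0 - e) a (by fun_prop)]
  exact cfc_mono (fun t _ => by simpa using hf t) (by fun_prop) (by fun_prop)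

lemma exists_boundedVectors_le {a x : H →L[ℂ] H} (ha : a ∈ M) (sa : IsSelfAdjoint a)
    (hx : x ∈ M.commutant) (hx0 : 0 ≤ x) (hx1 : x ≤ 1) (hψ : ‖ψ‖ = 1) {c e : ℝ} (hc : 0 ≤ c)
    (he : 0 < e) : ∃ y ∈ boundedVectors M ψ c, ∃ r : ℝ, ⟪a ψ, y⟫_ℂ = r ∧
      c * ((⟪x ψ, a ψ⟫_ℂ).re - e) ≤ r := by
  have hpos : ∀ t : ℝ, 0 ≤ max t 0 := fun t => le_max_right _ _
  have cf : Continuous fun t : ℝ => c * (max t 0 / (max t 0 + e)) :=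
    continuous_const.mul ((by fun_prop : Continuous fun t : ℝ => max t 0).div (by fun_prop)
      fun t => (by have := hpos t; positivity))
  obtain ⟨f, hf⟩ : ∃ f : ℝ → ℝ, f = fun t => c * (max t 0 / (max t 0 + e)) := ⟨_, rfl⟩
  rw [← hf] at cf
  have f0 : ∀ t, 0 ≤ f t := fun t => by have := hpos t; simp only [hf]; positivity
  have fc : ∀ t, f t ≤ c := fun t => by
    have := hpos t
    have h1 : max t 0 / (max t 0 + e) ≤ 1 := by rw [div_le_one (by positivity)]; linarith
    simpa [hf] using mul_le_mul_of_nonneg_left h1 hc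
  have hle : ∀ t, c * (max t 0 - e) ≤ t * f t := fun t => by
    simp only [hf]
    rw [mul_left_comm]
    refine mul_le_mul_of_nonneg_left ?_ hc
    rcases le_total t 0 with ht | ht
    · simp [ht, he.le]
    · rw [max_eq_left ht, mul_div_assoc', le_div_iff₀ (by positivity)]
      nlinarith
  have hge : c • (x * a - algebraMap ℝ _ e) ≤ a * cfc f a :=
    le_trans (smul_le_smul_of_nonneg_left (sub_le_sub_right (mul_le_cfc_posPart ha sa hx hx0 hx1) _)
      hc) (cfc_posPart_sub_le sa cf hle)
  have hn : ‖cfc f a‖ ≤ c := norm_cfc_le hc fun t _ => by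
    rw [Real.norm_of_nonneg (f0 t)]; exact fc t
  have hM := cfc_mem_vN M ha f
  have h0 : 0 ≤ cfc f a := cfc_nonneg fun t _ => f0 t
  have hcm : a * cfc f a = cfc f a * a := ((Commute.refl a).cfc_real f).eq.symm
  generalize cfc f a = h at *
  have h1 : ⟪a ψ, h ψ⟫_ℂ = ⟪ψ, (a * h) ψ⟫_ℂ :=
    (ContinuousLinearMap.isSelfAdjoint_iff_isSymmetric.1 sa) ψ (h ψ)
  have sah : IsSelfAdjoint (a * h) := by
    rw [isSelfAdjoint_iff, star_mul, sa.star_eq, (IsSelfAdjoint.of_nonneg h0).star_eq, hcm]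
  refine ⟨h ψ, ⟨h, hM, (ContinuousLinearMap.nonneg_iff_isPositive _).1 h0, hn, rfl⟩,
    (⟪ψ, (a * h) ψ⟫_ℂ).re, ?_, ?_⟩
  · rw [h1]
    refine (Complex.conj_eq_iff_re.1 ?_).symm
    rw [inner_conj_symm]
    exact (ContinuousLinearMap.isSelfAdjoint_iff_isSymmetric.1 sah) ψ ψ
  · have h4 := ((ContinuousLinearMap.le_def _ _).1 hge).re_inner_nonneg_right ψ
    have h2 : ⟪x ψ, a ψ⟫_ℂ = ⟪ψ, (x * a) ψ⟫_ℂ :=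
      (ContinuousLinearMap.isSelfAdjoint_iff_isSymmetric.1
        (IsSelfAdjoint.of_nonneg hx0)) ψ (a ψ)
    have h3 : (⟪ψ, (c • (x * a - algebraMap ℝ (H →L[ℂ] H) e)) ψ⟫_ℂ).re =
        c * ((⟪ψ, (x * a) ψ⟫_ℂ).re - e) := by
      rw [Algebra.algebraMap_eq_smul_one, ← Complex.coe_smul c, ← Complex.coe_smul e]
      simp [inner_self_eq_norm_sq_to_K, hψ]
    rw [sub_apply, inner_sub_right] at h4
    rw [h2]
    simp only [map_sub, RCLike.re_to_complex, h3] at h4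
    linarith

open ClosedSubmodule in
lemma exists_radonNikodym_aux (hd : Dense {x | ∃ y ∈ M.commutant, y ψ = x}) (hψ : ‖ψ‖ = 1)
    {ζ : ℂ} (hζ : 0 < ζ.re) {x : H →L[ℂ] H} (hx : x ∈ M.commutant) (hx0 : 0 ≤ x) (hx1 : x ≤ 1) :
    ∃ h ∈ M, IsSelfAdjoint h ∧
      ∀ a ∈ M, IsSelfAdjoint a → (⟪x ψ, a ψ⟫_ℂ).re = 2 * (ζ * ⟪h ψ, a ψ⟫_ℂ).re := by
  set K := (selfAdjointVectors M ψ).topologicalClosure with hK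
  have hKc : IsClosed (K : Set H) := Submodule.isClosed_topologicalClosure _
  obtain ⟨η, hηK, hη⟩ := exists_re_inner_smul_eq K hKc (ζ := (starRingEnd ℂ) ζ) (by simpa)
    ((1 / 2 : ℂ) • x ψ)
  have hη' : ∀ k ∈ K, 2 * (ζ * ⟪η, k⟫_ℂ).re = (⟪x ψ, k⟫_ℂ).re := fun k hk => by
    have := hη k hk
    rw [inner_smul_left, inner_smul_left] at this
    simp only [conj_conj] at this
    rw [this]
    simp
  set c : ℝ := 1 / (2 * ζ.re) with hc
  have hc0 : 0 < c := by positivity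
  suffices η ∈ boundedVectors M ψ c by
    obtain ⟨h, hM, hp, -, rfl⟩ := this
    refine ⟨h, hM, hp.isSelfAdjoint, fun a ha sa => (hη' _ ?_).symm⟩
    exact Submodule.le_topologicalClosure _ ⟨a, ha, sa, rfl⟩
  by_contra hmem
  obtain ⟨v, s, hv1, hv2⟩ := geometric_hahn_banach_closed_point
    (convex_boundedVectors c) (isClosed_boundedVectors hd c) hmem
  set u := (InnerProductSpace.toDual ℝ H).symm v with hu
  have huv : ∀ y, v y = (⟪u, y⟫_ℂ).re := fun y =>
    (InnerProductSpace.toDual_symm_apply (𝕜 := ℝ) (x := y) (y := v)).symm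
  obtain ⟨w, hwK, hw⟩ := exists_re_inner_smul_eq K hKc hζ ((1 / 2 : ℂ) • u)
  have hw' : ∀ k ∈ K, v k = 2 * ((starRingEnd ℂ) ζ * ⟪w, k⟫_ℂ).re := fun k hk => by
    have := hw k hk
    rw [inner_smul_left, inner_smul_left] at this
    rw [this, huv]
    simp
  have hηw : v η = (⟪x ψ, w⟫_ℂ).re := by
    rw [hw' η hηK, ← hη' w hwK, ← conj_re (ζ * _), map_mul, inner_conj_symm]
  rw [hηw] at hv2
  set g := (⟪x ψ, w⟫_ℂ).re - s with hg
  have hg0 : 0 < g := by linarith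
  set d := g / (3 * (‖x ψ‖ + 2 * ‖ζ‖ * c + 1)) with hdd
  have hd0 : 0 < d := by positivity
  obtain ⟨_, ⟨a, ha, sa, rfl⟩, haw⟩ := Metric.mem_closure_iff.1
    (show w ∈ closure (selfAdjointVectors M ψ : Set H) from hwK) d hd0
  obtain ⟨y, hy, r, hr, hle⟩ := exists_boundedVectors_le ha sa hx hx0 hx1 hψ hc0.le
    (show 0 < g / 3 by positivity)
  have hyK : y ∈ K := by
    obtain ⟨h, hM, hp, -, rfl⟩ := hy
    exact Submodule.le_topologicalClosure _ ⟨h, hM, hp.isSelfAdjoint, rfl⟩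
  have hyn : ‖y‖ ≤ c := by
    obtain ⟨h, hM, hp, hn, rfl⟩ := hy
    simpa [hψ] using h.le_of_opNorm_le hn ψ
  have h1 := hv1 y hy
  rw [hw' y hyK] at h1
  rw [dist_eq_norm] at haw
  have h2 : (⟪x ψ, w - a ψ⟫_ℂ).re ≤ ‖x ψ‖ * d :=
    (Complex.re_le_norm _).trans ((norm_inner_le_norm _ _).trans (by gcongr))
  have h3 : ((starRingEnd ℂ) ζ * ⟪a ψ - w, y⟫_ℂ).re ≤ ‖ζ‖ * (d * c) := by
    refine (Complex.re_le_norm _).trans ?_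
    rw [norm_mul, RCLike.norm_conj]
    gcongr
    refine (norm_inner_le_norm _ _).trans ?_
    rw [norm_sub_rev]
    gcongr
  rw [inner_sub_right, sub_re] at h2
  rw [inner_sub_left, mul_sub, sub_re, hr] at h3
  have h4 : ((starRingEnd ℂ) ζ * (r : ℂ)).re = ζ.re * r := by simp
  rw [h4] at h3
  have h5 : (⟪x ψ, a ψ⟫_ℂ).re - g / 3 ≤ 2 * (ζ.re * r) := by
    have h6 : ζ.re * (2 * c) = 1 := by rw [hc]; field_simp
    have h7 := mul_le_mul_of_nonneg_left hle (by positivity : 0 ≤ 2 * ζ.re)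
    linear_combination h7 + ((⟪x ψ, a ψ⟫_ℂ).re - g / 3) * (-h6)
  have h6 : d * (‖x ψ‖ + 2 * ‖ζ‖ * c + 1) = g / 3 := by rw [hdd]; field_simp
  nlinarith

/-- Sakai's Radon-Nikodym theorem in the form of Rieffel and van Daele. -/
lemma exists_radonNikodym (hd : Dense {x | ∃ y ∈ M.commutant, y ψ = x}) (hψ : ‖ψ‖ = 1)
    {ζ : ℂ} (hζ : 0 < ζ.re) {x : H →L[ℂ] H} (hx : x ∈ M.commutant) :
    ∃ h ∈ M, ∀ a ∈ M, ⟪x ψ, a ψ⟫_ℂ =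
      ζ * ⟪h ψ, a ψ⟫_ℂ + (starRingEnd ℂ) ζ * ⟪star a ψ, star h ψ⟫_ℂ := by
  refine vN_induction_positive (M := M.commutant) (p := fun x => ∃ h ∈ M, ∀ a ∈ M, ⟪x ψ, a ψ⟫_ℂ =
      ζ * ⟪h ψ, a ψ⟫_ℂ + (starRingEnd ℂ) ζ * ⟪star a ψ, star h ψ⟫_ℂ)
        (fun x hx hx0 hx1 => ?_) ?_ ?_ hx
  · obtain ⟨h, hM, sh, hh⟩ := exists_radonNikodym_aux hd hψ hζ hx hx0 hx1
    refine ⟨h, hM, fun a ha => ?_⟩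
    refine vN_induction_selfAdjoint (M := M) (p := fun a => ⟪x ψ, a ψ⟫_ℂ =
      ζ * ⟪h ψ, a ψ⟫_ℂ + (starRingEnd ℂ) ζ * ⟪star a ψ, star h ψ⟫_ℂ)
        (fun a ha sa => ?_) (fun a b h1 h2 => ?_)
      (fun t a h1 => ?_) ha
    · have e1 : ⟪x ψ, a ψ⟫_ℂ = ((⟪x ψ, a ψ⟫_ℂ).re : ℂ) := by
        refine (Complex.conj_eq_iff_re.1 ?_).symm
        rw [inner_conj_symm, inner_apply_comm ha hx, sa.star_eq,
          (IsSelfAdjoint.of_nonneg hx0).star_eq]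
      have e2 : (starRingEnd ℂ) ζ * ⟪star a ψ, star h ψ⟫_ℂ =
          (starRingEnd ℂ) (ζ * ⟪h ψ, a ψ⟫_ℂ) := by
        rw [sa.star_eq, sh.star_eq, map_mul, inner_conj_symm]
      rw [e1, hh a ha sa, e2, Complex.add_conj]
    · simp only [add_apply, inner_add_left, inner_add_right, star_add, h1, h2]
      ring
    · simp only [smul_apply, inner_smul_left, inner_smul_right, star_smul, h1, RCLike.star_def,
        conj_conj]
      ring
  · rintro x y ⟨h, hM, hh⟩ ⟨k, kM, kk⟩
    refine ⟨h + k, add_mem hM kM, fun a ha => ?_⟩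
    simp only [add_apply, inner_add_left, inner_add_right, star_add, hh a ha, kk a ha]
    ring
  · rintro t x ⟨h, hM, hh⟩
    refine ⟨t • h, smul_mem_vN M hM t, fun a ha => ?_⟩
    simp only [smul_apply, inner_smul_left, inner_smul_right, star_smul, hh a ha, RCLike.star_def]
    ring

end RadonNikodym

end CSGame

namespace CSGame

open Complex Filter Topology
open scoped InnerProductSpace


section Modular

variable {H : Type*} [NormedAddCommGroup H] [InnerProductSpace ℂ H] [CompleteSpace H]

/-- The bounded operators of the Rieffel-van Daele approach to modular theory, for a von Neumann
algebra `M` with cyclic and separating unit vector `ψ`. In terms of the modular operator,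
`R = 2 / (1 + Δ)` and `D` is the modular conjugation times `2 Δ ^ (1/2) / (1 + Δ)`. -/
structure IsModular (M : VonNeumannAlgebra H) (ψ : H) (R : H →L[ℂ] H)
    (D : H →SL[starRingEnd ℂ] H) : Prop where
  norm_eq_one : ‖ψ‖ = 1
  dense : Dense {x | ∃ a ∈ M, a ψ = x}
  dense_commutant : Dense {x | ∃ y ∈ M.commutant, y ψ = x}
  inner_R : ∀ x y, ⟪R x, y⟫_ℂ = ⟪x, R y⟫_ℂ
  nonneg_R : ∀ x, 0 ≤ (⟪R x, x⟫_ℂ).re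
  R_le_two : ∀ x, (⟪R x, x⟫_ℂ).re ≤ 2 * ‖x‖ ^ 2
  inner_D : ∀ x y, ⟪D x, y⟫_ℂ = ⟪D y, x⟫_ℂ
  D_D : ∀ x, D (D x) = R ((2 : ℂ) • x - R x)
  D_R : ∀ x, D (R x) = (2 : ℂ) • D x - R (D x)
  D_star : ∀ a ∈ M, D (star a ψ) = (2 : ℂ) • a ψ - R (a ψ)
  D_star_commutant : ∀ y ∈ M.commutant, D (star y ψ) = R (y ψ)
  exists_R_eq : ∀ y ∈ M.commutant, ∃ b ∈ M, b ψ = R (y ψ) ∧ star b ψ = D (y ψ)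
  radonNikodym : ∀ ζ : ℂ, 0 < ζ.re → ∀ x ∈ M.commutant, ∃ h ∈ M, ∀ a ∈ M, ⟪x ψ, a ψ⟫_ℂ =
      ζ * ⟪h ψ, a ψ⟫_ℂ + (starRingEnd ℂ) ζ * ⟪star a ψ, star h ψ⟫_ℂ

open ClosedSubmodule in
theorem exists_isModular {M : VonNeumannAlgebra H} {ψ : H} (hψ : ‖ψ‖ = 1)
    (hM : Dense {x | ∃ a ∈ M, a ψ = x}) (hM' : Dense {x | ∃ y ∈ M.commutant, y ψ = x}) :
    ∃ R D, IsModular M ψ R D := by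
  set K := (selfAdjointVectors M ψ).topologicalClosure with hK
  have hKc : IsClosed (K : Set H) := Submodule.isClosed_topologicalClosure _
  have : CompleteSpace K := hKc.completeSpace_coe
  have hmem : ∀ a ∈ M, IsSelfAdjoint a → a ψ ∈ K := fun a ha sa =>
    Submodule.le_topologicalClosure _ ⟨a, ha, sa, rfl⟩
  have hDR : ∀ x, diffProj K x = (2 : ℂ) • K.starProjection x - sumProj K x := fun x => by
    rw [diffProj_apply, sumProj_apply, two_smul]; abel
  have hproj : ∀ u w : H, w ∈ K → (∀ a ∈ M, IsSelfAdjoint a →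
      (⟪u, a ψ⟫_ℂ).re = (⟪w, a ψ⟫_ℂ).re) → K.starProjection u = w := fun u w hw h => by
    refine K.eq_starProjection_of_mem_of_inner_eq_zero hw fun k hk => ?_
    have hcl : (K : Set H) ⊆ {k | (⟪u - w, k⟫_ℂ).re = 0} := by
      rw [hK, Submodule.topologicalClosure_coe]
      refine closure_minimal ?_ (isClosed_eq (by fun_prop) (by fun_prop))
      rintro _ ⟨a, ha, sa, rfl⟩
      simp [h a ha sa]
    exact hcl hk
  have hIcomm : ∀ y ∈ M.commutant, IsSelfAdjoint y → K.starProjection (I • y ψ) = 0 :=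
    fun y hy sy => hproj _ 0 (zero_mem _) fun a ha sa => by
      have h1 : (starRingEnd ℂ) ⟪y ψ, a ψ⟫_ℂ = ⟪y ψ, a ψ⟫_ℂ := by
        rw [inner_conj_symm, inner_apply_comm ha hy, sa.star_eq, sy.star_eq]
      have h2 := Complex.conj_eq_iff_im.1 h1
      simp [h2]
  refine ⟨sumProj K, diffProj K, hψ, hM, hM', sumProj_inner K, fun x => ?_, fun x => ?_,
    diffProj_inner K, fun x => ?_, diffProj_sumProj_apply K, fun a ha => ?_, fun y hy => ?_,
    fun y hy => ?_, fun ζ hζ x hx => exists_radonNikodym hM' hψ hζ hx⟩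
  · rw [sumProj_inner_self]; positivity
  · rw [sumProj_inner_self]
    have h1 := K.norm_starProjection_apply_le x
    have h2 := K.norm_starProjection_apply_le (I • x)
    rw [norm_smul, norm_I, one_mul] at h2
    nlinarith [norm_nonneg (K.starProjection x), norm_nonneg (K.starProjection (I • x))]
  · rw [sumProj_sumProj_apply, map_sub, map_smul]
  · refine vN_induction_selfAdjoint (M := M) (p := fun a => diffProj K (star a ψ) =
      (2 : ℂ) • a ψ - sumProj K (a ψ)) (fun a ha sa => ?_) (fun a b h1 h2 => ?_)
      (fun t a h1 => ?_) ha
    · rw [sa.star_eq, hDR, K.starProjection_eq_self_iff.2 (hmem a ha sa)]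
    · simp only [star_add, add_apply, map_add, h1, h2, smul_add]; abel
    · simp only [star_smul, smul_apply, map_smulₛₗ, h1, RCLike.star_def, conj_conj, smul_sub,
        smul_comm t, RingHom.id_apply]
  · refine vN_induction_selfAdjoint (M := M.commutant) (p := fun y => diffProj K (star y ψ) =
      sumProj K (y ψ)) (fun y hy sy => ?_) (fun a b h1 h2 => ?_)
      (fun t a h1 => ?_) hy
    · rw [sy.star_eq, diffProj_apply, sumProj_apply, hIcomm y hy sy]
      simp
    · simp only [star_add, add_apply, map_add, h1, h2]
    · simp only [star_smul, smul_apply, map_smulₛₗ, h1, RCLike.star_def, conj_conj,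
        RingHom.id_apply]
  · have hpos : ∀ y ∈ M.commutant, 0 ≤ y → y ≤ 1 → ∃ b ∈ M, b ψ = sumProj K (y ψ) ∧
        star b ψ = diffProj K (y ψ) := fun y hy y0 y1 => by
      obtain ⟨h, hh, sh, hr⟩ := exists_radonNikodym_aux hM' hψ
        (show 0 < (1 / 2 : ℂ).re by norm_num) hy y0 y1
      have h1 : K.starProjection (y ψ) = h ψ := hproj _ _ (hmem h hh sh) fun a ha sa => by
        rw [hr a ha sa]; simp
      have h2 := hIcomm y hy (IsSelfAdjoint.of_nonneg y0)
      refine ⟨h, hh, ?_, ?_⟩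
      · rw [sumProj_apply, h1, h2]; simp
      · rw [sh.star_eq, diffProj_apply, h1, h2]; simp
    refine vN_induction_positive (M := M.commutant) (p := fun y => ∃ b ∈ M,
      b ψ = sumProj K (y ψ) ∧ star b ψ = diffProj K (y ψ)) hpos ?_ ?_ hy
    · rintro y z ⟨b, hb, b1, b2⟩ ⟨c, hc, c1, c2⟩
      exact ⟨b + c, add_mem hb hc, by simp [b1, c1], by simp [b2, c2]⟩
    · rintro t y ⟨b, hb, b1, b2⟩
      exact ⟨t • b, smul_mem_vN M hb t, by simp [b1], by simp [b2]⟩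

namespace IsModular

variable {M : VonNeumannAlgebra H} {ψ : H} {R : H →L[ℂ] H} {D : H →SL[starRingEnd ℂ] H}

lemma inner_D' (h : IsModular M ψ R D) (x y : H) : ⟪x, D y⟫_ℂ = ⟪y, D x⟫_ℂ := by
  rw [← inner_conj_symm, h.inner_D, inner_conj_symm]

/-- A continuous identity may be checked on the dense subspace `M' ψ`. -/
lemma ext_commutant (h : IsModular M ψ R D) {u v : H}
    (huv : ∀ y ∈ M.commutant, ⟪y ψ, u⟫_ℂ = ⟪y ψ, v⟫_ℂ) : u = v := by
  refine ext_inner_left ℂ fun w => ?_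
  refine h.dense_commutant.induction (P := fun w => ⟪w, u⟫_ℂ = ⟪w, v⟫_ℂ) ?_ ?_ w
  · rintro _ ⟨y, hy, rfl⟩
    exact huv y hy
  · exact isClosed_eq (by fun_prop) (by fun_prop)

lemma ext_vN (h : IsModular M ψ R D) {u v : H}
    (huv : ∀ y ∈ M, ⟪y ψ, u⟫_ℂ = ⟪y ψ, v⟫_ℂ) : u = v := by
  refine ext_inner_left ℂ fun w => ?_
  refine h.dense.induction (P := fun w => ⟪w, u⟫_ℂ = ⟪w, v⟫_ℂ) ?_ ?_ w
  · rintro _ ⟨y, hy, rfl⟩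
    exact huv y hy
  · exact isClosed_eq (by fun_prop) (by fun_prop)

lemma D_apply_vN (h : IsModular M ψ R D) {a : H →L[ℂ] H} (ha : a ∈ M) :
    D (a ψ) = (2 : ℂ) • star a ψ - R (star a ψ) := by
  simpa using h.D_star _ (star_mem ha)

lemma D_apply_commutant (h : IsModular M ψ R D) {y : H →L[ℂ] H} (hy : y ∈ M.commutant) :
    D (y ψ) = R (star y ψ) := by
  simpa using h.D_star_commutant _ (star_mem hy)

lemma inner_star_apply (a : H →L[ℂ] H) (x y : H) : ⟪star a x, y⟫_ℂ = ⟪x, a y⟫_ℂ := by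
  rw [ContinuousLinearMap.star_eq_adjoint, ContinuousLinearMap.adjoint_inner_left]

lemma inner_star_apply' (a : H →L[ℂ] H) (x y : H) : ⟪x, star a y⟫_ℂ = ⟪a x, y⟫_ℂ := by
  rw [ContinuousLinearMap.star_eq_adjoint, ContinuousLinearMap.adjoint_inner_right]

/-- The key identity: for `x ∈ M'` and `Re ζ > 0` there is `k ∈ M` with
`D x D = ζ (2 - R) k R + ζ̄ R k (2 - R)`. -/
theorem exists_D_comp_D (h : IsModular M ψ R D) {ζ : ℂ} (hζ : 0 < ζ.re) {x : H →L[ℂ] H}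
    (hx : x ∈ M.commutant) : ∃ k ∈ M, ∀ v, D (x (D v)) =
      ζ • ((2 : ℂ) • k (R v) - R (k (R v))) +
        (starRingEnd ℂ) ζ • R (k ((2 : ℂ) • v - R v)) := by
  obtain ⟨k, hk, hkx⟩ := h.radonNikodym ζ hζ x hx
  have hk' := star_mem hk
  refine ⟨star k, hk', fun v => ?_⟩
  refine h.dense_commutant.induction (P := fun v => D (x (D v)) =
      ζ • ((2 : ℂ) • star k (R v) - R (star k (R v))) +
        (starRingEnd ℂ) ζ • R (star k ((2 : ℂ) • v - R v))) ?_ ?_ v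
  swap
  · exact isClosed_eq (by fun_prop) (by fun_prop)
  rintro _ ⟨z, hz, rfl⟩
  refine h.ext_commutant fun y hy => ?_
  obtain ⟨a, ha, ha1, ha2⟩ := h.exists_R_eq y hy
  obtain ⟨b, hb, hb1, hb2⟩ := h.exists_R_eq z hz
  have e0 : ⟪y ψ, D (x (D (z ψ)))⟫_ℂ = ⟪x ψ, (b * star a) ψ⟫_ℂ := by
    rw [h.inner_D', ← ha2, ← hb2]
    have : x (star b ψ) = star b (x ψ) := congr($(commute_of_mem M (star_mem hb) hx) ψ).symm
    rw [this, inner_star_apply]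
    rfl
  have e1 : ⟪k ψ, (b * star a) ψ⟫_ℂ =
      ⟪y ψ, (2 : ℂ) • star k (R (z ψ)) - R (star k (R (z ψ)))⟫_ℂ := by
    have h1 := h.D_apply_vN (mul_mem (star_mem hb) hk)
    have h2 : star (star b * k) ψ = star k (R (z ψ)) := by
      rw [star_mul, star_star, ← hb1]; rfl
    rw [← h2, ← h1, h.inner_D', ← ha2]
    change ⟪k ψ, b (star a ψ)⟫_ℂ = _
    rw [← inner_star_apply]; rfl
  have e2 : ⟪star (b * star a) ψ, star k ψ⟫_ℂ =
      ⟪y ψ, R (star k ((2 : ℂ) • z ψ - R (z ψ)))⟫_ℂ := by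
    have h1 := h.D_apply_vN (mul_mem (star_mem ha) hk')
    have h2 : star (star a * star k) ψ = k (R (y ψ)) := by
      rw [star_mul, star_star, star_star, ← ha1]; rfl
    rw [h2] at h1
    have h3 : ⟪D ((star a * star k) ψ), z ψ⟫_ℂ = ⟪y ψ, R (star k ((2 : ℂ) • z ψ - R (z ψ)))⟫_ℂ := by
      rw [h1, ← h.inner_R, inner_star_apply', inner_sub_left, inner_sub_right, h.inner_R,
        inner_smul_left, inner_smul_right, Complex.conj_ofNat]
    rw [← h3, h.inner_D, ← hb2, star_mul, star_star]
    change ⟪a (star b ψ), star k ψ⟫_ℂ = ⟪star b ψ, star a (star k ψ)⟫_ℂ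
    exact (inner_star_apply' a _ _).symm
  rw [e0, hkx _ (mul_mem hb (star_mem ha)), e1, e2, inner_add_right,
    inner_smul_right (𝕜 := ℂ) _ _ ζ,
    inner_smul_right (𝕜 := ℂ) _ _ ((starRingEnd ℂ) ζ)]

end IsModular

end Modular

end CSGame

namespace CSGame

open Complex Filter Topology
open scoped InnerProductSpace BoundedContinuousFunction


section LogCalculus

/-- The function `x ↦ 2 / (1 + exp x)`. -/
noncomputable def fnR : ℝ →ᵇ ℂ :=
  BoundedContinuousFunction.ofNormedAddCommGroup (fun x => ((2 / (1 + Real.exp x) : ℝ) : ℂ))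
    (by
      refine Complex.continuous_ofReal.comp (Continuous.div (by fun_prop) (by fun_prop) fun x => ?_)
      positivity) 2 fun x => by
    rw [Complex.norm_real, Real.norm_of_nonneg (by positivity)]
    rw [div_le_iff₀ (by positivity)]
    nlinarith [Real.exp_pos x]

/-- The function `x ↦ 1 / cosh (x / 2)`. -/
noncomputable def fnT : ℝ →ᵇ ℂ :=
  BoundedContinuousFunction.ofNormedAddCommGroup (fun x => ((1 / Real.cosh (x / 2) : ℝ) : ℂ))
    (by
      refine Complex.continuous_ofReal.comp (Continuous.div (by fun_prop) (by fun_prop) fun x => ?_)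
      exact (Real.cosh_pos _).ne') 1 fun x => by
    have := Real.one_le_cosh (x / 2)
    rw [Complex.norm_real, Real.norm_of_nonneg (by positivity)]
    rw [div_le_one (by positivity)]
    exact this

@[simp] lemma fnR_apply (x : ℝ) : fnR x = ((2 / (1 + Real.exp x) : ℝ) : ℂ) := rfl
@[simp] lemma fnT_apply (x : ℝ) : fnT x = ((1 / Real.cosh (x / 2) : ℝ) : ℂ) := rfl

/-- The function `x ↦ conj (h (-x))`. -/
noncomputable def conjRefl (h : ℝ →ᵇ ℂ) : ℝ →ᵇ ℂ :=
  star (h.compContinuous ⟨fun x => -x, continuous_neg⟩)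

@[simp] lemma conjRefl_apply (h : ℝ →ᵇ ℂ) (x : ℝ) :
    conjRefl h x = (starRingEnd ℂ) (h (-x)) := rfl

/-- The interval `[0, 2]` in the complex plane. -/
def spec02 : Set ℂ := {z | z.im = 0 ∧ 0 ≤ z.re ∧ z.re ≤ 2}

instance : CompactSpace spec02 := by
  refine isCompact_iff_compactSpace.1 ?_
  have : spec02 = (fun r : ℝ => (r : ℂ)) '' Set.Icc 0 2 := by
    ext z
    constructor
    · rintro ⟨h1, h2, h3⟩
      exact ⟨z.re, ⟨h2, h3⟩, Complex.ext rfl (by simp [h1])⟩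
    · rintro ⟨r, ⟨h1, h2⟩, rfl⟩
      exact ⟨by simp, by simpa using h1, by simpa using h2⟩
  rw [this]
  exact isCompact_Icc.image Complex.continuous_ofReal

/-- The flip `z ↦ 2 - z` of the interval `[0, 2]`. -/
def flip02 : C(spec02, spec02) where
  toFun z := ⟨2 - z.1, by
    obtain ⟨z, h1, h2, h3⟩ := z
    refine ⟨by simp [h1], ?_, ?_⟩ <;> simp <;> linarith⟩

/-- The function `√(r (2 - r))`. -/
noncomputable def rho (r : ℝ) : ℝ := √(r * (2 - r))

lemma continuous_rho : Continuous rho := by unfold rho; fun_prop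

/-- The function `log ((2 - r) / r)`. -/
noncomputable def logRatio (r : ℝ) : ℝ := Real.log ((2 - r) / r)

lemma rho_eq_zero {r : ℝ} (h : ¬ (0 < r ∧ r < 2)) : rho r = 0 := by
  refine Real.sqrt_eq_zero_of_nonpos ?_
  by_cases h0 : 0 < r
  · exact mul_nonpos_of_nonneg_of_nonpos h0.le (by by_contra! h'; exact h ⟨h0, by linarith⟩)
  · exact mul_nonpos_of_nonpos_of_nonneg (by linarith) (by linarith)

lemma continuous_mul_rho (h : ℝ →ᵇ ℂ) : Continuous fun r : ℝ => h (logRatio r) * (rho r : ℂ) := by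
  refine continuous_iff_continuousAt.2 fun r => ?_
  by_cases hr : 0 < r ∧ r < 2
  · refine ContinuousAt.mul (h.continuous.continuousAt.comp ?_)
      (Complex.continuous_ofReal.comp continuous_rho).continuousAt
    have h1 : (2 - r) / r ≠ 0 := div_ne_zero (by linarith) (by linarith)
    exact ContinuousAt.log ((by fun_prop : ContinuousAt (fun r : ℝ => 2 - r) r).div
      continuousAt_id hr.1.ne') h1
  · have h0 := rho_eq_zero hr
    rw [ContinuousAt, h0]
    simp only [ofReal_zero, mul_zero]
    refine squeeze_zero_norm (a := fun r => ‖h‖ * rho r) (fun s => ?_) ?_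
    · rw [norm_mul, Complex.norm_real, Real.norm_of_nonneg (show 0 ≤ rho s from Real.sqrt_nonneg _)]
      exact mul_le_mul_of_nonneg_right (h.norm_coe_le_norm _) (Real.sqrt_nonneg _)
    · have : Tendsto (fun r => ‖h‖ * rho r) (𝓝 r) (𝓝 (‖h‖ * rho r)) :=
        (continuous_const.mul continuous_rho : Continuous fun r => ‖h‖ * rho r).tendsto r
      rwa [h0, mul_zero] at this

/-- The product of `h ∘ log ((2 - r) / r)` and `√(r (2 - r))`, as a continuous function. -/
noncomputable def mulRho (h : ℝ →ᵇ ℂ) : C(spec02, ℂ) :=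
  ⟨fun z => h (logRatio z.1.re) * (rho z.1.re : ℂ), by
    exact (continuous_mul_rho h).comp (by fun_prop)⟩

lemma logRatio_flip (r : ℝ) : logRatio (2 - r) = - logRatio r := by
  rw [logRatio, logRatio, ← Real.log_inv, inv_div]; congr 2; ring

lemma rho_flip (r : ℝ) : rho (2 - r) = rho r := by
  rw [rho, rho]; congr 1; ring

lemma fnT_logRatio (r : ℝ) (hr : 0 < r ∧ r < 2) : 1 / Real.cosh (logRatio r / 2) = rho r := by
  have h2 : 0 < 2 - r := by linarith
  have hr' := hr.1
  have h3 : Real.exp (logRatio r / 2) = √(2 - r) / √r := by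
    rw [Real.exp_half, logRatio, Real.exp_log (by positivity), Real.sqrt_div h2.le]
  rw [Real.cosh_eq, Real.exp_neg, h3, rho, Real.sqrt_mul hr.1.le]
  have e1 := Real.sq_sqrt h2.le
  have e2 := Real.sq_sqrt hr.1.le
  have p1 := Real.sqrt_pos.2 h2
  have p2 := Real.sqrt_pos.2 hr.1
  field_simp
  nlinarith

lemma fnR_logRatio (r : ℝ) (hr : 0 < r ∧ r < 2) : 2 / (1 + Real.exp (logRatio r)) = r := by
  have h2 : 0 < 2 - r := by linarith
  have hr' := hr.1
  rw [logRatio, Real.exp_log (by positivity)]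
  field_simp; ring

variable {H : Type*} [NormedAddCommGroup H] [InnerProductSpace ℂ H] [CompleteSpace H]

lemma dense_range_of_injective {T : H →L[ℂ] H} (hT : IsSelfAdjoint T)
    (hi : ∀ x, T x = 0 → x = 0) : DenseRange T := by
  have h1 : (LinearMap.range T.toLinearMap).topologicalClosure = ⊤ := by
    rw [Submodule.topologicalClosure_eq_top_iff, Submodule.eq_bot_iff]
    intro x hx
    refine hi x (ext_inner_left ℂ fun y => ?_)
    rw [inner_zero_right, ← hT.star_eq, IsModular.inner_star_apply']
    exact (Submodule.mem_orthogonal _ _).1 hx _ ⟨y, rfl⟩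
  have := Submodule.dense_iff_topologicalClosure_eq_top.2 h1
  exact this

lemma exists_cfc02 {R : H →L[ℂ] H} (hR : ∀ x y, ⟪R x, y⟫_ℂ = ⟪x, R y⟫_ℂ)
    (hR0 : ∀ x, 0 ≤ (⟪R x, x⟫_ℂ).re) (hR2 : ∀ x, (⟪R x, x⟫_ℂ).re ≤ 2 * ‖x‖ ^ 2) :
    ∃ κ : C(spec02, ℂ) →⋆ₐ[ℂ] (H →L[ℂ] H), κ (.restrict spec02 (.id ℂ)) = R := by
  have sR : IsSelfAdjoint R := ContinuousLinearMap.isSelfAdjoint_iff_isSymmetric.2 hR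
  have hpos : 0 ≤ R := by
    rw [ContinuousLinearMap.nonneg_iff_isPositive]
    exact ⟨hR, hR0⟩
  have hle : R ≤ algebraMap ℝ (H →L[ℂ] H) 2 := by
    rw [map_ofNat, ContinuousLinearMap.le_def, ← one_add_one_eq_two]
    refine ⟨fun x y => ?_, fun x => ?_⟩
    · have := hR x y
      simp [inner_sub_left, inner_sub_right, inner_add_left, inner_add_right, this]
    · have h1 := hR2 x
      have h2 : (⟪x, x⟫_ℂ).re = ‖x‖ ^ 2 := inner_self_eq_norm_sq (𝕜 := ℂ) x
      rw [ContinuousLinearMap.reApplyInnerSelf_apply]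
      simp only [sub_apply, add_apply, one_apply_eq_self, inner_sub_left,
        inner_add_left, map_sub, map_add, RCLike.re_to_complex, h2]
      linarith
  have hsp : spectrum ℂ R ⊆ spec02 := by
    intro z hz
    have h1 : z.im = 0 := sR.im_eq_zero_of_mem_spectrum hz
    have h2 : z = (z.re : ℂ) := Complex.ext rfl (by simp [h1])
    have h3 : z.re ∈ spectrum ℝ R := by
      rw [h2] at hz
      exact spectrum.of_algebraMap_mem (S := ℂ) hz
    exact ⟨h1, spectrum_nonneg_of_nonneg hpos h3, (le_algebraMap_iff_spectrum_le sR).1 hle _ h3⟩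
  refine ⟨(cfcHom sR.isStarNormal).comp (ContinuousMap.compStarAlgHom' ℂ ℂ
    ⟨Set.inclusion hsp, continuous_inclusion hsp⟩), ?_⟩
  exact cfcHom_id sR.isStarNormal

end LogCalculus

end CSGame

namespace CSGame

open Complex Filter Topology
open scoped InnerProductSpace BoundedContinuousFunction


section LogCalculus

variable {H : Type*} [NormedAddCommGroup H] [InnerProductSpace ℂ H] [CompleteSpace H]

/-- The function `z ↦ conj (f (2 - z))`. -/
noncomputable def conjFlip (f : C(spec02, ℂ)) : C(spec02, ℂ) := star (f.comp flip02)

lemma conjFlip_apply (f : C(spec02, ℂ)) (z : spec02) :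
    conjFlip f z = (starRingEnd ℂ) (f (flip02 z)) := rfl

lemma continuous_conjFlip : Continuous conjFlip := by unfold conjFlip; fun_prop

lemma cfc02_intertwine {R : H →L[ℂ] H} {κ : C(spec02, ℂ) →⋆ₐ[ℂ] (H →L[ℂ] H)}
    (hκ : κ (.restrict spec02 (.id ℂ)) = R) {D : H →SL[starRingEnd ℂ] H}
    (hD : ∀ x, D (R x) = (2 : ℂ) • D x - R (D x)) (f : C(spec02, ℂ)) (v : H) :
    D (κ f v) = κ (conjFlip f) (D v) := by
  have hκc : Continuous κ :=
    AddMonoidHomClass.continuous_of_bound κ 1 fun a => by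
      simpa using NonUnitalStarAlgHom.norm_apply_le κ a
  have hid : ∀ v, D (κ (.restrict spec02 (.id ℂ)) v) =
      κ (conjFlip (.restrict spec02 (.id ℂ))) (D v) := fun v => by
    have : conjFlip (.restrict spec02 (.id ℂ)) = (2 : ℂ) • 1 - .restrict spec02 (.id ℂ) := by
      ext z
      obtain ⟨z, h1, h2, h3⟩ := z
      have : (starRingEnd ℂ) z = z := Complex.conj_eq_iff_im.2 h1
      simp [conjFlip_apply, flip02, this, Complex.conj_ofNat]
    rw [this, hκ, hD, map_sub, map_smul, map_one, hκ]
    rfl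
  have hstar : star (.restrict spec02 (.id ℂ)) = (.restrict spec02 (.id ℂ) : C(spec02, ℂ)) := by
    ext ⟨z, h1, h2, h3⟩
    exact Complex.conj_eq_iff_im.2 h1
  revert v
  refine ContinuousMap.induction_on_of_compact (p := fun f => ∀ v, D (κ f v) =
    κ (conjFlip f) (D v)) (fun r v => ?_) hid (by rw [hstar]; exact hid) (fun f g hf hg v => ?_)
    (fun f g hf hg v => ?_) (fun f hf => ?_) f
  · have h1 : (ContinuousMap.const spec02 r) = r • (1 : C(spec02, ℂ)) := by ext; simp
    have h2 : conjFlip (r • 1) = (starRingEnd ℂ) r • (1 : C(spec02, ℂ)) := by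
      ext; simp [conjFlip_apply]
    rw [h1, h2, map_smul, map_smul, map_one]
    simp
  · have : conjFlip (f + g) = conjFlip f + conjFlip g := by ext; simp [conjFlip_apply]
    rw [this, map_add, map_add]
    simp [hf, hg]
  · have : conjFlip (f * g) = conjFlip f * conjFlip g := by ext; simp [conjFlip_apply]
    rw [this, map_mul, map_mul]
    simp [hf, hg]
  · intro v
    refine (hf.mono fun g hg => hg v).mem_of_closed
      (s := {g | D (κ g v) = κ (conjFlip g) (D v)}) (isClosed_eq ?_ ?_)
    · exact D.continuous.comp ((ContinuousLinearMap.apply ℂ H v).continuous.comp hκc)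
    · exact (ContinuousLinearMap.apply ℂ H (D v)).continuous.comp (hκc.comp continuous_conjFlip)

lemma mulRho_apply (h : ℝ →ᵇ ℂ) (z : spec02) :
    mulRho h z = h (logRatio z.1.re) * (rho z.1.re : ℂ) := rfl

lemma norm_mulRho_le (κ : C(spec02, ℂ) →⋆ₐ[ℂ] (H →L[ℂ] H)) (h : ℝ →ᵇ ℂ) (v : H) :
    ‖κ (mulRho h) v‖ ≤ ‖h‖ * ‖κ (mulRho 1) v‖ := by
  have hsq : ∀ f : C(spec02, ℂ), ((‖κ f v‖ : ℂ)) ^ 2 = ⟪κ (star f * f) v, v⟫_ℂ := fun f => by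
    rw [map_mul, map_star]
    change _ = ⟪star (κ f) (κ f v), v⟫_ℂ
    rw [IsModular.inner_star_apply, inner_self_eq_norm_sq_to_K]
    rfl
  set h' : ℝ →ᵇ ℂ := BoundedContinuousFunction.ofNormedAddCommGroup
    (fun x => ((√(‖h‖ ^ 2 - ‖h x‖ ^ 2) : ℝ) : ℂ)) (by fun_prop) ‖h‖ (fun x => by
      rw [Complex.norm_real, Real.norm_of_nonneg (Real.sqrt_nonneg _)]
      refine Real.sqrt_le_iff.2 ⟨norm_nonneg _, by nlinarith [sq_nonneg ‖h x‖]⟩) with hh'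
  have key : star (mulRho h) * mulRho h + star (mulRho h') * mulRho h' =
      ((‖h‖ ^ 2 : ℝ) : ℂ) • (star (mulRho 1) * mulRho 1) := by
    ext z
    have h1 : h' (logRatio z.1.re) = ((√(‖h‖ ^ 2 - ‖h (logRatio z.1.re)‖ ^ 2) : ℝ) : ℂ) := rfl
    have h2 : 0 ≤ ‖h‖ ^ 2 - ‖h (logRatio z.1.re)‖ ^ 2 := by
      have := h.norm_coe_le_norm (logRatio z.1.re)
      nlinarith [norm_nonneg (h (logRatio z.1.re))]
    simp only [ContinuousMap.add_apply, ContinuousMap.mul_apply, ContinuousMap.star_apply,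
      mulRho_apply, h1, ContinuousMap.smul_apply, RCLike.star_def, map_mul, conj_ofReal,
      BoundedContinuousFunction.coe_one, Pi.one_apply, one_mul, smul_eq_mul]
    have h3 : (starRingEnd ℂ) (h (logRatio z.1.re)) * h (logRatio z.1.re) =
      ((‖h (logRatio z.1.re)‖ ^ 2 : ℝ) : ℂ) := by rw [Complex.conj_mul']; push_cast; rfl
    have h4 : ((√(‖h‖ ^ 2 - ‖h (logRatio z.1.re)‖ ^ 2) : ℝ) : ℂ) *
      ((√(‖h‖ ^ 2 - ‖h (logRatio z.1.re)‖ ^ 2) : ℝ) : ℂ) =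
      ((‖h‖ ^ 2 - ‖h (logRatio z.1.re)‖ ^ 2 : ℝ) : ℂ) := by
      rw [← Complex.ofReal_mul, Real.mul_self_sqrt h2]
    push_cast at h3 h4 ⊢
    linear_combination (rho z.1.re : ℂ) ^ 2 * h3 + (rho z.1.re : ℂ) ^ 2 * h4
  have h5 : ‖κ (mulRho h) v‖ ^ 2 + ‖κ (mulRho h') v‖ ^ 2 =
      ‖h‖ ^ 2 * ‖κ (mulRho 1) v‖ ^ 2 := by
    have := congr(⟪κ $key v, v⟫_ℂ)
    rw [map_add, map_smul, add_apply, smul_apply, inner_add_left, inner_smul_left, ← hsq, ← hsq,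
      ← hsq, conj_ofReal] at this
    exact_mod_cast this
  refine abs_le_of_sq_le_sq' ?_ (by positivity) |>.2
  nlinarith [sq_nonneg ‖κ (mulRho h') v‖]

/-- The bounded continuous functional calculus of `log ((2 - R) / R)`. -/
theorem exists_logCalculus {R : H →L[ℂ] H} (hR : ∀ x y, ⟪R x, y⟫_ℂ = ⟪x, R y⟫_ℂ)
    (hR0 : ∀ x, 0 ≤ (⟪R x, x⟫_ℂ).re) (hR2 : ∀ x, (⟪R x, x⟫_ℂ).re ≤ 2 * ‖x‖ ^ 2)
    (hi : ∀ x, R ((2 : ℂ) • x - R x) = 0 → x = 0) :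
    ∃ Φ : (ℝ →ᵇ ℂ) →⋆ₐ[ℂ] (H →L[ℂ] H), Φ fnR = R ∧ DenseRange (Φ fnT) ∧
      ∀ D : H →SL[starRingEnd ℂ] H, (∀ x, D (R x) = (2 : ℂ) • D x - R (D x)) →
        ∀ h v, D (Φ h v) = Φ (conjRefl h) (D v) := by
  obtain ⟨κ, hκ⟩ := exists_cfc02 hR hR0 hR2
  set T := κ (mulRho 1) with hT
  have sT : IsSelfAdjoint T := by
    rw [isSelfAdjoint_iff, hT, ← map_star]
    congr 1
    ext z
    simp [mulRho_apply]
  have hTT : T * T = κ (.restrict spec02 (.id ℂ) * ((2 : ℂ) • 1 - .restrict spec02 (.id ℂ))) := by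
    rw [hT, ← map_mul]
    congr 1
    ext ⟨z, h1, h2, h3⟩
    have h4 : z = (z.re : ℂ) := Complex.ext rfl (by simp [h1])
    simp only [ContinuousMap.mul_apply, mulRho_apply, BoundedContinuousFunction.coe_one,
      Pi.one_apply, one_mul, ContinuousMap.sub_apply, ContinuousMap.smul_apply,
      ContinuousMap.one_apply, ContinuousMap.restrict_apply, ContinuousMap.id_apply]
    rw [← Complex.ofReal_mul, rho, Real.mul_self_sqrt (by nlinarith)]
    rw [h4]; simp
  have hTi : ∀ x, T x = 0 → x = 0 := fun x hx => hi x <| by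
    have := congr($hTT x)
    rw [map_mul, map_sub, hκ, map_smul, map_one] at this
    change T (T x) = R ((2 : ℂ) • x - R x) at this
    rw [← this, hx, map_zero]
  have hdense := dense_range_of_injective sT hTi
  have hn : ∀ h : ℝ →ᵇ ℂ, ∃ C, ∀ v, ‖(κ (mulRho h)).toLinearMap v‖ ≤ C * ‖T.toLinearMap v‖ :=
    fun h => ⟨‖h‖, fun v => norm_mulRho_le κ h v⟩
  set F : (ℝ →ᵇ ℂ) → H →L[ℂ] H := fun h =>
    (κ (mulRho h)).toLinearMap.extendOfNorm T.toLinearMap with hF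
  have hFT : ∀ h v, F h (T v) = κ (mulRho h) v := fun h v =>
    LinearMap.extendOfNorm_eq (f := (κ (mulRho h)).toLinearMap) (e := T.toLinearMap) hdense
      (hn h) v
  have ext' : ∀ A B : H →L[ℂ] H, (∀ v, A (T v) = B (T v)) → A = B := fun A B hAB => by
    ext v
    exact congr_fun (hdense.equalizer A.continuous B.continuous (funext hAB)) v
  have hcomm : ∀ f v, κ f (T v) = T (κ f v) := fun f v => by
    change (κ f * T) v = (T * κ f) v
    rw [hT, ← map_mul, mul_comm, map_mul]
  have hκκ : ∀ h h' v, κ (mulRho h) (κ (mulRho h') v) = T (κ (mulRho (h * h')) v) :=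
    fun h h' v => by
    change (κ (mulRho h) * κ (mulRho h')) v = (T * κ (mulRho (h * h'))) v
    rw [hT, ← map_mul, ← map_mul]
    congr 2
    ext z
    simp only [ContinuousMap.mul_apply, mulRho_apply, BoundedContinuousFunction.coe_one,
      Pi.one_apply, BoundedContinuousFunction.coe_mul, Pi.mul_apply]
    ring
  have hFc : ∀ h v, F h (T v) = T (F h v) := fun h v => by
    refine hdense.induction_on (p := fun v => F h (T v) = T (F h v)) v
      (isClosed_eq (by fun_prop) (by fun_prop)) fun v => ?_
    rw [hFT, hFT, hcomm]
  refine ⟨{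
    toFun := F
    map_one' := ext' _ _ fun v => by rw [hFT]; rfl
    map_zero' := ext' _ _ fun v => by
      rw [hFT, show mulRho 0 = 0 by ext; simp [mulRho_apply], map_zero]; rfl
    map_add' := fun h h' => ext' _ _ fun v => by
      rw [hFT, show mulRho (h + h') = mulRho h + mulRho h' by ext; simp [mulRho_apply, add_mul],
        map_add, add_apply, add_apply, hFT, hFT]
    map_mul' := fun h h' => ext' _ _ fun v => by
      change _ = F h (F h' (T v))
      refine hdense.induction_on (p := fun v => F (h * h') (T v) = F h (F h' (T v))) v
        (isClosed_eq (by fun_prop) (by fun_prop)) fun v => ?_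
      rw [hFT, hFT, hcomm, ← hκκ, hcomm, hFT]
    commutes' := fun c => ext' _ _ fun v => by
      rw [hFT, show mulRho (algebraMap ℂ (ℝ →ᵇ ℂ) c) = c • mulRho 1 by
        ext; simp [mulRho_apply, Algebra.algebraMap_eq_smul_one], map_smul,
        Algebra.algebraMap_eq_smul_one]
      rfl
    map_star' := fun h => ext' _ _ fun v => ext_inner_left ℂ fun w => by
      rw [IsModular.inner_star_apply', hFT]
      refine hdense.induction_on (p := fun w => ⟪w, κ (mulRho (star h)) v⟫_ℂ = ⟪F h w, T v⟫_ℂ) w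
        (isClosed_eq (by fun_prop) (by fun_prop)) fun w => ?_
      rw [hFT, show mulRho (star h) = star (mulRho h) by ext; simp [mulRho_apply], map_star,
        IsModular.inner_star_apply', hcomm, ← IsModular.inner_star_apply' T, sT.star_eq] },
    ?_, ?_, fun D hD h v => ?_⟩
  · refine ext' _ _ fun v => ?_
    change F fnR (T v) = _
    rw [hFT]
    change _ = (R * T) v
    rw [hT, ← hκ, ← map_mul]
    congr 2
    ext ⟨z, h1, h2, h3⟩
    have h4 : z = (z.re : ℂ) := Complex.ext rfl (by simp [h1])
    simp only [ContinuousMap.mul_apply, mulRho_apply, BoundedContinuousFunction.coe_one,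
      Pi.one_apply, one_mul, ContinuousMap.restrict_apply, ContinuousMap.id_apply, fnR_apply]
    by_cases hr : 0 < z.re ∧ z.re < 2
    · rw [fnR_logRatio _ hr, ← h4]
    · simp [rho_eq_zero hr]
  · have : F fnT = T := by
      refine ext' _ _ fun v => ?_
      rw [hFT]
      change _ = (T * T) v
      rw [hT, ← map_mul]
      congr 2
      ext ⟨z, h1, h2, h3⟩
      simp only [ContinuousMap.mul_apply, mulRho_apply, BoundedContinuousFunction.coe_one,
        Pi.one_apply, one_mul, fnT_apply]
      by_cases hr : 0 < z.re ∧ z.re < 2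
      · rw [fnT_logRatio _ hr]
      · simp [rho_eq_zero hr]
    change DenseRange (F fnT)
    rwa [this]
  · change D (F h v) = F (conjRefl h) (D v)
    have hc : ∀ h : ℝ →ᵇ ℂ, conjFlip (mulRho h) = mulRho (conjRefl h) := fun h => by
      ext z
      simp [conjFlip_apply, mulRho_apply, flip02, logRatio_flip, rho_flip]
    have hDT : ∀ v, D (T v) = T (D v) := fun v => by
      rw [hT, cfc02_intertwine hκ hD, hc]
      congr 3
      ext; simp
    refine hdense.induction_on (p := fun v => D (F h v) = F (conjRefl h) (D v)) v
      (isClosed_eq (by fun_prop) (by fun_prop)) fun v => ?_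
    rw [hFT, cfc02_intertwine hκ hD, hc, hDT, hFT]

end LogCalculus

end CSGame

namespace CSGame

open Complex Filter Topology
open scoped InnerProductSpace BoundedContinuousFunction


section Calculus

variable {H : Type*} [NormedAddCommGroup H] [InnerProductSpace ℂ H] [CompleteSpace H]
  (Φ : (ℝ →ᵇ ℂ) →⋆ₐ[ℂ] (H →L[ℂ] H))

lemma norm_starAlgHom_le_of_norm_le {k k' : ℝ →ᵇ ℂ} (hk : ∀ x, ‖k x‖ ≤ ‖k' x‖) (v : H) :
    ‖Φ k v‖ ≤ ‖Φ k' v‖ := by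
  have hsq : ∀ f : ℝ →ᵇ ℂ, ((‖Φ f v‖ : ℂ)) ^ 2 = ⟪Φ (star f * f) v, v⟫_ℂ := fun f => by
    rw [map_mul, map_star]
    change _ = ⟪star (Φ f) (Φ f v), v⟫_ℂ
    rw [IsModular.inner_star_apply, inner_self_eq_norm_sq_to_K]
    rfl
  set w : ℝ →ᵇ ℂ := BoundedContinuousFunction.ofNormedAddCommGroup
    (fun x => ((√(‖k' x‖ ^ 2 - ‖k x‖ ^ 2) : ℝ) : ℂ)) (by fun_prop) ‖k'‖ (fun x => by
      rw [Complex.norm_real, Real.norm_of_nonneg (Real.sqrt_nonneg _)]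
      have := k'.norm_coe_le_norm x
      refine Real.sqrt_le_iff.2 ⟨norm_nonneg _, by
        nlinarith [sq_nonneg ‖k x‖, norm_nonneg (k' x)]⟩)
  have key : star k * k + star w * w = star k' * k' := by
    ext x
    have h1 : w x = ((√(‖k' x‖ ^ 2 - ‖k x‖ ^ 2) : ℝ) : ℂ) := rfl
    have h2 : 0 ≤ ‖k' x‖ ^ 2 - ‖k x‖ ^ 2 := by nlinarith [hk x, norm_nonneg (k x)]
    simp only [BoundedContinuousFunction.coe_add, BoundedContinuousFunction.coe_mul, Pi.add_apply,
      Pi.mul_apply, BoundedContinuousFunction.star_apply, h1, RCLike.star_def, conj_ofReal,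
      Complex.conj_mul']
    rw [← Complex.ofReal_mul, Real.mul_self_sqrt h2]
    push_cast; ring
  have h5 : ‖Φ k v‖ ^ 2 + ‖Φ w v‖ ^ 2 = ‖Φ k' v‖ ^ 2 := by
    have := congr(⟪Φ $key v, v⟫_ℂ)
    rw [map_add, add_apply, inner_add_left, ← hsq, ← hsq, ← hsq] at this
    exact_mod_cast this
  refine abs_le_of_sq_le_sq' ?_ (by positivity) |>.2
  nlinarith [sq_nonneg ‖Φ w v‖]

lemma norm_starAlgHom_apply_le (h : ℝ →ᵇ ℂ) (v : H) : ‖Φ h v‖ ≤ ‖h‖ * ‖v‖ :=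
  ((Φ h).le_opNorm v).trans <| by gcongr; exact NonUnitalStarAlgHom.norm_apply_le Φ h

lemma norm_mul_fnT_tendsto {ι : Type*} {l : Filter ι} {h : ι → ℝ →ᵇ ℂ} {h₀ : ℝ →ᵇ ℂ} {c : ℝ}
    (hc : ∀ i, ‖h i‖ ≤ c) (hh : TendstoLocallyUniformly (fun i x => h i x) h₀ l) :
    Tendsto (fun i => ‖(h i - h₀) * fnT‖) l (𝓝 0) := by
  refine squeeze_zero_norm' (a := fun i => ‖(h i - h₀) * fnT‖) (by simp) ?_ |>.congr
    fun i => rfl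
  rw [Metric.tendsto_nhds]
  intro ε hε
  have hT : Tendsto (fun x => (c + ‖h₀‖) * ‖fnT x‖) (cocompact ℝ) (𝓝 0) := by
    rw [← mul_zero (c + ‖h₀‖)]
    refine Tendsto.const_mul _ ?_
    have h1 : Tendsto (fun x : ℝ => 2 / Real.exp (|x| / 2)) (cocompact ℝ) (𝓝 0) := by
      refine Tendsto.const_div_atTop (Real.tendsto_exp_atTop.comp ?_) _
      exact Tendsto.atTop_div_const (by norm_num) (tendsto_norm_cocompact_atTop (E := ℝ))
    refine squeeze_zero_norm (fun x => ?_) h1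
    rw [norm_norm, fnT_apply, Complex.norm_real, Real.norm_of_nonneg
      (by have := Real.cosh_pos (x / 2); positivity),
      ← Real.cosh_abs, abs_div, abs_two, Real.cosh_eq]
    rw [div_le_div_iff₀ (by positivity) (by positivity)]
    nlinarith [Real.exp_pos (-(|x| / 2))]
  have h2 := (Metric.tendsto_nhds.1 hT) (ε / 2) (by positivity)
  obtain ⟨K, hK, hKc⟩ := mem_cocompact.1 h2
  have h3 := (tendstoLocallyUniformly_iff_forall_isCompact.1 hh) K hK
  rw [Metric.tendstoUniformlyOn_iff] at h3
  filter_upwards [h3 (ε / 2) (by positivity)] with i hi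
  rw [dist_zero_right, norm_norm]
  refine lt_of_le_of_lt ?_ (half_lt_self hε)
  refine (BoundedContinuousFunction.norm_le (by positivity)).2 fun x => ?_
  rw [BoundedContinuousFunction.coe_mul, Pi.mul_apply, norm_mul]
  have hT1 : ‖fnT x‖ ≤ 1 := by
    have := Real.one_le_cosh (x / 2)
    rw [fnT_apply, Complex.norm_real, Real.norm_of_nonneg (by positivity),
      div_le_one (by positivity)]
    exact this
  by_cases hx : x ∈ K
  · have := hi x hx
    rw [dist_comm, dist_eq_norm] at this
    calc ‖(h i - h₀) x‖ * ‖fnT x‖ ≤ ‖(h i - h₀) x‖ * 1 := by gcongr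
      _ ≤ ε / 2 := by rw [mul_one]; exact this.le
  · have := hKc hx
    simp only [Set.mem_ofPred_eq, dist_zero_right, norm_mul, norm_norm] at this
    have h4 : ‖(h i - h₀) x‖ ≤ c + ‖h₀‖ :=
      ((h i - h₀).norm_coe_le_norm x).trans ((norm_sub_le _ _).trans (by gcongr; exact hc i))
    have h5 : ‖(h i - h₀) x‖ ≤ ‖c + ‖h₀‖‖ := h4.trans (le_abs_self _)
    exact (mul_le_mul_of_nonneg_right h5 (norm_nonneg _)).trans this.le

lemma tendsto_starAlgHom (hΦ : DenseRange (Φ fnT)) {ι : Type*} {l : Filter ι} {h : ι → ℝ →ᵇ ℂ}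
    {h₀ : ℝ →ᵇ ℂ} {c : ℝ} (hc : ∀ i, ‖h i‖ ≤ c)
    (hh : TendstoLocallyUniformly (fun i x => h i x) h₀ l) (v : H) :
    Tendsto (fun i => Φ (h i) v) l (𝓝 (Φ h₀ v)) := by
  have h1 := norm_mul_fnT_tendsto hc hh
  rw [Metric.tendsto_nhds]
  intro ε hε
  obtain ⟨w, hw⟩ := hΦ.exists_dist_lt v (show 0 < ε / (2 * (|c| + ‖h₀‖ + 1)) by positivity)
  have h2 : Tendsto (fun i => ‖(h i - h₀) * fnT‖ * ‖w‖) l (𝓝 0) := by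
    simpa using h1.mul_const ‖w‖
  filter_upwards [Metric.tendsto_nhds.1 h2 (ε / 2) (by positivity)] with i hi
  rw [dist_eq_norm]
  have e : Φ (h i) v - Φ h₀ v = Φ (h i - h₀) (v - Φ fnT w) + Φ ((h i - h₀) * fnT) w := by
    simp only [map_mul, map_sub, sub_apply, mul_apply_eq_comp]
    abel
  rw [e]
  rw [dist_zero_right, norm_mul, norm_norm, norm_norm] at hi
  have h3 := norm_starAlgHom_apply_le Φ ((h i - h₀) * fnT) w
  have h4 : ‖Φ (h i - h₀) (v - Φ fnT w)‖ ≤ ε / 2 := by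
    refine (norm_starAlgHom_apply_le Φ _ _).trans ?_
    rw [dist_eq_norm] at hw
    have h5 : ‖h i - h₀‖ ≤ |c| + ‖h₀‖ + 1 :=
      (norm_sub_le _ _).trans (by linarith [hc i, le_abs_self c])
    calc _ ≤ (|c| + ‖h₀‖ + 1) * (ε / (2 * (|c| + ‖h₀‖ + 1))) := by gcongr
      _ = ε / 2 := by field_simp
  linarith [norm_add_le (Φ (h i - h₀) (v - Φ fnT w)) (Φ ((h i - h₀) * fnT) w)]

/-- A vector fixed by `Φ fnR` only sees the value at `0`. -/
lemma starAlgHom_apply_of_fixed {ψ : H} (hψ : Φ fnR ψ = ψ) (h : ℝ →ᵇ ℂ) :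
    Φ h ψ = h 0 • ψ := by
  have h0 : Φ (fnR - 1) ψ = 0 := by simp [hψ]
  suffices h1 : Φ (h - h 0 • 1) ψ = 0 by
    rw [map_sub, map_smul, map_one, sub_apply, sub_eq_zero] at h1
    exact h1
  set A : ℝ →ᵇ ℂ := BoundedContinuousFunction.ofNormedAddCommGroup
    (fun x => ((‖fnR x - 1‖ : ℝ) : ℂ)) (by fun_prop) ‖fnR - 1‖ (fun x => by
      rw [Complex.norm_real, norm_norm]; exact (fnR - 1).norm_coe_le_norm x) with hA
  have hAx : ∀ x, A x = ((‖fnR x - 1‖ : ℝ) : ℂ) := fun x => rfl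
  have hA0 : Φ A ψ = 0 := by
    rw [← norm_le_zero_iff, ← norm_zero (E := H), ← h0]
    refine norm_starAlgHom_le_of_norm_le Φ (fun x => ?_) ψ
    rw [hAx, Complex.norm_real, norm_norm]; rfl
  have hR1 : ∀ x, fnR x - 1 = (((1 - Real.exp x) / (1 + Real.exp x) : ℝ) : ℂ) := fun x => by
    have : (1 + Real.exp x) ≠ 0 := by positivity
    rw [fnR_apply, ← Complex.ofReal_one, ← Complex.ofReal_sub]
    congr 1
    field_simp; ring
  set m : ℝ →ᵇ ℂ := h - h 0 • 1 with hm
  refine norm_le_zero_iff.1 (le_of_forall_pos_le_add fun ε hε => ?_)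
  obtain ⟨δ, hδ, hmδ⟩ := Metric.continuousAt_iff.1 (m.continuous.continuousAt (x := 0))
    (ε / (‖ψ‖ + 1)) (by positivity)
  have hm0 : m 0 = 0 := by simp [hm]
  set η := (Real.exp δ - 1) / (Real.exp δ + 1) with hη
  have hδ1 : 1 < Real.exp δ := Real.one_lt_exp_iff.2 hδ
  have hη0 : 0 < η := div_pos (by linarith) (by linarith)
  have hlow : ∀ x, δ ≤ |x| → η ≤ ‖fnR x - 1‖ := fun x hx => by
    rw [hR1, Complex.norm_real, Real.norm_eq_abs, abs_div, abs_of_pos (show 0 < 1 + Real.exp x by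
      positivity), hη, div_le_div_iff₀ (by positivity) (by positivity)]
    rcases le_abs'.1 hx with h1 | h1
    · have h2 : Real.exp x ≤ (Real.exp δ)⁻¹ := by rw [← Real.exp_neg]; exact Real.exp_le_exp.2 h1
      have h3 : Real.exp x * Real.exp δ ≤ 1 := by
        calc _ ≤ (Real.exp δ)⁻¹ * Real.exp δ := by gcongr
          _ = 1 := inv_mul_cancel₀ (by positivity)
      have := le_abs_self (1 - Real.exp x)
      nlinarith [Real.exp_pos x]
    · have h2 : Real.exp δ ≤ Real.exp x := Real.exp_le_exp.2 h1
      have := neg_abs_le (1 - Real.exp x)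
      nlinarith [Real.exp_pos x]
  set k : ℝ →ᵇ ℂ := ((ε / (‖ψ‖ + 1) : ℝ) : ℂ) • 1 + ((‖m‖ / η : ℝ) : ℂ) • A with hk
  have hkx : ∀ x, ‖k x‖ = ε / (‖ψ‖ + 1) + ‖m‖ / η * ‖fnR x - 1‖ := fun x => by
    have : k x = ((ε / (‖ψ‖ + 1) + ‖m‖ / η * ‖fnR x - 1‖ : ℝ) : ℂ) := by
      simp [hk, hAx]
    rw [this, Complex.norm_real, Real.norm_of_nonneg (by positivity)]
  have h2 := norm_starAlgHom_le_of_norm_le Φ (k := m) (k' := k) (fun x => ?_) ψ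
  · refine h2.trans ?_
    rw [hk, map_add, map_smul, map_smul, map_one, add_apply, smul_apply, smul_apply, hA0,
      smul_zero, add_zero, one_apply_eq_self, norm_smul, Complex.norm_real,
      Real.norm_of_nonneg (by positivity), zero_add, div_mul_eq_mul_div,
      div_le_iff₀ (by positivity)]
    nlinarith [norm_nonneg ψ]
  · rw [hkx]
    by_cases hx : |x| < δ
    · have := hmδ (x := x) (by simpa using hx)
      rw [hm0, dist_zero_right] at this
      have h3 : 0 ≤ ‖m‖ / η * ‖fnR x - 1‖ := by positivity
      linarith
    · have h3 := hlow x (not_lt.1 hx)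
      have h4 : ‖m‖ / η * η ≤ ‖m‖ / η * ‖fnR x - 1‖ := by gcongr
      rw [div_mul_cancel₀ _ hη0.ne'] at h4
      have h5 : 0 < ε / (‖ψ‖ + 1) := by positivity
      linarith [m.norm_coe_le_norm x]

end Calculus

section Tomita

variable {H : Type*} [NormedAddCommGroup H] [InnerProductSpace ℂ H] [CompleteSpace H]

/-- The data of modular theory: `Φ` is the bounded continuous functional calculus of the logarithm
of the modular operator and `J` is the modular conjugation. -/
structure IsTomita (M : VonNeumannAlgebra H) (ψ : H) (Φ : (ℝ →ᵇ ℂ) →⋆ₐ[ℂ] (H →L[ℂ] H))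
    (J : H →SL[starRingEnd ℂ] H) : Prop where
  modular : IsModular M ψ (Φ fnR) (J.comp (Φ fnT))
  denseRange : DenseRange (Φ fnT)
  J_J : ∀ x, J (J x) = x
  inner_J : ∀ x y, ⟪J x, y⟫_ℂ = ⟪J y, x⟫_ℂ
  J_apply : ∀ h v, J (Φ h v) = Φ (conjRefl h) (J v)

lemma fnR_mul_two_sub : fnR * ((2 : ℂ) • 1 - fnR) = fnT * fnT := by
  ext x
  simp only [BoundedContinuousFunction.coe_mul, Pi.mul_apply, BoundedContinuousFunction.coe_sub,
    Pi.sub_apply, BoundedContinuousFunction.coe_smul, BoundedContinuousFunction.coe_one,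
    Pi.one_apply, fnR_apply, fnT_apply]
  have h1 : Real.exp x = Real.exp (x / 2) ^ 2 :=
    by rw [← Real.exp_nat_mul]; congr 1; push_cast; ring
  have h2 : (2 : ℂ) • (1 : ℂ) = ((2 : ℝ) : ℂ) := by simp
  rw [h2, ← ofReal_sub, ← ofReal_mul, ← ofReal_mul]
  congr 1
  rw [h1, Real.cosh_eq, Real.exp_neg]
  have := Real.exp_pos (x / 2)
  field_simp
  ring

lemma conjRefl_fnT : conjRefl fnT = fnT := by
  ext x
  rw [conjRefl_apply, fnT_apply, fnT_apply, conj_ofReal, neg_div, Real.cosh_neg]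

theorem IsModular.exists_isTomita {M : VonNeumannAlgebra H} {ψ : H} {R : H →L[ℂ] H}
    {D : H →SL[starRingEnd ℂ] H} (h : IsModular M ψ R D) : ∃ Φ J, IsTomita M ψ Φ J := by
  have hi : ∀ x, R ((2 : ℂ) • x - R x) = 0 → x = 0 := fun x hx => by
    have h1 : D x = 0 := by
      have : ⟪D x, D x⟫_ℂ = 0 := by rw [h.inner_D, h.D_D, hx, inner_zero_left]
      exact inner_self_eq_zero.1 this
    have h2 : R x = 0 := h.ext_commutant fun y hy => by
      rw [inner_zero_right, ← h.inner_R]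
      have := h.D_apply_commutant (star_mem hy)
      rw [star_star] at this
      rw [← this, h.inner_D, h1, inner_zero_left]
    refine h.ext_vN fun y hy => ?_
    have h3 := h.D_apply_vN (star_mem hy)
    rw [star_star] at h3
    have h4 : ⟪D (star y ψ), x⟫_ℂ = 0 := by rw [h.inner_D, h1, inner_zero_left]
    rw [h3, inner_sub_left, h.inner_R, h2, inner_zero_right, sub_zero, inner_smul_left] at h4
    rw [inner_zero_right]
    simpa using h4
  obtain ⟨Φ, hΦR, hd, hΦD⟩ := exists_logCalculus h.inner_R h.nonneg_R h.R_le_two hi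
  set T := Φ fnT with hT
  have hDT : ∀ v, D (T v) = T (D v) := fun v => by
    rw [hΦD D h.D_R, conjRefl_fnT]
  have sT : star T = T := by
    rw [hT, ← map_star]
    congr 1
    ext x
    rw [BoundedContinuousFunction.star_apply, fnT_apply, RCLike.star_def, conj_ofReal]
  have hTT : ∀ v, T (T v) = R ((2 : ℂ) • v - R v) := fun v => by
    change (T * T) v = _
    rw [hT, ← map_mul, ← fnR_mul_two_sub, map_mul, map_sub, map_smul, hΦR, map_one]
    rfl
  have hn : ∀ v, ‖D v‖ = ‖T v‖ := fun v => by
    have : ⟪D v, D v⟫_ℂ = ⟪T v, T v⟫_ℂ := by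
      rw [h.inner_D, h.D_D, ← hTT, ← IsModular.inner_star_apply, sT]
    rw [inner_self_eq_norm_sq_to_K, inner_self_eq_norm_sq_to_K] at this
    have h2 : ‖D v‖ ^ 2 = ‖T v‖ ^ 2 := by exact_mod_cast this
    exact (pow_left_inj₀ (norm_nonneg _) (norm_nonneg _) two_ne_zero).1 h2
  set J : H →SL[starRingEnd ℂ] H := D.toLinearMap.extendOfNorm T.toLinearMap with hJ
  have hJT : ∀ v, J (T v) = D v := fun v =>
    LinearMap.extendOfNorm_eq (f := D.toLinearMap) (e := T.toLinearMap) hd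
      ⟨1, fun v => by rw [one_mul]; exact (hn v).le⟩ v
  have hJTD : J.comp T = D := by ext v; exact hJT v
  refine ⟨Φ, J, by rwa [← hT, hΦR, hJTD], hd, fun x => ?_, fun x y => ?_, fun k v => ?_⟩
  · refine hd.induction_on (p := fun x => J (J x) = x) x (isClosed_eq (by fun_prop) (by fun_prop))
      fun v => ?_
    rw [hJT]
    refine hd.induction_on (p := fun v => J (D v) = T v) v
      (isClosed_eq (by fun_prop) (by fun_prop)) fun v => ?_
    rw [hDT, hJT, h.D_D, hTT]
  · refine hd.induction_on (p := fun x => ⟪J x, y⟫_ℂ = ⟪J y, x⟫_ℂ) x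
      (isClosed_eq (by fun_prop) (by fun_prop)) fun x => ?_
    refine hd.induction_on (p := fun y => ⟪J (T x), y⟫_ℂ = ⟪J y, T x⟫_ℂ) y
      (isClosed_eq (by fun_prop) (by fun_prop)) fun y => ?_
    have e : ⟪D x, T y⟫_ℂ = ⟪T (D x), y⟫_ℂ := by
      rw [← IsModular.inner_star_apply, sT]
    rw [hJT, hJT, e, ← hDT, h.inner_D]
  · refine hd.induction_on (p := fun v => J (Φ k v) = Φ (conjRefl k) (J v)) v
      (isClosed_eq (by fun_prop) (by fun_prop)) fun v => ?_
    have : Φ k (T v) = T (Φ k v) := by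
      change (Φ k * T) v = (T * Φ k) v
      rw [hT, ← map_mul, mul_comm, map_mul]
    rw [this, hJT, hJT, hΦD D h.D_R]

end Tomita

end CSGame

namespace CSGame

open Complex Filter Topology
open scoped InnerProductSpace BoundedContinuousFunction


section Uniqueness

open MeasureTheory ProbabilityTheory

/-- The weight `t ↦ exp (θ t) / cosh (π t)`. -/
noncomputable def coshKernel (θ t : ℝ) : ℝ := Real.exp (θ * t) / Real.cosh (Real.pi * t)

lemma continuous_coshKernel (θ : ℝ) : Continuous (coshKernel θ) :=
  Continuous.div (by fun_prop) (by fun_prop) fun _ => (Real.cosh_pos _).ne'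

lemma coshKernel_pos (θ t : ℝ) : 0 < coshKernel θ t :=
  div_pos (Real.exp_pos _) (Real.cosh_pos _)

lemma coshKernel_le (θ t : ℝ) : coshKernel θ t ≤ 2 * Real.exp (θ * t - Real.pi * |t|) := by
  rw [coshKernel, div_le_iff₀ (Real.cosh_pos _), Real.exp_sub, ← Real.cosh_abs, abs_mul,
    abs_of_pos Real.pi_pos, Real.cosh_eq]
  have h1 := Real.exp_pos (θ * t)
  have h2 := Real.exp_pos (Real.pi * |t|)
  have h3 := Real.exp_pos (-(Real.pi * |t|))
  have h4 : 2 * (Real.exp (θ * t) / Real.exp (Real.pi * |t|)) *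
      ((Real.exp (Real.pi * |t|) + Real.exp (-(Real.pi * |t|))) / 2) =
      Real.exp (θ * t) + Real.exp (θ * t) * Real.exp (-(Real.pi * |t|)) /
        Real.exp (Real.pi * |t|) := by
    field_simp
  rw [h4]
  exact le_add_of_nonneg_right (by positivity)

lemma integrable_coshKernel {θ : ℝ} (hθ : |θ| < Real.pi) : Integrable (coshKernel θ) := by
  obtain ⟨h1, h2⟩ := abs_lt.1 hθ
  rw [← integrableOn_univ, ← Set.Iic_union_Ioi (a := (0 : ℝ))]
  refine IntegrableOn.union ?_ ?_
  · refine ((integrableOn_exp_mul_Iic (a := θ + Real.pi) (by linarith) 0).const_mul 2).mono'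
      (continuous_coshKernel θ).aestronglyMeasurable ?_
    refine ae_restrict_of_forall_mem measurableSet_Iic fun t ht => ?_
    rw [Real.norm_of_nonneg (coshKernel_pos θ t).le]
    refine (coshKernel_le θ t).trans_eq ?_
    rw [abs_of_nonpos ht]; ring_nf
  · refine ((integrableOn_exp_mul_Ioi (a := θ - Real.pi) (by linarith) 0).const_mul 2).mono'
      (continuous_coshKernel θ).aestronglyMeasurable ?_
    refine ae_restrict_of_forall_mem measurableSet_Ioi fun t ht => ?_
    rw [Real.norm_of_nonneg (coshKernel_pos θ t).le]
    refine (coshKernel_le θ t).trans_eq ?_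
    rw [abs_of_pos ht]; ring_nf

lemma integrable_coshKernel_mul {θ : ℝ} (hθ : |θ| < Real.pi) {G : ℝ → ℂ} (hG : Continuous G)
    {C : ℝ} (hC : ∀ t, ‖G t‖ ≤ C) : Integrable fun t => (coshKernel θ t : ℂ) * G t :=
  (integrable_coshKernel hθ).ofReal.mul_bdd (c := C) hG.aestronglyMeasurable
    (Eventually.of_forall hC)

lemma eq_of_integral_coshKernel_of_nonneg {f g : ℝ → ℝ} (hf : Continuous f) (hg : Continuous g)
    (hf0 : ∀ t, 0 ≤ f t) (hg0 : ∀ t, 0 ≤ g t) {C : ℝ} (hfC : ∀ t, f t ≤ C) (hgC : ∀ t, g t ≤ C)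
    (h : ∀ θ : ℝ, |θ| < Real.pi → ∫ t, coshKernel θ t * f t = ∫ t, coshKernel θ t * g t) :
    f = g := by
  set d : (ℝ → ℝ) → ℝ → NNReal := fun f t => Real.toNNReal (coshKernel 0 t * f t) with hd
  set μ : (ℝ → ℝ) → Measure ℝ := fun f => volume.withDensity fun t => (d f t : ENNReal) with hμ
  have hdm : ∀ {f}, Continuous f → Measurable (d f) := fun hf =>
    (((continuous_coshKernel 0).mul hf).measurable).real_toNNReal
  have hdc : ∀ {f : ℝ → ℝ} (_ : ∀ t, 0 ≤ f t) (t), ((d f t : NNReal) : ℝ) = coshKernel 0 t * f t :=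
    fun hf t => Real.coe_toNNReal _ (mul_nonneg (coshKernel_pos 0 t).le (hf t))
  have hk : ∀ θ t, coshKernel 0 t * Real.exp (θ * t) = coshKernel θ t := fun θ t => by
    simp [coshKernel]; ring
  have hIntR : ∀ {f : ℝ → ℝ}, Continuous f → (∀ t, 0 ≤ f t) → (∀ t, f t ≤ C) → ∀ θ : ℝ,
      |θ| < Real.pi → Integrable (fun t => coshKernel θ t * f t) := fun hf h0 hC θ hθ =>
    (integrable_coshKernel hθ).mul_bdd (c := C) hf.aestronglyMeasurable
      (Eventually.of_forall fun t => by rw [Real.norm_of_nonneg (h0 t)]; exact hC t)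
  have hset : ∀ {f : ℝ → ℝ}, Continuous f → (∀ t, 0 ≤ f t) → (∀ t, f t ≤ C) → ∀ θ : ℝ,
      |θ| < Real.pi → θ ∈ integrableExpSet id (μ f) := fun {f} hf h0 hC θ hθ => by
    change Integrable (fun t => Real.exp (θ * t)) (volume.withDensity _)
    rw [integrable_withDensity_iff_integrable_smul (hdm hf)]
    refine (hIntR hf h0 hC θ hθ).congr (Eventually.of_forall fun t => ?_)
    change _ = ((d f t : NNReal) : ℝ) * Real.exp (θ * t)
    rw [hdc h0, mul_right_comm, hk]
  have hIntC : ∀ {f : ℝ → ℝ}, Continuous f → (∀ t, 0 ≤ f t) → (∀ t, f t ≤ C) → ∀ z : ℂ,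
      |z.re| < Real.pi → z.re ∈ interior (integrableExpSet id (μ f)) := fun hf h0 hC z hz => by
    refine mem_interior.2 ⟨Set.Ioo (-Real.pi) Real.pi, fun θ hθ => hset hf h0 hC θ (abs_lt.2 hθ),
      isOpen_Ioo, abs_lt.1 hz⟩
  have hmgf : ∀ {f : ℝ → ℝ}, Continuous f → (∀ t, 0 ≤ f t) → ∀ θ : ℝ,
      mgf id (μ f) θ = ∫ t, coshKernel θ t * f t := fun {f} hf h0 θ => by
    change ∫ t, Real.exp (θ * t) ∂(volume.withDensity _) = _
    rw [integral_withDensity_eq_integral_smul (hdm hf)]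
    refine integral_congr_ae (Eventually.of_forall fun t => ?_)
    change ((d f t : NNReal) : ℝ) * Real.exp (θ * t) = _
    rw [hdc h0, mul_right_comm, hk]
  have hfin : ∀ {f : ℝ → ℝ}, Continuous f → (∀ t, 0 ≤ f t) → (∀ t, f t ≤ C) →
      IsFiniteMeasure (μ f) := fun {f} hf h0 hC => by
    have : Integrable (fun _ : ℝ => (1 : ℝ)) (μ f) := by
      have := hset hf h0 hC 0 (by simpa using Real.pi_pos)
      simpa [integrableExpSet] using this
    simpa [integrable_const_iff] using this
  have hfin1 := hfin hf hf0 hfC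
  have hfin2 := hfin hg hg0 hgC
  have key : Set.EqOn (complexMGF id (μ f)) (complexMGF id (μ g)) {z | |z.re| < Real.pi} := by
    refine AnalyticOnNhd.eqOn_of_preconnected_of_frequently_eq (z₀ := 0)
      (fun z hz => analyticAt_complexMGF (hIntC hf hf0 hfC z hz))
      (fun z hz => analyticAt_complexMGF (hIntC hg hg0 hgC z hz)) ?_
      (by simpa using Real.pi_pos) ?_
    · have : {z : ℂ | |z.re| < Real.pi} = reLm ⁻¹' Set.Ioo (-Real.pi) Real.pi := by
        ext z; simp [abs_lt]
      rw [this]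
      exact ((convex_Ioo _ _).linear_preimage reLm).isPreconnected
    · have h1 : ∃ᶠ x : ℝ in 𝓝[≠] (0 : ℝ), complexMGF id (μ f) x = complexMGF id (μ g) x := by
        refine Eventually.frequently ?_
        have : ∀ᶠ x : ℝ in 𝓝 0, |x| < Real.pi :=
          (isOpen_lt continuous_abs continuous_const).mem_nhds (by simpa using Real.pi_pos)
        filter_upwards [nhdsWithin_le_nhds this] with x hx
        rw [complexMGF_ofReal, complexMGF_ofReal, hmgf hf hf0, hmgf hg hg0, h x hx]
      refine Tendsto.frequently ?_ h1
      refine tendsto_nhdsWithin_iff.2 ⟨?_, ?_⟩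
      · have : Tendsto (fun x : ℝ => (x : ℂ)) (𝓝 0) (𝓝 ((0 : ℝ) : ℂ)) :=
          (Complex.continuous_ofReal.tendsto 0)
        exact (by simpa using this : Tendsto (fun x : ℝ => (x : ℂ)) (𝓝 0) (𝓝 0)).mono_left
          nhdsWithin_le_nhds
      · filter_upwards [self_mem_nhdsWithin] with x hx
        simpa using hx
  have hμeq : μ f = μ g := by
    refine Measure.ext_of_charFun (funext fun t => ?_)
    rw [← complexMGF_id_mul_I, ← complexMGF_id_mul_I]
    exact key (by simpa using Real.pi_pos)
  have hae := (withDensity_eq_iff_of_sigmaFinite (hdm hf).coe_nnreal_ennreal.aemeasurable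
    (hdm hg).coe_nnreal_ennreal.aemeasurable).1 hμeq
  have hc : (fun t => coshKernel 0 t * f t) = fun t => coshKernel 0 t * g t := by
    refine (Continuous.ae_eq_iff_eq volume ((continuous_coshKernel 0).mul hf)
      ((continuous_coshKernel 0).mul hg)).1 ?_
    filter_upwards [hae] with t ht
    have h1 : d f t = d g t := by exact_mod_cast ht
    change coshKernel 0 t * f t = coshKernel 0 t * g t
    rw [← hdc hf0, ← hdc hg0, h1]
  funext t
  exact mul_left_cancel₀ (coshKernel_pos 0 t).ne' (congrFun hc t)

theorem eq_zero_of_forall_integral_coshKernel {G : ℝ → ℂ} (hG : Continuous G) {C : ℝ}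
    (hC : ∀ t, ‖G t‖ ≤ C)
    (h : ∀ θ : ℝ, |θ| < Real.pi → ∫ t, (coshKernel θ t : ℂ) * G t = 0) : G = 0 := by
  have hC0 : 0 ≤ C := (norm_nonneg _).trans (hC 0)
  have main : ∀ g : ℝ → ℝ, Continuous g → (∀ t, |g t| ≤ C) →
      (∀ θ : ℝ, |θ| < Real.pi → ∫ t, coshKernel θ t * g t = 0) → g = 0 := fun g hg hgC hgi => by
    have := eq_of_integral_coshKernel_of_nonneg (f := fun t => C + g t) (g := fun _ => C)
      (C := 2 * C) (by fun_prop) (by fun_prop) (fun t => by linarith [(abs_le.1 (hgC t)).1])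
      (fun _ => hC0) (fun t => by linarith [(abs_le.1 (hgC t)).2]) (fun _ => by linarith)
      fun θ hθ => by
        simp_rw [mul_add]
        rw [integral_add ((integrable_coshKernel hθ).mul_const C)
          ((integrable_coshKernel hθ).mul_bdd (c := C) hg.aestronglyMeasurable
          (Eventually.of_forall hgC)), hgi θ hθ, add_zero]
    funext t
    have := congrFun this t
    simpa using this
  have hre := main (fun t => (G t).re) (by fun_prop) (fun t => (abs_re_le_norm _).trans (hC t))
    fun θ hθ => by
      have h1 := congrArg re (h θ hθ)
      have h2 := integral_re (𝕜 := ℂ) (integrable_coshKernel_mul hθ hG hC)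
      simp only [RCLike.re_to_complex] at h2
      rw [← h2] at h1
      simpa using h1
  have him := main (fun t => (G t).im) (by fun_prop) (fun t => (abs_im_le_norm _).trans (hC t))
    fun θ hθ => by
      have h1 := congrArg im (h θ hθ)
      have h2 := integral_im (𝕜 := ℂ) (integrable_coshKernel_mul hθ hG hC)
      simp only [RCLike.im_to_complex] at h2
      rw [← h2] at h1
      simpa using h1
  funext t
  exact Complex.ext (congrFun hre t) (congrFun him t)

end Uniqueness

end CSGame

namespace CSGame

open Complex Filter Topology
open scoped InnerProductSpace BoundedContinuousFunction


section Contour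

open MeasureTheory

lemma eq_zero_of_sinh_pi_mul_eq_zero {z : ℂ} (hz : |z.im| < 1)
    (h : Complex.sinh (Real.pi * z) = 0) : z = 0 := by
  have h1 : Complex.sin (Real.pi * z * I) = 0 := by rw [Complex.sin_mul_I, h, zero_mul]
  obtain ⟨k, hk⟩ := Complex.sin_eq_zero_iff.1 h1
  have hpi : (Real.pi : ℂ) ≠ 0 := by exact_mod_cast Real.pi_ne_zero
  have h2 : z * I = k := by
    have : (Real.pi : ℂ) * (z * I) = Real.pi * k := by rw [← mul_assoc, hk, mul_comm]
    exact mul_left_cancel₀ hpi this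
  have h3 := congrArg re h2
  have h4 := congrArg im h2
  simp at h3 h4
  have h5 : k = 0 := by
    have : |(k : ℝ)| < 1 := by rwa [← h3, abs_neg]
    exact Int.abs_lt_one_iff.1 (by exact_mod_cast this)
  rw [h5] at h2
  simpa using h2

lemma sinh_abs_le_norm_sinh (z : ℂ) : Real.sinh |z.re| ≤ ‖Complex.sinh z‖ := by
  have h1 := norm_sub_norm_le (Complex.exp z) (Complex.exp (-z))
  have h2 := norm_sub_norm_le (Complex.exp (-z)) (Complex.exp z)
  rw [norm_sub_rev] at h2
  simp only [Complex.norm_exp, Complex.neg_re] at h1 h2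
  rw [Complex.sinh, norm_div, Complex.norm_two, Real.sinh_eq]
  rcases abs_cases z.re with ⟨h, -⟩ | ⟨h, -⟩ <;> rw [h]
  · linarith
  · rw [neg_neg]; linarith

theorem integral_coshKernel_mul_shift {φ : ℂ → ℂ} (hφ : Differentiable ℂ φ) {B : ℝ}
    (hB : ∀ z : ℂ, |z.im| ≤ 1 / 2 → ‖φ z‖ ≤ B) {θ : ℝ} (hθ : |θ| < Real.pi) :
    ∫ t : ℝ, (coshKernel θ t : ℂ) * (exp (-(θ / 2 * I)) * φ (t - 1 / 2 * I) +
      exp (θ / 2 * I) * φ (t + 1 / 2 * I)) =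
      ((2 * Real.cos (θ / 2) * ∫ t, coshKernel θ t : ℝ) : ℂ) * φ 0 := by
  have hB0 : 0 ≤ B := (norm_nonneg _).trans (hB 0 (by simp))
  set S : ℂ → ℂ := fun z => Complex.sinh (Real.pi * z) with hS
  have hS0 : S 0 = 0 := by simp [hS]
  have hSd : Differentiable ℂ S := by simp only [hS]; fun_prop
  set f : ℂ → ℂ := fun z => exp (θ * z) * dslope φ 0 z / dslope S 0 z with hf
  have hds : ∀ {g : ℂ → ℂ}, Differentiable ℂ g → Differentiable ℂ (dslope g 0) := fun hg => by
    rw [← differentiableOn_univ]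
    exact (Complex.differentiableOn_dslope univ_mem).2 hg.differentiableOn
  have hne : ∀ z : ℂ, |z.im| < 1 → dslope S 0 z ≠ 0 := fun z hz => by
    by_cases h0 : z = 0
    · rw [h0, dslope_same]
      have : HasDerivAt S (Real.pi : ℂ) 0 := by
        have h1 : HasDerivAt (fun z : ℂ => (Real.pi : ℂ) * z) Real.pi 0 := by
          simpa using (hasDerivAt_id (0 : ℂ)).const_mul (Real.pi : ℂ)
        simpa using h1.csinh
      rw [this.deriv]
      exact_mod_cast Real.pi_ne_zero
    · rw [dslope_of_ne _ h0, slope_def_field, hS0, sub_zero, sub_zero]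
      exact div_ne_zero (fun h => h0 (eq_zero_of_sinh_pi_mul_eq_zero hz h)) h0
  have hfd : DifferentiableOn ℂ f {z | |z.im| < 1} := fun z hz =>
    (DifferentiableAt.div (DifferentiableAt.mul (by fun_prop) (hds hφ z)) (hds hSd z)
      (hne z hz)).differentiableWithinAt
  have hfz : ∀ z : ℂ, z ≠ 0 → f z = exp (θ * z) * (φ z - φ 0) / S z := fun z hz => by
    simp only [hf]
    rw [dslope_of_ne _ hz, dslope_of_ne _ hz, slope_def_field, slope_def_field, hS0, sub_zero,
      sub_zero, mul_div_assoc', div_div_div_cancel_right₀ hz]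
  have hside : ∀ T : ℝ, T ≠ 0 → ∀ y : ℝ, |y| ≤ 1 / 2 → ‖f (T + y * I)‖ ≤
      Real.exp (|θ| * |T|) * (2 * B) / Real.sinh (Real.pi * |T|) := fun T hT y hy => by
    have hz : ((T : ℂ) + y * I) ≠ 0 := fun h => hT (by simpa using congrArg re h)
    rw [hfz _ hz, norm_div, norm_mul, Complex.norm_exp]
    have h1 : 0 < Real.sinh (Real.pi * |T|) := Real.sinh_pos_iff.2 (by positivity)
    have h2 : Real.sinh (Real.pi * |T|) ≤ ‖S (T + y * I)‖ := by
      have := sinh_abs_le_norm_sinh (Real.pi * ((T : ℂ) + y * I))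
      simpa [abs_mul, abs_of_pos Real.pi_pos] using this
    gcongr
    · have : ((θ : ℂ) * (T + y * I)).re = θ * T := by simp
      rw [this, ← abs_mul]
      exact le_abs_self _
    · refine (norm_sub_le _ _).trans ?_
      have h3 := hB (T + y * I) (by simpa using hy)
      have h4 := hB 0 (by simp)
      linarith
  have hlim : Tendsto (fun T : ℝ => Real.exp (|θ| * |T|) * (2 * B) / Real.sinh (Real.pi * |T|))
      atTop (𝓝 0) := by
    have h1 : Tendsto (fun T : ℝ => 8 * B * Real.exp (-((Real.pi - |θ|) * T))) atTop (𝓝 0) := by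
      rw [← mul_zero (8 * B)]
      refine Tendsto.const_mul _ (Real.tendsto_exp_neg_atTop_nhds_zero.comp ?_)
      exact tendsto_id.const_mul_atTop (by linarith)
    refine squeeze_zero_norm' ?_ h1
    filter_upwards [eventually_ge_atTop 1] with T hT
    have hT0 : (0 : ℝ) < T := by linarith
    rw [abs_of_pos hT0]
    have h2 : 0 < Real.sinh (Real.pi * T) := Real.sinh_pos_iff.2 (by positivity)
    rw [Real.norm_of_nonneg (by positivity), div_le_iff₀ h2, Real.sinh_eq]
    have h3 : Real.exp (-((Real.pi - |θ|) * T)) * Real.exp (Real.pi * T) = Real.exp (|θ| * T) := by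
      rw [← Real.exp_add]; ring_nf
    have h4 : Real.exp (-(Real.pi * T)) ≤ Real.exp (Real.pi * T) / 2 := by
      have h5 : 1 ≤ Real.pi * T := by nlinarith [Real.pi_gt_three]
      have h6 : (2 : ℝ) ≤ Real.exp (Real.pi * T) := by
        linarith [Real.add_one_le_exp (Real.pi * T)]
      have h7 : Real.exp (-(Real.pi * T)) ≤ 1 := Real.exp_le_one_iff.2 (by linarith)
      linarith
    calc Real.exp (|θ| * T) * (2 * B)
        = 8 * B * Real.exp (-((Real.pi - |θ|) * T)) * (Real.exp (Real.pi * T) / 4) := by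
          rw [← h3]; ring
      _ ≤ _ := mul_le_mul_of_nonneg_left (by linarith) (by positivity)
  have hcos : ∀ t : ℝ, (Real.cosh (Real.pi * t) : ℂ) ≠ 0 := fun t => by
    exact_mod_cast (Real.cosh_pos _).ne'
  have hI2 : Complex.sinh (Real.pi / 2 * I) = I := by
    rw [Complex.sinh_mul_I, Complex.sin_pi_div_two, one_mul]
  have hC2 : Complex.cosh (Real.pi / 2 * I) = 0 := by
    rw [Complex.cosh_mul_I, Complex.cos_pi_div_two]
  have hbot : ∀ t : ℝ, f (t - 1 / 2 * I) =
      I * (coshKernel θ t * (exp (-(θ / 2 * I)) * (φ (t - 1 / 2 * I) - φ 0))) := fun t => by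
    have hz : ((t : ℂ) - 1 / 2 * I) ≠ 0 := fun h => by simpa using congrArg im h
    have h1 : S (t - 1 / 2 * I) = -(Real.cosh (Real.pi * t) * I) := by
      simp only [hS]
      rw [show (Real.pi : ℂ) * (t - 1 / 2 * I) = Real.pi * t - Real.pi / 2 * I by ring,
        Complex.sinh_sub, hI2, hC2]
      push_cast; ring
    have h2 : exp (θ * (t - 1 / 2 * I)) = exp (θ * t) * exp (-(θ / 2 * I)) := by
      rw [← Complex.exp_add]; ring_nf
    rw [hfz _ hz, h1, h2, coshKernel]
    push_cast
    have := hcos t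
    push_cast at this
    field_simp
    rw [I_sq]; ring
  have htop : ∀ t : ℝ, f (t + 1 / 2 * I) =
      -(I * (coshKernel θ t * (exp (θ / 2 * I) * (φ (t + 1 / 2 * I) - φ 0)))) := fun t => by
    have hz : ((t : ℂ) + 1 / 2 * I) ≠ 0 := fun h => by simpa using congrArg im h
    have h1 : S (t + 1 / 2 * I) = Real.cosh (Real.pi * t) * I := by
      simp only [hS]
      rw [show (Real.pi : ℂ) * (t + 1 / 2 * I) = Real.pi * t + Real.pi / 2 * I by ring,
        Complex.sinh_add, hI2, hC2]
      push_cast; ring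
    have h2 : exp (θ * (t + 1 / 2 * I)) = exp (θ * t) * exp (θ / 2 * I) := by
      rw [← Complex.exp_add]; ring_nf
    rw [hfz _ hz, h1, h2, coshKernel]
    push_cast
    have := hcos t
    push_cast at this
    field_simp
    rw [I_sq]; ring
  set g : ℝ → ℂ := fun t => (coshKernel θ t : ℂ) * (exp (-(θ / 2 * I)) * (φ (t - 1 / 2 * I) - φ 0)
    + exp (θ / 2 * I) * (φ (t + 1 / 2 * I) - φ 0)) with hg
  have hφc := hφ.continuous
  have hn1 : ∀ s : ℝ, ‖exp (s * I)‖ = 1 := fun s => Complex.norm_exp_ofReal_mul_I s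
  have hn2 : ‖exp (θ / 2 * I)‖ = 1 := by simpa using hn1 (θ / 2)
  have hn3 : ‖exp (-(θ / 2 * I))‖ = 1 := by
    have := hn1 (-(θ / 2)); rw [← this]; congr 2; push_cast; ring
  have hb1 : ∀ t : ℝ, ‖φ (t - 1 / 2 * I)‖ ≤ B := fun t => hB _ (by simp [abs_of_pos])
  have hb2 : ∀ t : ℝ, ‖φ (t + 1 / 2 * I)‖ ≤ B := fun t => hB _ (by simp [abs_of_pos])
  have hint1 : Integrable fun t : ℝ => (coshKernel θ t : ℂ) * (exp (-(θ / 2 * I)) *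
      φ (t - 1 / 2 * I) + exp (θ / 2 * I) * φ (t + 1 / 2 * I)) :=
    integrable_coshKernel_mul hθ (by fun_prop) (C := 2 * B) fun t => by
      refine (norm_add_le _ _).trans ?_
      rw [norm_mul, norm_mul, hn2, hn3]
      linarith [hb1 t, hb2 t]
  have hint2 : Integrable fun t : ℝ => (coshKernel θ t : ℂ) * ((exp (-(θ / 2 * I)) +
      exp (θ / 2 * I)) * φ 0) :=
    (integrable_coshKernel hθ).ofReal.mul_const _
  have hgsub : g = fun t => (coshKernel θ t : ℂ) * (exp (-(θ / 2 * I)) *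
      φ (t - 1 / 2 * I) + exp (θ / 2 * I) * φ (t + 1 / 2 * I)) - (coshKernel θ t : ℂ) *
      ((exp (-(θ / 2 * I)) + exp (θ / 2 * I)) * φ 0) := by
    funext t; simp only [hg]; ring
  have hgint : Integrable g := by rw [hgsub]; exact hint1.sub hint2
  have hrect : ∀ T : ℝ, 0 < T → I * (∫ t in (-T)..T, g t) +
      I * (∫ y in (-(1 / 2) : ℝ)..(1 / 2), f (T + y * I)) -
      I * (∫ y in (-(1 / 2) : ℝ)..(1 / 2), f ((-T : ℝ) + y * I)) = 0 := fun T hT => by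
    have h1 := Complex.integral_boundary_rect_eq_zero_of_differentiableOn f
      ⟨-T, -(1 / 2)⟩ ⟨T, 1 / 2⟩ (hfd.mono fun z hz => by
        have h2 := hz.2
        simp only [Set.mem_preimage] at h2
        rw [Set.uIcc_of_le (by norm_num)] at h2
        change |z.im| < 1
        rw [abs_lt]; constructor <;> linarith [h2.1, h2.2])
    simp only [smul_eq_mul] at h1
    have e : ∫ t in (-T)..T, g t = (∫ t in (-T)..T, -I * f (t - 1 / 2 * I)) -
        ∫ t in (-T)..T, -I * f (t + 1 / 2 * I) := by
      rw [← intervalIntegral.integral_sub]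
      · refine intervalIntegral.integral_congr fun t _ => ?_
        simp only [hbot, htop, hg]
        ring_nf
        rw [I_sq]; ring
      · simp only [hbot]
        refine Continuous.intervalIntegrable ?_ _ _
        have := continuous_coshKernel θ
        fun_prop
      · simp only [htop]
        refine Continuous.intervalIntegrable ?_ _ _
        have := continuous_coshKernel θ
        fun_prop
    rw [e, intervalIntegral.integral_const_mul, intervalIntegral.integral_const_mul, mul_sub,
      ← mul_assoc, ← mul_assoc, mul_neg, I_mul_I, neg_neg, one_mul, one_mul]
    rw [← h1]
    have e1 : ∀ x : ℝ, (x : ℂ) + ((-(1 / 2) : ℝ) : ℂ) * I = x - 1 / 2 * I := fun x => by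
      push_cast; ring
    have e2 : ∀ x : ℝ, (x : ℂ) + ((1 / 2 : ℝ) : ℂ) * I = x + 1 / 2 * I := fun x => by
      push_cast; ring
    simp only [e1, e2]
  have hsidelim : ∀ s : ℝ → ℝ, (∀ T, |s T| = |T|) → Tendsto (fun T : ℝ => I *
      (∫ y in (-(1 / 2) : ℝ)..(1 / 2), f ((s T : ℝ) + y * I))) atTop (𝓝 0) := fun s hs => by
    refine squeeze_zero_norm' ?_ hlim
    filter_upwards [eventually_gt_atTop 0] with T hT
    rw [norm_mul, norm_I, one_mul]
    have := intervalIntegral.norm_integral_le_of_norm_le_const (a := (-(1 / 2) : ℝ)) (b := 1 / 2)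
      (f := fun y : ℝ => f ((s T : ℝ) + y * I))
      (C := Real.exp (|θ| * |T|) * (2 * B) / Real.sinh (Real.pi * |T|)) fun y hy => by
        rw [Set.uIoc_of_le (by norm_num)] at hy
        rw [← hs T]
        refine hside (s T) (fun h => ?_) y (abs_le.2 ⟨hy.1.le, hy.2⟩)
        have := hs T
        rw [h, abs_zero] at this
        exact hT.ne' (abs_eq_zero.1 this.symm)
    refine this.trans_eq ?_
    norm_num
  have hfin : ∫ t, g t = 0 := by
    have h1 := (intervalIntegral_tendsto_integral hgint tendsto_neg_atTop_atBot
      tendsto_id).const_mul I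
    have h2 := (h1.add (hsidelim id fun _ => rfl)).sub (hsidelim (fun T => -T) fun T => abs_neg T)
    have h3 : Tendsto (fun _ : ℝ => (0 : ℂ)) atTop (𝓝 (I * ∫ t, g t)) := by
      simp only [add_zero, sub_zero] at h2
      refine h2.congr' ?_
      filter_upwards [eventually_gt_atTop 0] with T hT
      exact hrect T hT
    have := tendsto_nhds_unique h3 tendsto_const_nhds
    simpa using this
  rw [hgsub, integral_sub hint1 hint2, sub_eq_zero] at hfin
  rw [hfin, integral_mul_const, integral_complex_ofReal]
  have : exp (-(θ / 2 * I)) + exp (θ / 2 * I) = ((2 * Real.cos (θ / 2) : ℝ) : ℂ) := by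
    push_cast
    rw [Complex.cos]; ring_nf
  rw [this]
  push_cast
  ring

end Contour

end CSGame

namespace CSGame

open Complex Filter Topology
open scoped InnerProductSpace BoundedContinuousFunction


section Cutoff

/-- A continuous even cutoff function, equal to `1` on `[-n, n]` and to `0` off `[-n-1, n+1]`. -/
noncomputable def cutReal (n : ℕ) (x : ℝ) : ℝ := max 0 (min 1 (n + 1 - |x|))

lemma continuous_cutReal (n : ℕ) : Continuous (cutReal n) := by unfold cutReal; fun_prop

lemma cutReal_nonneg (n : ℕ) (x : ℝ) : 0 ≤ cutReal n x := le_max_left _ _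

lemma cutReal_le_one (n : ℕ) (x : ℝ) : cutReal n x ≤ 1 := max_le zero_le_one (min_le_left _ _)

lemma cutReal_eq_one {n : ℕ} {x : ℝ} (h : |x| ≤ n) : cutReal n x = 1 := by
  rw [cutReal, min_eq_left (by linarith), max_eq_right zero_le_one]

lemma cutReal_eq_zero {n : ℕ} {x : ℝ} (h : n + 1 ≤ |x|) : cutReal n x = 0 :=
  max_eq_left ((min_le_right _ _).trans (by linarith))

/-- The function `x ↦ exp (i t x)`. -/
noncomputable def uFn (t : ℝ) : ℝ →ᵇ ℂ :=
  BoundedContinuousFunction.ofNormedAddCommGroup (fun x => exp ((t * x : ℝ) * I)) (by fun_prop) 1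
    fun x => (Complex.norm_exp_ofReal_mul_I _).le

lemma uFn_apply (t x : ℝ) : uFn t x = exp ((t * x : ℝ) * I) := rfl

/-- The function `x ↦ cutReal n x * exp (i z x)`. -/
noncomputable def expCut (n : ℕ) (z : ℂ) : ℝ →ᵇ ℂ :=
  BoundedContinuousFunction.ofNormedAddCommGroup
    (fun x => (cutReal n x : ℂ) * exp (z * x * I))
    (by have := continuous_cutReal n; fun_prop) (Real.exp (|z.im| * (n + 1))) fun x => by
      rw [norm_mul, Complex.norm_real, Real.norm_of_nonneg (cutReal_nonneg n x), Complex.norm_exp]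
      by_cases hx : |x| ≤ n + 1
      · refine (mul_le_of_le_one_left (Real.exp_pos _).le (cutReal_le_one n x)).trans ?_
        refine Real.exp_le_exp.2 ?_
        have : (z * x * I).re = -(z.im * x) := by simp
        rw [this]
        refine (neg_le_abs _).trans ?_
        rw [abs_mul]
        gcongr
      · rw [cutReal_eq_zero (not_le.1 hx).le, zero_mul]
        positivity

lemma expCut_apply (n : ℕ) (z : ℂ) (x : ℝ) :
    expCut n z x = (cutReal n x : ℂ) * exp (z * x * I) := rfl

lemma norm_expCut_le (n : ℕ) (z : ℂ) : ‖expCut n z‖ ≤ Real.exp (|z.im| * (n + 1)) :=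
  BoundedContinuousFunction.norm_ofNormedAddCommGroup_le _ (Real.exp_pos _).le _

/-- The function `x ↦ x * cutReal n x`. -/
noncomputable def idCut (n : ℕ) : ℝ →ᵇ ℂ :=
  BoundedContinuousFunction.ofNormedAddCommGroup
    (fun x => ((cutReal n x * x : ℝ) : ℂ))
    (by have := continuous_cutReal n; fun_prop) (n + 1) fun x => by
      rw [Complex.norm_real, Real.norm_eq_abs, abs_mul, abs_of_nonneg (cutReal_nonneg n x)]
      by_cases hx : |x| ≤ n + 1
      · exact (mul_le_of_le_one_left (abs_nonneg _) (cutReal_le_one n x)).trans hx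
      · rw [cutReal_eq_zero (not_le.1 hx).le, zero_mul]
        positivity

lemma expCut_eq (n : ℕ) (z : ℂ) :
    expCut n z = NormedSpace.exp (z • (I • idCut (n + 1))) * expCut n 0 := by
  ext x
  set ev : (ℝ →ᵇ ℂ) →+* ℂ :=
    { toFun := fun f => f x, map_one' := rfl, map_mul' := fun _ _ => rfl, map_zero' := rfl,
      map_add' := fun _ _ => rfl }
  have hev : Continuous ev := continuous_eval_const x
  have h1 := NormedSpace.map_exp ev hev (z • (I • idCut (n + 1)))
  change _ = ev (NormedSpace.exp (z • (I • idCut (n + 1)))) * expCut n 0 x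
  rw [h1]
  change _ = NormedSpace.exp (z * (I * ((cutReal (n + 1) x * x : ℝ) : ℂ))) * expCut n 0 x
  rw [expCut_apply, expCut_apply, ← Complex.exp_eq_exp_ℂ]
  by_cases hx : |x| ≤ n + 1
  · rw [cutReal_eq_one (n := n + 1) (by exact_mod_cast hx)]
    simp
    ring_nf
  · rw [cutReal_eq_zero (not_le.1 hx).le]
    simp

lemma differentiable_expCut (n : ℕ) : Differentiable ℂ (expCut n) := by
  have : expCut n = fun z => NormedSpace.exp (z • (I • idCut (n + 1))) * expCut n 0 :=
    funext (expCut_eq n)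
  rw [this]
  exact fun z => ((hasDerivAt_exp_smul_const
    (𝕂 := ℂ) (I • idCut (n + 1)) z).differentiableAt).mul_const _

lemma star_expCut (n : ℕ) (z : ℂ) : star (expCut n z) = expCut n (-(starRingEnd ℂ) z) := by
  ext x
  rw [BoundedContinuousFunction.star_apply, expCut_apply, expCut_apply, RCLike.star_def, map_mul,
    conj_ofReal, ← exp_conj]
  congr 2
  simp

lemma star_uFn (t : ℝ) : star (uFn t) = uFn (-t) := by
  ext x
  rw [BoundedContinuousFunction.star_apply, uFn_apply, uFn_apply, RCLike.star_def, ← exp_conj]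
  congr 1
  simp

lemma uFn_mul_uFn (s t : ℝ) : uFn s * uFn t = uFn (s + t) := by
  ext x
  rw [BoundedContinuousFunction.coe_mul, Pi.mul_apply, uFn_apply, uFn_apply, uFn_apply, ← exp_add]
  congr 1; push_cast; ring

lemma uFn_zero : uFn 0 = 1 := by ext x; simp [uFn_apply]

lemma norm_uFn_le (t : ℝ) : ‖uFn t‖ ≤ 1 :=
  BoundedContinuousFunction.norm_ofNormedAddCommGroup_le _ zero_le_one _

lemma uFn_mul_expCut (n : ℕ) (t : ℝ) (z : ℂ) : uFn t * expCut n z = expCut n (t + z) := by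
  ext x
  rw [BoundedContinuousFunction.coe_mul, Pi.mul_apply, uFn_apply, expCut_apply, expCut_apply,
    mul_left_comm, ← exp_add]
  congr 2; push_cast; ring

/-- The function `x ↦ cutReal n x * cosh (x / 2)`. -/
noncomputable def coshCut (n : ℕ) : ℝ →ᵇ ℂ :=
  (1 / 2 : ℂ) • (expCut n (1 / 2 * I) + expCut n (-(1 / 2 * I)))

lemma expCut_half_I (n : ℕ) (x : ℝ) :
    expCut n (1 / 2 * I) x = ((cutReal n x * Real.exp (-(x / 2)) : ℝ) : ℂ) := by
  rw [expCut_apply]; push_cast; congr 2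
  linear_combination (x / 2 : ℂ) * I_sq

lemma expCut_neg_half_I (n : ℕ) (x : ℝ) :
    expCut n (-(1 / 2 * I)) x = ((cutReal n x * Real.exp (x / 2) : ℝ) : ℂ) := by
  rw [expCut_apply]; push_cast; congr 2
  linear_combination (-x / 2 : ℂ) * I_sq

lemma coshCut_apply (n : ℕ) (x : ℝ) :
    coshCut n x = ((cutReal n x * Real.cosh (x / 2) : ℝ) : ℂ) := by
  change (1 / 2 : ℂ) * (expCut n _ x + expCut n _ x) = _
  rw [expCut_half_I, expCut_neg_half_I, Real.cosh_eq]
  push_cast; ring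

lemma fnT_mul_coshCut (n : ℕ) : fnT * coshCut n = expCut n 0 := by
  ext x
  rw [BoundedContinuousFunction.coe_mul, Pi.mul_apply, coshCut_apply, fnT_apply, expCut_apply,
    ← ofReal_mul]
  have := (Real.cosh_pos (x / 2)).ne'
  rw [show 1 / Real.cosh (x / 2) * (cutReal n x * Real.cosh (x / 2)) = cutReal n x by field_simp]
  simp

lemma fnR_mul_coshCut (n : ℕ) : fnR * coshCut n = expCut n (1 / 2 * I) := by
  ext x
  rw [BoundedContinuousFunction.coe_mul, Pi.mul_apply, coshCut_apply, fnR_apply, expCut_half_I,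
    ← ofReal_mul]
  congr 1
  have h1 : Real.exp x = Real.exp (x / 2) ^ 2 :=
    by rw [← Real.exp_nat_mul]; congr 1; push_cast; ring
  rw [h1, Real.cosh_eq, Real.exp_neg]
  have := Real.exp_pos (x / 2)
  field_simp
  ring

lemma two_sub_fnR_mul_coshCut (n : ℕ) :
    ((2 : ℂ) • 1 - fnR) * coshCut n = expCut n (-(1 / 2 * I)) := by
  rw [sub_mul, fnR_mul_coshCut, coshCut, smul_mul_assoc, one_mul, smul_smul]
  norm_num

lemma tendstoLocallyUniformly_of_cut {h : ℕ → ℝ → ℂ} {h₀ : ℝ → ℂ}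
    (hh : ∀ (n : ℕ) (x : ℝ), |x| ≤ n → h n x = h₀ x) : TendstoLocallyUniformly h h₀ atTop := by
  rw [tendstoLocallyUniformly_iff_forall_isCompact]
  intro K hK
  obtain ⟨r, hr⟩ := hK.isBounded.exists_norm_le
  rw [Metric.tendstoUniformlyOn_iff]
  intro ε hε
  filter_upwards [eventually_ge_atTop ⌈r⌉₊] with n hn x hx
  rw [hh n x ((hr x hx).trans ((Nat.le_ceil r).trans (by exact_mod_cast hn))), dist_self]
  exact hε

lemma tendstoLocallyUniformly_uFn (t₀ : ℝ) :
    TendstoLocallyUniformly (fun t x => uFn t x) (uFn t₀) (𝓝 t₀) := by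
  have h1 : Continuous (Function.uncurry fun t x : ℝ => uFn t x) := by
    simp only [uFn_apply]
    unfold Function.uncurry
    fun_prop
  exact ContinuousMap.tendsto_iff_tendstoLocallyUniformly.1
    ((ContinuousMap.curry ⟨_, h1⟩).continuous.tendsto t₀)

variable {H : Type*} [NormedAddCommGroup H] [InnerProductSpace ℂ H] [CompleteSpace H]
  (Φ : (ℝ →ᵇ ℂ) →⋆ₐ[ℂ] (H →L[ℂ] H))

lemma tendsto_expCut_zero (hΦ : DenseRange (Φ fnT)) (v : H) :
    Tendsto (fun n => Φ (expCut n 0) v) atTop (𝓝 v) := by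
  have := tendsto_starAlgHom Φ hΦ (h := fun n => expCut n 0) (h₀ := 1) (l := atTop) (c := 1)
    (fun n => by simpa using norm_expCut_le n 0)
    (tendstoLocallyUniformly_of_cut fun n x hx => by
      rw [expCut_apply, cutReal_eq_one hx]; simp) v
  simpa using this

lemma continuous_uFn_apply (hΦ : DenseRange (Φ fnT)) (v : H) :
    Continuous fun t => Φ (uFn t) v :=
  continuous_iff_continuousAt.2 fun t => tendsto_starAlgHom Φ hΦ norm_uFn_le
    (tendstoLocallyUniformly_uFn t) v

lemma norm_uFn_apply_le (t : ℝ) (v : H) : ‖Φ (uFn t) v‖ ≤ ‖v‖ :=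
  (norm_starAlgHom_apply_le Φ _ v).trans
    (mul_le_of_le_one_left (norm_nonneg v) (norm_uFn_le t))

end Cutoff

end CSGame

namespace CSGame

open Complex Filter Topology
open scoped InnerProductSpace BoundedContinuousFunction


section Tomita

open MeasureTheory

variable {H : Type*} [NormedAddCommGroup H] [InnerProductSpace ℂ H] [CompleteSpace H]

/-- The linear operator `J x J`. -/
noncomputable def jConj (J : H →SL[starRingEnd ℂ] H) (x : H →L[ℂ] H) : H →L[ℂ] H :=
  J.comp (x.comp J)

@[simp] lemma jConj_apply (J : H →SL[starRingEnd ℂ] H) (x : H →L[ℂ] H) (v : H) :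
    jConj J x v = J (x (J v)) := rfl

/-- The modular automorphism group. -/
noncomputable def modAut (Φ : (ℝ →ᵇ ℂ) →⋆ₐ[ℂ] (H →L[ℂ] H)) (t : ℝ) (a : H →L[ℂ] H) :
    H →L[ℂ] H := Φ (uFn t) * a * Φ (uFn (-t))

namespace IsTomita

variable {M : VonNeumannAlgebra H} {ψ : H} {Φ : (ℝ →ᵇ ℂ) →⋆ₐ[ℂ] (H →L[ℂ] H)}
  {J : H →SL[starRingEnd ℂ] H}

lemma J_T (h : IsTomita M ψ Φ J) (v : H) : J (Φ fnT v) = Φ fnT (J v) := by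
  rw [h.J_apply, conjRefl_fnT]

lemma inner_starAlgHom (f : ℝ →ᵇ ℂ) (u v : H) : ⟪Φ f u, v⟫_ℂ = ⟪u, Φ (star f) v⟫_ℂ := by
  rw [map_star, IsModular.inner_star_apply']

lemma starAlgHom_mul_apply (f g : ℝ →ᵇ ℂ) (v : H) : Φ (f * g) v = Φ f (Φ g v) := by
  rw [map_mul]; rfl

/-- The sesquilinear identity behind Tomita's theorem, tested on spectrally truncated vectors. -/
lemma inner_jConj_cut (h : IsTomita M ψ Φ J) {ζ : ℂ} {x k : H →L[ℂ] H}
    (hk : ∀ v, J (Φ fnT (x (J (Φ fnT v)))) = ζ • ((2 : ℂ) • k (Φ fnR v) - Φ fnR (k (Φ fnR v))) +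
      (starRingEnd ℂ) ζ • Φ fnR (k ((2 : ℂ) • v - Φ fnR v))) (n : ℕ) (u v : H) :
    ⟪Φ (expCut n 0) u, jConj J x (Φ (expCut n 0) v)⟫_ℂ =
      ζ * ⟪Φ (expCut n (-(1 / 2 * I))) u, k (Φ (expCut n (1 / 2 * I)) v)⟫_ℂ +
      (starRingEnd ℂ) ζ * ⟪Φ (expCut n (1 / 2 * I)) u, k (Φ (expCut n (-(1 / 2 * I))) v)⟫_ℂ := by
  have hR : star fnR = fnR := by
    ext x
    rw [BoundedContinuousFunction.star_apply, fnR_apply, RCLike.star_def, conj_ofReal]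
  have hT : star fnT = fnT := by
    ext x
    rw [BoundedContinuousFunction.star_apply, fnT_apply, RCLike.star_def, conj_ofReal]
  have e1 : Φ (expCut n (1 / 2 * I)) v = Φ fnR (Φ (coshCut n) v) := by
    rw [← starAlgHom_mul_apply, fnR_mul_coshCut]
  have e2 : Φ (expCut n (-(1 / 2 * I))) v =
      (2 : ℂ) • Φ (coshCut n) v - Φ fnR (Φ (coshCut n) v) := by
    rw [← two_sub_fnR_mul_coshCut, starAlgHom_mul_apply, map_sub, map_smul, map_one]; rfl
  have e3 : ∀ w, ⟪Φ (expCut n (1 / 2 * I)) u, w⟫_ℂ = ⟪Φ (coshCut n) u, Φ fnR w⟫_ℂ := fun w => by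
    rw [← fnR_mul_coshCut, starAlgHom_mul_apply, inner_starAlgHom, hR]
  have e4 : ∀ w, ⟪Φ (expCut n (-(1 / 2 * I))) u, w⟫_ℂ =
      ⟪Φ (coshCut n) u, (2 : ℂ) • w - Φ fnR w⟫_ℂ := fun w => by
    rw [← two_sub_fnR_mul_coshCut, starAlgHom_mul_apply, map_sub, map_smul, map_one, sub_apply,
      inner_sub_left, inner_sub_right, inner_starAlgHom, hR, smul_apply, inner_smul_left,
      inner_smul_right]
    simp [Complex.conj_ofNat]
  rw [e3, e4, e1, e2, ← inner_smul_right, ← inner_smul_right, ← inner_add_right, ← hk,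
    ← fnT_mul_coshCut, starAlgHom_mul_apply, starAlgHom_mul_apply, inner_starAlgHom, hT, h.J_T]
  rfl

lemma integral_modAut_cut (h : IsTomita M ψ Φ J) {θ : ℝ} (hθ : |θ| < Real.pi) {x k : H →L[ℂ] H}
    (hk : ∀ v, J (Φ fnT (x (J (Φ fnT v)))) = exp (-(θ / 2 * I)) •
      ((2 : ℂ) • k (Φ fnR v) - Φ fnR (k (Φ fnR v))) +
      (starRingEnd ℂ) (exp (-(θ / 2 * I))) • Φ fnR (k ((2 : ℂ) • v - Φ fnR v))) (n : ℕ) (u v : H) :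
    ∫ t : ℝ, (coshKernel θ t : ℂ) * ⟪Φ (expCut n 0) u, modAut Φ t (jConj J x) (Φ (expCut n 0) v)⟫_ℂ
      = ((2 * Real.cos (θ / 2) * ∫ t, coshKernel θ t : ℝ) : ℂ) *
        ⟪Φ (expCut n 0) u, k (Φ (expCut n 0) v)⟫_ℂ := by
  set φ : ℂ → ℂ := fun z => ⟪u, Φ (expCut n z) (k (Φ (expCut n (-z)) v))⟫_ℂ with hφ
  have hΦc : Continuous Φ := AddMonoidHomClass.continuous_of_bound Φ 1 fun f => by
    rw [one_mul]; exact NonUnitalStarAlgHom.norm_apply_le Φ f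
  set Ψ : (ℝ →ᵇ ℂ) →L[ℂ] (H →L[ℂ] H) := ⟨Φ.toAlgHom.toLinearMap, hΦc⟩ with hΨ
  have hφd : Differentiable ℂ φ := by
    have h1 : Differentiable ℂ fun z => Ψ (expCut n z) :=
      Ψ.differentiable.comp (differentiable_expCut n)
    have h2 : Differentiable ℂ fun z => Ψ (expCut n (-z)) :=
      h1.comp differentiable_neg
    have h3 : Differentiable ℂ fun z => (innerSL ℂ u) (Ψ (expCut n z) (k (Ψ (expCut n (-z)) v))) :=
      (innerSL ℂ u).differentiable.comp (h1.clm_apply (k.differentiable.comp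
        (h2.clm_apply (differentiable_const v))))
    exact h3
  have hB : ∀ z : ℂ, |z.im| ≤ 1 / 2 → ‖φ z‖ ≤
      ‖u‖ * (Real.exp (1 / 2 * (n + 1)) * (‖k‖ * (Real.exp (1 / 2 * (n + 1)) * ‖v‖))) :=
    fun z hz => by
      have h1 : ∀ z : ℂ, |z.im| ≤ 1 / 2 → ∀ w, ‖Φ (expCut n z) w‖ ≤
          Real.exp (1 / 2 * (n + 1)) * ‖w‖ := fun z hz w => by
        refine (norm_starAlgHom_apply_le Φ _ w).trans ?_
        gcongr
        refine (norm_expCut_le n z).trans ?_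
        gcongr
      refine (norm_inner_le_norm _ _).trans ?_
      gcongr
      refine (h1 z hz _).trans ?_
      gcongr
      refine (k.le_opNorm _).trans ?_
      gcongr
      exact h1 (-z) (by simpa using hz) _
  have key := integral_coshKernel_mul_shift hφd hB hθ
  have e0 : φ 0 = ⟪Φ (expCut n 0) u, k (Φ (expCut n 0) v)⟫_ℂ := by
    simp only [hφ, neg_zero]
    rw [inner_starAlgHom, star_expCut]; simp
  rw [e0] at key
  rw [← key]
  refine integral_congr_ae (Eventually.of_forall fun t => ?_)
  change _ * _ = _ * _
  congr 1
  have h1 : ⟪Φ (expCut n 0) u, modAut Φ t (jConj J x) (Φ (expCut n 0) v)⟫_ℂ =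
      ⟪Φ (expCut n 0) (Φ (uFn (-t)) u), jConj J x (Φ (expCut n 0) (Φ (uFn (-t)) v))⟫_ℂ := by
    have c : ∀ w, Φ (expCut n 0) (Φ (uFn (-t)) w) = Φ (uFn (-t)) (Φ (expCut n 0) w) := fun w => by
      rw [← starAlgHom_mul_apply, mul_comm, starAlgHom_mul_apply]
    rw [c, c, inner_starAlgHom (uFn (-t)), star_uFn, neg_neg]
    rfl
  rw [h1, h.inner_jConj_cut hk]
  have c : ∀ z w, Φ (expCut n z) (Φ (uFn (-t)) w) = Φ (expCut n ((-t : ℝ) + z)) w := fun z w => by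
    rw [← starAlgHom_mul_apply, mul_comm, uFn_mul_expCut]
  have e5 : (starRingEnd ℂ) (exp (-(θ / 2 * I))) = exp (θ / 2 * I) := by
    rw [← exp_conj]; congr 1; simp [Complex.conj_ofNat]
  rw [c, c, c, c, e5]
  simp only [hφ]
  congr 2
  · rw [inner_starAlgHom, star_expCut]
    congr 3
    · congr 1; simp [Complex.conj_ofNat]; ring
    · congr 3; push_cast; ring
  · rw [inner_starAlgHom, star_expCut]
    congr 3
    · congr 1; simp [Complex.conj_ofNat]; ring
    · congr 3; push_cast; ring

end IsTomita

end Tomita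

end CSGame

namespace CSGame

open Complex Filter Topology
open scoped InnerProductSpace BoundedContinuousFunction


section Tomita

open MeasureTheory

variable {H : Type*} [NormedAddCommGroup H] [InnerProductSpace ℂ H] [CompleteSpace H]

namespace IsTomita

variable {M : VonNeumannAlgebra H} {ψ : H} {Φ : (ℝ →ᵇ ℂ) →⋆ₐ[ℂ] (H →L[ℂ] H)}
  {J : H →SL[starRingEnd ℂ] H}

lemma norm_J (h : IsTomita M ψ Φ J) (v : H) : ‖J v‖ = ‖v‖ := by
  have h1 : ⟪J v, J v⟫_ℂ = ⟪v, v⟫_ℂ := by rw [h.inner_J, h.J_J]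
  rw [inner_self_eq_norm_sq_to_K, inner_self_eq_norm_sq_to_K] at h1
  have h2 : ‖J v‖ ^ 2 = ‖v‖ ^ 2 := by exact_mod_cast h1
  exact (pow_left_inj₀ (norm_nonneg _) (norm_nonneg _) two_ne_zero).1 h2

lemma inner_J' (h : IsTomita M ψ Φ J) (u v : H) : ⟪u, J v⟫_ℂ = ⟪v, J u⟫_ℂ := by
  rw [← inner_conj_symm, h.inner_J, inner_conj_symm]

lemma norm_modAut_apply_le (t : ℝ) (a : H →L[ℂ] H) (v : H) :
    ‖modAut Φ t a v‖ ≤ ‖a‖ * ‖v‖ := by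
  change ‖Φ (uFn t) (a (Φ (uFn (-t)) v))‖ ≤ _
  refine (norm_uFn_apply_le Φ t _).trans ((a.le_opNorm _).trans ?_)
  gcongr
  exact norm_uFn_apply_le Φ _ v

lemma inner_modAut (t : ℝ) (a : H →L[ℂ] H) (u v : H) :
    ⟪u, modAut Φ t a v⟫_ℂ = ⟪Φ (uFn (-t)) u, a (Φ (uFn (-t)) v)⟫_ℂ := by
  rw [inner_starAlgHom, star_uFn, neg_neg]; rfl

lemma continuous_inner_modAut (h : IsTomita M ψ Φ J) (a : H →L[ℂ] H) (u v : H) :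
    Continuous fun t => ⟪u, modAut Φ t a v⟫_ℂ := by
  simp only [inner_modAut]
  have h1 := fun v => (continuous_uFn_apply Φ h.denseRange v).comp continuous_neg
  exact (h1 u).inner (a.continuous.comp (h1 v))

lemma norm_inner_modAut_le (t : ℝ) (a : H →L[ℂ] H) (u v : H) :
    ‖⟪u, modAut Φ t a v⟫_ℂ‖ ≤ ‖u‖ * (‖a‖ * ‖v‖) := by
  refine (norm_inner_le_norm _ _).trans ?_
  gcongr
  exact norm_modAut_apply_le t a v

lemma integral_modAut (h : IsTomita M ψ Φ J) {θ : ℝ} (hθ : |θ| < Real.pi) {x k : H →L[ℂ] H}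
    (hk : ∀ v, J (Φ fnT (x (J (Φ fnT v)))) = exp (-(θ / 2 * I)) •
      ((2 : ℂ) • k (Φ fnR v) - Φ fnR (k (Φ fnR v))) +
      (starRingEnd ℂ) (exp (-(θ / 2 * I))) • Φ fnR (k ((2 : ℂ) • v - Φ fnR v))) (u v : H) :
    ∫ t : ℝ, (coshKernel θ t : ℂ) * ⟪u, modAut Φ t (jConj J x) v⟫_ℂ
      = ((2 * Real.cos (θ / 2) * ∫ t, coshKernel θ t : ℝ) : ℂ) * ⟪u, k v⟫_ℂ := by
  have hE := tendsto_expCut_zero Φ h.denseRange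
  have hb : ∀ n v, ‖Φ (expCut n 0) v‖ ≤ ‖v‖ := fun n v => by
    refine (norm_starAlgHom_apply_le Φ _ v).trans ?_
    have := norm_expCut_le n 0
    simp only [zero_im, abs_zero, zero_mul, Real.exp_zero] at this
    exact mul_le_of_le_one_left (norm_nonneg _) this
  refine tendsto_nhds_unique (tendsto_integral_of_dominated_convergence
    (μ := volume) (f := fun t => (coshKernel θ t : ℂ) * ⟪u, modAut Φ t (jConj J x) v⟫_ℂ)
    (F := fun n t => (coshKernel θ t : ℂ) *
      ⟪Φ (expCut n 0) u, modAut Φ t (jConj J x) (Φ (expCut n 0) v)⟫_ℂ)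
    (fun t => coshKernel θ t * (‖u‖ * (‖jConj J x‖ * ‖v‖))) (fun n => ?_) ?_ (fun n => ?_) ?_) ?_
  · exact (integrable_coshKernel_mul hθ (h.continuous_inner_modAut _ _ _)
      fun t => norm_inner_modAut_le _ _ _ _).1
  · exact (integrable_coshKernel hθ).mul_const _
  · refine Eventually.of_forall fun t => ?_
    rw [norm_mul, norm_real, Real.norm_of_nonneg (coshKernel_pos θ t).le]
    have := (coshKernel_pos θ t).le
    gcongr
    refine (norm_inner_modAut_le _ _ _ _).trans ?_
    gcongr
    · exact hb n u
    · exact hb n v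
  · refine Eventually.of_forall fun t => ?_
    refine Tendsto.const_mul _ ((hE u).inner ?_)
    exact ((modAut Φ t (jConj J x)).continuous.tendsto _).comp (hE v)
  · simp only [h.integral_modAut_cut hθ hk]
    exact Tendsto.const_mul _ ((hE u).inner ((k.continuous.tendsto _).comp (hE v)))

/-- One half of Tomita's theorem. -/
theorem modAut_jConj_mem (h : IsTomita M ψ Φ J) {x : H →L[ℂ] H} (hx : x ∈ M.commutant) (t : ℝ) :
    modAut Φ t (jConj J x) ∈ M := by
  refine mem_of_commute M fun y hy => ?_
  refine ContinuousLinearMap.ext fun v => ext_inner_left ℂ fun u => ?_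
  set G : ℝ → ℂ := fun t => ⟪star y u, modAut Φ t (jConj J x) v⟫_ℂ -
    ⟪u, modAut Φ t (jConj J x) (y v)⟫_ℂ with hG
  have hGc : Continuous G :=
    (h.continuous_inner_modAut _ _ _).sub (h.continuous_inner_modAut _ _ _)
  have hG0 : G = 0 := by
    refine eq_zero_of_forall_integral_coshKernel hGc (C := ‖star y u‖ * (‖jConj J x‖ * ‖v‖) +
      ‖u‖ * (‖jConj J x‖ * ‖y v‖)) (fun t => ?_) fun θ hθ => ?_
    · exact (norm_sub_le _ _).trans (add_le_add (norm_inner_modAut_le _ _ _ _)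
        (norm_inner_modAut_le _ _ _ _))
    · have hre : 0 < (exp (-(θ / 2 * I))).re := by
        have : (-(θ / 2 * I) : ℂ) = ((-(θ / 2) : ℝ) : ℂ) * I := by push_cast; ring
        rw [this, exp_ofReal_mul_I_re]
        rw [abs_lt] at hθ
        exact Real.cos_pos_of_mem_Ioo ⟨by linarith, by linarith⟩
      obtain ⟨k, hkM, hk⟩ := h.modular.exists_D_comp_D hre hx
      simp only [hG, mul_sub]
      rw [integral_sub, h.integral_modAut hθ hk, h.integral_modAut hθ hk,
        IsModular.inner_star_apply, ← mul_apply_eq_comp, ← mul_apply_eq_comp k,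
        commute_of_mem M hkM hy, sub_self]
      all_goals
        exact integrable_coshKernel_mul hθ (h.continuous_inner_modAut _ _ _) fun t =>
          norm_inner_modAut_le _ _ _ _
  have := congrFun hG0 t
  simp only [hG, Pi.zero_apply, sub_eq_zero, IsModular.inner_star_apply] at this
  exact this

lemma modAut_zero (a : H →L[ℂ] H) : modAut Φ 0 a = a := by
  rw [modAut, neg_zero, uFn_zero, map_one, one_mul, mul_one]

theorem jConj_mem (h : IsTomita M ψ Φ J) {x : H →L[ℂ] H} (hx : x ∈ M.commutant) :
    jConj J x ∈ M := by
  simpa [modAut_zero] using h.modAut_jConj_mem hx 0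

lemma fnR_apply_vec (h : IsTomita M ψ Φ J) : Φ fnR ψ = ψ := by
  have h1 := h.modular.D_star 1 (one_mem _)
  have h2 := h.modular.D_star_commutant 1 (one_mem _)
  rw [star_one, one_apply_eq_self] at h1 h2
  have h3 : (2 : ℂ) • Φ fnR ψ = (2 : ℂ) • ψ := by
    rw [eq_sub_iff_add_eq] at h1
    rw [← h1, h2, two_smul]
  exact smul_right_injective _ two_ne_zero h3

lemma starAlgHom_apply_vec (h : IsTomita M ψ Φ J) (f : ℝ →ᵇ ℂ) : Φ f ψ = f 0 • ψ :=
  starAlgHom_apply_of_fixed Φ h.fnR_apply_vec f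

lemma J_vec (h : IsTomita M ψ Φ J) : J ψ = ψ := by
  have h2 := h.modular.D_star_commutant 1 (one_mem _)
  rw [star_one, one_apply_eq_self, h.fnR_apply_vec] at h2
  change J (Φ fnT ψ) = ψ at h2
  rw [h.starAlgHom_apply_vec] at h2
  simpa using h2

end IsTomita

end Tomita

end CSGame

namespace CSGame

open Complex Filter Topology
open scoped InnerProductSpace BoundedContinuousFunction


section Tomita

open MeasureTheory

variable {H : Type*} [NormedAddCommGroup H] [InnerProductSpace ℂ H] [CompleteSpace H]

namespace IsTomita

variable {M : VonNeumannAlgebra H} {ψ : H} {Φ : (ℝ →ᵇ ℂ) →⋆ₐ[ℂ] (H →L[ℂ] H)}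
  {J : H →SL[starRingEnd ℂ] H}

lemma T_J_star (h : IsTomita M ψ Φ J) {c : H →L[ℂ] H} (hc : c ∈ M) :
    Φ fnT (J (star c ψ)) = (2 : ℂ) • c ψ - Φ fnR (c ψ) := by
  rw [← h.J_T]
  exact h.modular.D_star c hc

lemma expCut_J_star (h : IsTomita M ψ Φ J) {c : H →L[ℂ] H} (hc : c ∈ M) (n : ℕ) :
    Φ (expCut n 0) (J (star c ψ)) = Φ (expCut n (-(1 / 2 * I))) (c ψ) := by
  rw [← fnT_mul_coshCut, mul_comm, starAlgHom_mul_apply, h.T_J_star hc,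
    ← two_sub_fnR_mul_coshCut, mul_comm, starAlgHom_mul_apply, map_sub Φ, map_smul Φ, map_one]
  rfl

lemma inner_J_star (h : IsTomita M ψ Φ J) {c x : H →L[ℂ] H} (hc : c ∈ M) (hx : x ∈ M) :
    ⟪J (star x ψ), c ψ⟫_ℂ = ⟪x ψ, J (star c ψ)⟫_ℂ := by
  have hE := tendsto_expCut_zero Φ h.denseRange
  have h1 : ∀ n, ⟪J (star x ψ), Φ (expCut n 0) (c ψ)⟫_ℂ =
      ⟪x ψ, Φ (expCut n 0) (J (star c ψ))⟫_ℂ := fun n => by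
    have e0 : star (expCut n 0) = expCut n 0 := by rw [star_expCut]; simp
    have e1 : star (expCut n (-(1 / 2 * I))) = expCut n (-(1 / 2 * I)) := by
      rw [star_expCut]; simp [Complex.conj_ofNat]
    rw [← e0, ← inner_starAlgHom, h.expCut_J_star hx, e0, h.expCut_J_star hc, inner_starAlgHom, e1]
  exact tendsto_nhds_unique (tendsto_const_nhds.inner (hE _))
    ((tendsto_const_nhds.inner (hE _)).congr fun n => (h1 n).symm)

lemma star_jConj (h : IsTomita M ψ Φ J) (x : H →L[ℂ] H) : star (jConj J x) = jConj J (star x) := by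
  refine ContinuousLinearMap.ext fun v => ext_inner_right ℂ fun u => ?_
  rw [IsModular.inner_star_apply, jConj_apply, jConj_apply, h.inner_J', h.inner_J,
    IsModular.inner_star_apply']

lemma jConj_jConj (h : IsTomita M ψ Φ J) (x : H →L[ℂ] H) : jConj J (jConj J x) = x := by
  ext v; simp [h.J_J]

lemma dense_jConj (h : IsTomita M ψ Φ J) :
    Dense {v | ∃ x ∈ M.commutant, jConj J x ψ = v} := by
  have h1 : {v | ∃ x ∈ M.commutant, jConj J x ψ = v} = J '' {v | ∃ y ∈ M.commutant, y ψ = v} := by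
    ext v
    constructor
    · rintro ⟨x, hx, rfl⟩
      exact ⟨_, ⟨x, hx, rfl⟩, by rw [jConj_apply, h.J_vec]⟩
    · rintro ⟨_, ⟨x, hx, rfl⟩, rfl⟩
      exact ⟨x, hx, by rw [jConj_apply, h.J_vec]⟩
  rw [h1]
  have hs : Function.Surjective J := fun v => ⟨J v, h.J_J v⟩
  exact hs.denseRange.dense_image J.continuous h.modular.dense_commutant

/-- The other half of Tomita's theorem. -/
theorem jConj_mem_commutant (h : IsTomita M ψ Φ J) {x : H →L[ℂ] H} (hx : x ∈ M) :
    jConj J x ∈ M.commutant := by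
  refine mem_of_commute M.commutant fun y hy => ?_
  rw [VonNeumannAlgebra.commutant_commutant] at hy
  have key : ∀ α ∈ M.commutant, ∀ β ∈ M.commutant,
      ⟪jConj J α ψ, (y * jConj J x) (jConj J β ψ)⟫_ℂ =
        ⟪jConj J α ψ, (jConj J x * y) (jConj J β ψ)⟫_ℂ := fun α hα β hβ => by
    have ha := h.jConj_mem hα
    have hb := h.jConj_mem hβ
    have hc : star (jConj J α) * y * jConj J β ∈ M := mul_mem (mul_mem (star_mem ha) hy) hb
    have hcomm : ∀ z ∈ M, ∀ γ ∈ M.commutant, jConj J z (jConj J γ ψ) = jConj J γ (J (z ψ)) :=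
      fun z hz γ hγ => by
        rw [jConj_apply, jConj_apply, jConj_apply, h.J_J, h.J_J, h.J_vec, ← mul_apply_eq_comp,
          commute_of_mem M hz hγ]
        rfl
    have h1 := h.inner_J_star hc hx
    rw [mul_apply_eq_comp, hcomm x hx β hβ, mul_apply_eq_comp (jConj J x),
      ← IsModular.inner_star_apply (jConj J x), h.star_jConj, hcomm _ (star_mem hx) α hα]
    have h2 : ⟪jConj J α (J (star x ψ)), y (jConj J β ψ)⟫_ℂ =
        ⟪J (star x ψ), (star (jConj J α) * y * jConj J β) ψ⟫_ℂ := by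
      rw [← IsModular.inner_star_apply']; rfl
    have h3 : ⟪jConj J α ψ, y (jConj J β (J (x ψ)))⟫_ℂ =
        ⟪star (star (jConj J α) * y * jConj J β) ψ, J (x ψ)⟫_ℂ := by
      rw [IsModular.inner_star_apply, mul_apply_eq_comp, mul_apply_eq_comp,
        IsModular.inner_star_apply']
    rw [h2, h3, h1, h.inner_J']
  have hd := h.dense_jConj
  refine ContinuousLinearMap.ext fun v => ext_inner_left ℂ fun u => ?_
  have h1 : ∀ u ∈ {v | ∃ x ∈ M.commutant, jConj J x ψ = v}, ∀ v,
      ⟪u, (y * jConj J x) v⟫_ℂ = ⟪u, (jConj J x * y) v⟫_ℂ := by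
    rintro _ ⟨α, hα, rfl⟩ v
    refine hd.induction (P := fun v => ⟪jConj J α ψ, (y * jConj J x) v⟫_ℂ =
      ⟪jConj J α ψ, (jConj J x * y) v⟫_ℂ) ?_ (isClosed_eq (by fun_prop) (by fun_prop)) v
    rintro _ ⟨β, hβ, rfl⟩
    exact key α hα β hβ
  exact hd.induction (P := fun u => ⟪u, (y * jConj J x) v⟫_ℂ =
      ⟪u, (jConj J x * y) v⟫_ℂ) (fun u hu => h1 u hu v) (isClosed_eq (by fun_prop) (by fun_prop)) u

/-- The modular automorphism group preserves the algebra. -/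
theorem modAut_mem (h : IsTomita M ψ Φ J) {a : H →L[ℂ] H} (ha : a ∈ M) (t : ℝ) :
    modAut Φ t a ∈ M := by
  rw [← h.jConj_jConj a]
  exact h.modAut_jConj_mem (h.jConj_mem_commutant ha) t

end IsTomita

end Tomita

end CSGame

namespace CSGame

open Complex Filter Topology
open scoped InnerProductSpace BoundedContinuousFunction


section KMS

open MeasureTheory

variable {H : Type*} [NormedAddCommGroup H] [InnerProductSpace ℂ H] [CompleteSpace H]

namespace IsTomita

variable {M : VonNeumannAlgebra H} {ψ : H} {Φ : (ℝ →ᵇ ℂ) →⋆ₐ[ℂ] (H →L[ℂ] H)}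
  {J : H →SL[starRingEnd ℂ] H}

lemma starAlgHom_J_star (h : IsTomita M ψ Φ J) {c : H →L[ℂ] H} (hc : c ∈ M) {k : ℕ}
    {p q : ℝ →ᵇ ℂ} (hp : ∀ x, (k : ℝ) < |x| → p x = 0) (hpq : ∀ x, q x = Real.exp (x / 2) * p x) :
    Φ p (J (star c ψ)) = Φ q (c ψ) := by
  have h0 : p = p * expCut k 0 := by
    ext x
    rw [BoundedContinuousFunction.mul_apply, expCut_apply]
    by_cases hx : |x| ≤ k
    · simp [cutReal_eq_one hx]
    · simp [hp x (not_le.1 hx)]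
  have h1 : q = p * expCut k (-(1 / 2 * I)) := by
    ext x
    rw [BoundedContinuousFunction.mul_apply, expCut_apply, hpq]
    by_cases hx : |x| ≤ k
    · have : (-(1 / 2 * I) * x * I : ℂ) = ((x / 2 : ℝ) : ℂ) := by
        push_cast; linear_combination (-(x : ℂ) / 2) * I_mul_I
      rw [cutReal_eq_one hx, this, ofReal_exp]
      push_cast; ring
    · simp [hp x (not_le.1 hx)]
  rw [h1, starAlgHom_mul_apply, ← h.expCut_J_star hc, ← starAlgHom_mul_apply, ← h0]

/-- The KMS condition, tested on compactly supported functions of the modular operator. -/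
lemma inner_starAlgHom_swap (h : IsTomita M ψ Φ J) {a b : H →L[ℂ] H} (ha : a ∈ M) (hb : b ∈ M)
    {k : ℕ} {n n' : ℝ →ᵇ ℂ} (hn : ∀ x, (k : ℝ) < |x| → n x = 0)
    (hn' : ∀ x, n' x = Real.exp x * n (-x)) :
    ⟪star b ψ, Φ n (a ψ)⟫_ℂ = ⟪star a ψ, Φ n' (b ψ)⟫_ℂ := by
  set p := n * expCut k (1 / 2 * I) with hp
  have hpx : ∀ x, p x = Real.exp (-x / 2) * n x := fun x => by
    rw [hp, BoundedContinuousFunction.mul_apply, expCut_apply]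
    by_cases hx : |x| ≤ k
    · have : ((1 / 2 * I) * x * I : ℂ) = ((-x / 2 : ℝ) : ℂ) := by
        push_cast; linear_combination ((x : ℂ) / 2) * I_mul_I
      rw [cutReal_eq_one hx, this, ofReal_exp]
      push_cast; ring
    · simp [hn x (not_le.1 hx)]
  have h1 : Φ p (J (star a ψ)) = Φ n (a ψ) := by
    refine h.starAlgHom_J_star ha (k := k) (fun x hx => by rw [hpx, hn x hx, mul_zero]) fun x => ?_
    rw [hpx, ← mul_assoc, ← ofReal_mul, ← Real.exp_add]
    simp [neg_div]
  have h2 : Φ (star (conjRefl p)) (J (star b ψ)) = Φ n' (b ψ) := by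
    refine h.starAlgHom_J_star hb (k := k) (fun x hx => ?_) fun x => ?_
    · rw [BoundedContinuousFunction.star_apply, conjRefl_apply, hpx, hn (-x) (by rwa [abs_neg])]
      simp
    · rw [BoundedContinuousFunction.star_apply, conjRefl_apply, RCLike.star_def, conj_conj, hpx,
        hn', ← mul_assoc, ← ofReal_mul, ← Real.exp_add]
      congr 3; ring
  rw [← h1, ← h2, ← inner_starAlgHom, h.inner_J', h.J_apply]
  congr 3
  ext x
  simp

end IsTomita

end KMS

end CSGame

namespace CSGame

open Complex Filter Topology
open scoped InnerProductSpace BoundedContinuousFunction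


section Shift

open MeasureTheory

/-- The translate `x ↦ g (x - s)`. -/
noncomputable def shiftFn (g : ℝ →ᵇ ℂ) (s : ℝ) : ℝ →ᵇ ℂ :=
  g.compContinuous ⟨fun x => x - s, by fun_prop⟩

@[simp] lemma shiftFn_apply (g : ℝ →ᵇ ℂ) (s x : ℝ) : shiftFn g s x = g (x - s) := rfl

/-- Composition with `x ↦ -x`. -/
noncomputable def reflFn (g : ℝ →ᵇ ℂ) : ℝ →ᵇ ℂ := g.compContinuous ⟨fun x => -x, by fun_prop⟩

@[simp] lemma reflFn_apply (g : ℝ →ᵇ ℂ) (x : ℝ) : reflFn g x = g (-x) := rfl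

lemma hasCompactSupport_of_abs {E : Type*} [Zero E] {g : ℝ → E} {k : ℝ}
    (hg : ∀ x, k < |x| → g x = 0) : HasCompactSupport g := by
  refine HasCompactSupport.intro (isCompact_closedBall (0 : ℝ) k) fun x hx => hg x ?_
  simpa using hx

lemma continuous_shiftFn {g : ℝ →ᵇ ℂ} {k : ℝ} (hg : ∀ x, k < |x| → g x = 0) :
    Continuous (shiftFn g) := by
  have huc : UniformContinuous g :=
    (hasCompactSupport_of_abs hg).uniformContinuous_of_continuous g.continuous
  rw [Metric.uniformContinuous_iff] at huc
  rw [Metric.continuous_iff]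
  intro s ε hε
  obtain ⟨δ, hδ, h⟩ := huc (ε / 2) (half_pos hε)
  refine ⟨δ, hδ, fun s' hs' => ?_⟩
  refine lt_of_le_of_lt ((BoundedContinuousFunction.dist_le (half_pos hε).le).2 fun x => ?_)
    (half_lt_self hε)
  refine (h ?_).le
  change dist (x - s') (x - s) < δ
  rwa [dist_sub_left]

lemma continuous_reflFn_shiftFn {g : ℝ →ᵇ ℂ} {k : ℝ} (hg : ∀ x, k < |x| → g x = 0) :
    Continuous fun s => reflFn (shiftFn g s) :=
  (BoundedContinuousFunction.lipschitz_compContinuous _).continuous.comp (continuous_shiftFn hg)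

lemma integral_shift_swap (g : ℝ →ᵇ ℂ) (t x : ℝ) :
    ∫ s : ℝ, (Real.exp s * g (-s) * exp (-(t * s) * I)) * (exp (t * x * I) * g (x - s)) =
      ∫ s : ℝ, (Real.exp s * g (-s) * exp (-(t * s) * I)) * (Real.exp x * g (-x - s)) := by
  rw [← integral_add_right_eq_self _ x]
  congr 1 with s
  have e1 : exp (-(t * (s + x : ℝ)) * I) * exp (t * x * I) = exp (-(t * s) * I) := by
    rw [← exp_add]; congr 1; push_cast; ring
  have e2 : (Real.exp (s + x) : ℂ) = Real.exp s * Real.exp x := by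
    rw [Real.exp_add, ofReal_mul]
  rw [← e1, e2, show x - (s + x) = -s by ring, show -(s + x) = -x - s by ring]
  ring

variable {H : Type*} [NormedAddCommGroup H] [InnerProductSpace ℂ H] [CompleteSpace H]
variable {M : VonNeumannAlgebra H} {ψ : H} {Φ : (ℝ →ᵇ ℂ) →⋆ₐ[ℂ] (H →L[ℂ] H)}
  {J : H →SL[starRingEnd ℂ] H}

lemma continuous_starAlgHom (Φ : (ℝ →ᵇ ℂ) →⋆ₐ[ℂ] (H →L[ℂ] H)) : Continuous Φ :=
  AddMonoidHomClass.continuous_of_bound Φ 1 fun f => by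
    rw [one_mul]; exact NonUnitalStarAlgHom.norm_apply_le Φ f

/-- The KMS condition integrated against translations turns into a trace property. -/
theorem IsTomita.integral_swap (h : IsTomita M ψ Φ J) {a b : H →L[ℂ] H} (ha : a ∈ M) (hb : b ∈ M)
    {g : ℝ →ᵇ ℂ} {k : ℕ} (hg : ∀ x, (k : ℝ) < |x| → g x = 0) (t : ℝ) :
    ∫ s : ℝ, (Real.exp s * g (-s) * exp (-(t * s) * I)) *
        ⟪star a ψ, Φ (uFn t) (Φ (shiftFn g s) (b ψ))⟫_ℂ =
      ∫ s : ℝ, (Real.exp s * g (-s) * exp (-(t * s) * I)) *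
        ⟪star b ψ, Φ (shiftFn g s) (a ψ)⟫_ℂ := by
  set L : (ℝ →ᵇ ℂ) →L[ℂ] ℂ := (innerSL ℂ (star a ψ)).comp
    (((ContinuousLinearMap.apply ℂ H (b ψ))).comp
      ⟨Φ.toAlgHom.toLinearMap, continuous_starAlgHom Φ⟩) with hL
  have hLx : ∀ f, L f = ⟪star a ψ, Φ f (b ψ)⟫_ℂ := fun f => rfl
  set c : ℝ → ℂ := fun s => Real.exp s * g (-s) * exp (-(t * s) * I) with hc
  have hcc : Continuous c := by have := g.continuous; fun_prop
  have hcs : HasCompactSupport c := by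
    refine hasCompactSupport_of_abs (k := k) fun x hx => ?_
    simp [hc, hg (-x) (by rwa [abs_neg])]
  set G : ℝ →ᵇ ℂ := g * expCut k I with hG
  have hGx : ∀ x, G x = Real.exp (-x) * g x := fun x => by
    rw [hG, BoundedContinuousFunction.mul_apply, expCut_apply]
    by_cases hx : |x| ≤ k
    · have : (I * x * I : ℂ) = ((-x : ℝ) : ℂ) := by
        push_cast; linear_combination (x : ℂ) * I_mul_I
      rw [cutReal_eq_one hx, this, ofReal_exp]
      push_cast; ring
    · simp [hg x (not_le.1 hx)]
  have hGs : ∀ x, (k : ℝ) < |x| → G x = 0 := fun x hx => by rw [hGx, hg x hx, mul_zero]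
  set K1 : ℝ → ℝ →ᵇ ℂ := fun s => c s • (uFn t * shiftFn g s) with hK1
  set K2 : ℝ → ℝ →ᵇ ℂ := fun s => c s • ((Real.exp (-s) : ℂ) • reflFn (shiftFn G s)) with hK2
  have i1 : Integrable K1 := by
    refine Continuous.integrable_of_hasCompactSupport ?_ hcs.smul_right
    exact hcc.smul (continuous_const.mul (continuous_shiftFn hg))
  have i2 : Integrable K2 := by
    refine Continuous.integrable_of_hasCompactSupport ?_ hcs.smul_right
    refine hcc.smul (Continuous.smul (continuous_ofReal.comp (Real.continuous_exp.comp
      continuous_neg)) (continuous_reflFn_shiftFn hGs))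
  have hK : ∫ s, K1 s = ∫ s, K2 s := by
    ext x
    have e : ∀ K : ℝ → ℝ →ᵇ ℂ, Integrable K → (∫ s, K s) x = ∫ s, K s x := fun K hK =>
      ((BoundedContinuousFunction.evalCLM ℂ x).integral_comp_comm hK).symm
    rw [e _ i1, e _ i2]
    convert integral_shift_swap g t x using 3 with s s
    · simp only [hK1, hc, BoundedContinuousFunction.coe_smul, BoundedContinuousFunction.mul_apply,
        smul_eq_mul, uFn_apply, shiftFn_apply]
      push_cast; ring
    · simp only [hK2, hc, BoundedContinuousFunction.coe_smul,
        smul_eq_mul, reflFn_apply, shiftFn_apply, hGx]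
      rw [show -(-x - s) = x + s by ring, Real.exp_add, Real.exp_neg]
      have : (Real.exp s : ℂ) ≠ 0 := by simp
      push_cast
      field_simp
  have e1 : ∀ s, L (K1 s) = c s * ⟪star a ψ, Φ (uFn t) (Φ (shiftFn g s) (b ψ))⟫_ℂ := fun s => by
    rw [hK1, map_smul, hLx, IsTomita.starAlgHom_mul_apply, smul_eq_mul]
  have e2 : ∀ s, L (K2 s) = c s * ⟪star b ψ, Φ (shiftFn g s) (a ψ)⟫_ℂ := fun s => by
    rw [hK2, map_smul, hLx, smul_eq_mul]
    congr 1
    obtain ⟨k', hk'⟩ := exists_nat_gt ((k : ℝ) + |s|)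
    refine (h.inner_starAlgHom_swap ha hb (k := k') (n := shiftFn g s)
      (fun x hx => hg (x - s) ?_) fun x => ?_).symm
    · have := abs_sub_abs_le_abs_sub x s
      linarith
    · simp only [BoundedContinuousFunction.coe_smul, smul_eq_mul, reflFn_apply, shiftFn_apply, hGx]
      rw [← mul_assoc, ← ofReal_mul, ← Real.exp_add]
      congr 3; ring
  calc _ = ∫ s, L (K1 s) := by simp only [e1]; rfl
    _ = L (∫ s, K1 s) := L.integral_comp_comm i1
    _ = L (∫ s, K2 s) := by rw [hK]
    _ = ∫ s, L (K2 s) := (L.integral_comp_comm i2).symm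
    _ = _ := by simp only [e2]; rfl

end Shift

section Trig

lemma exists_trig_approx_on {f : ℝ →ᵇ ℂ} {k : ℝ} (hf : ∀ x, k ≤ |x| → f x = 0) {N ε : ℝ}
    (hN : k ≤ N) (hN0 : 0 < N) (hε : 0 < ε) : ∃ h ∈ Submodule.span ℂ (Set.range uFn),
      ‖h‖ ≤ ‖f‖ + ε ∧ ∀ x, |x| < N → ‖h x - f x‖ ≤ ε := by
  have : Fact (0 < 2 * N) := ⟨by linarith⟩
  have hab : -N + 2 * N = N := by ring
  set F : C(AddCircle (2 * N), ℂ) := ⟨AddCircle.liftIco (2 * N) (-N) f,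
    AddCircle.liftIco_continuous (by
      rw [hab, hf _ (by rwa [abs_neg, abs_of_pos hN0]), hf _ (by rwa [abs_of_pos hN0])])
      f.continuous.continuousOn⟩ with hF
  have hFn : ‖F‖ ≤ ‖f‖ := by
    refine (ContinuousMap.norm_le _ (norm_nonneg _)).2 fun z => ?_
    obtain ⟨x, hx, rfl⟩ := AddCircle.coe_image_Ico_eq (2 * N) (-N) ▸ Set.mem_univ z
    rw [hF]
    change ‖AddCircle.liftIco (2 * N) (-N) f _‖ ≤ _
    rw [AddCircle.liftIco_coe_apply hx]
    exact f.norm_coe_le_norm x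
  have hd : F ∈ (Submodule.span ℂ (Set.range (fourier (T := 2 * N)))).topologicalClosure := by
    rw [span_fourier_closure_eq_top]; trivial
  obtain ⟨p, hp, hpF⟩ := Metric.mem_closure_iff.1 hd ε hε
  set Ψ : C(AddCircle (2 * N), ℂ) →ₗ[ℂ] (ℝ →ᵇ ℂ) :=
    { toFun := fun q => (BoundedContinuousFunction.mkOfCompact q).compContinuous
        ⟨fun x => (x : AddCircle (2 * N)), AddCircle.continuous_mk' _⟩
      map_add' := fun _ _ => rfl
      map_smul' := fun _ _ => rfl } with hΨ
  have hΨx : ∀ q x, Ψ q x = q (x : AddCircle (2 * N)) := fun _ _ => rfl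
  rw [dist_eq_norm] at hpF
  refine ⟨Ψ p, ?_, ?_, fun x hx => ?_⟩
  · have : Submodule.span ℂ (Set.range (fourier (T := 2 * N))) ≤
        (Submodule.span ℂ (Set.range uFn)).comap Ψ := by
      refine Submodule.span_le.2 ?_
      rintro _ ⟨m, rfl⟩
      refine Submodule.subset_span ⟨2 * Real.pi * m / (2 * N), ?_⟩
      ext x
      rw [hΨx, uFn_apply, fourier_coe_apply]
      congr 1; push_cast; ring
    exact this hp
  · refine (BoundedContinuousFunction.norm_le (by positivity)).2 fun x => ?_
    rw [hΨx]
    refine (p.norm_coe_le_norm _).trans ?_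
    have := norm_sub_norm_le p F
    rw [norm_sub_rev] at this
    linarith
  · have : f x = F (x : AddCircle (2 * N)) := by
      rw [hF]
      change _ = AddCircle.liftIco (2 * N) (-N) f _
      rw [AddCircle.liftIco_coe_apply]
      rw [abs_lt] at hx
      exact ⟨hx.1.le, by linarith [hx.2]⟩
    rw [this, hΨx, ← ContinuousMap.sub_apply]
    refine ((p - F).norm_coe_le_norm _).trans ?_
    rw [norm_sub_rev]; exact hpF.le

lemma exists_trig_approx {f : ℝ →ᵇ ℂ} {k : ℝ} (hf : ∀ x, k ≤ |x| → f x = 0) :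
    ∃ h : ℕ → ℝ →ᵇ ℂ, (∀ n, h n ∈ Submodule.span ℂ (Set.range uFn)) ∧ (∀ n, ‖h n‖ ≤ ‖f‖ + 1) ∧
      TendstoLocallyUniformly (fun n x => h n x) f atTop := by
  have h1 : ∀ n : ℕ, ∃ h ∈ Submodule.span ℂ (Set.range uFn),
      ‖h‖ ≤ ‖f‖ + 1 / ((n : ℝ) + 1) ∧ ∀ x, |x| < |k| + n + 1 → ‖h x - f x‖ ≤ 1 / ((n : ℝ) + 1) :=
    fun n => exists_trig_approx_on hf (by linarith [le_abs_self k, n.cast_nonneg (α := ℝ)])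
      (by positivity) (by positivity)
  choose h h2 h3 h4 using h1
  refine ⟨h, h2, fun n => (h3 n).trans ?_, ?_⟩
  · gcongr
    rw [div_le_one (by positivity)]
    linarith [n.cast_nonneg (α := ℝ)]
  · rw [Metric.tendstoLocallyUniformly_iff]
    intro ε hε x
    refine ⟨Metric.ball x 1, Metric.ball_mem_nhds _ one_pos, ?_⟩
    have e1 := (tendsto_one_div_add_atTop_nhds_zero_nat (𝕜 := ℝ)).eventually (gt_mem_nhds hε)
    have e2 := tendsto_natCast_atTop_atTop (R := ℝ) |>.eventually (eventually_ge_atTop |x|)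
    filter_upwards [e1, e2] with n hn1 hn2 y hy
    rw [dist_comm, dist_eq_norm]
    refine (h4 n y ?_).trans_lt hn1
    rw [Metric.mem_ball, Real.dist_eq] at hy
    have := abs_sub_abs_le_abs_sub y x
    linarith [abs_nonneg k]

end Trig

end CSGame

namespace CSGame

open Complex Filter Topology
open scoped InnerProductSpace BoundedContinuousFunction


variable {H : Type*} [NormedAddCommGroup H] [InnerProductSpace ℂ H] [CompleteSpace H]

section Crossed

/-- The function `s ↦ e^{-its} a Φ(u_t)`. -/
noncomputable def crossedElem (Φ : (ℝ →ᵇ ℂ) →⋆ₐ[ℂ] (H →L[ℂ] H)) (a : H →L[ℂ] H) (t : ℝ) :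
    ℝ →ᵇ (H →L[ℂ] H) :=
  BoundedContinuousFunction.ofNormedAddCommGroup
    (fun s : ℝ => exp (-(t * s) * I) • (a * Φ (uFn t))) (by fun_prop) ‖a * Φ (uFn t)‖ fun s => by
      rw [norm_smul, show (-(t * s) * I : ℂ) = ((-(t * s) : ℝ) : ℂ) * I by push_cast; ring,
        norm_exp_ofReal_mul_I, one_mul]

lemma crossedElem_apply (Φ : (ℝ →ᵇ ℂ) →⋆ₐ[ℂ] (H →L[ℂ] H)) (a : H →L[ℂ] H) (t s : ℝ) :
    crossedElem Φ a t s = exp (-(t * s) * I) • (a * Φ (uFn t)) := rfl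

lemma crossedElem_mul (Φ : (ℝ →ᵇ ℂ) →⋆ₐ[ℂ] (H →L[ℂ] H)) (a b : H →L[ℂ] H) (t r : ℝ) :
    crossedElem Φ a t * crossedElem Φ b r = crossedElem Φ (a * modAut Φ t b) (t + r) := by
  ext1 s
  have h : Φ (uFn t) * (b * Φ (uFn r)) = modAut Φ t b * Φ (uFn (t + r)) := by
    rw [modAut, mul_assoc _ (Φ (uFn (-t))), ← map_mul, uFn_mul_uFn, neg_add_cancel_left, mul_assoc]
  simp only [BoundedContinuousFunction.mul_apply, crossedElem_apply, smul_mul_smul_comm]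
  rw [← exp_add, mul_assoc a, h, mul_assoc]
  congr 2; push_cast; ring

/-- The linear span of the functions `s ↦ e^{-its} a Φ(u_t)` with `a ∈ M`. -/
noncomputable def crossedSpan (M : VonNeumannAlgebra H) (Φ : (ℝ →ᵇ ℂ) →⋆ₐ[ℂ] (H →L[ℂ] H)) :
    Submodule ℂ (ℝ →ᵇ (H →L[ℂ] H)) :=
  Submodule.span ℂ {w | ∃ a ∈ M, ∃ t, w = crossedElem Φ a t}

variable {M : VonNeumannAlgebra H} {ψ : H} {Φ : (ℝ →ᵇ ℂ) →⋆ₐ[ℂ] (H →L[ℂ] H)}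
  {J : H →SL[starRingEnd ℂ] H}

lemma IsTomita.mul_mem_crossedSpan (h : IsTomita M ψ Φ J) {v w : ℝ →ᵇ (H →L[ℂ] H)}
    (hv : v ∈ crossedSpan M Φ) (hw : w ∈ crossedSpan M Φ) : v * w ∈ crossedSpan M Φ := by
  have := Submodule.mul_mem_mul hv hw
  rw [crossedSpan, Submodule.span_mul_span] at this
  refine Submodule.span_mono ?_ this
  rintro _ ⟨_, ⟨a, ha, t, rfl⟩, _, ⟨b, hb, r, rfl⟩, rfl⟩
  exact ⟨_, mul_mem ha (h.modAut_mem hb t), t + r, crossedElem_mul Φ a b t r⟩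

/-- Pointwise strong limits of uniformly bounded sequences from `crossedSpan M Φ`. -/
def IsCrossedLimit (M : VonNeumannAlgebra H) (Φ : (ℝ →ᵇ ℂ) →⋆ₐ[ℂ] (H →L[ℂ] H))
    (w : ℝ →ᵇ (H →L[ℂ] H)) : Prop :=
  ∃ v : ℕ → ℝ →ᵇ (H →L[ℂ] H), (∀ n, v n ∈ crossedSpan M Φ) ∧ (∃ c, ∀ n, ‖v n‖ ≤ c) ∧
    ∀ s x, Tendsto (fun n => v n s x) atTop (𝓝 (w s x))

lemma IsCrossedLimit.add {v w : ℝ →ᵇ (H →L[ℂ] H)} (hv : IsCrossedLimit M Φ v)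
    (hw : IsCrossedLimit M Φ w) : IsCrossedLimit M Φ (v + w) := by
  obtain ⟨v', h1, ⟨c, h2⟩, h3⟩ := hv
  obtain ⟨w', k1, ⟨d, k2⟩, k3⟩ := hw
  exact ⟨fun n => v' n + w' n, fun n => add_mem (h1 n) (k1 n),
    ⟨c + d, fun n => (norm_add_le _ _).trans (add_le_add (h2 n) (k2 n))⟩,
    fun s x => (h3 s x).add (k3 s x)⟩

lemma IsCrossedLimit.algebraMap_mul {w : ℝ →ᵇ (H →L[ℂ] H)} (hw : IsCrossedLimit M Φ w) (z : ℂ) :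
    IsCrossedLimit M Φ (algebraMap ℂ _ z * w) := by
  obtain ⟨w', k1, ⟨d, k2⟩, k3⟩ := hw
  have e : ∀ w : ℝ →ᵇ (H →L[ℂ] H), algebraMap ℂ _ z * w = z • w := fun w =>
    (Algebra.smul_def z w).symm
  refine ⟨fun n => algebraMap ℂ _ z * w' n, fun n => ?_, ⟨‖z‖ * d, fun n => ?_⟩,
    fun s x => ?_⟩
  · change algebraMap ℂ _ z * w' n ∈ _
    rw [e]; exact Submodule.smul_mem _ z (k1 n)
  · change ‖algebraMap ℂ _ z * w' n‖ ≤ _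
    rw [e, norm_smul]
    exact mul_le_mul_of_nonneg_left (k2 n) (norm_nonneg z)
  · simp only [e]
    exact (k3 s x).const_smul z

lemma IsTomita.isCrossedLimit_mul (h : IsTomita M ψ Φ J) {v w : ℝ →ᵇ (H →L[ℂ] H)}
    (hv : IsCrossedLimit M Φ v) (hw : IsCrossedLimit M Φ w) : IsCrossedLimit M Φ (v * w) := by
  obtain ⟨v', h1, ⟨c, h2⟩, h3⟩ := hv
  obtain ⟨w', k1, ⟨d, k2⟩, k3⟩ := hw
  have hc : 0 ≤ c := (norm_nonneg _).trans (h2 0)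
  refine ⟨fun n => v' n * w' n, fun n => h.mul_mem_crossedSpan (h1 n) (k1 n),
    ⟨c * d, fun n => (norm_mul_le _ _).trans (by gcongr; exacts [h2 n, k2 n])⟩, fun s x => ?_⟩
  have e1 : Tendsto (fun n => v' n s (w' n s x - w s x)) atTop (𝓝 0) := by
    have e2 : Tendsto (fun n => c * ‖w' n s x - w s x‖) atTop (𝓝 0) := by
      simpa using ((k3 s x).sub_const (w s x)).norm.const_mul c
    refine squeeze_zero_norm (fun n => ?_) e2
    refine ((v' n s).le_opNorm _).trans ?_
    gcongr
    exact ((v' n).norm_coe_le_norm s).trans (h2 n)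
  simpa [BoundedContinuousFunction.mul_apply, mul_apply_eq_comp] using e1.add (h3 s (w s x))

lemma isCrossedLimit_const {a : H →L[ℂ] H} (ha : a ∈ M) :
    IsCrossedLimit M Φ (BoundedContinuousFunction.const ℝ a) := by
  refine ⟨fun _ => crossedElem Φ a 0, fun _ => Submodule.subset_span ⟨a, ha, 0, rfl⟩,
    ⟨_, fun _ => le_rfl⟩, fun s x => ?_⟩
  simp [crossedElem_apply, uFn_zero]

/-- The function `s ↦ Φ(f(· - s))`. -/
noncomputable def hatFn (Φ : (ℝ →ᵇ ℂ) →⋆ₐ[ℂ] (H →L[ℂ] H)) (f : ℝ →ᵇ ℂ) (k : ℕ)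
    (hf : ∀ x, (k : ℝ) < |x| → f x = 0) : ℝ →ᵇ (H →L[ℂ] H) :=
  BoundedContinuousFunction.ofNormedAddCommGroup (fun s : ℝ => Φ (shiftFn f s))
    ((continuous_starAlgHom Φ).comp (continuous_shiftFn hf)) ‖f‖ fun s =>
      (NonUnitalStarAlgHom.norm_apply_le Φ _).trans
        ((BoundedContinuousFunction.norm_le (norm_nonneg f)).2 fun x => f.norm_coe_le_norm (x - s))

lemma hatFn_apply {f : ℝ →ᵇ ℂ} {k : ℕ} (hf : ∀ x, (k : ℝ) < |x| → f x = 0) (s : ℝ) :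
    hatFn Φ f k hf s = Φ (shiftFn f s) := rfl

lemma exists_crossedSpan_eq {f : ℝ →ᵇ ℂ} (hf : f ∈ Submodule.span ℂ (Set.range uFn)) :
    ∃ w ∈ crossedSpan M Φ, ∀ s, w s = Φ (shiftFn f s) := by
  induction hf using Submodule.span_induction with
  | mem f hf =>
    obtain ⟨t, rfl⟩ := hf
    refine ⟨crossedElem Φ 1 t, Submodule.subset_span ⟨1, one_mem M, t, rfl⟩, fun s => ?_⟩
    rw [crossedElem_apply, one_mul, ← map_smul]
    congr 1
    ext x
    simp only [BoundedContinuousFunction.coe_smul, smul_eq_mul, shiftFn_apply, uFn_apply]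
    rw [← exp_add]
    congr 1; push_cast; ring
  | zero => exact ⟨0, zero_mem _, fun s => (map_zero Φ).symm⟩
  | add f g _ _ hf hg =>
    obtain ⟨v, hv, hv'⟩ := hf
    obtain ⟨w, hw, hw'⟩ := hg
    refine ⟨v + w, add_mem hv hw, fun s => ?_⟩
    rw [BoundedContinuousFunction.add_apply, hv', hw', ← map_add]; rfl
  | smul z f _ hf =>
    obtain ⟨v, hv, hv'⟩ := hf
    refine ⟨z • v, Submodule.smul_mem _ _ hv, fun s => ?_⟩
    change z • v s = _
    rw [hv', ← map_smul]; rfl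

lemma IsTomita.isCrossedLimit_hatFn (h : IsTomita M ψ Φ J) {f : ℝ →ᵇ ℂ} {k : ℕ}
    (hf : ∀ x, (k : ℝ) < |x| → f x = 0) : IsCrossedLimit M Φ (hatFn Φ f k hf) := by
  obtain ⟨p, hp, hpn, hpt⟩ := exists_trig_approx (f := f) (k := k + 1)
    (fun x hx => hf x (by linarith))
  choose w hw hw' using fun n => exists_crossedSpan_eq (M := M) (Φ := Φ) (hp n)
  have hb : ∀ n s, ‖shiftFn (p n) s‖ ≤ ‖f‖ + 1 := fun n s =>
    (BoundedContinuousFunction.norm_le (by positivity)).2 fun x =>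
      ((p n).norm_coe_le_norm (x - s)).trans (hpn n)
  refine ⟨w, hw, ⟨‖f‖ + 1, fun n => (BoundedContinuousFunction.norm_le (by positivity)).2
    fun s => ?_⟩, fun s x => ?_⟩
  · rw [hw']
    exact (NonUnitalStarAlgHom.norm_apply_le Φ _).trans (hb n s)
  · simp only [hw', hatFn_apply]
    refine tendsto_starAlgHom Φ h.denseRange (fun n => hb n s) ?_ x
    exact hpt.comp (fun x => x - s) (by fun_prop)

end Crossed

end CSGame

namespace CSGame

open Complex Filter Topology
open scoped InnerProductSpace BoundedContinuousFunction


section Trace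

open MeasureTheory

variable {H : Type*} [NormedAddCommGroup H] [InnerProductSpace ℂ H] [CompleteSpace H]

/-- The functional `w ↦ ∫_{-k}^0 e^s ⟪ψ, w(s) ψ⟫ ds`. -/
noncomputable def weightInt (ψ : H) (k : ℕ) (w : ℝ →ᵇ (H →L[ℂ] H)) : ℂ :=
  ∫ s in Set.Icc (-k : ℝ) 0, (Real.exp s : ℂ) * ⟪ψ, w s ψ⟫_ℂ

lemma integrableOn_weight (ψ φ : H) (k : ℕ) (w : ℝ →ᵇ (H →L[ℂ] H)) :
    IntegrableOn (fun s : ℝ => (Real.exp s : ℂ) * ⟪ψ, w s φ⟫_ℂ) (Set.Icc (-k : ℝ) 0) := by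
  have := w.continuous
  exact (by fun_prop : Continuous fun s : ℝ => (Real.exp s : ℂ) * ⟪ψ,
    w s φ⟫_ℂ).continuousOn.integrableOn_Icc

lemma weightInt_add (ψ : H) (k : ℕ) (v w : ℝ →ᵇ (H →L[ℂ] H)) :
    weightInt ψ k (v + w) = weightInt ψ k v + weightInt ψ k w := by
  rw [weightInt, weightInt, weightInt,
    ← integral_add (integrableOn_weight ψ ψ k v) (integrableOn_weight ψ ψ k w)]
  congr 1 with s
  rw [BoundedContinuousFunction.add_apply, add_apply, inner_add_right, mul_add]

lemma weightInt_algebraMap_mul (ψ : H) (k : ℕ) (z : ℂ) (w : ℝ →ᵇ (H →L[ℂ] H)) :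
    weightInt ψ k (algebraMap ℂ _ z * w) = z * weightInt ψ k w := by
  rw [show algebraMap ℂ _ z * w = z • w from (Algebra.smul_def z w).symm, weightInt, weightInt,
    ← integral_const_mul]
  congr 1 with s
  change _ * ⟪ψ, z • w s ψ⟫_ℂ = _
  rw [inner_smul_right]; ring

variable {M : VonNeumannAlgebra H} {ψ : H} {Φ : (ℝ →ᵇ ℂ) →⋆ₐ[ℂ] (H →L[ℂ] H)}
  {J : H →SL[starRingEnd ℂ] H}

lemma star_hatFn {f : ℝ →ᵇ ℂ} {k : ℕ} (hf : ∀ x, (k : ℝ) < |x| → f x = 0) (hs : star f = f) :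
    star (hatFn Φ f k hf) = hatFn Φ f k hf := by
  ext1 s
  change star (Φ (shiftFn f s)) = Φ (shiftFn f s)
  rw [← map_star]
  congr 1
  ext x
  exact DFunLike.congr_fun hs (x - s)

/-- `w ↦ ∫ e^s f(-s)² ⟪ψ, (w b̂ - b̂ w) ψ⟫ ds`, where `b̂ = Φ(f_s)² b`. -/
lemma IsTomita.weightInt_swap_aux (h : IsTomita M ψ Φ J) {b : H →L[ℂ] H} (hb : b ∈ M)
    {f : ℝ →ᵇ ℂ} {k : ℕ} (hf : ∀ x, (k : ℝ) < |x| → f x = 0) (hf0 : ∀ x ≤ 0, f x = 0)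
    (w : ℝ →ᵇ (H →L[ℂ] H)) (hw : IsCrossedLimit M Φ w) :
    ∫ s in Set.Icc (-k : ℝ) 0, (Real.exp s * (f (-s) * f (-s)) : ℂ) *
        ⟪ψ, w s (Φ (shiftFn (f * f) s) (b ψ))⟫_ℂ =
      ∫ s in Set.Icc (-k : ℝ) 0, (Real.exp s * (f (-s) * f (-s)) : ℂ) *
        ⟪star b ψ, Φ (shiftFn (f * f) s) (w s ψ)⟫_ℂ := by
  have hff : ∀ x, (k : ℝ) < |x| → (f * f) x = 0 := fun x hx => by
    rw [BoundedContinuousFunction.mul_apply, hf x hx, mul_zero]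
  have hcg : Continuous fun s => Φ (shiftFn (f * f) s) :=
    (continuous_starAlgHom Φ).comp (continuous_shiftFn hff)
  have hcf := f.continuous
  have hcc : Continuous fun s : ℝ => (Real.exp s * (f (-s) * f (-s)) : ℂ) := by fun_prop
  have i1 : ∀ w : ℝ →ᵇ (H →L[ℂ] H), IntegrableOn (fun s : ℝ =>
      (Real.exp s * (f (-s) * f (-s)) : ℂ) * ⟪ψ, w s (Φ (shiftFn (f * f) s) (b ψ))⟫_ℂ)
      (Set.Icc (-k : ℝ) 0) := fun w => by
    have := w.continuous
    have h2 : Continuous fun s => w s (Φ (shiftFn (f * f) s) (b ψ)) :=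
      this.clm_apply (hcg.clm_apply continuous_const)
    exact (hcc.mul (continuous_const.inner h2)).integrableOn_Icc
  have i2 : ∀ w : ℝ →ᵇ (H →L[ℂ] H), IntegrableOn (fun s : ℝ =>
      (Real.exp s * (f (-s) * f (-s)) : ℂ) * ⟪star b ψ, Φ (shiftFn (f * f) s) (w s ψ)⟫_ℂ)
      (Set.Icc (-k : ℝ) 0) := fun w => by
    have := w.continuous
    have h2 : Continuous fun s => Φ (shiftFn (f * f) s) (w s ψ) :=
      hcg.clm_apply (this.clm_apply continuous_const)
    exact (hcc.mul (continuous_const.inner h2)).integrableOn_Icc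
  have hspan : ∀ w ∈ crossedSpan M Φ,
      ∫ s in Set.Icc (-k : ℝ) 0, (Real.exp s * (f (-s) * f (-s)) : ℂ) *
        ⟪ψ, w s (Φ (shiftFn (f * f) s) (b ψ))⟫_ℂ =
      ∫ s in Set.Icc (-k : ℝ) 0, (Real.exp s * (f (-s) * f (-s)) : ℂ) *
        ⟪star b ψ, Φ (shiftFn (f * f) s) (w s ψ)⟫_ℂ := by
    intro w hw
    induction hw using Submodule.span_induction with
    | mem w hw =>
      obtain ⟨a, ha, t, rfl⟩ := hw
      have key := h.integral_swap ha hb hff t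
      have hz : ∀ s ∉ Set.Icc (-k : ℝ) 0, (f (-s) : ℂ) = 0 := fun s hs => by
        by_cases h0 : s ≤ 0
        · refine hf _ ?_
          have : s < -k := by by_contra! h'; exact hs ⟨h', h0⟩
          rw [abs_neg, abs_of_nonpos h0]; linarith
        · exact hf0 _ (by linarith)
      rw [setIntegral_eq_integral_of_forall_compl_eq_zero (fun s hs => by rw [hz s hs]; simp),
        setIntegral_eq_integral_of_forall_compl_eq_zero (fun s hs => by rw [hz s hs]; simp)]
      convert key using 3 with s s
      · rw [crossedElem_apply, BoundedContinuousFunction.mul_apply]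
        change _ * ⟪ψ, exp (-(t * s) * I) • a (Φ (uFn t) _)⟫_ℂ = _
        rw [inner_smul_right, ContinuousLinearMap.star_eq_adjoint,
          ContinuousLinearMap.adjoint_inner_left]
        ring
      · rw [crossedElem_apply, BoundedContinuousFunction.mul_apply]
        change _ * ⟪_, Φ _ (exp (-(t * s) * I) • a (Φ (uFn t) ψ))⟫_ℂ = _
        rw [h.starAlgHom_apply_vec, uFn_apply, show exp ((t * (0 : ℝ) : ℝ) * I) = 1 by simp,
          one_smul, map_smul, inner_smul_right]
        ring
    | zero => simp
    | add v w _ _ hv hw =>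
      simp only [BoundedContinuousFunction.add_apply, add_apply, inner_add_right, map_add, mul_add]
      rw [integral_add (i1 v) (i1 w), integral_add (i2 v) (i2 w), hv, hw]
    | smul z w _ hw =>
      have e : ∀ s x, (z • w) s x = z • w s x := fun _ _ => rfl
      simp only [e, inner_smul_right, map_smul, mul_left_comm _ z]
      rw [integral_const_mul, integral_const_mul, hw]
  obtain ⟨v, hv, ⟨c, hc⟩, hl⟩ := hw
  have hc0 : 0 ≤ c := (norm_nonneg _).trans (hc 0)
  have hg : ∀ s, ‖Φ (shiftFn (f * f) s)‖ ≤ ‖f * f‖ := fun s =>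
    (hatFn Φ (f * f) k hff).norm_coe_le_norm s |>.trans
      (BoundedContinuousFunction.norm_ofNormedAddCommGroup_le _ (norm_nonneg _) _)
  have hcW : Continuous fun s : ℝ => ‖(Real.exp s * (f (-s) * f (-s)) : ℂ)‖ := by fun_prop
  have t1 : Tendsto (fun n => ∫ s in Set.Icc (-k : ℝ) 0, (Real.exp s * (f (-s) * f (-s)) : ℂ) *
        ⟪ψ, v n s (Φ (shiftFn (f * f) s) (b ψ))⟫_ℂ) atTop
      (𝓝 (∫ s in Set.Icc (-k : ℝ) 0, (Real.exp s * (f (-s) * f (-s)) : ℂ) *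
        ⟪ψ, w s (Φ (shiftFn (f * f) s) (b ψ))⟫_ℂ)) := by
    refine tendsto_integral_of_dominated_convergence
      (fun s => ‖(Real.exp s * (f (-s) * f (-s)) : ℂ)‖ * (‖ψ‖ * (c * (‖f * f‖ * ‖b ψ‖))))
      (fun n => (i1 (v n)).aestronglyMeasurable)
      (Continuous.integrableOn_Icc (by fun_prop)) (fun n => .of_forall fun s => ?_)
      (.of_forall fun s => ?_)
    · rw [norm_mul]
      gcongr
      refine (norm_inner_le_norm _ _).trans ?_
      gcongr
      refine ((v n s).le_opNorm _).trans ?_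
      gcongr
      · exact ((v n).norm_coe_le_norm s).trans (hc n)
      · exact ((Φ _).le_opNorm _).trans (by gcongr; exact hg s)
    · exact (tendsto_const_nhds.inner (hl s _)).const_mul _
  have t2 : Tendsto (fun n => ∫ s in Set.Icc (-k : ℝ) 0, (Real.exp s * (f (-s) * f (-s)) : ℂ) *
        ⟪star b ψ, Φ (shiftFn (f * f) s) (v n s ψ)⟫_ℂ) atTop
      (𝓝 (∫ s in Set.Icc (-k : ℝ) 0, (Real.exp s * (f (-s) * f (-s)) : ℂ) *
        ⟪star b ψ, Φ (shiftFn (f * f) s) (w s ψ)⟫_ℂ)) := by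
    refine tendsto_integral_of_dominated_convergence
      (fun s => ‖(Real.exp s * (f (-s) * f (-s)) : ℂ)‖ * (‖star b ψ‖ * (‖f * f‖ * (c * ‖ψ‖))))
      (fun n => (i2 (v n)).aestronglyMeasurable)
      (Continuous.integrableOn_Icc (by fun_prop)) (fun n => .of_forall fun s => ?_)
      (.of_forall fun s => ?_)
    · rw [norm_mul]
      gcongr
      refine (norm_inner_le_norm _ _).trans ?_
      gcongr
      refine ((Φ _).le_opNorm _).trans ?_
      gcongr
      · exact hg s
      · exact ((v n s).le_opNorm _).trans (by gcongr; exact ((v n).norm_coe_le_norm s).trans (hc n))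
    · exact (tendsto_const_nhds.inner (((Φ _).continuous.tendsto _).comp (hl s _))).const_mul _
  refine tendsto_nhds_unique t1 ?_
  simp only [hspan _ (hv _)]
  exact t2

/-- The elements `Φ(f_s) b Φ(f_s)` with `b ∈ M`. -/
def compressedSet (M : VonNeumannAlgebra H) (Φ : (ℝ →ᵇ ℂ) →⋆ₐ[ℂ] (H →L[ℂ] H)) (f : ℝ →ᵇ ℂ) (k : ℕ)
    (hf : ∀ x, (k : ℝ) < |x| → f x = 0) : Set (ℝ →ᵇ (H →L[ℂ] H)) :=
  {w | ∃ b ∈ M, w = hatFn Φ f k hf * BoundedContinuousFunction.const ℝ b * hatFn Φ f k hf}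

lemma IsTomita.exists_of_mem_adjoin (h : IsTomita M ψ Φ J) {f : ℝ →ᵇ ℂ} {k : ℕ}
    (hf : ∀ x, (k : ℝ) < |x| → f x = 0) {u : ℝ →ᵇ (H →L[ℂ] H)}
    (hu : u ∈ Algebra.adjoin ℂ (compressedSet M Φ f k hf)) : ∃ (z : ℂ) (w : ℝ →ᵇ (H →L[ℂ] H)),
      IsCrossedLimit M Φ w ∧ u = algebraMap ℂ _ z + hatFn Φ f k hf * w * hatFn Φ f k hf := by
  have hF := h.isCrossedLimit_hatFn hf
  induction hu using Algebra.adjoin_induction with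
  | mem u hu =>
    obtain ⟨b, hb, rfl⟩ := hu
    exact ⟨0, _, isCrossedLimit_const hb, by rw [map_zero, zero_add]⟩
  | algebraMap z =>
    refine ⟨z, _, isCrossedLimit_const (zero_mem M), ?_⟩
    rw [show BoundedContinuousFunction.const ℝ (0 : H →L[ℂ] H) = 0 from rfl, mul_zero, zero_mul,
      add_zero]
  | add u v _ _ hu hv =>
    obtain ⟨z, w, hw, rfl⟩ := hu
    obtain ⟨z', w', hw', rfl⟩ := hv
    refine ⟨z + z', w + w', hw.add hw', ?_⟩
    rw [map_add, mul_add, add_mul]; abel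
  | mul u v _ _ hu hv =>
    obtain ⟨z, w, hw, rfl⟩ := hu
    obtain ⟨z', w', hw', rfl⟩ := hv
    refine ⟨z * z', algebraMap ℂ _ z * w' + algebraMap ℂ _ z' * w + w * (hatFn Φ f k hf * hatFn Φ f
      k hf) * w',
      ((hw'.algebraMap_mul z).add (hw.algebraMap_mul z')).add
        (h.isCrossedLimit_mul (h.isCrossedLimit_mul hw (h.isCrossedLimit_mul hF hF)) hw'), ?_⟩
    simp only [mul_add, add_mul, mul_assoc, map_mul, Algebra.left_comm _ z, Algebra.left_comm _ z',
      ← Algebra.commutes z']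
    abel

lemma IsTomita.weightInt_swap_gen (h : IsTomita M ψ Φ J) {f : ℝ →ᵇ ℂ} {k : ℕ}
    (hf : ∀ x, (k : ℝ) < |x| → f x = 0) (hf0 : ∀ x ≤ 0, f x = 0) (hs : star f = f)
    {w : ℝ →ᵇ (H →L[ℂ] H)} (hw : IsCrossedLimit M Φ w) {b : H →L[ℂ] H} (hb : b ∈ M) :
    weightInt ψ k (hatFn Φ f k hf * w * hatFn Φ f k hf *
      (hatFn Φ f k hf * BoundedContinuousFunction.const ℝ b * hatFn Φ f k hf)) =
    weightInt ψ k ((hatFn Φ f k hf * BoundedContinuousFunction.const ℝ b * hatFn Φ f k hf) *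
      (hatFn Φ f k hf * w * hatFn Φ f k hf)) := by
  have hst : ∀ s, star (Φ (shiftFn f s)) = Φ (shiftFn f s) := fun s =>
    DFunLike.congr_fun (star_hatFn hf hs) s
  have hin : ∀ s v, ⟪ψ, Φ (shiftFn f s) v⟫_ℂ = f (-s) * ⟪ψ, v⟫_ℂ := fun s v => by
    rw [← hst s, ContinuousLinearMap.star_eq_adjoint, ContinuousLinearMap.adjoint_inner_right,
      h.starAlgHom_apply_vec, inner_smul_left, shiftFn_apply, zero_sub]
    congr 1
    exact DFunLike.congr_fun hs (-s)
  have hmul : ∀ s v, Φ (shiftFn (f * f) s) v = Φ (shiftFn f s) (Φ (shiftFn f s) v) := fun s v => by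
    rw [← IsTomita.starAlgHom_mul_apply]; rfl
  have key := h.weightInt_swap_aux hb hf hf0 w hw
  rw [weightInt, weightInt]
  convert key using 3 with s s
  · simp only [BoundedContinuousFunction.mul_apply, hatFn_apply, mul_apply_eq_comp, hin,
      BoundedContinuousFunction.const_apply, h.starAlgHom_apply_vec, map_smul, inner_smul_right,
      hmul, shiftFn_apply, zero_sub]
    ring
  · rw [ContinuousLinearMap.star_eq_adjoint,
          ContinuousLinearMap.adjoint_inner_left]
    simp only [BoundedContinuousFunction.mul_apply, hatFn_apply, mul_apply_eq_comp, hin,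
      BoundedContinuousFunction.const_apply, h.starAlgHom_apply_vec, map_smul, inner_smul_right,
      hmul, shiftFn_apply, zero_sub]
    ring

theorem IsTomita.weightInt_mul_comm (h : IsTomita M ψ Φ J) {f : ℝ →ᵇ ℂ} {k : ℕ}
    (hf : ∀ x, (k : ℝ) < |x| → f x = 0) (hf0 : ∀ x ≤ 0, f x = 0) (hs : star f = f)
    {u v : ℝ →ᵇ (H →L[ℂ] H)} (hu : u ∈ Algebra.adjoin ℂ (compressedSet M Φ f k hf))
    (hv : v ∈ Algebra.adjoin ℂ (compressedSet M Φ f k hf)) :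
    weightInt ψ k (u * v) = weightInt ψ k (v * u) := by
  induction hv using Algebra.adjoin_induction generalizing u with
  | mem v hv =>
    obtain ⟨b, hb, rfl⟩ := hv
    obtain ⟨z, w, hw, rfl⟩ := h.exists_of_mem_adjoin hf hu
    rw [add_mul, mul_add, weightInt_add, weightInt_add, h.weightInt_swap_gen hf hf0 hs hw hb,
      weightInt_algebraMap_mul, ← Algebra.commutes z, weightInt_algebraMap_mul]
  | algebraMap z => rw [Algebra.commutes]
  | add v w _ _ hv hw => rw [mul_add, add_mul, weightInt_add, weightInt_add, hv hu, hw hu]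
  | mul v w hv' hw' hv hw =>
    rw [← mul_assoc, hw (mul_mem hu hv'), ← mul_assoc, hv (mul_mem hw' hu), mul_assoc]

end Trace

end CSGame

namespace CSGame

open Complex Filter Topology
open scoped InnerProductSpace BoundedContinuousFunction ComplexOrder


section GNS

universe u

variable {H : Type*} [NormedAddCommGroup H] [InnerProductSpace ℂ H] [CompleteSpace H]

/-- The commutant of a self-adjoint set of operators, as a von Neumann algebra. -/
noncomputable def commutantVN (s : Set (H →L[ℂ] H))
    (hs : ∀ a ∈ s, star a ∈ s) : VonNeumannAlgebra H where
  __ := StarSubalgebra.centralizer ℂ s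
  centralizer_centralizer' := by
    have : (StarSubalgebra.centralizer ℂ s : Set (H →L[ℂ] H)) = Set.centralizer s := by
      rw [StarSubalgebra.coe_centralizer, Set.union_eq_left.2]
      intro a ha
      rw [← star_star a]; exact hs _ ha
    change Set.centralizer (Set.centralizer (StarSubalgebra.centralizer ℂ s : Set (H →L[ℂ] H))) =
      (StarSubalgebra.centralizer ℂ s : Set (H →L[ℂ] H))
    rw [this, Set.centralizer_centralizer_centralizer]

lemma mem_commutantVN {s : Set (H →L[ℂ] H)} {hs : ∀ a ∈ s, star a ∈ s} {a : H →L[ℂ] H} :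
    a ∈ commutantVN s hs ↔ ∀ b ∈ s, b * a = a * b := by
  change a ∈ StarSubalgebra.centralizer ℂ s ↔ _
  rw [StarSubalgebra.mem_centralizer_iff]
  exact ⟨fun h b hb => (h b hb).1, fun h b hb => ⟨h b hb, h _ (hs b hb)⟩⟩

/-- A vector which is a trace vector for a dense family of vectors `u ξ` is a trace vector for every
operator commuting with the right multiplications. -/
lemma trace_of_right_mul {A : Type*} [Ring A] [StarRing A]
    {ρ : A → H →L[ℂ] H} {R : A → H →L[ℂ] H} {ξ : H} (hd : Dense (Set.range fun a => ρ a ξ))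
    (hR : ∀ a, R a ξ = ρ a ξ) (hRs : ∀ a, star (R a) = R (star a))
    (hn : ∀ a, ‖ρ (star a) ξ‖ = ‖ρ a ξ‖) {u v : H →L[ℂ] H} (hu : ∀ a, R a * u = u * R a)
    (hu' : ∀ a, R a * star u = star u * R a) (hv : ∀ a, R a * v = v * R a)
    (hv' : ∀ a, R a * star v = star v * R a) : ⟪ξ, (u * v) ξ⟫_ℂ = ⟪ξ, (v * u) ξ⟫_ℂ := by
  have e : ∀ w : H →L[ℂ] H, (∀ a, R a * w = w * R a) → (∀ a, R a * star w = star w * R a) → ∀ b,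
      ⟪w ξ, ρ b ξ⟫_ℂ = ⟪ρ (star b) ξ, star w ξ⟫_ℂ := by
    intro w hw hw' b
    rw [← hR b, ← hR (star b), ← hRs, ContinuousLinearMap.star_eq_adjoint (R b),
      ContinuousLinearMap.adjoint_inner_left, ← mul_apply_eq_comp, hw', mul_apply_eq_comp,
      ContinuousLinearMap.star_eq_adjoint, ContinuousLinearMap.adjoint_inner_right]
  have le : ∀ w : H →L[ℂ] H, (∀ a, R a * w = w * R a) → (∀ a, R a * star w = star w * R a) →
      ‖star w ξ‖ ≤ ‖w ξ‖ := by
    intro w hw hw'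
    have h1 : ∀ x : H, ‖⟪x, star w ξ⟫_ℂ‖ ≤ ‖x‖ * ‖w ξ‖ := fun x => by
      refine hd.induction (P := fun x => ‖⟪x, star w ξ⟫_ℂ‖ ≤ ‖x‖ * ‖w ξ‖) ?_
        (isClosed_le (by fun_prop) (by fun_prop)) x
      rintro _ ⟨b, rfl⟩
      have := e w hw hw' (star b)
      rw [star_star] at this
      dsimp only
      rw [← this, ← hn b, mul_comm]
      exact norm_inner_le_norm _ _
    have h2 := h1 (star w ξ)
    rw [inner_self_eq_norm_sq_to_K] at h2
    by_contra! h3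
    have h4 : 0 < ‖star w ξ‖ := (norm_nonneg _).trans_lt h3
    simp only [coe_algebraMap, norm_pow, norm_real, norm_norm] at h2
    nlinarith
  have hvn : ‖star v ξ‖ = ‖v ξ‖ := by
    refine le_antisymm (le v hv hv') ?_
    have := le (star v) hv' (by rwa [star_star])
    rwa [star_star] at this
  have key : ∀ ε > 0, ∃ b, ‖ρ b ξ - v ξ‖ < ε ∧ ‖ρ (star b) ξ - star v ξ‖ < ε := by
    intro ε hε
    obtain ⟨_, hb, b, rfl⟩ := Metric.dense_iff.1 hd (v ξ) ε hε
    rw [Metric.mem_ball, dist_eq_norm] at hb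
    refine ⟨b, hb, ?_⟩
    have h1 : ‖ρ (star b) ξ - star v ξ‖ ^ 2 = ‖ρ b ξ - v ξ‖ ^ 2 := by
      rw [@norm_sub_sq ℂ, @norm_sub_sq ℂ, hn, hvn, ← e v hv hv']
      simp [inner_re_symm (𝕜 := ℂ) (v ξ)]
    rwa [(sq_eq_sq₀ (norm_nonneg _) (norm_nonneg _)).1 h1]
  choose! b hb1 hb2 using fun n : ℕ => key (1 / ((n : ℝ) + 1)) (by positivity)
  have t1 : Tendsto (fun n => ρ (b n) ξ) atTop (𝓝 (v ξ)) :=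
    tendsto_iff_norm_sub_tendsto_zero.2 (squeeze_zero (fun _ => norm_nonneg _) (fun n => (hb1 n).le)
      tendsto_one_div_add_atTop_nhds_zero_nat)
  have t2 : Tendsto (fun n => ρ (star (b n)) ξ) atTop (𝓝 (star v ξ)) :=
    tendsto_iff_norm_sub_tendsto_zero.2 (squeeze_zero (fun _ => norm_nonneg _) (fun n => (hb2 n).le)
      tendsto_one_div_add_atTop_nhds_zero_nat)
  have t3 : Tendsto (fun n => ⟪star u ξ, ρ (b n) ξ⟫_ℂ) atTop (𝓝 ⟪star u ξ, v ξ⟫_ℂ) :=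
    tendsto_const_nhds.inner t1
  have t4 : Tendsto (fun n => ⟪ρ (star (b n)) ξ, u ξ⟫_ℂ) atTop (𝓝 ⟪star v ξ, u ξ⟫_ℂ) :=
    t2.inner tendsto_const_nhds
  have e2 := fun n => e (star u) hu' (by rwa [star_star]) (b n)
  simp only [star_star] at e2
  simp only [e2] at t3
  have := tendsto_nhds_unique t3 t4
  rw [ContinuousLinearMap.star_eq_adjoint, ContinuousLinearMap.adjoint_inner_left,
    ContinuousLinearMap.star_eq_adjoint, ContinuousLinearMap.adjoint_inner_left] at this
  exact this

/-- The GNS construction of a tracial state. -/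
theorem exists_tracial_representation {B : Type u} [CStarAlgebra B] (τ : B →ₗ[ℂ] ℂ)
    (hpos : ∀ x, 0 ≤ τ (star x * x)) (h1 : τ 1 = 1) (htr : ∀ x y, τ (x * y) = τ (y * x)) :
    ∃ (K : Type u) (_ : NormedAddCommGroup K) (_ : InnerProductSpace ℂ K) (_ : CompleteSpace K)
      (ξ : K) (N : VonNeumannAlgebra K) (ρ : B →⋆ₐ[ℂ] (K →L[ℂ] K)),
      ‖ξ‖ = 1 ∧ (∀ b, ρ b ∈ N) ∧ (∀ u ∈ N, ∀ v ∈ N, ⟪ξ, (u * v) ξ⟫_ℂ = ⟪ξ, (v * u) ξ⟫_ℂ) ∧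
      (∀ b, ⟪ξ, ρ b ξ⟫_ℂ = τ b) ∧ Dense (Set.range fun b => ρ b ξ) := by
  let _ : PartialOrder B := CStarAlgebra.spectralOrder B
  have : StarOrderedRing B := CStarAlgebra.spectralOrderedRing B
  set f : B →ₚ[ℂ] ℂ := PositiveLinearMap.mk₀ τ fun x hx => by
    obtain ⟨y, rfl⟩ := CStarAlgebra.nonneg_iff_eq_star_mul_self.1 hx
    exact hpos y with hf
  have hfx : ∀ x, f x = τ x := fun _ => rfl
  set j : B → f.GNS := fun b => ((f.toPreGNS b : f.PreGNS) : f.GNS) with hj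
  have hjd : DenseRange j := by
    have : DenseRange ((↑) : f.PreGNS → f.GNS) := UniformSpace.Completion.denseRange_coe
    exact this.comp f.toPreGNS.surjective.denseRange (UniformSpace.Completion.continuous_coe _)
  have hin : ∀ a b, ⟪j a, j b⟫_ℂ = τ (star a * b) := fun a b => by
    rw [hj, UniformSpace.Completion.inner_coe]; rfl
  have hnorm : ∀ a, ‖j a‖ ^ 2 = (τ (star a * a)).re := fun a => by
    rw [← hin, inner_self_eq_norm_sq_to_K]
    simp [← ofReal_pow]
  have hρ : ∀ a b, f.gnsStarAlgHom a (j b) = j (a * b) := fun a b => by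
    change f.gnsNonUnitalStarAlgHom a ((f.toPreGNS b : f.PreGNS) : f.GNS) = _
    rw [PositiveLinearMap.gnsNonUnitalStarAlgHom_apply_coe]
    rfl
  have hns : ∀ b, ‖j (star b)‖ = ‖j b‖ := fun b => by
    rw [← sq_eq_sq₀ (norm_nonneg _) (norm_nonneg _), hnorm, hnorm, star_star, htr]
  have hR0 : ∀ a : B, ∃ R : f.GNS →L[ℂ] f.GNS, ∀ b, R (j b) = j (b * a) := by
    intro a
    set R : f.PreGNS →L[ℂ] f.PreGNS := LinearMap.mkContinuous
      (f.toPreGNS.toLinearMap ∘ₗ (LinearMap.mulRight ℂ a) ∘ₗ f.ofPreGNS.toLinearMap) ‖a‖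
      (fun x => by
        obtain ⟨b, rfl⟩ := f.toPreGNS.surjective x
        change ‖f.toPreGNS (b * a)‖ ≤ ‖a‖ * ‖f.toPreGNS b‖
        rw [← UniformSpace.Completion.norm_coe, ← UniformSpace.Completion.norm_coe (f.toPreGNS b)]
        change ‖j (b * a)‖ ≤ ‖a‖ * ‖j b‖
        rw [← hns (b * a), ← hns b, star_mul, ← hρ, ← norm_star a]
        exact (ContinuousLinearMap.le_opNorm _ _).trans
          (by gcongr; exact NonUnitalStarAlgHom.norm_apply_le _ _)) with hR
    refine ⟨R.completion, fun b => ?_⟩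
    rw [hj]
    dsimp only
    rw [ContinuousLinearMap.completion_apply_coe]
    rfl
  choose R hR using hR0
  have hjs : ∀ {u v : f.GNS →L[ℂ] f.GNS}, (∀ b, u (j b) = v (j b)) → u = v := fun {u v} h =>
    ContinuousLinearMap.ext fun x => congrFun (hjd.equalizer u.continuous v.continuous
      (funext h)) x
  have hRs : ∀ a, star (R a) = R (star a) := fun a => by
    rw [ContinuousLinearMap.star_eq_adjoint]
    symm
    rw [ContinuousLinearMap.eq_adjoint_iff]
    intro x y
    refine hjd.induction_on₂ (p := fun x y => ⟪R (star a) x, y⟫_ℂ = ⟪x, R a y⟫_ℂ)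
      (isClosed_eq (by fun_prop) (by fun_prop)) (fun b c => ?_) x y
    rw [hR, hR, hin, hin, star_mul, star_star, mul_assoc, htr, mul_assoc]
  have hρ1 : ∀ b, f.gnsStarAlgHom b (j 1) = j b := fun b => by rw [hρ, mul_one]
  refine ⟨f.GNS, inferInstance, inferInstance, inferInstance, j 1,
    commutantVN (Set.range R) (by rintro _ ⟨a, rfl⟩; exact ⟨star a, (hRs a).symm⟩),
    f.gnsStarAlgHom, ?_, fun b => ?_, fun u hu v hv => ?_, fun b => ?_, ?_⟩
  · rw [← pow_eq_one_iff_of_nonneg (norm_nonneg _) two_ne_zero, hnorm, star_one, one_mul, h1]; rfl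
  · rw [mem_commutantVN]
    rintro _ ⟨a, rfl⟩
    refine hjs fun c => ?_
    rw [mul_apply_eq_comp, mul_apply_eq_comp, hρ, hR, hR, hρ, mul_assoc]
  · have hu' := star_mem hu
    have hv' := star_mem hv
    rw [mem_commutantVN] at hu hv hu' hv'
    refine trace_of_right_mul (ρ := f.gnsStarAlgHom) (R := R) ?_ (fun a => ?_) hRs (fun a => ?_)
      (fun a => hu _ ⟨a, rfl⟩) (fun a => hu' _ ⟨a, rfl⟩) (fun a => hv _ ⟨a, rfl⟩)
      (fun a => hv' _ ⟨a, rfl⟩)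
    · simp only [hρ1]; exact hjd
    · rw [hρ1, hR, one_mul]
    · rw [hρ1, hρ1, hns]
  · rw [hρ1, hin, star_one, one_mul]
  · simp only [hρ1]; exact hjd

/-- A state on a C⋆-algebra which is tracial on a star subalgebra is represented by a trace vector
of a von Neumann algebra. -/
theorem exists_tracial_representation_of_subalgebra {A : Type u} [CStarAlgebra A]
    (S : StarSubalgebra ℂ A) (τ : A →L[ℂ] ℂ) (hpos : ∀ x, 0 ≤ τ (star x * x)) (h1 : τ 1 = 1)
    (htr : ∀ x ∈ S, ∀ y ∈ S, τ (x * y) = τ (y * x)) :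
    ∃ (K : Type u) (_ : NormedAddCommGroup K) (_ : InnerProductSpace ℂ K) (_ : CompleteSpace K)
      (ξ : K) (N : VonNeumannAlgebra K) (ρ : S →⋆ₐ[ℂ] (K →L[ℂ] K)),
      ‖ξ‖ = 1 ∧ (∀ b, ρ b ∈ N) ∧ (∀ u ∈ N, ∀ v ∈ N, ⟪ξ, (u * v) ξ⟫_ℂ = ⟪ξ, (v * u) ξ⟫_ℂ) ∧
      (∀ b, ⟪ξ, ρ b ξ⟫_ℂ = τ b) ∧
      (∀ b : S, (∃ y, (b : A) = star y * y) → (ρ b).IsPositive) := by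
  have htr' : ∀ x ∈ S.topologicalClosure, ∀ y ∈ S.topologicalClosure, τ (x * y) = τ (y * x) := by
    intro x hx y hy
    have e : ∀ x ∈ S, ∀ y ∈ S.topologicalClosure, τ (x * y) = τ (y * x) := by
      intro x hx y hy
      rw [← SetLike.mem_coe, StarSubalgebra.topologicalClosure_coe] at hy
      refine closure_minimal (t := {y | τ (x * y) = τ (y * x)}) (fun y hy => htr x hx y hy)
        (isClosed_eq (by fun_prop) (by fun_prop)) hy
    rw [← SetLike.mem_coe, StarSubalgebra.topologicalClosure_coe] at hx
    exact closure_minimal (t := {x | τ (x * y) = τ (y * x)}) (fun x hx => e x hx y hy)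
        (isClosed_eq (by fun_prop) (by fun_prop)) hx
  have : IsClosed (S.topologicalClosure : Set A) := S.isClosed_topologicalClosure
  obtain ⟨K, i1, i2, i3, ξ, N, ρ, k1, k2, k3, k4, k5⟩ := exists_tracial_representation
    (B := S.topologicalClosure) (τ.toLinearMap.comp S.topologicalClosure.subtype.toLinearMap)
    (fun x => hpos x) h1 (fun x y => htr' x x.2 y y.2)
  refine ⟨K, i1, i2, i3, ξ, N, ρ.comp (StarSubalgebra.inclusion S.le_topologicalClosure), k1,
    fun b => k2 _, k3, fun b => k4 _, ?_⟩
  rintro b ⟨y, hy⟩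
  set b' : S.topologicalClosure := StarSubalgebra.inclusion S.le_topologicalClosure b with hb'
  have hby : (b' : A) = star y * y := hy
  have hbs : star b' = b' := Subtype.ext (by
    change star (b' : A) = b'
    rw [hby, star_mul, star_star])
  change (ρ b').IsPositive
  have hsa : star (ρ b') = ρ b' := by rw [← map_star, hbs]
  refine (ContinuousLinearMap.isPositive_def' ).2 ⟨hsa, fun x => ?_⟩
  rw [ContinuousLinearMap.reApplyInnerSelf_apply]
  refine k5.induction (P := fun x => 0 ≤ RCLike.re ⟪ρ b' x, x⟫_ℂ) ?_
    (isClosed_le continuous_const (by fun_prop)) x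
  rintro _ ⟨c, rfl⟩
  have e : ⟪ρ b' (ρ c ξ), ρ c ξ⟫_ℂ = τ (star (y * c) * (y * c)) := by
    have h2 : ((star (b' * c) * c : S.topologicalClosure) : A) = star (y * c) * (y * c) := by
      change star ((b' : A) * c) * (c : A) = _
      rw [hby]
      simp only [star_mul, star_star, mul_assoc]
    rw [← mul_apply_eq_comp, ← map_mul, ← ContinuousLinearMap.adjoint_inner_right,
      ← ContinuousLinearMap.star_eq_adjoint, ← map_star, ← mul_apply_eq_comp, ← map_mul, k4]
    exact congrArg τ h2
  dsimp only
  rw [e]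
  exact (Complex.le_def.1 (hpos _)).1

end GNS

end CSGame

namespace CSGame

open Complex Filter Topology
open scoped InnerProductSpace BoundedContinuousFunction


section Mean

open MeasureTheory

/-- The function that vanishes outside `[0, k]`, equals one on `[δ, k - 1]`, and is piecewise
linear. -/
noncomputable def rampFn (δ : ℝ) (k : ℕ) : ℝ →ᵇ ℂ :=
  BoundedContinuousFunction.ofNormedAddCommGroup
    (fun x => ((max 0 (min 1 (min (x / δ) (k - x))) : ℝ) : ℂ)) (by fun_prop) 1 fun x => by
      rw [norm_real, Real.norm_of_nonneg (le_max_left _ _)]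
      exact max_le zero_le_one (min_le_left _ _)

lemma rampFn_apply (δ : ℝ) (k : ℕ) (x : ℝ) :
    rampFn δ k x = ((max 0 (min 1 (min (x / δ) (k - x))) : ℝ) : ℂ) := rfl

lemma star_rampFn (δ : ℝ) (k : ℕ) : star (rampFn δ k) = rampFn δ k := by
  ext x
  rw [BoundedContinuousFunction.star_apply, rampFn_apply]
  exact conj_ofReal _

lemma norm_rampFn_le (δ : ℝ) (k : ℕ) : ‖rampFn δ k‖ ≤ 1 :=
  BoundedContinuousFunction.norm_ofNormedAddCommGroup_le _ zero_le_one _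

lemma rampFn_of_nonpos {δ : ℝ} (hδ : 0 < δ) (k : ℕ) {x : ℝ} (hx : x ≤ 0) : rampFn δ k x = 0 := by
  rw [rampFn_apply, max_eq_left, ofReal_zero]
  exact (min_le_right _ _).trans ((min_le_left _ _).trans (div_nonpos_of_nonpos_of_nonneg hx hδ.le))

lemma rampFn_of_lt_abs {δ : ℝ} (hδ : 0 < δ) (k : ℕ) (x : ℝ) (hx : (k : ℝ) < |x|) :
    rampFn δ k x = 0 := by
  rcases le_total x 0 with h | h
  · exact rampFn_of_nonpos hδ k h
  · rw [abs_of_nonneg h] at hx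
    rw [rampFn_apply, max_eq_left, ofReal_zero]
    exact (min_le_right _ _).trans ((min_le_right _ _).trans (by linarith))

lemma rampFn_eq_one {δ : ℝ} (hδ : 0 < δ) (k : ℕ) {x : ℝ} (h1 : δ ≤ x) (h2 : x ≤ k - 1) :
    rampFn δ k x = 1 := by
  have : (1 : ℝ) ≤ x / δ := (one_le_div hδ).2 h1
  rw [rampFn_apply, min_eq_left (le_min this (by linarith)), max_eq_right zero_le_one, ofReal_one]

/-- The average `∫_{-k}^0 e^s f(-s)² f(x - s)² ds`. -/
noncomputable def meanFn (f : ℝ →ᵇ ℂ) (k : ℕ) : ℝ →ᵇ ℂ :=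
  ∫ s in Set.Icc (-k : ℝ) 0, (Real.exp s * (f (-s) * f (-s)) : ℂ) • shiftFn (f * f) s

lemma integrableOn_meanFn {f : ℝ →ᵇ ℂ} {k : ℕ} (hf : ∀ x, (k : ℝ) < |x| → f x = 0) :
    IntegrableOn (fun s : ℝ => (Real.exp s * (f (-s) * f (-s)) : ℂ) • shiftFn (f * f) s)
      (Set.Icc (-k : ℝ) 0) := by
  have hcf := f.continuous
  have hff : ∀ x, (k : ℝ) < |x| → (f * f) x = 0 := fun x hx => by
    rw [BoundedContinuousFunction.mul_apply, hf x hx, zero_mul]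
  exact ((by fun_prop : Continuous fun s : ℝ => (Real.exp s * (f (-s) * f (-s)) : ℂ)).smul
    (continuous_shiftFn hff)).integrableOn_Icc

lemma meanFn_apply {f : ℝ →ᵇ ℂ} {k : ℕ} (hf : ∀ x, (k : ℝ) < |x| → f x = 0) (x : ℝ) :
    meanFn f k x = ∫ s in Set.Icc (-k : ℝ) 0,
      (Real.exp s * (f (-s) * f (-s)) : ℂ) * (f (x - s) * f (x - s)) :=
  ((BoundedContinuousFunction.evalCLM ℂ x).integral_comp_comm (integrableOn_meanFn hf)).symm

lemma inner_starAlgHom_meanFn {H : Type*} [NormedAddCommGroup H] [InnerProductSpace ℂ H]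
    [CompleteSpace H] (Φ : (ℝ →ᵇ ℂ) →⋆ₐ[ℂ] (H →L[ℂ] H)) {f : ℝ →ᵇ ℂ} {k : ℕ}
    (hf : ∀ x, (k : ℝ) < |x| → f x = 0) (u v : H) :
    ⟪u, Φ (meanFn f k) v⟫_ℂ = ∫ s in Set.Icc (-k : ℝ) 0,
      (Real.exp s * (f (-s) * f (-s)) : ℂ) * ⟪u, Φ (shiftFn (f * f) s) v⟫_ℂ := by
  set L : (ℝ →ᵇ ℂ) →L[ℂ] ℂ := (innerSL ℂ u).comp
    (((ContinuousLinearMap.apply ℂ H v)).comp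
      ⟨Φ.toAlgHom.toLinearMap, continuous_starAlgHom Φ⟩) with hL
  have hLx : ∀ f, L f = ⟪u, Φ f v⟫_ℂ := fun f => rfl
  rw [← hLx, meanFn, ← L.integral_comp_comm (integrableOn_meanFn hf)]
  congr 1 with s
  rw [map_smul, hLx, smul_eq_mul]

lemma exp_sub_exp_le_setIntegral {G : ℝ → ℝ} (hG : Continuous G) (hG0 : ∀ s, 0 ≤ G s) {k a b : ℝ}
    (ha : -k ≤ a) (hb : b ≤ 0) (h1 : ∀ s ∈ Set.Icc a b, 1 ≤ G s) :
    Real.exp b - Real.exp a ≤ ∫ s in Set.Icc (-k) 0, Real.exp s * G s := by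
  have h0 : ∀ s, 0 ≤ Real.exp s * G s := fun s => mul_nonneg (Real.exp_pos s).le (hG0 s)
  rcases le_total a b with hab | hab
  · have hi : ∀ u v, IntegrableOn (fun s => Real.exp s * G s) (Set.Icc u v) := fun u v =>
      (by fun_prop : Continuous fun s => Real.exp s * G s).integrableOn_Icc
    calc Real.exp b - Real.exp a = ∫ s in a..b, Real.exp s := by rw [integral_exp]
      _ = ∫ s in Set.Icc a b, Real.exp s := by
        rw [intervalIntegral.integral_of_le hab, integral_Icc_eq_integral_Ioc]
      _ ≤ ∫ s in Set.Icc a b, Real.exp s * G s := by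
        refine setIntegral_mono_on (Real.continuous_exp.integrableOn_Icc) (hi _ _)
          measurableSet_Icc fun s hs => ?_
        exact le_mul_of_one_le_right (Real.exp_pos s).le (h1 s hs)
      _ ≤ _ := setIntegral_mono_set (hi _ _) (Eventually.of_forall h0)
        (Set.Icc_subset_Icc ha hb).eventuallyLE
  · exact (sub_nonpos.2 (Real.exp_le_exp.2 hab)).trans (integral_nonneg h0)

lemma setIntegral_le_exp {G : ℝ → ℝ} (hG : Continuous G) (hG1 : ∀ s, G s ≤ 1) (k : ℝ) {b : ℝ}
    (h0 : ∀ s, b < s → G s ≤ 0) : ∫ s in Set.Icc (-k) 0, Real.exp s * G s ≤ Real.exp b := by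
  have hi : IntegrableOn (fun s => Real.exp s * G s) (Set.Icc (-k) 0) :=
    (by fun_prop : Continuous fun s => Real.exp s * G s).integrableOn_Icc
  have hI : Integrable (Set.indicator (Set.Iic b) Real.exp) :=
    (integrable_indicator_iff measurableSet_Iic).2 (integrableOn_exp_Iic b)
  calc ∫ s in Set.Icc (-k) 0, Real.exp s * G s
      ≤ ∫ s in Set.Icc (-k) 0, Set.indicator (Set.Iic b) Real.exp s := by
        refine setIntegral_mono_on hi hI.integrableOn measurableSet_Icc fun s _ => ?_
        rw [Set.indicator_apply]
        split_ifs with hs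
        · exact mul_le_of_le_one_right (Real.exp_pos s).le (hG1 s)
        · exact mul_nonpos_of_nonneg_of_nonpos (Real.exp_pos s).le (h0 s (not_le.1 hs))
    _ ≤ ∫ s, Set.indicator (Set.Iic b) Real.exp s := setIntegral_le_integral hI
        (Eventually.of_forall fun s => Set.indicator_nonneg (fun _ _ => (Real.exp_pos _).le) s)
    _ = Real.exp b := by rw [integral_indicator measurableSet_Iic, integral_exp_Iic]

lemma abs_exp_half_sub_le {δ κ x m : ℝ} (hδ : 0 < δ) (hκ : 0 < κ) (hκ1 : κ ≤ 1) (hm : 0 ≤ m)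
    (hu : m ≤ Real.exp (min 0 x)) (hl0 : 0 ≤ x → Real.exp (-δ) - Real.exp x * κ ^ 2 ≤ m)
    (hl1 : x < 0 → Real.exp (x - δ) - κ ^ 2 ≤ m) :
    |Real.exp (x / 2) - m| ≤ |1 - Real.exp (x / 2)| + (δ + κ) * (1 + Real.exp (x / 2)) := by
  have ht : Real.exp x = Real.exp (x / 2) ^ 2 := by
    rw [← Real.exp_nat_mul]; congr 1; push_cast; ring
  have hd : 1 - δ ≤ Real.exp (-δ) := by linarith [Real.add_one_le_exp (-δ)]
  have htp := Real.exp_pos (x / 2)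
  rcases le_or_gt 0 x with hx | hx
  · have h1 : 1 ≤ Real.exp (x / 2) := Real.one_le_exp (by linarith)
    rw [min_eq_left hx, Real.exp_zero] at hu
    have hl := hl0 hx
    rw [ht] at hl
    generalize Real.exp (x / 2) = t at *
    rw [abs_of_nonneg (by linarith), abs_of_nonpos (by linarith)]
    have : 1 - m ≤ δ + κ * t := by
      rcases le_total (κ * t) 1 with h | h
      · nlinarith [mul_pos hκ htp]
      · linarith
    nlinarith
  · have h1 : Real.exp (x / 2) ≤ 1 := Real.exp_le_one_iff.2 (by linarith)
    rw [min_eq_right hx.le, ht] at hu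
    have hl := hl1 hx
    rw [sub_eq_add_neg x, Real.exp_add, ht] at hl
    generalize Real.exp (x / 2) = t at *
    rw [abs_of_nonneg (by nlinarith), abs_of_nonneg (by linarith)]
    have h3 : t ^ 2 * (1 - δ) ≤ t ^ 2 * Real.exp (-δ) := by gcongr
    have h4 : κ ^ 2 ≤ κ := by nlinarith
    have h5 : t ^ 2 ≤ 1 := by nlinarith
    nlinarith [mul_pos hδ htp, mul_pos hκ htp]

/-- The averages of the ramp functions approximate `x ↦ e^{x/2}` near `x = 0`. -/
lemma exists_meanFn_rampFn {η : ℝ} (hη : 0 < η) : ∃ (δ : ℝ) (k : ℕ) (m : ℝ → ℝ), 0 < δ ∧ 0 < k ∧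
    ∀ x, meanFn (rampFn δ k) k x = m x ∧ 0 ≤ m x ∧
      |Real.exp (x / 2) - m x| ≤ |1 - Real.exp (x / 2)| + η * (1 + Real.exp (x / 2)) := by
  have hlim : Tendsto (fun n : ℕ => Real.exp (-(n : ℝ) / 2)) atTop (𝓝 0) := by
    refine Real.tendsto_exp_atBot.comp ?_
    have := (tendsto_natCast_atTop_atTop (R := ℝ)).atTop_div_const (r := 2) two_pos
    refine (tendsto_neg_atTop_atBot.comp this).congr fun n => ?_
    simp [neg_div]
  obtain ⟨n, hn⟩ := (hlim.eventually (gt_mem_nhds (half_pos hη))).exists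
  set δ := η / 2 with hδ
  have hδ0 : 0 < δ := half_pos hη
  set k := n + 1 with hk
  set g : ℝ → ℝ := fun x => max 0 (min 1 (min (x / δ) (k - x))) with hg
  have hgf : ∀ x, rampFn δ k x = g x := fun x => rfl
  have hg0 : ∀ x, 0 ≤ g x := fun x => le_max_left _ _
  have hg1 : ∀ x, g x ≤ 1 := fun x => max_le zero_le_one (min_le_left _ _)
  have hgn : ∀ x ≤ 0, g x = 0 := fun x hx => by
    rw [← ofReal_inj, ← hgf, rampFn_of_nonpos hδ0 k hx, ofReal_zero]
  have hgo : ∀ x, δ ≤ x → x ≤ n → g x = 1 := fun x h1 h2 => by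
    rw [← ofReal_inj, ← hgf, rampFn_eq_one hδ0 k h1 (by rw [hk]; push_cast; linarith), ofReal_one]
  have hgc : Continuous g := by rw [hg]; fun_prop
  refine ⟨δ, k, fun x => ∫ s in Set.Icc (-k : ℝ) 0,
    Real.exp s * ((g (-s) * g (-s)) * (g (x - s) * g (x - s))), hδ0, n.succ_pos, fun x => ?_⟩
  set G : ℝ → ℝ := fun s => (g (-s) * g (-s)) * (g (x - s) * g (x - s)) with hG
  have hGc : Continuous G := by rw [hG]; fun_prop
  have hG0 : ∀ s, 0 ≤ G s := fun s => mul_nonneg (mul_self_nonneg _) (mul_self_nonneg _)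
  have hG1 : ∀ s, G s ≤ 1 := fun s => by
    have h : ∀ y, g y * g y ≤ 1 := fun y => mul_le_one₀ (hg1 y) (hg0 y) (hg1 y)
    exact mul_le_one₀ (h _) (mul_self_nonneg _) (h _)
  have hGo : ∀ s, δ ≤ -s → -s ≤ n → δ ≤ x - s → x - s ≤ n → 1 ≤ G s := fun s h1 h2 h3 h4 => by
    rw [hG]; dsimp only
    rw [hgo _ h1 h2, hgo _ h3 h4]; norm_num
  refine ⟨?_, ?_, ?_⟩
  · rw [meanFn_apply (rampFn_of_lt_abs hδ0 k), ← integral_complex_ofReal]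
    congr 1 with s
    simp only [hgf]
    push_cast
    ring
  · exact integral_nonneg fun s => mul_nonneg (Real.exp_pos s).le (hG0 s)
  have hκ : Real.exp (-(n : ℝ) / 2) ^ 2 = Real.exp (-n) := by
    rw [← Real.exp_nat_mul]; congr 1; push_cast; ring
  have hkn : (-k : ℝ) ≤ -n := by rw [hk]; push_cast; linarith
  refine (abs_exp_half_sub_le hδ0 (Real.exp_pos (-(n : ℝ) / 2)) ?_
    (integral_nonneg fun s => mul_nonneg (Real.exp_pos s).le (hG0 s)) ?_ ?_ ?_).trans ?_
  · exact Real.exp_le_one_iff.2 (by have : (0 : ℝ) ≤ n := n.cast_nonneg; linarith)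
  · refine setIntegral_le_exp hGc hG1 k fun s hs => le_of_eq ?_
    rw [hG]
    rcases lt_or_ge 0 s with h | h
    · dsimp only
      rw [hgn (-s) (by linarith)]; ring
    · dsimp only
      rw [hgn (x - s)]
      · ring
      · rcases min_lt_iff.1 hs with h' | h' <;> linarith
  · intro hx
    rw [hκ, ← Real.exp_add]
    refine exp_sub_exp_le_setIntegral hGc hG0 (by linarith) (by linarith) fun s hs => ?_
    exact hGo s (by linarith [hs.2]) (by linarith [hs.1]) (by linarith [hs.2]) (by linarith [hs.1])
  · intro hx
    rw [hκ]
    refine exp_sub_exp_le_setIntegral hGc hG0 hkn (by linarith) fun s hs => ?_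
    exact hGo s (by linarith [hs.2]) (by linarith [hs.1]) (by linarith [hs.2]) (by linarith [hs.1])
  · gcongr
    linarith

end Mean

end CSGame

namespace CSGame

open Complex Filter Topology
open scoped InnerProductSpace BoundedContinuousFunction


section JBound

/-- The function `x ↦ √(2 / (1 + e^x))`. -/
noncomputable def sqrtR : ℝ →ᵇ ℂ :=
  BoundedContinuousFunction.ofNormedAddCommGroup (fun x => ((√(2 / (1 + Real.exp x)) : ℝ) : ℂ))
    (by
      refine Complex.continuous_ofReal.comp (Real.continuous_sqrt.comp
        (Continuous.div (by fun_prop) (by fun_prop) fun x => ?_))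
      positivity) (√2) fun x => by
    rw [Complex.norm_real, Real.norm_of_nonneg (Real.sqrt_nonneg _)]
    refine Real.sqrt_le_sqrt (div_le_self zero_le_two ?_)
    linarith [Real.exp_pos x]

/-- The function `x ↦ √(2 / (1 + e^{-x}))`. -/
noncomputable def sqrtR' : ℝ →ᵇ ℂ := reflFn sqrtR

lemma sqrtR_apply (x : ℝ) : sqrtR x = ((√(2 / (1 + Real.exp x)) : ℝ) : ℂ) := rfl

lemma sqrtR'_apply (x : ℝ) : sqrtR' x = ((Real.exp (x / 2) * √(2 / (1 + Real.exp x)) : ℝ) : ℂ) := by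
  rw [sqrtR', reflFn_apply, sqrtR_apply]
  congr 1
  have h1 : Real.exp (x / 2) = √(Real.exp x) := by rw [Real.exp_half]
  rw [h1, ← Real.sqrt_mul (Real.exp_pos x).le, Real.exp_neg]
  congr 1
  have := Real.exp_pos x
  field_simp
  ring

lemma sqrtR_mul_sqrtR : sqrtR * sqrtR = fnR := by
  ext x
  rw [BoundedContinuousFunction.mul_apply, sqrtR_apply, fnR_apply, ← ofReal_mul,
    Real.mul_self_sqrt (by positivity)]

lemma sqrtR_mul_sqrtR' : sqrtR * sqrtR' = fnT := by
  ext x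
  rw [BoundedContinuousFunction.mul_apply, sqrtR_apply, sqrtR'_apply, fnT_apply, ← ofReal_mul]
  congr 1
  have h1 : Real.exp x = Real.exp (x / 2) ^ 2 := by
    rw [← Real.exp_nat_mul]; congr 1; push_cast; ring
  rw [mul_left_comm, Real.mul_self_sqrt (by positivity), h1, Real.cosh_eq, Real.exp_neg]
  have := Real.exp_pos (x / 2)
  field_simp
  ring

lemma sqrtR'_mul_sqrtR' : sqrtR' * sqrtR' = (2 : ℂ) • 1 - fnR := by
  ext x
  have h2 : ((2 : ℂ) • (1 : ℝ →ᵇ ℂ) - fnR) x = ((2 - 2 / (1 + Real.exp x) : ℝ) : ℂ) := by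
    rw [BoundedContinuousFunction.sub_apply, fnR_apply]
    simp
  rw [BoundedContinuousFunction.mul_apply, sqrtR'_apply, h2, ← ofReal_mul]
  congr 1
  have h1 : Real.exp x = Real.exp (x / 2) ^ 2 := by
    rw [← Real.exp_nat_mul]; congr 1; push_cast; ring
  rw [mul_mul_mul_comm, Real.mul_self_sqrt (by positivity), h1]
  field_simp
  ring

lemma conjRefl_two_sub_fnR : conjRefl ((2 : ℂ) • 1 - fnR) = fnR := by
  ext x
  rw [conjRefl_apply, BoundedContinuousFunction.sub_apply, fnR_apply, fnR_apply]
  have : ((2 : ℂ) • (1 : ℝ →ᵇ ℂ)) (-x) = ((2 : ℝ) : ℂ) := by simp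
  rw [this, ← ofReal_sub, conj_ofReal]
  congr 1
  rw [Real.exp_neg]
  have := Real.exp_pos x
  field_simp
  ring

variable {H : Type*} [NormedAddCommGroup H] [InnerProductSpace ℂ H] [CompleteSpace H]
  {M : VonNeumannAlgebra H} {ψ : H} {Φ : (ℝ →ᵇ ℂ) →⋆ₐ[ℂ] (H →L[ℂ] H)}
  {J : H →SL[starRingEnd ℂ] H}

lemma IsTomita.exists_common_preimage (h : IsTomita M ψ Φ J) {a : H →L[ℂ] H} (ha : a ∈ M)
    (hs : star a = a) : ∃ ζ, Φ sqrtR ζ = a ψ ∧ Φ sqrtR' ζ = J (a ψ) := by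
  have e1 : Φ fnT (J (a ψ)) = Φ ((2 : ℂ) • 1 - fnR) (a ψ) := by
    have := h.T_J_star ha
    rw [hs] at this
    rw [this, map_sub, map_smul, map_one]; rfl
  have e2 : Φ fnT (a ψ) = Φ fnR (J (a ψ)) := by
    rw [← h.J_J (a ψ), ← h.J_T, e1, h.J_apply, conjRefl_two_sub_fnR, h.J_J]
  have e3 : ∀ v, Φ ((2 : ℂ) • 1 - fnR) v = (2 : ℂ) • v - Φ fnR v := fun v => by
    rw [map_sub, map_smul, map_one]; rfl
  refine ⟨(1 / 2 : ℂ) • (Φ sqrtR (a ψ) + Φ sqrtR' (J (a ψ))), ?_, ?_⟩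
  · rw [map_smul, map_add, ← starAlgHom_mul_apply, ← starAlgHom_mul_apply, sqrtR_mul_sqrtR,
      sqrtR_mul_sqrtR', e1, e3, add_sub_cancel, smul_smul]
    norm_num
  · rw [map_smul, map_add, ← starAlgHom_mul_apply, ← starAlgHom_mul_apply, sqrtR'_mul_sqrtR',
      mul_comm, sqrtR_mul_sqrtR', e2, e3, add_sub_cancel, smul_smul]
    norm_num

/-- A function close to `x ↦ e^{x/2}` near `0` gives an operator close to the modular conjugation
on those self-adjoint elements which almost commute with the state. -/
theorem IsTomita.norm_J_sub_le (h : IsTomita M ψ Φ J) {f : ℝ →ᵇ ℂ} {m : ℝ → ℝ} {η : ℝ} (hη : 0 ≤ η)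
    (hfm : ∀ x, f x = m x)
    (hm : ∀ x, |Real.exp (x / 2) - m x| ≤ |1 - Real.exp (x / 2)| + η * (1 + Real.exp (x / 2)))
    {a : H →L[ℂ] H} (ha : a ∈ M) (hs : star a = a) :
    ‖J (a ψ) - Φ f (a ψ)‖ ≤ ‖J (a ψ) - a ψ‖ + 2 * η * ‖a ψ‖ := by
  obtain ⟨ζ, h1, h2⟩ := h.exists_common_preimage ha hs
  set d : ℝ →ᵇ ℂ := BoundedContinuousFunction.ofNormedAddCommGroup
    (fun x => (‖(sqrtR' - sqrtR) x‖ : ℂ)) (by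
      have := (sqrtR' - sqrtR).continuous
      fun_prop) ‖sqrtR' - sqrtR‖ (fun x => by
        rw [norm_real, norm_norm]; exact BoundedContinuousFunction.norm_coe_le_norm _ x) with hd
  have hdx : ∀ x, d x = (‖(sqrtR' - sqrtR) x‖ : ℂ) := fun x => rfl
  have hsub : ∀ f g : ℝ →ᵇ ℂ, Φ (f - g) ζ = Φ f ζ - Φ g ζ := fun f g => by rw [map_sub]; rfl
  have e1 : J (a ψ) - Φ f (a ψ) = Φ (sqrtR' - f * sqrtR) ζ := by
    rw [hsub, starAlgHom_mul_apply, h1, h2]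
  have e2 : ‖Φ d ζ‖ ≤ ‖J (a ψ) - a ψ‖ := by
    rw [← h2, ← h1, ← hsub]
    exact norm_starAlgHom_le_of_norm_le Φ (fun x => by rw [hdx, norm_real, norm_norm]) ζ
  have e3 : ‖Φ (sqrtR' - f * sqrtR) ζ‖ ≤ ‖Φ (d + (η : ℂ) • (sqrtR + sqrtR')) ζ‖ := by
    refine norm_starAlgHom_le_of_norm_le Φ (fun x => ?_) ζ
    have hp : 0 ≤ √(2 / (1 + Real.exp x)) := Real.sqrt_nonneg _
    have hx : (d + (η : ℂ) • (sqrtR + sqrtR')) x =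
        ((√(2 / (1 + Real.exp x)) * (|1 - Real.exp (x / 2)| + η * (1 + Real.exp (x / 2))) : ℝ) : ℂ)
          := by
      have h3 : (sqrtR' - sqrtR) x =
          ((√(2 / (1 + Real.exp x)) * (Real.exp (x / 2) - 1) : ℝ) : ℂ) := by
        rw [BoundedContinuousFunction.sub_apply, sqrtR_apply, sqrtR'_apply]; push_cast; ring
      rw [BoundedContinuousFunction.add_apply, hdx, h3, BoundedContinuousFunction.smul_apply,
        BoundedContinuousFunction.add_apply, sqrtR_apply, sqrtR'_apply, norm_real, Real.norm_eq_abs,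
        abs_mul, abs_of_nonneg hp, abs_sub_comm, smul_eq_mul]
      push_cast; ring
    have hy : (sqrtR' - f * sqrtR) x =
        ((√(2 / (1 + Real.exp x)) * (Real.exp (x / 2) - m x) : ℝ) : ℂ) := by
      rw [BoundedContinuousFunction.sub_apply, BoundedContinuousFunction.mul_apply, sqrtR_apply,
        sqrtR'_apply, hfm]
      push_cast; ring
    have hpos : 0 ≤ |1 - Real.exp (x / 2)| + η * (1 + Real.exp (x / 2)) := by
      have := Real.exp_pos (x / 2)
      positivity
    rw [hx, hy, norm_real, norm_real, Real.norm_eq_abs, Real.norm_eq_abs, abs_mul, abs_mul,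
      abs_of_nonneg hp, abs_of_nonneg hpos]
    exact mul_le_mul_of_nonneg_left (hm x) hp
  have e4 : Φ (d + (η : ℂ) • (sqrtR + sqrtR')) ζ = Φ d ζ + (η : ℂ) • (a ψ + J (a ψ)) := by
    rw [← h2, ← h1, map_add, map_smul, map_add]; rfl
  rw [e1]
  refine e3.trans ?_
  rw [e4]
  refine (norm_add_le _ _).trans (add_le_add e2 ?_)
  rw [norm_smul, norm_real, Real.norm_of_nonneg hη, mul_comm 2 η, mul_assoc, two_mul]
  gcongr
  refine (norm_add_le _ _).trans ?_
  rw [h.norm_J]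

end JBound

end CSGame

namespace CSGame

open Complex Filter Topology
open scoped InnerProductSpace BoundedContinuousFunction ComplexOrder


section Model

universe u

open MeasureTheory

/-- A positive map `θ` from a star algebra of operators on `H` into a von Neumann algebra on `K`
with
trace vector `ξ`, such that the trace dominates the form `⟪a ψ, T (b ψ)⟫` on positive elements. -/
structure IsTracialModel {H K : Type*} [NormedAddCommGroup H] [InnerProductSpace ℂ H]
    [CompleteSpace H] [NormedAddCommGroup K] [InnerProductSpace ℂ K] [CompleteSpace K]
    (S : StarSubalgebra ℂ (H →L[ℂ] H)) (ψ : H) (T : H → H) (ξ : K) (N : VonNeumannAlgebra K)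
    (θ : (H →L[ℂ] H) → (K →L[ℂ] K)) : Prop where
  norm_eq_one : ‖ξ‖ = 1
  trace : ∀ u ∈ N, ∀ v ∈ N, ⟪ξ, (u * v) ξ⟫_ℂ = ⟪ξ, (v * u) ξ⟫_ℂ
  mem : ∀ a ∈ S, θ a ∈ N
  isPositive : ∀ a ∈ S, a.IsPositive → (θ a).IsPositive
  map_add : ∀ a ∈ S, ∀ b ∈ S, θ (a + b) = θ a + θ b
  one_sub : (1 - θ 1).IsPositive
  le : ∀ a ∈ S, ∀ b ∈ S, a.IsPositive → b.IsPositive →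
    (⟪a ψ, T (b ψ)⟫_ℂ).re ≤ (⟪ξ, (θ a * θ b) ξ⟫_ℂ).re

lemma exists_one_sub_eq_star_mul_self {A : Type*} [CStarAlgebra A] {h : A} (hh : ‖h‖ ≤ 1) :
    ∃ y, 1 - star h * h = star y * y := by
  let _ : PartialOrder A := CStarAlgebra.spectralOrder A
  have : StarOrderedRing A := CStarAlgebra.spectralOrderedRing A
  refine CStarAlgebra.nonneg_iff_eq_star_mul_self.1 (sub_nonneg.2 ?_)
  refine CStarAlgebra.star_mul_le_algebraMap_norm_sq.trans ?_
  rw [← map_one (algebraMap ℝ A)]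
  exact algebraMap_mono A (pow_le_one₀ (norm_nonneg h) hh)

variable {H : Type*} [NormedAddCommGroup H] [InnerProductSpace ℂ H] [CompleteSpace H]

lemma exists_sq_eq_of_isPositive {M : VonNeumannAlgebra H} {a : H →L[ℂ] H} (ha : a ∈ M)
    (hp : a.IsPositive) : ∃ y ∈ M, star y = y ∧ y * y = a := by
  have h0 : 0 ≤ a := (ContinuousLinearMap.nonneg_iff_isPositive a).2 hp
  refine ⟨CFC.sqrt a, ?_, (IsSelfAdjoint.of_nonneg (CFC.sqrt_nonneg a)).star_eq,
    CFC.sqrt_mul_sqrt_self a h0⟩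
  rw [CFC.sqrt_eq_real_sqrt a h0, cfcₙ_eq_cfc]
  exact cfc_mem_vN M ha _

lemma re_inner_mul_nonneg {M : VonNeumannAlgebra H} {ψ : H}
    (htr : ∀ u ∈ M, ∀ v ∈ M, ⟪ψ, (u * v) ψ⟫_ℂ = ⟪ψ, (v * u) ψ⟫_ℂ) {a b : H →L[ℂ] H} (ha : a ∈ M)
    (hb : b ∈ M) (hpa : a.IsPositive) (hpb : b.IsPositive) : 0 ≤ (⟪ψ, (a * b) ψ⟫_ℂ).re := by
  obtain ⟨y, hy, hys, rfl⟩ := exists_sq_eq_of_isPositive ha hpa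
  rw [mul_assoc, htr _ hy _ (mul_mem hy hb), mul_assoc, mul_apply_eq_comp]
  nth_rw 1 [← hys]
  rw [IsModular.inner_star_apply', mul_apply_eq_comp]
  exact hpb.re_inner_nonneg_right (y ψ)

lemma norm_weightInt_le (ψ : H) (k : ℕ) (w : ℝ →ᵇ (H →L[ℂ] H)) :
    ‖weightInt ψ k w‖ ≤ ‖ψ‖ ^ 2 * volume.real (Set.Icc (-k : ℝ) 0) * ‖w‖ := by
  have : ∀ s ∈ Set.Icc (-k : ℝ) 0, ‖(Real.exp s : ℂ) * ⟪ψ, w s ψ⟫_ℂ‖ ≤ ‖ψ‖ ^ 2 * ‖w‖ := by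
    intro s hs
    rw [norm_mul, norm_real, Real.norm_of_nonneg (Real.exp_pos s).le]
    calc Real.exp s * ‖⟪ψ, w s ψ⟫_ℂ‖ ≤ 1 * (‖ψ‖ * (‖w‖ * ‖ψ‖)) := by
          gcongr
          · exact Real.exp_le_one_iff.2 hs.2
          · refine (norm_inner_le_norm _ _).trans ?_
            gcongr
            exact (w s).le_of_opNorm_le (w.norm_coe_le_norm s) ψ
      _ = _ := by ring
  refine (norm_setIntegral_le_of_norm_le_const (by simp) this).trans (le_of_eq (by ring))

/-- The functional `weightInt` as a continuous linear map. -/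
noncomputable def weightCLM (ψ : H) (k : ℕ) : (ℝ →ᵇ (H →L[ℂ] H)) →L[ℂ] ℂ :=
  LinearMap.mkContinuous
    { toFun := weightInt ψ k
      map_add' := weightInt_add ψ k
      map_smul' := fun z w => by
        rw [Algebra.smul_def z w]
        exact weightInt_algebraMap_mul ψ k z w } _ (norm_weightInt_le ψ k)

lemma weightInt_star_mul_self (ψ : H) (k : ℕ) (w : ℝ →ᵇ (H →L[ℂ] H)) :
    0 ≤ weightInt ψ k (star w * w) := by
  have e : ∀ s : ℝ, (Real.exp s : ℂ) * ⟪ψ, (star w * w) s ψ⟫_ℂ =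
      ((Real.exp s * ‖w s ψ‖ ^ 2 : ℝ) : ℂ) := fun s => by
    rw [BoundedContinuousFunction.mul_apply, mul_apply_eq_comp,
      BoundedContinuousFunction.star_apply,
      IsModular.inner_star_apply', inner_self_eq_norm_sq_to_K]
    push_cast; rfl
  rw [weightInt]
  simp only [e]
  rw [integral_complex_ofReal, ← ofReal_zero, real_le_real]
  exact integral_nonneg fun s => by positivity

lemma weightInt_one {ψ : H} (hψ : ‖ψ‖ = 1) (k : ℕ) :
    weightInt ψ k 1 = ((1 - Real.exp (-k) : ℝ) : ℂ) := by
  rw [weightInt]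
  have e : ∀ s : ℝ, (Real.exp s : ℂ) * ⟪ψ, (1 : ℝ →ᵇ (H →L[ℂ] H)) s ψ⟫_ℂ = ((Real.exp s : ℝ) : ℂ) :=
    fun s => by
      rw [BoundedContinuousFunction.coe_one, Pi.one_apply, one_apply_eq_self,
        inner_self_eq_norm_sq_to_K, hψ]
      simp
  simp only [e]
  rw [integral_complex_ofReal, integral_Icc_eq_integral_Ioc,
    ← intervalIntegral.integral_of_le (by simp), integral_exp, Real.exp_zero]

variable {M : VonNeumannAlgebra H} {ψ : H} {Φ : (ℝ →ᵇ ℂ) →⋆ₐ[ℂ] (H →L[ℂ] H)}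
  {J : H →SL[starRingEnd ℂ] H}

lemma mem_adjoin_compressedSet {f : ℝ →ᵇ ℂ} {k : ℕ} (hf : ∀ x, (k : ℝ) < |x| → f x = 0)
    (hs : star f = f) (u : ℝ →ᵇ (H →L[ℂ] H)) :
    u ∈ StarAlgebra.adjoin ℂ (compressedSet M Φ f k hf) ↔
      u ∈ Algebra.adjoin ℂ (compressedSet M Φ f k hf) := by
  rw [← StarSubalgebra.mem_toSubalgebra, StarAlgebra.adjoin_toSubalgebra, Set.union_eq_left.2]
  rintro w ⟨b, hb, hw⟩
  refine ⟨star b, star_mem hb, ?_⟩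
  have hF : ∀ s, star (hatFn Φ f k hf s) = hatFn Φ f k hf s := fun s =>
    DFunLike.congr_fun (star_hatFn hf hs) s
  rw [← star_star w, hw]
  ext1 s
  change star (hatFn Φ f k hf s * b * hatFn Φ f k hf s) = hatFn Φ f k hf s * star b * hatFn Φ f k
    hf s
  rw [star_mul, star_mul, hF, mul_assoc]

/-- The crossed product by the modular flow provides tracial models. -/
theorem IsTomita.exists_isTracialModel {H : Type u} [NormedAddCommGroup H]
    [InnerProductSpace ℂ H] [CompleteSpace H] {M : VonNeumannAlgebra H} {ψ : H}
    {Φ : (ℝ →ᵇ ℂ) →⋆ₐ[ℂ] (H →L[ℂ] H)} {J : H →SL[starRingEnd ℂ] H}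
    (h : IsTomita M ψ Φ J) (hψ : ‖ψ‖ = 1) {f : ℝ →ᵇ ℂ} {k : ℕ} (hk : 0 < k)
    (hf : ∀ x, (k : ℝ) < |x| → f x = 0) (hf0 : ∀ x ≤ 0, f x = 0) (hs : star f = f)
    (hf1 : ‖f‖ ≤ 1) :
    ∃ (K : Type u) (_ : NormedAddCommGroup K) (_ : InnerProductSpace ℂ K) (_ : CompleteSpace K)
      (ξ : K) (N : VonNeumannAlgebra K) (θ : (H →L[ℂ] H) → (K →L[ℂ] K)),
      IsTracialModel M.toStarSubalgebra ψ (Φ (meanFn f k)) ξ N θ := by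
  classical
  set F := hatFn Φ f k hf with hF
  have hFs : star F = F := star_hatFn hf hs
  set Z : ℝ := 1 - Real.exp (-k) with hZ
  have hZ0 : 0 < Z := by
    rw [hZ, sub_pos, Real.exp_lt_one_iff]
    simpa using hk
  have hZ1 : Z ≤ 1 := by rw [hZ]; linarith [Real.exp_pos (-(k : ℝ))]
  have hZi : (0 : ℂ) ≤ (Z : ℂ)⁻¹ := by rw [← ofReal_inv, ← ofReal_zero, real_le_real]; positivity
  set S := StarAlgebra.adjoin ℂ (compressedSet M Φ f k hf) with hS
  obtain ⟨K, i1, i2, i3, ξ, N, ρ, k1, k2, k3, k4, k5⟩ :=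
    exists_tracial_representation_of_subalgebra S ((Z : ℂ)⁻¹ • weightCLM ψ k)
      (fun x => mul_nonneg hZi (weightInt_star_mul_self ψ k x))
      (by
        change (Z : ℂ)⁻¹ * weightInt ψ k 1 = 1
        rw [weightInt_one hψ, inv_mul_cancel₀ (ofReal_ne_zero.2 hZ0.ne')])
      (fun x hx y hy => by
        rw [hS, mem_adjoin_compressedSet hf hs] at hx hy
        exact congrArg ((Z : ℂ)⁻¹ * ·) (h.weightInt_mul_comm hf hf0 hs hx hy))
  have hmem : ∀ b ∈ M, F * BoundedContinuousFunction.const ℝ b * F ∈ S := fun b hb =>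
    StarAlgebra.subset_adjoin _ _ ⟨b, hb, rfl⟩
  set θ : (H →L[ℂ] H) → (K →L[ℂ] K) := fun b =>
    if hb : b ∈ M then ρ ⟨_, hmem b hb⟩ else 0 with hθ
  have hθb : ∀ b (hb : b ∈ M), θ b = ρ ⟨_, hmem b hb⟩ := fun b hb => by
    rw [hθ]; exact dif_pos hb
  have hθpos : ∀ a ∈ M, a.IsPositive → (θ a).IsPositive := by
    intro a ha hp
    rw [hθb a ha]
    refine k5 _ ?_
    obtain ⟨y, hy⟩ := CStarAlgebra.nonneg_iff_eq_star_mul_self.1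
      ((ContinuousLinearMap.nonneg_iff_isPositive a).2 hp)
    refine ⟨BoundedContinuousFunction.const ℝ y * F, ?_⟩
    have e : BoundedContinuousFunction.const ℝ a =
        star (BoundedContinuousFunction.const ℝ y) * BoundedContinuousFunction.const ℝ y := by
      ext1 s
      exact hy
    change F * BoundedContinuousFunction.const ℝ a * F = _
    rw [e, star_mul, hFs]
    simp only [mul_assoc]
  refine ⟨K, i1, i2, i3, ξ, N, θ, k1, k3, fun a ha => ?_, hθpos, fun a ha b hb => ?_, ?_, ?_⟩
  · rw [hθb a ha]; exact k2 _
  · rw [hθb a ha, hθb b hb, hθb _ (add_mem ha hb), ← map_add]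
    congr 1
    refine Subtype.ext ?_
    have e : BoundedContinuousFunction.const ℝ (a + b) =
        BoundedContinuousFunction.const ℝ a + BoundedContinuousFunction.const ℝ b := rfl
    change F * BoundedContinuousFunction.const ℝ (a + b) * F =
      F * BoundedContinuousFunction.const ℝ a * F + F * BoundedContinuousFunction.const ℝ b * F
    rw [e, mul_add, add_mul]
  · rw [hθb 1 (one_mem M), ← map_one ρ, ← map_sub]
    refine k5 _ ?_
    have hFn : ‖F‖ ≤ 1 :=
      (BoundedContinuousFunction.norm_ofNormedAddCommGroup_le _ (norm_nonneg f) _).trans hf1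
    obtain ⟨y, hy⟩ := exists_one_sub_eq_star_mul_self hFn
    refine ⟨y, ?_⟩
    rw [← hy, hFs]
    change 1 - F * 1 * F = 1 - F * F
    rw [mul_one]
  · intro a ha b hb hpa hpb
    have hnn : 0 ≤ (⟪ξ, (θ a * θ b) ξ⟫_ℂ).re := by
      refine re_inner_mul_nonneg k3 ?_ ?_ (hθpos a ha hpa) (hθpos b hb hpb)
      · rw [hθb a ha]; exact k2 _
      · rw [hθb b hb]; exact k2 _
    have hin : ∀ (g : ℝ →ᵇ ℂ), star g = g → ∀ u v, ⟪Φ g u, v⟫_ℂ = ⟪u, Φ g v⟫_ℂ := fun g hg u v => by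
      rw [IsTomita.inner_starAlgHom, hg]
    have hss : ∀ s, star (shiftFn f s) = shiftFn f s := fun s => by
      ext x
      exact DFunLike.congr_fun hs (x - s)
    have e : ⟪a ψ, Φ (meanFn f k) (b ψ)⟫_ℂ = weightInt ψ k
        ((F * BoundedContinuousFunction.const ℝ a * F) *
          (F * BoundedContinuousFunction.const ℝ b * F)) := by
      rw [inner_starAlgHom_meanFn Φ hf, weightInt]
      congr 1 with s
      have hFf : ∀ s, F s = Φ (shiftFn f s) := fun s => rfl
      have hsh : shiftFn (f * f) s = shiftFn f s * shiftFn f s := rfl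
      have hfr : (starRingEnd ℂ) (f (-s)) = f (-s) := DFunLike.congr_fun hs (-s)
      simp only [BoundedContinuousFunction.mul_apply, BoundedContinuousFunction.const_apply,
        mul_apply_eq_comp, hFf]
      rw [← hin _ (hss s), h.starAlgHom_apply_vec, shiftFn_apply, zero_sub, hsh,
        IsTomita.starAlgHom_mul_apply, map_smul, map_smul, map_smul, map_smul,
        inner_smul_left, inner_smul_right, hfr,
        hpa.inner_left_eq_inner_right]
      ring
    have e2 : (Z : ℂ) * ⟪ξ, (θ a * θ b) ξ⟫_ℂ = ⟪a ψ, Φ (meanFn f k) (b ψ)⟫_ℂ := by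
      rw [hθb a ha, hθb b hb, ← map_mul, k4, e]
      change (Z : ℂ) * ((Z : ℂ)⁻¹ * weightInt ψ k _) = _
      rw [mul_inv_cancel_left₀ (ofReal_ne_zero.2 hZ0.ne')]
      rfl
    rw [← e2, re_ofReal_mul]
    exact mul_le_of_le_one_left hnn hZ1

end Model

end CSGame

namespace CSGame

open Complex Filter Topology
open scoped InnerProductSpace BoundedContinuousFunction ComplexOrder


section Projections

variable {K : Type*} [NormedAddCommGroup K] [InnerProductSpace ℂ K] [CompleteSpace K]
  {N : VonNeumannAlgebra K}

lemma starProjection_mem_of_invariant {U : Submodule ℂ K} [U.HasOrthogonalProjection]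
    (hU : ∀ x ∈ N.commutant, ∀ v ∈ U, x v ∈ U) : U.starProjection ∈ N := by
  refine mem_of_commute N fun x hx => ?_
  have hV : ∀ x ∈ N.commutant, U.starProjection * x * U.starProjection = x * U.starProjection := by
    intro x hx
    ext v
    exact Submodule.starProjection_eq_self_iff.2 (hU x hx _ (Submodule.starProjection_apply_mem U
      v))
  have hs : star U.starProjection = U.starProjection := isSelfAdjoint_starProjection U
  have := congrArg star (hV (star x) (star_mem hx))
  rw [star_mul, star_mul, star_mul, star_star, hs, ← mul_assoc, hV x hx] at this
  exact this

lemma exists_starProjection_two_mul_sub {A : K →L[ℂ] K} (hA : A ∈ N) (h0 : A.IsPositive)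
    (h1 : (1 - A).IsPositive) : ∃ Q : Submodule ℂ K, ∃ _ : IsClosed (Q : Set K),
      ∃ _ : Q.HasOrthogonalProjection, (∀ x ∈ N.commutant, ∀ v ∈ Q, x v ∈ Q) ∧
      ((2 : ℝ) • A - Q.starProjection).IsPositive ∧
      (1 - (2 : ℝ) • A + Q.starProjection).IsPositive := by
  have hA0 : 0 ≤ A := (ContinuousLinearMap.nonneg_iff_isPositive A).2 h0
  have hA1 : A ≤ 1 := sub_nonneg.1 ((ContinuousLinearMap.nonneg_iff_isPositive _).2 h1)
  have hsa : IsSelfAdjoint A := IsSelfAdjoint.of_nonneg hA0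
  have hspec : ∀ x ∈ spectrum ℝ A, 0 ≤ x ∧ x ≤ 1 := fun x hx =>
    ⟨spectrum_nonneg_of_nonneg hA0 hx, (CFC.le_one_iff A hsa).1 hA1 x hx⟩
  set B := cfc (fun x : ℝ => max (x - 1 / 2) 0) A with hB
  set B' := cfc (fun x : ℝ => max (1 / 2 - x) 0) A with hB'
  have hBs : star B = B := (cfc_predicate _ A : IsSelfAdjoint B).star_eq
  have hB's : star B' = B' := (cfc_predicate _ A : IsSelfAdjoint B').star_eq
  have hBB' : B' * B = 0 := by
    rw [hB, hB', ← cfc_mul _ _ A (by fun_prop) (by fun_prop), ← cfc_zero ℝ A]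
    congr 1
    funext x
    rcases le_total x (1 / 2) with h | h
    · rw [max_eq_right (sub_nonpos.2 h) (a := x - 1 / 2), mul_zero]; rfl
    · rw [max_eq_right (sub_nonpos.2 h), zero_mul]; rfl
  have hdiff : (2 : ℝ) • A = 1 + (2 : ℝ) • B - (2 : ℝ) • B' := by
    rw [hB, hB', ← cfc_smul _ _ A (by fun_prop), ← cfc_smul _ _ A (by fun_prop), ← cfc_one ℝ A,
      ← cfc_add (a := A) _ _ (by fun_prop) (by fun_prop),
      ← cfc_sub _ _ A (by fun_prop) (by fun_prop)]
    conv_lhs => rw [← cfc_id' ℝ A, ← cfc_smul _ _ A (by fun_prop)]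
    congr 1
    funext x
    simp only [smul_eq_mul, Pi.one_apply]
    rcases le_total x (1 / 2) with h | h
    · rw [max_eq_right (sub_nonpos.2 h), max_eq_left (sub_nonneg.2 h)]; ring
    · rw [max_eq_right (sub_nonpos.2 h), max_eq_left (sub_nonneg.2 h)]; ring
  have hBpos : 0 ≤ B := cfc_nonneg fun x _ => le_max_right _ _
  have hB'pos : 0 ≤ B' := cfc_nonneg fun x _ => le_max_right _ _
  have hBle : 0 ≤ 1 - (2 : ℝ) • B := by
    rw [hB, ← cfc_smul _ _ A (by fun_prop), ← cfc_one ℝ A,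
      ← cfc_sub _ _ A (by fun_prop) (by fun_prop)]
    refine cfc_nonneg fun x hx => ?_
    have := hspec x hx
    simp only [smul_eq_mul, Pi.one_apply]
    rcases le_total x (1 / 2) with h | h
    · rw [max_eq_right (sub_nonpos.2 h)]; norm_num
    · rw [max_eq_left (sub_nonneg.2 h)]; linarith
  have hB'le : 0 ≤ 1 - (2 : ℝ) • B' := by
    rw [hB', ← cfc_smul _ _ A (by fun_prop), ← cfc_one ℝ A,
      ← cfc_sub _ _ A (by fun_prop) (by fun_prop)]
    refine cfc_nonneg fun x hx => ?_
    have := hspec x hx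
    simp only [smul_eq_mul, Pi.one_apply]
    rcases le_total x (1 / 2) with h | h
    · rw [max_eq_left (sub_nonneg.2 h)]; linarith
    · rw [max_eq_right (sub_nonpos.2 h)]; norm_num
  let Q : Submodule ℂ K := B.range.topologicalClosure
  have hQc : IsClosed (Q : Set K) := Submodule.isClosed_topologicalClosure _
  have : CompleteSpace Q := hQc.completeSpace_coe
  have hQp : Q.HasOrthogonalProjection := inferInstance
  have hBm : B ∈ N := cfc_mem_vN N hA _
  set q := Q.starProjection with hq
  have hqs : star q = q := isSelfAdjoint_starProjection Q
  have hqB : q * B = B := by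
    ext v
    exact Submodule.starProjection_eq_self_iff.2 (subset_closure ⟨v, rfl⟩)
  have hBq : B * q = B := by simpa [hBs, hqs] using congrArg star hqB
  have hker : ∀ v ∈ Q, B' v = 0 := by
    intro v hv
    have hcl : IsClosed {v | B' v = 0} := isClosed_singleton.preimage B'.continuous
    refine hcl.closure_subset_iff.2 ?_ hv
    rintro _ ⟨u, rfl⟩
    exact DFunLike.congr_fun hBB' u
  have hB'q : B' * q = 0 := by
    ext v
    exact hker _ (Submodule.starProjection_apply_mem Q v)
  have hqB' : q * B' = 0 := by simpa [hB's, hqs] using congrArg star hB'q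
  have hz : (2 : ℝ) • (0 : K →L[ℂ] K) = 0 := smul_zero _
  have hqq : q * q = q := Q.isIdempotentElem_starProjection
  refine ⟨Q, hQc, hQp, fun x hx v hv => ?_, ?_, ?_⟩
  · have hcl : IsClosed {v | x v ∈ Q} := hQc.preimage x.continuous
    refine hcl.closure_subset_iff.2 ?_ hv
    rintro _ ⟨u, rfl⟩
    refine subset_closure ⟨x u, ?_⟩
    exact DFunLike.congr_fun (commute_of_mem N hBm hx) u
  · rw [← ContinuousLinearMap.nonneg_iff_isPositive, hdiff]
    have e : 1 + (2 : ℝ) • B - (2 : ℝ) • B' - q =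
        star (1 - q) * (1 - (2 : ℝ) • B') * (1 - q) + (2 : ℝ) • B := by
      rw [star_sub, star_one, hqs]
      simp only [sub_mul, mul_sub, one_mul, mul_one, mul_smul_comm, smul_mul_assoc, hB'q, hqB', hqq,
        sub_zero, sub_self, hz]
      abel
    rw [e]
    exact add_nonneg (star_left_conjugate_nonneg hB'le _) (smul_nonneg (by norm_num) hBpos)
  · rw [← ContinuousLinearMap.nonneg_iff_isPositive, hdiff]
    have e : 1 - (1 + (2 : ℝ) • B - (2 : ℝ) • B') + q =
        star q * (1 - (2 : ℝ) • B) * q + (2 : ℝ) • B' := by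
      rw [hqs]
      simp only [sub_mul, mul_sub, mul_one, mul_smul_comm, smul_mul_assoc, hBq, hqB, hqq]
      abel
    rw [e]
    exact add_nonneg (star_left_conjugate_nonneg hBle _) (smul_nonneg (by norm_num) hB'pos)

/-- A finite family of closed subspaces can be shrunk to an independent one with the same closed
span, staying invariant under any set of operators closed under adjoints. -/
lemma exists_independent_subspaces {α : Type*} [DecidableEq α] (Q : α → Submodule ℂ K)
    (hQ : ∀ a, IsClosed (Q a : Set K)) (hinv : ∀ a, ∀ x ∈ N.commutant, ∀ v ∈ Q a, x v ∈ Q a)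
    (s : Finset α) : ∃ P : α → Submodule ℂ K, (∀ a, IsClosed (P a : Set K)) ∧ (∀ a, P a ≤ Q a) ∧
      (∀ a, ∀ x ∈ N.commutant, ∀ v ∈ P a, x v ∈ P a) ∧
      (∀ v : α → K, (∀ a, v a ∈ P a) → ∑ a ∈ s, v a = 0 → ∀ a ∈ s, v a = 0) ∧
      ∀ a ∈ s, Q a ≤ (⨆ b ∈ s, P b).topologicalClosure := by
  induction s using Finset.induction_on with
  | empty => exact ⟨Q, hQ, fun a => le_rfl, hinv, by simp, by simp⟩
  | insert k s hk ih =>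
    obtain ⟨P, h1, h2, h3, h4, h5⟩ := ih
    set L : Submodule ℂ K := (⨆ b ∈ s, P b).topologicalClosure with hL
    have hLc : IsClosed (L : Set K) := Submodule.isClosed_topologicalClosure _
    have hLinv : ∀ x ∈ N.commutant, ∀ v ∈ L, x v ∈ L := by
      intro x hx v hv
      have hcl : IsClosed {v | x v ∈ L} := hLc.preimage x.continuous
      refine hcl.closure_subset_iff.2 ?_ hv
      have : (⨆ b ∈ s, P b) ≤ (⨆ b ∈ s, P b).comap (x : K →ₗ[ℂ] K) :=
        iSup₂_le fun b hb u hu =>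
          Submodule.mem_comap.2 ((le_iSup₂ (f := fun b (_ : b ∈ s) => P b) b hb) (h3 b x hx u hu))
      exact fun u hu => subset_closure (this hu)
    set G : Submodule ℂ K := Q k ⊓ L with hG
    have hGc : IsClosed (G : Set K) := (hQ k).inter hLc
    have : CompleteSpace G := hGc.completeSpace_coe
    have hupd : ∀ b ∈ s, Function.update P k (Q k ⊓ Gᗮ) b = P b := fun b hb =>
      Function.update_of_ne (ne_of_mem_of_not_mem hb hk) _ _
    have hsup : (⨆ b ∈ insert k s, Function.update P k (Q k ⊓ Gᗮ) b) = (Q k ⊓ Gᗮ) ⊔ ⨆ b ∈ s,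
      P b := by
      rw [Finset.iSup_insert, Function.update_self]
      congr 1
      exact iSup_congr fun b => iSup_congr fun hb => hupd b hb
    refine ⟨Function.update P k (Q k ⊓ Gᗮ), fun a => ?_, fun a => ?_, fun a x hx v hv => ?_,
      fun v hv hsum => ?_, fun a ha => ?_⟩
    · rcases eq_or_ne a k with rfl | h
      · rw [Function.update_self]; exact (hQ a).inter (Submodule.isClosed_orthogonal _)
      · rw [Function.update_of_ne h]; exact h1 a
    · rcases eq_or_ne a k with rfl | h
      · rw [Function.update_self]; exact inf_le_left
      · rw [Function.update_of_ne h]; exact h2 a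
    · rcases eq_or_ne a k with rfl | h
      · rw [Function.update_self] at hv ⊢
        refine ⟨hinv a x hx v hv.1, (Submodule.mem_orthogonal _ _).2 fun u hu => ?_⟩
        rw [← star_star x, IsModular.inner_star_apply']
        exact (Submodule.mem_orthogonal _ _).1 hv.2 _
          ⟨hinv a _ (star_mem hx) u hu.1, hLinv _ (star_mem hx) u hu.2⟩
      · rw [Function.update_of_ne h] at hv ⊢; exact h3 a x hx v hv
    · rw [Finset.sum_insert hk] at hsum
      have hvk := hv k
      rw [Function.update_self] at hvk
      have hvs : ∀ b ∈ s, v b ∈ P b := fun b hb => by rw [← hupd b hb]; exact hv b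
      have hL' : ∑ b ∈ s, v b ∈ L := Submodule.le_topologicalClosure _
        (Submodule.sum_mem _ fun b hb =>
          (le_iSup₂ (f := fun b (_ : b ∈ s) => P b) b hb) (hvs b hb))
      have hvL : v k ∈ L := by
        rw [eq_neg_of_add_eq_zero_left hsum]
        exact neg_mem hL'
      have hvk0 : v k = 0 := inner_self_eq_zero.1
        ((Submodule.mem_orthogonal _ _).1 hvk.2 (v k) ⟨hvk.1, hvL⟩)
      intro a ha
      rcases Finset.mem_insert.1 ha with rfl | ha
      · exact hvk0
      · rw [hvk0, zero_add] at hsum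
        have := h4 (fun b => if b ∈ s then v b else 0) (fun b => by
          by_cases hb : b ∈ s
          · simp only [hb, if_true]; exact hvs b hb
          · simp only [hb, if_false]; exact zero_mem _) (by
          rw [← hsum]; exact Finset.sum_congr rfl fun b hb => by simp only [hb, if_true]) a ha
        simpa only [ha, if_true] using this
    · have hLle : L ≤ (⨆ b ∈ insert k s, Function.update P k (Q k ⊓ Gᗮ) b).topologicalClosure := by
        rw [hsup]; exact Submodule.topologicalClosure_mono le_sup_right
      rcases Finset.mem_insert.1 ha with rfl | ha
      · intro v hv
        have hd : G.starProjection v + Gᗮ.starProjection v = v :=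
          Submodule.starProjection_add_starProjection_orthogonal v
        rw [← hd]
        have hGv := Submodule.starProjection_apply_mem G v
        refine add_mem (hLle hGv.2) (Submodule.le_topologicalClosure _ ?_)
        rw [hsup]
        refine Submodule.mem_sup_left ⟨?_, Submodule.starProjection_apply_mem _ v⟩
        have : Gᗮ.starProjection v = v - G.starProjection v :=
          eq_sub_of_add_eq' hd
        rw [this]
        exact sub_mem hv hGv.1
      · exact (h5 a ha).trans hLle

end Projections

end CSGame

namespace CSGame

open Complex Filter Topology
open scoped InnerProductSpace BoundedContinuousFunction ComplexOrder


section Orthogonalization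

variable {K : Type*} [NormedAddCommGroup K] [InnerProductSpace ℂ K] [CompleteSpace K]
  {N : VonNeumannAlgebra K}

lemma denseRange_of_injective_of_star_eq {T : K →L[ℂ] K} (hT : star T = T)
    (hi : ∀ v, T v = 0 → v = 0) : DenseRange T := by
  have : T.range.topologicalClosure = ⊤ := by
    rw [Submodule.topologicalClosure_eq_top_iff, Submodule.eq_bot_iff]
    intro v hv
    refine hi v (inner_self_eq_zero (𝕜 := ℂ).1 ?_)
    nth_rw 1 [← hT]
    rw [IsModular.inner_star_apply]
    exact (Submodule.mem_orthogonal' _ _).1 hv _ ⟨T v, rfl⟩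
  rw [DenseRange, dense_iff_closure_eq]
  exact congrArg (fun U : Submodule ℂ K => (U : Set K)) this

lemma starProjection_star (U : Submodule ℂ K) [U.HasOrthogonalProjection] :
    star U.starProjection = U.starProjection :=
  isSelfAdjoint_starProjection U

lemma starProjection_mul_self (U : Submodule ℂ K) [U.HasOrthogonalProjection] :
    U.starProjection * U.starProjection = U.starProjection :=
  U.isIdempotentElem_starProjection

lemma inner_starProjection_self (U : Submodule ℂ K) [U.HasOrthogonalProjection] (v : K) :
    ⟪v, U.starProjection v⟫_ℂ = (‖U.starProjection v‖ ^ 2 : ℝ) := by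
  rw [← starProjection_mul_self, mul_apply_eq_comp]
  nth_rw 1 [← starProjection_star]
  rw [IsModular.inner_star_apply', inner_self_eq_norm_sq_to_K,
    ← mul_apply_eq_comp U.starProjection, starProjection_mul_self]
  push_cast; rfl

/-- Symmetric orthogonalization of an independent family of subspaces. -/
lemma exists_orthogonalization {ι : Type*} [Fintype ι] [DecidableEq ι] (P : ι → Submodule ℂ K)
    [∀ i, (P i).HasOrthogonalProjection]
    (hinv : ∀ i, ∀ x ∈ N.commutant, ∀ v ∈ P i, x v ∈ P i)
    (hind : ∀ v : ι → K, (∀ i, v i ∈ P i) → ∑ i, v i = 0 → ∀ i, v i = 0)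
    (hinj : ∀ v, (∀ i, (P i).starProjection v = 0) → v = 0) :
    ∃ (D : ι → K →L[ℂ] K) (T : K →L[ℂ] K), T ∈ N ∧ T.IsPositive ∧ (∀ i, D i ∈ N) ∧
      (∀ i, (P i).starProjection * D i = D i) ∧
      ∑ i, star (D i) * D i = 1 ∧
      (∀ i j, D i * star (D j) = if i = j then (P i).starProjection else 0) ∧
      ∑ i, D i = T ∧ T * T = ∑ i, (P i).starProjection := by
  set p : ι → K →L[ℂ] K := fun i => (P i).starProjection with hp
  have hpN : ∀ i, p i ∈ N := fun i => starProjection_mem_of_invariant (hinv i)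
  set S : K →L[ℂ] K := ∑ i, p i with hS
  have hS0 : 0 ≤ S := Finset.sum_nonneg fun i _ =>
    (ContinuousLinearMap.nonneg_iff_isPositive _).2
      (ContinuousLinearMap.IsPositive.of_isStarProjection
      ⟨(P i).isIdempotentElem_starProjection, isSelfAdjoint_starProjection (P i)⟩)
  have hSN : S ∈ N := sum_mem fun i _ => hpN i
  obtain ⟨T, hTN, hTs, hTT, hTp⟩ : ∃ T ∈ N, star T = T ∧ T * T = S ∧ T.IsPositive := by
    refine ⟨CFC.sqrt S, ?_, (IsSelfAdjoint.of_nonneg (CFC.sqrt_nonneg S)).star_eq,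
      CFC.sqrt_mul_sqrt_self S hS0,
      (ContinuousLinearMap.nonneg_iff_isPositive _).1 (CFC.sqrt_nonneg S)⟩
    rw [CFC.sqrt_eq_real_sqrt S hS0, cfcₙ_eq_cfc]
    exact cfc_mem_vN N hSN _
  have hnorm : ∀ v, ‖T v‖ ^ 2 = ∑ i, ‖p i v‖ ^ 2 := fun v => by
    have : ⟪v, S v⟫_ℂ = (‖T v‖ ^ 2 : ℝ) := by
      rw [← hTT, mul_apply_eq_comp]
      nth_rw 1 [← hTs]
      rw [IsModular.inner_star_apply', inner_self_eq_norm_sq_to_K]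
      push_cast; rfl
    rw [hS, sum_apply, inner_sum] at this
    simp only [hp, inner_starProjection_self] at this
    exact_mod_cast this.symm
  have hTinj : ∀ v, T v = 0 → v = 0 := fun v hv => by
    refine hinj v fun i => ?_
    have h0 := hnorm v
    rw [hv, norm_zero, zero_pow two_ne_zero] at h0
    have := (Finset.sum_eq_zero_iff_of_nonneg fun i _ => sq_nonneg ‖p i v‖).1 h0.symm i
      (Finset.mem_univ i)
    exact norm_eq_zero.1 (pow_eq_zero_iff two_ne_zero |>.1 this)
  have hTd : DenseRange T := denseRange_of_injective_of_star_eq hTs hTinj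
  have hple : ∀ i v, ‖p i v‖ ≤ ‖T v‖ := fun i v => by
    refine le_of_sq_le_sq ?_ (norm_nonneg _)
    rw [hnorm]
    exact Finset.single_le_sum (f := fun i => ‖p i v‖ ^ 2) (fun i _ => sq_nonneg _)
      (Finset.mem_univ i)
  set D : ι → K →L[ℂ] K := fun i => (p i).toLinearMap.extendOfNorm T.toLinearMap with hD
  have hDT : ∀ i v, D i (T v) = p i v := fun i =>
    LinearMap.extendOfNorm_eq (f := (p i).toLinearMap) (e := T.toLinearMap) hTd
      ⟨1, fun v => by rw [one_mul]; exact hple i v⟩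
  have hext : ∀ {A B : K →L[ℂ] K}, (∀ v, A (T v) = B (T v)) → A = B := fun {A B} h => by
    refine ContinuousLinearMap.ext fun v => ?_
    exact congrFun (hTd.equalizer A.continuous B.continuous (funext h)) v
  have hpD : ∀ i, p i * D i = D i := fun i => hext fun v => by
    rw [mul_apply_eq_comp, hDT, ← mul_apply_eq_comp, hp, starProjection_mul_self]
  have hsumD : ∑ i, D i = T := hext fun v => by
    rw [sum_apply, ← mul_apply_eq_comp T T, hTT, hS, sum_apply]
    exact Finset.sum_congr rfl fun i _ => hDT i v
  have hTD : ∀ i, T * star (D i) = p i := fun i => by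
    rw [← star_inj, star_mul, star_star, hTs, hp, starProjection_star]
    exact ContinuousLinearMap.ext (hDT i)
  refine ⟨D, T, hTN, hTp, fun i => ?_, hpD, ?_, fun i j => ?_, hsumD, hTT⟩
  · refine mem_of_commute N fun x hx => hext fun v => ?_
    have h1 := DFunLike.congr_fun (commute_of_mem N hTN hx) v
    have h2 := DFunLike.congr_fun (commute_of_mem N (hpN i) hx) v
    simp only [mul_apply_eq_comp] at h1 h2 ⊢
    rw [hDT, ← h1, hDT, h2]
  · refine hext fun v => ?_
    refine ext_inner_left ℂ fun w => ?_
    refine hTd.induction_on (p := fun w => ⟪w, (∑ i, star (D i) * D i) (T v)⟫_ℂ =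
      ⟪w, (1 : K →L[ℂ] K) (T v)⟫_ℂ) w (isClosed_eq (by fun_prop) (by fun_prop)) fun w => ?_
    rw [sum_apply, inner_sum, one_apply_eq_self]
    nth_rw 3 [← hTs]
    rw [IsModular.inner_star_apply, ← mul_apply_eq_comp T T, hTT, hS, sum_apply, inner_sum]
    refine Finset.sum_congr rfl fun i _ => ?_
    rw [mul_apply_eq_comp, IsModular.inner_star_apply', hDT, hDT]
    rw [← IsModular.inner_star_apply', hp, starProjection_star, ← mul_apply_eq_comp,
      starProjection_mul_self]
  · refine ContinuousLinearMap.ext fun v => ?_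
    have hmem : ∀ i u, D i u ∈ P i := fun i u => by
      rw [← hpD i]; exact Submodule.starProjection_apply_mem _ _
    have := hind (fun i => D i (star (D j) v) - if i = j then p j v else 0) (fun i => ?_) ?_ i
    · rw [mul_apply_eq_comp, sub_eq_zero.1 this]
      split_ifs with h
      · rw [h]
      · rfl
    · refine sub_mem (hmem _ _) ?_
      split_ifs with h
      · rw [h]; exact Submodule.starProjection_apply_mem _ _
      · exact zero_mem _
    · rw [Finset.sum_sub_distrib, ← sum_apply, hsumD, Finset.sum_ite_eq' Finset.univ j,
        if_pos (Finset.mem_univ j),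
        ← mul_apply_eq_comp, hTD, sub_self]

end Orthogonalization

end CSGame

namespace CSGame

open Complex Filter Topology
open scoped InnerProductSpace BoundedContinuousFunction ComplexOrder


section Trace

variable {K : Type*} [NormedAddCommGroup K] [InnerProductSpace ℂ K]

/-- The real part of the vector functional of `ξ`. -/
noncomputable def tr (ξ : K) (a : K →L[ℂ] K) : ℝ := (⟪ξ, a ξ⟫_ℂ).re

lemma tr_add (ξ : K) (a b : K →L[ℂ] K) : tr ξ (a + b) = tr ξ a + tr ξ b := by
  rw [tr, add_apply, inner_add_right, add_re]; rfl

lemma tr_sub (ξ : K) (a b : K →L[ℂ] K) : tr ξ (a - b) = tr ξ a - tr ξ b := by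
  rw [tr, sub_apply, inner_sub_right, sub_re]; rfl

lemma tr_zero (ξ : K) : tr ξ 0 = 0 := by
  rw [tr, zero_apply, inner_zero_right, zero_re]

lemma tr_smul (ξ : K) (c : ℝ) (a : K →L[ℂ] K) : tr ξ (c • a) = c * tr ξ a := by
  rw [tr, smul_apply, inner_smul_right_eq_smul, smul_re, smul_eq_mul]; rfl

lemma tr_sum (ξ : K) {ι : Type*} (s : Finset ι) (a : ι → K →L[ℂ] K) :
    tr ξ (∑ i ∈ s, a i) = ∑ i ∈ s, tr ξ (a i) := by
  rw [tr, sum_apply, inner_sum, re_sum]; rfl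

lemma tr_one {ξ : K} (h : ‖ξ‖ = 1) : tr ξ 1 = 1 := by
  rw [tr, one_apply_eq_self, inner_self_eq_norm_sq_to_K, h]; simp

variable [CompleteSpace K]

lemma tr_star (ξ : K) (a : K →L[ℂ] K) : tr ξ (star a) = tr ξ a := by
  rw [tr, IsModular.inner_star_apply', ← inner_conj_symm, conj_re]; rfl

lemma tr_star_mul_self (ξ : K) (a : K →L[ℂ] K) : tr ξ (star a * a) = ‖a ξ‖ ^ 2 := by
  rw [tr, mul_apply_eq_comp, IsModular.inner_star_apply', inner_self_eq_norm_sq_to_K]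
  exact_mod_cast rfl

lemma isPositive_starProjection (U : Submodule ℂ K) [U.HasOrthogonalProjection] :
    U.starProjection.IsPositive :=
  ContinuousLinearMap.IsPositive.of_isStarProjection
    ⟨U.isIdempotentElem_starProjection, isSelfAdjoint_starProjection U⟩

lemma isPositive_of_star_mul_self {a : K →L[ℂ] K} (h1 : star a = a) (h2 : a * a = a) :
    a.IsPositive :=
  ContinuousLinearMap.IsPositive.of_isStarProjection ⟨h2, h1⟩

lemma isPositive_starProjection_sub {U V : Submodule ℂ K} [U.HasOrthogonalProjection]
    [V.HasOrthogonalProjection] (h : U ≤ V) : (V.starProjection - U.starProjection).IsPositive := by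
  have h1 : V.starProjection * U.starProjection = U.starProjection := by
    ext v
    exact Submodule.starProjection_eq_self_iff.2 (h (Submodule.starProjection_apply_mem U v))
  have h2 : U.starProjection * V.starProjection = U.starProjection := by
    simpa [starProjection_star] using congrArg star h1
  refine isPositive_of_star_mul_self ?_ ?_
  · rw [star_sub, starProjection_star, starProjection_star]
  · rw [mul_sub, sub_mul, sub_mul, h1, h2, starProjection_mul_self, starProjection_mul_self,
      sub_self,
      sub_zero]

/-- The unit vector `ξ` induces a trace on `N`. -/
structure IsTrace (N : VonNeumannAlgebra K) (ξ : K) : Prop where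
  norm_eq_one : ‖ξ‖ = 1
  mul_comm : ∀ u ∈ N, ∀ v ∈ N, ⟪ξ, (u * v) ξ⟫_ℂ = ⟪ξ, (v * u) ξ⟫_ℂ

variable {N : VonNeumannAlgebra K} {ξ : K}

lemma IsTrace.tr_mul_comm (h : IsTrace N ξ) {u v : K →L[ℂ] K} (hu : u ∈ N) (hv : v ∈ N) :
    tr ξ (u * v) = tr ξ (v * u) :=
  congrArg re (h.mul_comm u hu v hv)

lemma IsTrace.tr_mul_nonneg (h : IsTrace N ξ) {u v : K →L[ℂ] K} (hu : u ∈ N) (hv : v ∈ N)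
    (hup : u.IsPositive) (hvp : v.IsPositive) : 0 ≤ tr ξ (u * v) :=
  re_inner_mul_nonneg h.mul_comm hu hv hup hvp

lemma IsTrace.tr_eq_one (h : IsTrace N ξ) : tr ξ 1 = 1 := tr_one h.norm_eq_one

/-- `√s ≥ (3 s - s²) / 2` under the trace. -/
lemma tr_sqrt_ge (ξ : K) {T : K →L[ℂ] K} (hT : T.IsPositive) :
    3 * tr ξ (T * T) - tr ξ (T * T * (T * T)) ≤ 2 * tr ξ T := by
  have hs : star T = T := hT.isSelfAdjoint
  have h1 : 0 ≤ tr ξ (star (T * (T - 1)) * (T * (T - 1))) := by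
    rw [tr_star_mul_self]; positivity
  have h2 : 0 ≤ tr ξ ((T - 1) * T * (T - 1)) := by
    rw [tr, mul_assoc, mul_apply_eq_comp]
    nth_rw 1 [show T - 1 = star (T - 1) by rw [star_sub, hs, star_one]]
    rw [IsModular.inner_star_apply', mul_apply_eq_comp]
    exact hT.re_inner_nonneg_right _
  have e1 : star (T * (T - 1)) * (T * (T - 1)) =
      T * T * (T * T) - (2 : ℝ) • (T * T * T) + T * T := by
    rw [star_mul, star_sub, hs, star_one, two_smul]
    noncomm_ring
  have e2 : (T - 1) * T * (T - 1) = T * T * T - (2 : ℝ) • (T * T) + T := by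
    rw [two_smul]
    noncomm_ring
  rw [e1, tr_add, tr_sub, tr_smul] at h1
  rw [e2, tr_add, tr_sub, tr_smul] at h2
  linarith

end Trace

end CSGame

namespace CSGame

open Complex Filter Topology
open scoped InnerProductSpace BoundedContinuousFunction ComplexOrder


section Rounding

variable {K : Type*} [NormedAddCommGroup K] [InnerProductSpace ℂ K] [CompleteSpace K]
  {N : VonNeumannAlgebra K} {ξ : K}

lemma isPositive_sum {ι : Type*} {s : Finset ι} {A : ι → K →L[ℂ] K}
    (h : ∀ i ∈ s, (A i).IsPositive) : (∑ i ∈ s, A i).IsPositive :=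
  (ContinuousLinearMap.nonneg_iff_isPositive _).1 <| Finset.sum_nonneg fun i hi =>
    (ContinuousLinearMap.nonneg_iff_isPositive _).2 (h i hi)

lemma isPositive_one_sub_of_sum_eq_one {α : Type*} [Fintype α] [DecidableEq α] {A : α → K →L[ℂ] K}
    (hA : ∀ a, (A a).IsPositive) (hsum : ∑ a, A a = 1) (a : α) : (1 - A a).IsPositive := by
  rw [← hsum, ← Finset.add_sum_erase _ _ (Finset.mem_univ a), add_sub_cancel_left]
  exact isPositive_sum fun b _ => hA b

lemma star_eq_of_isPositive {a : K →L[ℂ] K} (h : a.IsPositive) : star a = a :=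
  h.isSelfAdjoint

/-- The trace of `D⋆ D B` for a positive contraction `B` is controlled by replacing `D` by a
projection. -/
lemma IsTrace.tr_star_mul_self_mul_le (h : IsTrace N ξ) {D p B : K →L[ℂ] K} (hD : D ∈ N)
    (hp : p ∈ N)
    (hps : star p = p) (hpp : p * p = p) (hB : B ∈ N) (hB0 : B.IsPositive)
    (hB1 : (1 - B).IsPositive) :
    tr ξ (star D * D * B) ≤ 2 * tr ξ (p * B) + 2 * ‖(star D - p) ξ‖ ^ 2 := by
  obtain ⟨y, hy, hys, hyy⟩ := exists_sq_eq_of_isPositive hB hB0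
  have hys' : ∀ w, ‖y w‖ ^ 2 ≤ ‖w‖ ^ 2 := fun w => by
    have := hB1.re_inner_nonneg_right w
    rw [sub_apply, inner_sub_right, map_sub, one_apply_eq_self, ← hyy, mul_apply_eq_comp] at this
    nth_rw 1 [← hys] at this
    rw [IsModular.inner_star_apply', inner_self_eq_norm_sq, inner_self_eq_norm_sq] at this
    linarith
  have e1 : tr ξ (star D * D * B) = ‖y (star D ξ)‖ ^ 2 := by
    rw [← mul_apply_eq_comp, ← tr_star_mul_self, star_mul, star_star, hys, mul_assoc,
      h.tr_mul_comm (star_mem hD) (mul_mem hD hB), ← hyy]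
    simp only [mul_assoc]
  have e2 : tr ξ (p * B) = ‖y (p ξ)‖ ^ 2 := by
    rw [← mul_apply_eq_comp, ← tr_star_mul_self, star_mul, hys, hps, ← mul_assoc, mul_assoc p, hyy,
      ← h.tr_mul_comm hp (mul_mem hp hB), ← mul_assoc, hpp]
  have e3 : y (star D ξ) = y (p ξ) + y ((star D - p) ξ) := by
    rw [← map_add, sub_apply, add_sub_cancel]
  rw [e1, e2, e3]
  have := hys' ((star D - p) ξ)
  have h4 := parallelogram_law_with_norm ℂ (y (p ξ)) (y ((star D - p) ξ))
  nlinarith [norm_nonneg (y (p ξ) - y ((star D - p) ξ))]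

lemma IsTrace.norm_star_sub_sq (h : IsTrace N ξ) {D p : K →L[ℂ] K} (hD : D ∈ N) (hp : p ∈ N)
    (hps : star p = p) (hpp : p * p = p) (hpD : p * D = D) (hDD : D * star D = p) :
    ‖(star D - p) ξ‖ ^ 2 = 2 * tr ξ p - 2 * tr ξ D := by
  have e : star (star D - p) * (star D - p) = p - D * p - star (D * p) + p := by
    rw [star_sub, star_star, hps, sub_mul, mul_sub, mul_sub, hDD, hpp, star_mul, hps]
    abel
  rw [← tr_star_mul_self, e, tr_add, tr_sub, tr_sub, tr_star, h.tr_mul_comm hD hp, hpD]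
  ring

lemma IsTrace.tr_mul_two_smul_sub (h : IsTrace N ξ) {A q : K →L[ℂ] K} (hA : A ∈ N) (hq : q ∈ N)
    (hA1 : (1 - A).IsPositive) (hq2 : ((2 : ℝ) • A - q).IsPositive) :
    tr ξ (q * (1 - A)) ≤ 2 * tr ξ (A - A * A) := by
  have := h.tr_mul_nonneg (sub_mem (real_smul_mem_vN N hA 2) hq) (sub_mem (one_mem N) hA) hq2 hA1
  rw [sub_mul, tr_sub, smul_mul_assoc, tr_smul, mul_sub A, mul_one] at this
  linarith

lemma IsTrace.tr_one_sub_mul_le (h : IsTrace N ξ) {A q f : K →L[ℂ] K} (hA : A ∈ N) (hq : q ∈ N)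
    (hf : f ∈ N) (hA0 : A.IsPositive) (hq1 : (1 - (2 : ℝ) • A + q).IsPositive)
    (hfq : (1 - q - f).IsPositive) : tr ξ (f * A) ≤ 2 * tr ξ (A - A * A) := by
  have h1 := h.tr_mul_nonneg (sub_mem (sub_mem (one_mem N) hq) hf) hA hfq hA0
  have h2 := h.tr_mul_nonneg (add_mem (sub_mem (one_mem N) (real_smul_mem_vN N hA 2)) hq) hA hq1 hA0
  rw [sub_mul, sub_mul, one_mul, tr_sub, tr_sub] at h1
  rw [add_mul, sub_mul, one_mul, tr_add, tr_sub, smul_mul_assoc, tr_smul] at h2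
  rw [tr_sub]
  linarith

/-- A POVM in a tracial von Neumann algebra which is almost projective is close to a PVM. -/
theorem IsTrace.exists_pvm (h : IsTrace N ξ) {α : Type*} [Fintype α] [Nonempty α]
    (A : α → K →L[ℂ] K) (hA : ∀ a, A a ∈ N) (hA0 : ∀ a, (A a).IsPositive) (hsum : ∑ a, A a = 1) :
    ∃ r : α → K →L[ℂ] K, (∀ a, r a ∈ N) ∧ (∀ a, star (r a) = r a) ∧ (∀ a, r a * r a = r a) ∧
      ∑ a, r a = 1 ∧ 1 - 14 * (1 - ∑ a, tr ξ (A a * A a)) ≤ ∑ a, tr ξ (r a * A a) := by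
  classical
  have hA1 := isPositive_one_sub_of_sum_eq_one hA0 hsum
  set δ := 1 - ∑ a, tr ξ (A a * A a) with hδ
  have hδsum : ∑ a, tr ξ (A a - A a * A a) = δ := by
    simp only [tr_sub]
    rw [Finset.sum_sub_distrib, ← tr_sum, hsum, h.tr_eq_one]
  choose Q hQc hQp hQinv hQ2 hQ1 using fun a =>
    exists_starProjection_two_mul_sub (hA a) (hA0 a) (hA1 a)
  obtain ⟨P, hPc, hPQ, hPinv, hPind, hPsup⟩ :=
    exists_independent_subspaces Q hQc hQinv Finset.univ
  have _inst : ∀ a, (P a).HasOrthogonalProjection := fun a => by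
    have : CompleteSpace (P a) := (hPc a).completeSpace_coe
    infer_instance
  set p : α → K →L[ℂ] K := fun a => (P a).starProjection with hp
  have hpN : ∀ a, p a ∈ N := fun a => starProjection_mem_of_invariant (hPinv a)
  have hqN : ∀ a, (Q a).starProjection ∈ N := fun a => starProjection_mem_of_invariant (hQinv a)
  have hps : ∀ a, star (p a) = p a := fun a => starProjection_star _
  have hpp : ∀ a, p a * p a = p a := fun a => starProjection_mul_self _
  let L : Submodule ℂ K := ⨅ a, (p a).ker
  have hL : ∀ v, v ∈ L ↔ ∀ a, p a v = 0 := fun v => by simp [L]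
  have hLc : IsClosed (L : Set K) := by
    have : (L : Set K) = ⋂ a, {v | p a v = 0} := by ext v; simp [hL]
    rw [this]
    exact isClosed_iInter fun a => isClosed_singleton.preimage (p a).continuous
  have _instL : L.HasOrthogonalProjection := by
    have : CompleteSpace L := hLc.completeSpace_coe
    infer_instance
  have hLinv : ∀ x ∈ N.commutant, ∀ v ∈ L, x v ∈ L := fun x hx v hv => by
    rw [hL] at hv ⊢
    intro a
    have := DFunLike.congr_fun (commute_of_mem N (hpN a) hx) v
    simp only [mul_apply_eq_comp] at this
    rw [this, hv a, map_zero]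
  let P' : Option α → Submodule ℂ K := fun o => o.elim L P
  have _inst' : ∀ o, (P' o).HasOrthogonalProjection := fun o => by
    cases o with
    | none => exact _instL
    | some a => exact _inst a
  set f := L.starProjection with hf
  have hfs : star f = f := starProjection_star _
  have hff : f * f = f := starProjection_mul_self _
  have hfN : f ∈ N := starProjection_mem_of_invariant hLinv
  have hpf : ∀ a, p a * f = 0 := fun a => by
    ext v
    exact (hL _).1 (Submodule.starProjection_apply_mem L v) a
  have hfp : ∀ a, f * p a = 0 := fun a => by
    simpa [hfs, hps] using congrArg star (hpf a)
  obtain ⟨D, T, hTN, hT0, hDN, hpD, hDsum, hDD, hDT, hTT⟩ := exists_orthogonalization (N := N) P'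
    (fun o => by
      cases o with
      | none => exact hLinv
      | some a => exact hPinv a)
    (fun v hv hv0 => by
      rw [Fintype.sum_option] at hv0
      have hvn : v none = 0 := by
        have h1 : f (v none) = v none := Submodule.starProjection_eq_self_iff.2 (hv none)
        have h2 := congrArg f hv0
        rw [map_add, h1, map_sum, map_zero, Finset.sum_eq_zero, add_zero] at h2
        · exact h2
        · intro a _
          have h3 : p a (v (some a)) = v (some a) :=
            Submodule.starProjection_eq_self_iff.2 (hv (some a))
          rw [← h3, ← mul_apply_eq_comp, hfp, zero_apply]
      rw [hvn, zero_add] at hv0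
      intro o
      cases o with
      | none => exact hvn
      | some a => exact hPind (fun a => v (some a)) (fun a =>
          hv (some a)) hv0 a (Finset.mem_univ a))
    (fun v hv => by
      have hvL : v ∈ L := (hL v).2 fun a => hv (some a)
      rw [← Submodule.starProjection_eq_self_iff.2 hvL]
      exact hv none)
  set S := ∑ a, p a with hS
  have hTS : T * T = f + S := by rw [hTT, Fintype.sum_option]; rfl
  have hfq : ∀ a, (1 - (Q a).starProjection - f).IsPositive := fun a => by
    have : L ≤ (Q a)ᗮ := fun v hv => (Submodule.mem_orthogonal _ _).2 fun u hu => by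
      have hle : (⨆ b ∈ Finset.univ, P b).topologicalClosure ≤ (ℂ ∙ v)ᗮ := by
        refine Submodule.topologicalClosure_minimal _ (iSup₂_le fun b _ u hu => ?_)
          (Submodule.isClosed_orthogonal _)
        rw [Submodule.mem_orthogonal_singleton_iff_inner_right,
          ← Submodule.starProjection_eq_self_iff.2 hu, ← IsModular.inner_star_apply]
        change ⟪star (p b) v, u⟫_ℂ = 0
        rw [hps, (hL v).1 hv b, inner_zero_left]
      exact Submodule.mem_orthogonal_singleton_iff_inner_left.1
        (hle (hPsup a (Finset.mem_univ a) hu))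
    have h2 := isPositive_starProjection_sub this
    have h3 : (Q a)ᗮ.starProjection = 1 - (Q a).starProjection := by
      ext v
      exact eq_sub_of_add_eq' (Submodule.starProjection_add_starProjection_orthogonal v)
    rwa [h3] at h2
  have htrf : tr ξ f ≤ 2 * δ := by
    calc tr ξ f = ∑ a, tr ξ (f * A a) := by rw [← tr_sum, ← Finset.mul_sum, hsum, mul_one]
      _ ≤ ∑ a, 2 * tr ξ (A a - A a * A a) := Finset.sum_le_sum fun a _ =>
          h.tr_one_sub_mul_le (hA a) (hqN a) hfN (hA0 a) (hQ1 a) (hfq a)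
      _ = _ := by rw [← Finset.mul_sum, hδsum]
  have hpA : ∀ a, tr ξ (p a * (1 - A a)) ≤ 2 * tr ξ (A a - A a * A a) := fun a => by
    have := h.tr_mul_nonneg (sub_mem (hqN a) (hpN a)) (sub_mem (one_mem N) (hA a))
      (isPositive_starProjection_sub (hPQ a)) (hA1 a)
    rw [sub_mul, tr_sub] at this
    linarith [h.tr_mul_two_smul_sub (hA a) (hqN a) (hA1 a) (hQ2 a)]
  have hpA' : ∑ a, tr ξ (p a * (1 - A a)) ≤ 2 * δ := by
    rw [← hδsum, Finset.mul_sum]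
    exact Finset.sum_le_sum fun a _ => hpA a
  have hDtr : ∀ o, tr ξ (star (D o) * D o) = tr ξ (P' o).starProjection := fun o => by
    rw [h.tr_mul_comm (star_mem (hDN o)) (hDN o), hDD, if_pos rfl]
  have htot : tr ξ f + tr ξ S = 1 := by
    have e : ∑ o, tr ξ (star (D o) * D o) = 1 := by rw [← tr_sum, hDsum, h.tr_eq_one]
    rw [← e, Fintype.sum_congr _ _ hDtr, Fintype.sum_option, tr_sum]
    rfl
  have hSS : tr ξ (S * S) ≤ tr ξ S + 4 * δ := by
    have hb : ∀ b a, a ≠ b → tr ξ (p b * p a) ≤ 2 * tr ξ (p b * A a) := fun b a _ => by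
      have hpos : ((2 : ℝ) • A a - p a).IsPositive := by
        have := (hQ2 a).add (isPositive_starProjection_sub (hPQ a))
        rwa [sub_add_sub_cancel] at this
      have := h.tr_mul_nonneg (hpN b) (sub_mem (real_smul_mem_vN N (hA a) 2) (hpN a))
        (isPositive_starProjection _) hpos
      rw [mul_sub, tr_sub, mul_smul_comm, tr_smul] at this
      linarith
    have hb' : ∀ b, tr ξ (p b * S) ≤ tr ξ (p b) + 2 * tr ξ (p b * (1 - A b)) := fun b => by
      have e : p b * (1 - A b) = ∑ a ∈ Finset.univ.erase b, p b * A a := by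
        rw [← hsum, ← Finset.add_sum_erase _ _ (Finset.mem_univ b), add_sub_cancel_left,
          Finset.mul_sum]
      rw [e, hS, ← Finset.add_sum_erase _ _ (Finset.mem_univ b), mul_add, hpp, tr_add,
        Finset.mul_sum,
        tr_sum, tr_sum, Finset.mul_sum]
      exact add_le_add_right
        (Finset.sum_le_sum fun a ha => hb b a (Finset.ne_of_mem_erase ha)) _
    have e : S * S = ∑ b, p b * S := by rw [← Finset.sum_mul]
    rw [e, tr_sum]
    refine (Finset.sum_le_sum fun b _ => hb' b).trans ?_
    rw [Finset.sum_add_distrib, ← Finset.mul_sum, hS, tr_sum]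
    linarith
  have hTTTT : tr ξ (T * T * (T * T)) ≤ 1 + 4 * δ := by
    have h1 : f * S = 0 := by
      rw [hS, Finset.mul_sum]; exact Finset.sum_eq_zero fun a _ => hfp a
    have h2 : S * f = 0 := by
      rw [hS, Finset.sum_mul]; exact Finset.sum_eq_zero fun a _ => hpf a
    rw [hTS, mul_add, add_mul, add_mul, hff, h1, h2, add_zero, zero_add, tr_add]
    linarith
  have hTtr : 2 - 2 * tr ξ T ≤ 4 * δ := by
    have := tr_sqrt_ge ξ hT0
    have h2 : tr ξ (T * T) = 1 := by rw [hTS, tr_add, htot]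
    rw [h2] at this
    linarith
  have hE0 : ∀ o, ‖(star (D o) - (P' o).starProjection) ξ‖ ^ 2 =
      2 * tr ξ (P' o).starProjection - 2 * tr ξ (D o) := fun o =>
    h.norm_star_sub_sq (hDN o) (by
      cases o with
      | none => exact hfN
      | some a => exact hpN a) (starProjection_star _) (starProjection_mul_self _) (hpD o)
      (by rw [hDD, if_pos rfl])
  have hE : ∑ a, ‖(star (D (some a)) - p a) ξ‖ ^ 2 ≤ 4 * δ := by
    have h1 : ∑ o, ‖(star (D o) - (P' o).starProjection) ξ‖ ^ 2 = 2 - 2 * tr ξ T := by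
      rw [Finset.sum_congr rfl fun o _ => hE0 o, Finset.sum_sub_distrib, ← Finset.mul_sum,
        ← Finset.mul_sum, ← tr_sum, ← tr_sum, hDT, ← hTT, hTS, tr_add, htot, mul_one]
    rw [Fintype.sum_option] at h1
    have h2 := sq_nonneg ‖(star (D none) - (P' none).starProjection) ξ‖
    change _ + ∑ a, ‖(star (D (some a)) - p a) ξ‖ ^ 2 = _ at h1
    linarith
  set r₀ : Option α → K →L[ℂ] K := fun o => star (D o) * D o with hr₀
  have hr₀N : ∀ o, r₀ o ∈ N := fun o => mul_mem (star_mem (hDN o)) (hDN o)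
  have hr₀s : ∀ o, star (r₀ o) = r₀ o := fun o => by
    rw [hr₀]; simp only [star_mul, star_star]
  have hr₀r : ∀ o o', r₀ o * r₀ o' = if o = o' then r₀ o else 0 := fun o o' => by
    have e : r₀ o * r₀ o' = star (D o) * (D o * star (D o')) * D o' := by
      simp only [hr₀, mul_assoc]
    rw [e, hDD]
    split_ifs with h
    · subst h
      rw [mul_assoc, hpD]
    · rw [mul_zero, zero_mul]
  obtain ⟨a₀⟩ := ‹Nonempty α›
  refine ⟨fun a => r₀ (some a) + if a = a₀ then r₀ none else 0, fun a => ?_, fun a => ?_,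
    fun a => ?_,
    ?_, ?_⟩
  · refine add_mem (hr₀N _) ?_
    split_ifs
    · exact hr₀N _
    · exact zero_mem N
  · beta_reduce
    rw [star_add, hr₀s]
    split_ifs
    · rw [hr₀s]
    · rw [star_zero]
  · beta_reduce
    split_ifs
    · simp only [mul_add, add_mul, hr₀r]
      simp
    · rw [add_zero, hr₀r, if_pos rfl]
  · rw [Finset.sum_add_distrib, Finset.sum_ite_eq' Finset.univ a₀, if_pos (Finset.mem_univ _),
      add_comm,
      ← Fintype.sum_option, hDsum]
  · have h1 : ∀ a, tr ξ (p a) - (2 * tr ξ (p a * (1 - A a)) + 2 * ‖(star (D (some a)) - p a) ξ‖ ^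
      2) ≤
        tr ξ ((r₀ (some a) + if a = a₀ then r₀ none else 0) * A a) := fun a => by
      have h2 := h.tr_star_mul_self_mul_le (hDN (some a)) (hpN a) (hps a) (hpp a)
        (sub_mem (one_mem N) (hA a)) (hA1 a) (by rw [sub_sub_cancel]; exact hA0 a)
      have h3 : tr ξ (star (D (some a)) * D (some a) * (1 - A a)) =
          tr ξ (p a) - tr ξ (r₀ (some a) * A a) := by
        rw [mul_sub, mul_one, tr_sub, hDtr]
        rfl
      have h4 : 0 ≤ tr ξ ((if a = a₀ then r₀ none else 0) * A a) := by
        split_ifs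
        · refine h.tr_mul_nonneg (hr₀N _) (hA a) (isPositive_of_star_mul_self (hr₀s _) ?_) (hA0 a)
          rw [hr₀r, if_pos rfl]
        · rw [zero_mul, tr_zero]
      rw [add_mul, tr_add]
      linarith
    refine le_trans ?_ (Finset.sum_le_sum fun a _ => h1 a)
    rw [Finset.sum_sub_distrib, Finset.sum_add_distrib, ← Finset.mul_sum, ← Finset.mul_sum,
      ← tr_sum]
    linarith

end Rounding

end CSGame

namespace CSGame

open Complex Filter Topology
open scoped InnerProductSpace BoundedContinuousFunction ComplexOrder


section Closeness

variable {K : Type*} [NormedAddCommGroup K] [InnerProductSpace ℂ K] [CompleteSpace K]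
  {N : VonNeumannAlgebra K} {ξ : K}

/-- A positive operator valued measure in `N`. -/
structure IsPOVM {α : Type*} [Fintype α] (N : VonNeumannAlgebra K) (A : α → K →L[ℂ] K) : Prop where
  mem : ∀ a, A a ∈ N
  isPositive : ∀ a, (A a).IsPositive
  sum_eq_one : ∑ a, A a = 1

/-- The marginal of a family of operators along `g`. -/
noncomputable def marginal {α β : Type*} [Fintype α] [DecidableEq β] (g : α → β)
    (A : α → K →L[ℂ] K) (b : β) : K →L[ℂ] K :=
  ∑ a, if g a = b then A a else 0

lemma sum_marginal {α β : Type*} [Fintype α] [Fintype β] [DecidableEq β] (g : α → β)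
    (A : α → K →L[ℂ] K) : ∑ b, marginal g A b = ∑ a, A a := by
  simp only [marginal]
  rw [Finset.sum_comm]
  simp

lemma sum_tr_marginal_mul {α β : Type*} [Fintype α] [Fintype β] [DecidableEq β] (g : α → β)
    (A : α → K →L[ℂ] K) (B : β → K →L[ℂ] K) :
    ∑ b, tr ξ (marginal g A b * B b) = ∑ a, tr ξ (A a * B (g a)) := by
  simp only [marginal, Finset.sum_mul, tr_sum]
  rw [Finset.sum_comm]
  refine Finset.sum_congr rfl fun a _ => ?_
  simp [ite_mul, apply_ite (tr ξ), tr_zero]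

lemma isPositive_marginal {α β : Type*} [Fintype α] [DecidableEq β] {g : α → β}
    {A : α → K →L[ℂ] K} (hA : ∀ a, (A a).IsPositive) (b : β) : (marginal g A b).IsPositive :=
  isPositive_sum fun a _ => by
    split_ifs
    · exact hA a
    · exact ContinuousLinearMap.isPositive_zero

lemma IsPOVM.marginal {α β : Type*} [Fintype α] [Fintype β] [DecidableEq β] {A : α → K →L[ℂ] K}
    (hA : IsPOVM N A) (g : α → β) : IsPOVM N (marginal g A) :=
  ⟨fun _ => sum_mem fun a _ => by
    split_ifs
    · exact hA.mem a
    · exact zero_mem N, isPositive_marginal hA.isPositive, (sum_marginal g A).trans hA.sum_eq_one⟩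

lemma IsTrace.norm_sub_sq (h : IsTrace N ξ) {X Y : K →L[ℂ] K} (hX : X ∈ N) (hY : Y ∈ N)
    (hXp : X.IsPositive) (hYp : Y.IsPositive) :
    ‖(X - Y) ξ‖ ^ 2 = tr ξ (X * X) + tr ξ (Y * Y) - 2 * tr ξ (X * Y) := by
  rw [← tr_star_mul_self, star_sub, star_eq_of_isPositive hXp, star_eq_of_isPositive hYp, sub_mul,
    mul_sub, mul_sub, tr_sub, tr_sub, tr_sub, h.tr_mul_comm hY hX]
  ring

lemma IsTrace.tr_mul_self_le (h : IsTrace N ξ) {α : Type*} [Fintype α] {A : α → K →L[ℂ] K}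
    (hA : IsPOVM N A) : ∑ a, tr ξ (A a * A a) ≤ 1 := by
  classical
  have : ∀ a, tr ξ (A a * A a) ≤ tr ξ (A a) := fun a => by
    have := h.tr_mul_nonneg (hA.mem a) (sub_mem (one_mem N) (hA.mem a)) (hA.isPositive a)
      (isPositive_one_sub_of_sum_eq_one hA.isPositive hA.sum_eq_one a)
    rw [mul_sub, mul_one, tr_sub] at this
    linarith
  refine (Finset.sum_le_sum fun a _ => this a).trans ?_
  rw [← tr_sum, hA.sum_eq_one, h.tr_eq_one]

lemma IsTrace.sum_norm_sub_sq_le (h : IsTrace N ξ) {α : Type*} [Fintype α] {A B : α → K →L[ℂ] K}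
    (hA : IsPOVM N A) (hB : IsPOVM N B) :
    ∑ a, ‖(A a - B a) ξ‖ ^ 2 ≤ 2 - 2 * ∑ a, tr ξ (A a * B a) := by
  rw [Finset.sum_congr rfl fun a _ => h.norm_sub_sq (hA.mem a) (hB.mem a) (hA.isPositive a)
    (hB.isPositive a), Finset.sum_sub_distrib, Finset.sum_add_distrib, ← Finset.mul_sum]
  linarith [h.tr_mul_self_le hA, h.tr_mul_self_le hB]

lemma IsTrace.sum_tr_mul_ge_of_close (h : IsTrace N ξ) {α : Type*} [Fintype α]
    {A B r s : α → K →L[ℂ] K} (hA : IsPOVM N A) (hB : IsPOVM N B) (hr : IsPOVM N r)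
    (hs : IsPOVM N s) (hr1 : ∑ a, tr ξ (r a * r a) = 1) (hs1 : ∑ a, tr ξ (s a * s a) = 1) :
    1 - 3 * (1 - ∑ a, tr ξ (r a * A a)) - 3 * (1 - ∑ a, tr ξ (A a * B a)) -
      3 * (1 - ∑ a, tr ξ (s a * B a)) ≤ ∑ a, tr ξ (r a * s a) := by
  have h1 := h.sum_norm_sub_sq_le hr hA
  have h2 := h.sum_norm_sub_sq_le hA hB
  have h3 := h.sum_norm_sub_sq_le hs hB
  have h4 : ∑ a, ‖(r a - s a) ξ‖ ^ 2 = 2 - 2 * ∑ a, tr ξ (r a * s a) := by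
    rw [Finset.sum_congr rfl fun a _ => h.norm_sub_sq (hr.mem a) (hs.mem a) (hr.isPositive a)
      (hs.isPositive a), Finset.sum_sub_distrib, Finset.sum_add_distrib, ← Finset.mul_sum, hr1, hs1]
    norm_num
  have h5 : ∑ a, ‖(r a - s a) ξ‖ ^ 2 ≤ 3 * ∑ a, ‖(r a - A a) ξ‖ ^ 2 +
      3 * ∑ a, ‖(A a - B a) ξ‖ ^ 2 + 3 * ∑ a, ‖(s a - B a) ξ‖ ^ 2 := by
    rw [Finset.mul_sum, Finset.mul_sum, Finset.mul_sum, ← Finset.sum_add_distrib,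
      ← Finset.sum_add_distrib]
    refine Finset.sum_le_sum fun a _ => ?_
    have e : (r a - s a) ξ = (r a - A a) ξ + (A a - B a) ξ - (s a - B a) ξ := by
      simp only [sub_apply]; abel
    have hle : ‖(r a - s a) ξ‖ ≤ ‖(r a - A a) ξ‖ + ‖(A a - B a) ξ‖ + ‖(s a - B a) ξ‖ := by
      rw [e]
      exact (norm_sub_le _ _).trans (by gcongr; exact norm_add_le _ _)
    have := pow_le_pow_left₀ (norm_nonneg _) hle 2
    nlinarith [sq_nonneg (‖(r a - A a) ξ‖ - ‖(A a - B a) ξ‖),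
      sq_nonneg (‖(r a - A a) ξ‖ - ‖(s a - B a) ξ‖), sq_nonneg (‖(A a - B a) ξ‖ - ‖(s a - B a) ξ‖)]
  linarith

lemma marginal_star_mul {α β : Type*} [Fintype α] [DecidableEq β] (g : α → β)
    {r : α → K →L[ℂ] K} (hr : ∀ a a', a ≠ a' → r a * r a' = 0)
    (hrr : ∀ a, r a * r a = r a) (b : β) :
    marginal g r b * marginal g r b = marginal g r b := by
  classical
  simp only [marginal, Finset.sum_mul, Finset.mul_sum]
  refine Finset.sum_congr rfl fun a _ => ?_
  rw [Finset.sum_eq_single a]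
  · split_ifs
    · exact hrr a
    · exact mul_zero _
  · intro a' _ hne
    split_ifs <;> simp [hr _ _ hne]
  · simp

/-- Distinct members of a projection valued measure are orthogonal. -/
lemma mul_eq_zero_of_sum_eq_one {α : Type*} [Fintype α] {r : α → K →L[ℂ] K}
    (hs : ∀ a, star (r a) = r a) (hr : ∀ a, r a * r a = r a) (h1 : ∑ a, r a = 1) {a a' : α}
    (h : a ≠ a') : r a * r a' = 0 := by
  classical
  have hn : ∀ a v, ⟪v, r a v⟫_ℂ = (‖r a v‖ ^ 2 : ℝ) := fun a v => by
    nth_rw 1 [← hr a]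
    rw [mul_apply_eq_comp]
    nth_rw 1 [← hs a]
    rw [IsModular.inner_star_apply', inner_self_eq_norm_sq_to_K]
    push_cast; rfl
  ext v
  set w := r a' v with hw
  have hw' : r a' w = w := by rw [hw, ← mul_apply_eq_comp, hr]
  have h2 : ∑ b, ‖r b w‖ ^ 2 = ‖w‖ ^ 2 := by
    have : ⟪w, (∑ b, r b) w⟫_ℂ = (‖w‖ ^ 2 : ℝ) := by
      rw [h1, one_apply_eq_self, inner_self_eq_norm_sq_to_K]; push_cast; rfl
    rw [sum_apply, inner_sum] at this
    simp only [hn] at this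
    exact_mod_cast this
  rw [← Finset.add_sum_erase _ _ (Finset.mem_univ a'), hw'] at h2
  have h3 : ∑ b ∈ Finset.univ.erase a', ‖r b w‖ ^ 2 = 0 := by linarith
  have h4 := (Finset.sum_eq_zero_iff_of_nonneg fun b _ => sq_nonneg ‖r b w‖).1 h3 a
    (Finset.mem_erase.2 ⟨h, Finset.mem_univ _⟩)
  exact norm_eq_zero.1 (pow_eq_zero_iff two_ne_zero |>.1 h4)

lemma IsTrace.sum_tr_mul_le_marginal (h : IsTrace N ξ) {α β : Type*} [Fintype α] [Fintype β]
    [DecidableEq β] (g : α → β) {r A : α → K →L[ℂ] K} (hr : IsPOVM N r) (hA : IsPOVM N A) :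
    ∑ a, tr ξ (r a * A a) ≤ ∑ b, tr ξ (CSGame.marginal g r b * CSGame.marginal g A b) := by
  classical
  rw [sum_tr_marginal_mul]
  refine Finset.sum_le_sum fun a _ => ?_
  have : tr ξ (r a * (CSGame.marginal g A (g a))) = ∑ a',
    tr ξ (r a * if g a' = g a then A a' else 0) := by
    rw [← tr_sum, ← Finset.mul_sum]; rfl
  rw [this]
  refine le_trans (le_of_eq ?_) (Finset.single_le_sum (fun a' _ => ?_) (Finset.mem_univ a))
  · rw [if_pos rfl]
  · split_ifs
    · exact h.tr_mul_nonneg (hr.mem _) (hA.mem _) (hr.isPositive _) (hA.isPositive _)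
    · rw [mul_zero, tr_zero]

/-- Consistency of a pair of POVMs passes to nearby PVMs. -/
theorem IsTrace.sum_tr_pvm_ge (h : IsTrace N ξ) {α β : Type*} [Fintype α] [Fintype β]
    (g : α → β) {r A : α → K →L[ℂ] K} {s B : β → K →L[ℂ] K} (hA : IsPOVM N A)
    (hB : IsPOVM N B) (hrN : ∀ a, r a ∈ N) (hrs : ∀ a, star (r a) = r a)
    (hrr : ∀ a, r a * r a = r a) (hr1 : ∑ a, r a = 1) (hsN : ∀ a, s a ∈ N)
    (hss : ∀ a, star (s a) = s a) (hsq : ∀ a, s a * s a = s a) (hs1 : ∑ a, s a = 1) :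
    1 - 3 * (1 - ∑ a, tr ξ (r a * A a)) - 3 * (1 - ∑ a, tr ξ (A a * B (g a))) -
      3 * (1 - ∑ b, tr ξ (s b * B b)) ≤ ∑ a, tr ξ (r a * s (g a)) := by
  classical
  have hr : IsPOVM N r := ⟨hrN, fun a => isPositive_of_star_mul_self (hrs a) (hrr a), hr1⟩
  have hs : IsPOVM N s := ⟨hsN, fun a => isPositive_of_star_mul_self (hss a) (hsq a), hs1⟩
  have h1 := h.sum_tr_mul_ge_of_close (hA.marginal g) hB (hr.marginal g) hs (by
      simp only [marginal_star_mul g (fun a a' => mul_eq_zero_of_sum_eq_one hrs hrr hr1) hrr]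
      rw [← tr_sum, sum_marginal, hr1, h.tr_eq_one]) (by
      simp only [hsq]
      rw [← tr_sum, hs1, h.tr_eq_one])
  rw [sum_tr_marginal_mul g A B, sum_tr_marginal_mul g r s] at h1
  linarith [h.sum_tr_mul_le_marginal g hr hA]

end Closeness

end CSGame

namespace CSGame

open Complex Filter Topology
open scoped InnerProductSpace BoundedContinuousFunction ComplexOrder


section ModelExistence

universe u

/-- A star subalgebra on which the vector functional of `ψ` is tracial has a tracial model. -/
theorem exists_isTracialModel_of_trace {H : Type u} [NormedAddCommGroup H]
    [InnerProductSpace ℂ H] [CompleteSpace H] {ψ : H} (hψ : ‖ψ‖ = 1)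
    (S : StarSubalgebra ℂ (H →L[ℂ] H))
    (htr : ∀ x ∈ S, ∀ y ∈ S, ⟪ψ, (x * y) ψ⟫_ℂ = ⟪ψ, (y * x) ψ⟫_ℂ) :
    ∃ (K : Type u) (_ : NormedAddCommGroup K) (_ : InnerProductSpace ℂ K) (_ : CompleteSpace K)
      (ξ : K) (N : VonNeumannAlgebra K) (θ : (H →L[ℂ] H) → (K →L[ℂ] K)),
      IsTracialModel S ψ id ξ N θ := by
  classical
  set τ : (H →L[ℂ] H) →L[ℂ] ℂ :=
    (innerSL ℂ ψ).comp (ContinuousLinearMap.apply ℂ H ψ) with hτ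
  have hτa : ∀ a, τ a = ⟪ψ, a ψ⟫_ℂ := fun a => rfl
  obtain ⟨K, i1, i2, i3, ξ, N, ρ, k1, k2, k3, k4, k5⟩ :=
    exists_tracial_representation_of_subalgebra S τ (fun x => by
        rw [hτa, mul_apply_eq_comp, IsModular.inner_star_apply', inner_self_eq_norm_sq_to_K]
        exact pow_nonneg (Complex.zero_le_real.2 (norm_nonneg (x ψ))) 2) (by
        rw [hτa, one_apply_eq_self, inner_self_eq_norm_sq_to_K, hψ]; simp) htr
  refine ⟨K, i1, i2, i3, ξ, N, fun b => if hb : b ∈ S then ρ ⟨b, hb⟩ else 0, ?_⟩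
  refine ⟨k1, k3, fun a ha => ?_, fun a ha hp => ?_, fun a ha b hb => ?_, ?_,
    fun a ha b hb hpa hpb => ?_⟩
  · simp only [dif_pos ha]
    exact k2 _
  · simp only [dif_pos ha]
    exact k5 _ (CStarAlgebra.nonneg_iff_eq_star_mul_self.1
      ((ContinuousLinearMap.nonneg_iff_isPositive a).2 hp))
  · simp only [dif_pos ha, dif_pos hb, dif_pos (add_mem ha hb)]
    exact map_add ρ ⟨a, ha⟩ ⟨b, hb⟩
  · have : ρ ⟨1, one_mem S⟩ = 1 := map_one ρ
    simp only [dif_pos (one_mem S), this, sub_self]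
    exact ContinuousLinearMap.isPositive_zero
  · simp only [dif_pos ha, dif_pos hb]
    have e : ρ ⟨a, ha⟩ * ρ ⟨b, hb⟩ = ρ (⟨a, ha⟩ * ⟨b, hb⟩) := (map_mul ρ _ _).symm
    rw [e, k4]
    change _ ≤ (⟪ψ, (a * b) ψ⟫_ℂ).re
    rw [mul_apply_eq_comp, ← hpa.inner_left_eq_inner_right]
    exact le_rfl

namespace IsTomita

variable {H : Type u} [NormedAddCommGroup H] [InnerProductSpace ℂ H] [CompleteSpace H]
  {M : VonNeumannAlgebra H} {ψ : H} {Φ : (ℝ →ᵇ ℂ) →⋆ₐ[ℂ] (H →L[ℂ] H)}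
  {J : H →SL[starRingEnd ℂ] H}

lemma inner_mul_comm_of_J_eq (h : IsTomita M ψ Φ J) {a c : H →L[ℂ] H} (ha : a ∈ M)
    (hs : star a = a) (hJ : J (a ψ) = a ψ) (hc : c ∈ M) :
    ⟪ψ, (a * c) ψ⟫_ℂ = ⟪ψ, (c * a) ψ⟫_ℂ := by
  have := h.inner_J_star hc ha
  rw [hs, hJ, h.inner_J', hJ, IsModular.inner_star_apply] at this
  rw [mul_apply_eq_comp, mul_apply_eq_comp, ← this, ← IsModular.inner_star_apply, hs]

lemma inner_mul_comm_of_mem_adjoin (h : IsTomita M ψ Φ J) {s : Set (H →L[ℂ] H)}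
    (hs : ∀ a ∈ s, a ∈ M ∧ star a = a ∧ J (a ψ) = a ψ) {x : H →L[ℂ] H}
    (hx : x ∈ StarAlgebra.adjoin ℂ s) :
    x ∈ M ∧ ∀ c ∈ M, ⟪ψ, (x * c) ψ⟫_ℂ = ⟪ψ, (c * x) ψ⟫_ℂ := by
  have hle : StarAlgebra.adjoin ℂ s ≤ M.toStarSubalgebra :=
    StarAlgebra.adjoin_le fun a ha => (hs a ha).1
  refine ⟨hle hx, ?_⟩
  rw [← StarSubalgebra.mem_toSubalgebra, StarAlgebra.adjoin_toSubalgebra] at hx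
  have hss : s ∪ star s = s := by
    refine Set.union_eq_left.2 fun a ha => ?_
    rw [Set.mem_star] at ha
    have := (hs _ ha).2.1
    rw [star_star] at this
    rwa [← this] at ha
  rw [hss] at hx
  suffices x ∈ M ∧ ∀ c ∈ M, ⟪ψ, (x * c) ψ⟫_ℂ = ⟪ψ, (c * x) ψ⟫_ℂ from this.2
  induction hx using Algebra.adjoin_induction with
  | mem a ha =>
    exact ⟨(hs a ha).1, fun c hc => h.inner_mul_comm_of_J_eq (hs a ha).1 (hs a ha).2.1 (hs a
      ha).2.2 hc⟩
  | algebraMap r =>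
    refine ⟨algebraMap_mem M.toStarSubalgebra r, fun c _ => ?_⟩
    rw [Algebra.commutes]
  | add a b _ _ iha ihb =>
    refine ⟨add_mem iha.1 ihb.1, fun c hc => ?_⟩
    rw [add_mul, mul_add, add_apply, add_apply, inner_add_right, inner_add_right, iha.2 c hc,
      ihb.2 c hc]
  | mul a b _ _ iha ihb =>
    refine ⟨mul_mem iha.1 ihb.1, fun c hc => ?_⟩
    rw [mul_assoc, iha.2 _ (mul_mem ihb.1 hc), mul_assoc, ihb.2 _ (mul_mem hc iha.1), mul_assoc]

/-- A tracial model whose form is close to the one induced by `J`, with error controlled by `η`. -/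
theorem exists_isTracialModel_close (h : IsTomita M ψ Φ J) (hψ : ‖ψ‖ = 1)
    {s : Set (H →L[ℂ] H)} (hs : ∀ a ∈ s, a ∈ M ∧ star a = a) {η : ℝ} (hη : 0 ≤ η)
    (hη0 : η = 0 → ∀ a ∈ s, J (a ψ) = a ψ) :
    ∃ (S : StarSubalgebra ℂ (H →L[ℂ] H)) (T : H → H) (K : Type u) (_ : NormedAddCommGroup K)
      (_ : InnerProductSpace ℂ K) (_ : CompleteSpace K) (ξ : K) (N : VonNeumannAlgebra K)
      (θ : (H →L[ℂ] H) → (K →L[ℂ] K)), s ⊆ S ∧ IsTracialModel S ψ T ξ N θ ∧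
      ∀ a ∈ s, ‖J (a ψ) - T (a ψ)‖ ≤ ‖J (a ψ) - a ψ‖ + 2 * η * ‖a ψ‖ := by
  rcases hη.eq_or_lt with h0 | h0
  · have hs' : ∀ a ∈ s, a ∈ M ∧ star a = a ∧ J (a ψ) = a ψ := fun a ha =>
      ⟨(hs a ha).1, (hs a ha).2, hη0 h0.symm a ha⟩
    obtain ⟨K, i1, i2, i3, ξ, N, θ, hm⟩ := exists_isTracialModel_of_trace hψ
      (StarAlgebra.adjoin ℂ s) fun x hx y hy =>
        (h.inner_mul_comm_of_mem_adjoin hs' hx).2 y (h.inner_mul_comm_of_mem_adjoin hs' hy).1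
    refine ⟨_, id, K, i1, i2, i3, ξ, N, θ, StarAlgebra.subset_adjoin ℂ s, hm, fun a _ => ?_⟩
    rw [← h0]
    simp
  · obtain ⟨δ, k, m, hδ, hk, hm⟩ := exists_meanFn_rampFn h0
    obtain ⟨K, i1, i2, i3, ξ, N, θ, hmod⟩ := h.exists_isTracialModel hψ hk
      (fun x hx => rampFn_of_lt_abs hδ k x hx) (fun x hx => rampFn_of_nonpos hδ k hx)
      (star_rampFn δ k) (norm_rampFn_le δ k)
    refine ⟨_, _, K, i1, i2, i3, ξ, N, θ, fun a ha => (hs a ha).1, hmod, fun a ha => ?_⟩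
    exact h.norm_J_sub_le hη (fun x => (hm x).1) (fun x => (hm x).2.2)
      (hs a ha).1 (hs a ha).2

end IsTomita

end ModelExistence

end CSGame

namespace CSGame

open Complex Filter Topology
open scoped InnerProductSpace BoundedContinuousFunction ComplexOrder


section Completion

variable {H K : Type*} [NormedAddCommGroup H] [InnerProductSpace ℂ H] [CompleteSpace H]
  [NormedAddCommGroup K] [InnerProductSpace ℂ K] [CompleteSpace K]
  {S : StarSubalgebra ℂ (H →L[ℂ] H)} {ψ : H} {T : H → H} {ξ : K} {N : VonNeumannAlgebra K}
  {θ : (H →L[ℂ] H) → (K →L[ℂ] K)}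

/-- The image of a POVM under `θ`, completed to a POVM by adding the defect at the index `a₀`. -/
noncomputable def completion {α : Type*} [DecidableEq α] (θ : (H →L[ℂ] H) → (K →L[ℂ] K)) (a₀ : α)
    (E : α → H →L[ℂ] H) (a : α) : K →L[ℂ] K :=
  θ (E a) + if a = a₀ then 1 - θ 1 else 0

namespace IsTracialModel

lemma isTrace (h : IsTracialModel S ψ T ξ N θ) : IsTrace N ξ := ⟨h.norm_eq_one, h.trace⟩

lemma map_sum (h : IsTracialModel S ψ T ξ N θ) {α : Type*} (s : Finset α) {E : α → H →L[ℂ] H}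
    (hE : ∀ a, E a ∈ S) : θ (∑ a ∈ s, E a) = ∑ a ∈ s, θ (E a) := by
  classical
  induction s using Finset.induction_on with
  | empty =>
    have := h.map_add 0 (zero_mem S) 0 (zero_mem S)
    rw [add_zero] at this
    rw [Finset.sum_empty, Finset.sum_empty]
    exact left_eq_add.1 this
  | insert a s ha ih =>
    rw [Finset.sum_insert ha, Finset.sum_insert ha, h.map_add _ (hE a) _ (sum_mem fun a _ =>
      hE a), ih]

lemma defect_mem (h : IsTracialModel S ψ T ξ N θ) (p : Prop) [Decidable p] :
    (if p then 1 - θ 1 else 0) ∈ N := by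
  split_ifs
  · exact sub_mem (one_mem N) (h.mem 1 (one_mem S))
  · exact zero_mem N

lemma isPositive_defect (h : IsTracialModel S ψ T ξ N θ) (p : Prop) [Decidable p] :
    (if p then 1 - θ 1 else 0).IsPositive := by
  split_ifs
  · exact h.one_sub
  · exact ContinuousLinearMap.isPositive_zero

lemma isPOVM_completion (h : IsTracialModel S ψ T ξ N θ) {α : Type*} [Fintype α] [DecidableEq α]
    (a₀ : α) {E : α → H →L[ℂ] H} (hE : ∀ a, E a ∈ S) (hp : ∀ a, (E a).IsPositive)
    (h1 : ∑ a, E a = 1) : IsPOVM N (completion θ a₀ E) := by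
  refine ⟨fun a => add_mem (h.mem _ (hE a)) (h.defect_mem _),
    fun a => (h.isPositive _ (hE a) (hp a)).add (h.isPositive_defect _), ?_⟩
  simp only [completion]
  rw [Finset.sum_add_distrib, ← h.map_sum _ hE, h1, Finset.sum_ite_eq' Finset.univ a₀,
    if_pos (Finset.mem_univ _), add_sub_cancel]

lemma le_tr_completion (h : IsTracialModel S ψ T ξ N θ) {α β : Type*} [DecidableEq α]
    [DecidableEq β] (a₀ : α) (b₀ : β) {E : α → H →L[ℂ] H} {F : β → H →L[ℂ] H} {a : α} {b : β}
    (hE : E a ∈ S) (hF : F b ∈ S) (hEp : (E a).IsPositive) (hFp : (F b).IsPositive) :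
    (⟪E a ψ, T (F b ψ)⟫_ℂ).re ≤ tr ξ (completion θ a₀ E a * completion θ b₀ F b) := by
  have h0 := h.le _ hE _ hF hEp hFp
  have ht := h.isTrace
  have h1 := ht.tr_mul_nonneg (h.mem _ hE) (h.defect_mem (b = b₀)) (h.isPositive _ hE hEp)
    (h.isPositive_defect (b = b₀))
  have h2 := ht.tr_mul_nonneg (h.defect_mem (a = a₀)) (h.mem _ hF) (h.isPositive_defect (a = a₀))
    (h.isPositive _ hF hFp)
  have h3 := ht.tr_mul_nonneg (h.defect_mem (a = a₀)) (h.defect_mem (b = b₀))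
    (h.isPositive_defect (a = a₀)) (h.isPositive_defect (b = b₀))
  change _ ≤ tr ξ _ at h0
  rw [completion, completion, add_mul, mul_add, mul_add, tr_add, tr_add, tr_add]
  linarith

end IsTracialModel

end Completion

end CSGame

namespace CSGame

open Complex Filter Topology
open scoped InnerProductSpace BoundedContinuousFunction ComplexOrder


section SelfPolar

lemma exists_mul_self_eq_fnT : ∃ q : ℝ →ᵇ ℂ, star q = q ∧ q * q = fnT := by
  refine ⟨BoundedContinuousFunction.ofNormedAddCommGroup
    (fun x => ((√(1 / Real.cosh (x / 2)) : ℝ) : ℂ)) ?_ 1 fun x => ?_, ?_, ?_⟩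
  · refine Complex.continuous_ofReal.comp (Real.continuous_sqrt.comp
      (Continuous.div (by fun_prop) (by fun_prop) fun x => (Real.cosh_pos _).ne'))
  · have := Real.one_le_cosh (x / 2)
    rw [Complex.norm_real, Real.norm_of_nonneg (Real.sqrt_nonneg _)]
    refine Real.sqrt_le_one.2 ?_
    rw [div_le_one (by positivity)]
    exact this
  · ext x
    exact conj_ofReal _
  · ext x
    have := (Real.cosh_pos (x / 2)).le
    rw [BoundedContinuousFunction.mul_apply]
    change ((√(1 / Real.cosh (x / 2)) : ℝ) : ℂ) * ((√(1 / Real.cosh (x / 2)) : ℝ) : ℂ) =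
      ((1 / Real.cosh (x / 2) : ℝ) : ℂ)
    rw [← ofReal_mul, Real.mul_self_sqrt (by positivity)]

variable {H : Type*} [NormedAddCommGroup H] [InnerProductSpace ℂ H] [CompleteSpace H]
  {M : VonNeumannAlgebra H} {ψ : H} {Φ : (ℝ →ᵇ ℂ) →⋆ₐ[ℂ] (H →L[ℂ] H)}
  {J : H →SL[starRingEnd ℂ] H}

lemma sum_norm_sq_le {α : Type*} [Fintype α] (hψ : ‖ψ‖ = 1) {E : α → H →L[ℂ] H}
    (hE : IsPOVM M E) : ∑ a, ‖E a ψ‖ ^ 2 ≤ 1 := by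
  classical
  have key : ∀ a, ‖E a ψ‖ ^ 2 ≤ tr ψ (E a) := fun a => by
    obtain ⟨y, -, hys, hy⟩ := exists_sq_eq_of_isPositive (hE.mem a) (hE.isPositive a)
    have h1 := (isPositive_one_sub_of_sum_eq_one hE.isPositive hE.sum_eq_one
      a).re_inner_nonneg_right
      (y ψ)
    rw [sub_apply, inner_sub_right, map_sub, one_apply_eq_self] at h1
    have h2 : ‖E a ψ‖ ^ 2 = (⟪y ψ, E a (y ψ)⟫_ℂ).re := by
      rw [← tr_star_mul_self, star_eq_of_isPositive (hE.isPositive a), tr,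
        ← IsModular.inner_star_apply', hys, ← hy]
      rfl
    have h3 : tr ψ (E a) = (⟪y ψ, y ψ⟫_ℂ).re := by
      rw [tr, ← IsModular.inner_star_apply', hys, ← hy]
      rfl
    rw [h2, h3]
    exact sub_nonneg.1 h1
  calc ∑ a, ‖E a ψ‖ ^ 2 ≤ ∑ a, tr ψ (E a) := Finset.sum_le_sum fun a _ => key a
    _ = 1 := by rw [← tr_sum, hE.sum_eq_one, tr_one hψ]

/-- The real part of the form `⟪a ψ, J (b ψ)⟫`. -/
noncomputable def polarForm (J : H →SL[starRingEnd ℂ] H) (ψ : H) (a b : H →L[ℂ] H) : ℝ :=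
  (⟪a ψ, J (b ψ)⟫_ℂ).re

lemma polarForm_sum_left {ι : Type*} (s : Finset ι) (a : ι → H →L[ℂ] H) (b : H →L[ℂ] H) :
    polarForm J ψ (∑ i ∈ s, a i) b = ∑ i ∈ s, polarForm J ψ (a i) b := by
  rw [polarForm, sum_apply, sum_inner, re_sum]; rfl

lemma polarForm_sum_right {ι : Type*} (s : Finset ι) (a : H →L[ℂ] H) (b : ι → H →L[ℂ] H) :
    polarForm J ψ a (∑ i ∈ s, b i) = ∑ i ∈ s, polarForm J ψ a (b i) := by
  rw [polarForm, sum_apply, map_sum, inner_sum, re_sum]; rfl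

lemma polarForm_zero_left (b : H →L[ℂ] H) : polarForm J ψ 0 b = 0 := by
  rw [polarForm, zero_apply, inner_zero_left, zero_re]

lemma polarForm_zero_right (a : H →L[ℂ] H) : polarForm J ψ a 0 = 0 := by
  rw [polarForm, zero_apply, map_zero, inner_zero_right, zero_re]

namespace IsTomita

lemma polarForm_comm (h : IsTomita M ψ Φ J) (a b : H →L[ℂ] H) :
    polarForm J ψ a b = polarForm J ψ b a := by
  rw [polarForm, h.inner_J', polarForm]

lemma polarForm_self_nonneg (h : IsTomita M ψ Φ J) {a : H →L[ℂ] H} (ha : a ∈ M)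
    (hs : star a = a) : 0 ≤ polarForm J ψ a a := by
  obtain ⟨ζ, h1, h2⟩ := h.exists_common_preimage ha hs
  obtain ⟨q, hq, hqq⟩ := exists_mul_self_eq_fnT
  have hsR : star sqrtR = sqrtR := by
    ext x
    exact conj_ofReal _
  rw [polarForm, ← h2, ← h1, inner_starAlgHom, hsR, ← starAlgHom_mul_apply, sqrtR_mul_sqrtR', ← hqq,
    starAlgHom_mul_apply]
  nth_rw 1 [← hq]
  rw [← inner_starAlgHom]
  exact inner_self_nonneg (𝕜 := ℂ)

lemma polarForm_sub_self (h : IsTomita M ψ Φ J) (a b : H →L[ℂ] H) :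
    polarForm J ψ (a - b) (a - b) =
      polarForm J ψ a a + polarForm J ψ b b - 2 * polarForm J ψ a b := by
  have := h.polarForm_comm a b
  simp only [polarForm, sub_apply, map_sub, inner_sub_left, inner_sub_right, sub_re] at *
  linarith

lemma isPositive_jConj (h : IsTomita M ψ Φ J) {a : H →L[ℂ] H} (ha : a.IsPositive) :
    (jConj J a).IsPositive := by
  rw [ContinuousLinearMap.isPositive_iff_complex]
  intro v
  have e : ⟪jConj J a v, v⟫_ℂ = ⟪J v, a (J v)⟫_ℂ := by
    rw [jConj_apply, h.inner_J]
  rw [e, ← ha.inner_left_eq_inner_right]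
  exact (ContinuousLinearMap.isPositive_iff_complex a).1 ha (J v)

lemma polarForm_nonneg (h : IsTomita M ψ Φ J) {a b : H →L[ℂ] H} (ha : a ∈ M) (hb : b ∈ M)
    (hap : a.IsPositive) (hbp : b.IsPositive) : 0 ≤ polarForm J ψ a b := by
  obtain ⟨y, hy, hys, hyy⟩ := exists_sq_eq_of_isPositive ha hap
  have hc : y * jConj J b = jConj J b * y := commute_of_mem M hy (h.jConj_mem_commutant hb)
  have e : ⟪a ψ, J (b ψ)⟫_ℂ = ⟪y ψ, jConj J b (y ψ)⟫_ℂ := by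
    have h1 : J (b ψ) = jConj J b ψ := by rw [jConj_apply, h.J_vec]
    rw [h1, ← hyy, mul_apply_eq_comp, ← mul_apply_eq_comp (jConj J b) y, ← hc, mul_apply_eq_comp,
      ← IsModular.inner_star_apply', hys]
  rw [polarForm, e]
  exact (h.isPositive_jConj hbp).re_inner_nonneg_right _

lemma norm_J_sub_sq (h : IsTomita M ψ Φ J) (a : H →L[ℂ] H) :
    ‖J (a ψ) - a ψ‖ ^ 2 = 2 * ‖a ψ‖ ^ 2 - 2 * polarForm J ψ a a := by
  rw [@norm_sub_sq ℂ, h.norm_J, polarForm, ← inner_conj_symm]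
  have e : RCLike.re ((starRingEnd ℂ) ⟪a ψ, J (a ψ)⟫_ℂ) = (⟪a ψ, J (a ψ)⟫_ℂ).re := conj_re _
  rw [e]
  ring

/-- Two POVMs that are correlated under the self-polar form are self-correlated. -/
lemma one_sub_le_of_polarForm (h : IsTomita M ψ Φ J) (hψ : ‖ψ‖ = 1) {α : Type*} [Fintype α]
    {E F : α → H →L[ℂ] H} (hE : IsPOVM M E) (hF : IsPOVM M F) :
    1 - ∑ a, polarForm J ψ (E a) (E a) ≤ 2 * (1 - ∑ a, polarForm J ψ (E a) (F a)) := by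
  have h1 : 0 ≤ ∑ a, polarForm J ψ (E a - F a) (E a - F a) := Finset.sum_nonneg fun a _ =>
    h.polarForm_self_nonneg (sub_mem (hE.mem a) (hF.mem a)) (by
      rw [star_sub, star_eq_of_isPositive (hE.isPositive a),
        star_eq_of_isPositive (hF.isPositive a)])
  simp only [h.polarForm_sub_self] at h1
  rw [Finset.sum_sub_distrib, Finset.sum_add_distrib, ← Finset.mul_sum] at h1
  have h2 : 0 ≤ ∑ a, ‖J (F a ψ) - F a ψ‖ ^ 2 := Finset.sum_nonneg fun a _ => sq_nonneg _
  simp only [h.norm_J_sub_sq] at h2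
  rw [Finset.sum_sub_distrib, ← Finset.mul_sum, ← Finset.mul_sum] at h2
  linarith [sum_norm_sq_le hψ hF]

lemma sum_polarForm_self_le (h : IsTomita M ψ Φ J) (hψ : ‖ψ‖ = 1) {α : Type*} [Fintype α]
    {E : α → H →L[ℂ] H} (hE : IsPOVM M E) : ∑ a, polarForm J ψ (E a) (E a) ≤ 1 := by
  have h2 : 0 ≤ ∑ a, ‖J (E a ψ) - E a ψ‖ ^ 2 := Finset.sum_nonneg fun a _ => sq_nonneg _
  simp only [h.norm_J_sub_sq] at h2
  rw [Finset.sum_sub_distrib, ← Finset.mul_sum, ← Finset.mul_sum] at h2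
  linarith [sum_norm_sq_le hψ hE]

lemma sum_norm_J_sub_sq_le (h : IsTomita M ψ Φ J) (hψ : ‖ψ‖ = 1) {α : Type*} [Fintype α]
    {E : α → H →L[ℂ] H} (hE : IsPOVM M E) :
    ∑ a, ‖J (E a ψ) - E a ψ‖ ^ 2 ≤ 2 * (1 - ∑ a, polarForm J ψ (E a) (E a)) := by
  simp only [h.norm_J_sub_sq]
  rw [Finset.sum_sub_distrib, ← Finset.mul_sum, ← Finset.mul_sum]
  linarith [sum_norm_sq_le hψ hE]

/-- Replacing `J` by a nearby map `T` changes the correlation of two POVMs by little. -/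
lemma sum_re_inner_ge (h : IsTomita M ψ Φ J) (hψ : ‖ψ‖ = 1) {α : Type*} [Fintype α]
    {E F : α → H →L[ℂ] H} (hE : IsPOVM M E) (hF : IsPOVM M F) {T : H → H} {η : ℝ}
    (hT : ∀ a, ‖J (F a ψ) - T (F a ψ)‖ ≤ ‖J (F a ψ) - F a ψ‖ + 2 * η * ‖F a ψ‖) :
    ∑ a, polarForm J ψ (E a) (F a) -
      √(4 * (1 - ∑ a, polarForm J ψ (F a) (F a)) + 8 * η ^ 2) ≤
      ∑ a, (⟪E a ψ, T (F a ψ)⟫_ℂ).re := by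
  have h1 : ∑ a, ‖J (F a ψ) - T (F a ψ)‖ ^ 2 ≤
      4 * (1 - ∑ a, polarForm J ψ (F a) (F a)) + 8 * η ^ 2 := by
    have h2 : ∑ a, ‖J (F a ψ) - T (F a ψ)‖ ^ 2 ≤
        2 * ∑ a, ‖J (F a ψ) - F a ψ‖ ^ 2 + 8 * η ^ 2 * ∑ a, ‖F a ψ‖ ^ 2 := by
      rw [Finset.mul_sum, Finset.mul_sum, ← Finset.sum_add_distrib]
      refine Finset.sum_le_sum fun a _ => ?_
      have := pow_le_pow_left₀ (norm_nonneg _) (hT a) 2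
      nlinarith [sq_nonneg (‖J (F a ψ) - F a ψ‖ - 2 * η * ‖F a ψ‖)]
    have h3 := h.sum_norm_J_sub_sq_le hψ hF
    have h4 := mul_le_mul_of_nonneg_left (sum_norm_sq_le hψ hF) (show (0 : ℝ) ≤ 8 * η ^ 2 by
      positivity)
    linarith
  have h5 : ∑ a, polarForm J ψ (E a) (F a) - ∑ a, (⟪E a ψ, T (F a ψ)⟫_ℂ).re ≤
      ∑ a, ‖E a ψ‖ * ‖J (F a ψ) - T (F a ψ)‖ := by
    rw [← Finset.sum_sub_distrib]
    refine Finset.sum_le_sum fun a _ => ?_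
    rw [polarForm, ← sub_re, ← inner_sub_right]
    exact (re_le_norm _).trans (norm_inner_le_norm _ _)
  have h6 : ∑ a, ‖E a ψ‖ * ‖J (F a ψ) - T (F a ψ)‖ ≤
      √(4 * (1 - ∑ a, polarForm J ψ (F a) (F a)) + 8 * η ^ 2) := by
    refine (Real.sum_mul_le_sqrt_mul_sqrt _ _ _).trans ?_
    have := Real.sqrt_le_one.2 (sum_norm_sq_le hψ hE)
    exact (mul_le_of_le_one_left (Real.sqrt_nonneg _) this).trans (Real.sqrt_le_sqrt h1)
  linarith

lemma sum_polarForm_marginal {α β : Type*} [Fintype α] [Fintype β]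
    [DecidableEq β] (g : α → β) (E : α → H →L[ℂ] H) (F : β → H →L[ℂ] H) :
    ∑ b, polarForm J ψ (marginal g E b) (F b) = ∑ a, polarForm J ψ (E a) (F (g a)) := by
  simp only [marginal, polarForm_sum_left]
  rw [Finset.sum_comm]
  refine Finset.sum_congr rfl fun a _ => ?_
  rw [Finset.sum_eq_single (g a) (fun b _ hb => by rw [if_neg hb.symm, polarForm_zero_left])
    (by simp), if_pos rfl]

/-- Union bound: if functions `g x` jointly separate points,
the self-correlation defect of a POVM is
at most the sum of the defects of its marginals. -/
lemma one_sub_le_sum_marginal (h : IsTomita M ψ Φ J) (hψ : ‖ψ‖ = 1) {α β ι : Type*} [Fintype α]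
    [Fintype β] [DecidableEq β] (s : Finset ι) (g : ι → α → β)
    (hg : ∀ a a', a ≠ a' → ∃ i ∈ s, g i a ≠ g i a') {E : α → H →L[ℂ] H} (hE : IsPOVM M E) :
    1 - ∑ a, polarForm J ψ (E a) (E a) ≤
      ∑ i ∈ s, (1 - ∑ b, polarForm J ψ (marginal (g i) E b) (marginal (g i) E b)) := by
  classical
  set p : α → α → ℝ := fun a a' => polarForm J ψ (E a) (E a') with hp
  have hp0 : ∀ a a', 0 ≤ p a a' := fun a a' =>
    h.polarForm_nonneg (hE.mem a) (hE.mem a') (hE.isPositive a) (hE.isPositive a')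
  have hsum : ∑ a, ∑ a', p a a' = 1 := by
    simp only [hp, ← polarForm_sum_right, ← polarForm_sum_left]
    rw [hE.sum_eq_one, polarForm, one_apply_eq_self, h.J_vec, inner_self_eq_norm_sq_to_K, hψ]
    simp
  have h1 : 1 - ∑ a, polarForm J ψ (E a) (E a) = ∑ a, ∑ a', if a = a' then 0 else p a a' := by
    rw [← hsum, ← Finset.sum_sub_distrib]
    refine Finset.sum_congr rfl fun a _ => ?_
    rw [← Finset.add_sum_erase _ _ (Finset.mem_univ a), add_sub_cancel_left,
      ← Finset.add_sum_erase Finset.univ _ (Finset.mem_univ a), if_pos rfl, zero_add]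
    exact Finset.sum_congr rfl fun a' ha' => (if_neg (Finset.ne_of_mem_erase ha').symm).symm
  have h2 : ∀ i, 1 - ∑ b, polarForm J ψ (marginal (g i) E b) (marginal (g i) E b) =
      ∑ a, ∑ a', if g i a = g i a' then 0 else p a a' := fun i => by
    rw [sum_polarForm_marginal, ← hsum, ← Finset.sum_sub_distrib]
    refine Finset.sum_congr rfl fun a _ => ?_
    rw [marginal, polarForm_sum_right, ← Finset.sum_sub_distrib]
    refine Finset.sum_congr rfl fun a' _ => ?_
    rcases eq_or_ne (g i a) (g i a') with e | e
    · rw [if_pos e, if_pos e.symm, sub_self]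
    · rw [if_neg e, if_neg e.symm, polarForm_zero_right, sub_zero]
  rw [h1]
  simp only [h2]
  rw [Finset.sum_comm (s := s)]
  refine Finset.sum_le_sum fun a _ => ?_
  rw [Finset.sum_comm (s := s)]
  refine Finset.sum_le_sum fun a' _ => ?_
  have hnn : ∀ i ∈ s, 0 ≤ if g i a = g i a' then 0 else p a a' := fun i _ => by
    split_ifs
    · exact le_rfl
    · exact hp0 _ _
  split_ifs with e
  · exact Finset.sum_nonneg hnn
  · obtain ⟨i, his, hi⟩ := hg a a' e
    refine le_trans (le_of_eq ?_) (Finset.single_le_sum hnn his)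
    rw [if_neg hi]

/-- The conjugate of a POVM in the commutant is a POVM in `M`. -/
lemma isPOVM_jConj (h : IsTomita M ψ Φ J) {α : Type*} [Fintype α] {Q : α → H →L[ℂ] H}
    (hQ : IsPOVM M.commutant Q) : IsPOVM M (fun a => jConj J (Q a)) := by
  refine ⟨fun a => h.jConj_mem (hQ.mem a), fun a => h.isPositive_jConj (hQ.isPositive a), ?_⟩
  ext v
  rw [sum_apply]
  simp only [jConj_apply]
  rw [← map_sum, ← sum_apply, hQ.sum_eq_one, one_apply_eq_self, h.J_J, one_apply_eq_self]

lemma polarForm_jConj (h : IsTomita M ψ Φ J) (a b : H →L[ℂ] H) :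
    polarForm J ψ a (jConj J b) = (⟪a ψ, b ψ⟫_ℂ).re := by
  rw [polarForm, jConj_apply, h.J_vec, h.J_J]

end IsTomita

end SelfPolar

end CSGame

namespace CSGame

open Complex Filter Topology
open scoped InnerProductSpace BoundedContinuousFunction ComplexOrder


section Rounding

universe u

/-- A projection valued measure in `N`. -/
structure IsPVM {K : Type*} [NormedAddCommGroup K] [InnerProductSpace ℂ K] [CompleteSpace K]
    {α : Type*} [Fintype α] (N : VonNeumannAlgebra K) (r : α → K →L[ℂ] K) : Prop where
  mem : ∀ a, r a ∈ N
  star_eq : ∀ a, star (r a) = r a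
  mul_self : ∀ a, r a * r a = r a
  sum_eq_one : ∑ a, r a = 1

lemma exists_isPVM {K : Type*} [NormedAddCommGroup K] [InnerProductSpace ℂ K] [CompleteSpace K]
    (N : VonNeumannAlgebra K) (α : Type*) [Fintype α] [Nonempty α] :
    ∃ r : α → K →L[ℂ] K, IsPVM N r := by
  classical
  obtain ⟨a₀⟩ := ‹Nonempty α›
  refine ⟨fun a => if a = a₀ then 1 else 0, fun a => ?_, fun a => ?_, fun a => ?_, ?_⟩
  · split_ifs
    · exact one_mem N
    · exact zero_mem N
  · split_ifs <;> simp
  · split_ifs <;> simp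
  · simp

lemma IsTrace.exists_isPVM {K : Type*} [NormedAddCommGroup K] [InnerProductSpace ℂ K]
    [CompleteSpace K] {N : VonNeumannAlgebra K} {ξ : K} (h : IsTrace N ξ) {α : Type*} [Fintype α]
    [Nonempty α] {A : α → K →L[ℂ] K} (hA : IsPOVM N A) : ∃ r : α → K →L[ℂ] K, IsPVM N r ∧
      1 - 14 * (1 - ∑ a, tr ξ (A a * A a)) ≤ ∑ a, tr ξ (r a * A a) := by
  obtain ⟨r, h1, h2, h3, h4, h5⟩ := h.exists_pvm A hA.mem hA.isPositive hA.sum_eq_one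
  exact ⟨r, ⟨h1, h2, h3, h4⟩, h5⟩

variable {H : Type u} [NormedAddCommGroup H] [InnerProductSpace ℂ H] [CompleteSpace H]
  {M : VonNeumannAlgebra H} {ψ : H} {Φ : (ℝ →ᵇ ℂ) →⋆ₐ[ℂ] (H →L[ℂ] H)}
  {J : H →SL[starRingEnd ℂ] H}

lemma sum_re_inner_marginal {α β : Type*} [Fintype α] [Fintype β] [DecidableEq β] (g : α → β)
    (E : α → H →L[ℂ] H) (v : β → H) (ψ : H) :
    ∑ b, (⟪marginal g E b ψ, v b⟫_ℂ).re = ∑ a, (⟪E a ψ, v (g a)⟫_ℂ).re := by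
  simp only [marginal, sum_apply, sum_inner, re_sum]
  rw [Finset.sum_comm]
  refine Finset.sum_congr rfl fun a _ => ?_
  rw [Finset.sum_eq_single (g a) (fun b _ hb => by
    rw [if_neg hb.symm, zero_apply, inner_zero_left, zero_re]) (by simp), if_pos rfl]

lemma IsTomita.J_apply_eq_of_sum_polarForm (h : IsTomita M ψ Φ J) (hψ : ‖ψ‖ = 1) {α : Type*}
    [Fintype α] {F : α → H →L[ℂ] H} (hF : IsPOVM M F)
    (h0 : 1 - ∑ a, polarForm J ψ (F a) (F a) ≤ 0) (a : α) : J (F a ψ) = F a ψ := by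
  have h1 := h.sum_norm_J_sub_sq_le hψ hF
  have h2 := Finset.single_le_sum (f := fun a => ‖J (F a ψ) - F a ψ‖ ^ 2)
    (fun a _ => sq_nonneg _) (Finset.mem_univ a)
  have h3 : ‖J (F a ψ) - F a ψ‖ ^ 2 ≤ 0 := by linarith
  exact sub_eq_zero.1 (norm_eq_zero.1 (pow_eq_zero_iff two_ne_zero |>.1
    (le_antisymm h3 (sq_nonneg _))))

/-- Rounding of a commuting strategy for a constraint-variable game, in standard form, to a tracial
strategy. Here `e i` is the total losing probability over the variables of the constraint `i`. -/
theorem IsTomita.exists_tracial_strategy (h : IsTomita M ψ Φ J) (hψ : ‖ψ‖ = 1)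
    {I X Sig : Type*} [Fintype Sig] [Nonempty Sig] {α : I → Type*} [∀ i, Fintype (α i)]
    [∀ i, Nonempty (α i)] (Vs : I → Finset X) (g : ∀ i, X → α i → Sig)
    (hg : ∀ i a a', a ≠ a' → ∃ x ∈ Vs i, g i x a ≠ g i x a')
    {P : ∀ i, α i → H →L[ℂ] H} {Q : X → Sig → H →L[ℂ] H} (hP : ∀ i, IsPOVM M (P i))
    (hQ : ∀ x, IsPOVM M.commutant (Q x)) {e : I → ℝ}
    (he : ∀ i, e i = ∑ x ∈ Vs i, (1 - ∑ a, (⟪P i a ψ, Q x (g i x a) ψ⟫_ℂ).re))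
    {η : ℝ} (hη : 0 ≤ η) (hη0 : η = 0 → ∀ i, e i = 0) :
    ∃ (K : Type u) (_ : NormedAddCommGroup K) (_ : InnerProductSpace ℂ K) (_ : CompleteSpace K)
      (ξ : K) (N : VonNeumannAlgebra K) (r : ∀ i, α i → K →L[ℂ] K) (s : X → Sig → K →L[ℂ] K),
      IsTrace N ξ ∧ (∀ i, IsPVM N (r i)) ∧ (∀ x, IsPVM N (s x)) ∧
      ∀ i, 0 ≤ e i ∧ ∀ x ∈ Vs i, 1 - (171 * e i + 87 * √(8 * e i + 8 * η ^ 2)) ≤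
        ∑ a, tr ξ (r i a * s x (g i x a)) := by
  classical
  set B : X → Sig → H →L[ℂ] H := fun x σ => jConj J (Q x σ) with hBdef
  have hB : ∀ x, IsPOVM M (B x) := fun x => h.isPOVM_jConj (hQ x)
  set d : I → X → ℝ := fun i x => 1 - ∑ a, (⟪P i a ψ, Q x (g i x a) ψ⟫_ℂ).re with hd
  have hE : ∀ i x, IsPOVM M (marginal (g i x) (P i)) := fun i x => (hP i).marginal (g i x)
  have hd' : ∀ i x, 1 - ∑ σ, polarForm J ψ (marginal (g i x) (P i) σ) (B x σ) = d i x := by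
    intro i x
    rw [IsTomita.sum_polarForm_marginal]
    simp only [hBdef, h.polarForm_jConj, hd]
  have hβE : ∀ i x, 1 - ∑ σ, polarForm J ψ (marginal (g i x) (P i) σ) (marginal (g i x) (P i) σ) ≤
      2 * d i x := fun i x => by
    rw [← hd']
    exact h.one_sub_le_of_polarForm hψ (hE i x) (hB x)
  have hd0 : ∀ i x, 0 ≤ d i x := fun i x => by
    linarith [hβE i x, h.sum_polarForm_self_le hψ (hE i x)]
  have hβB : ∀ i x, 1 - ∑ σ, polarForm J ψ (B x σ) (B x σ) ≤ 2 * d i x := fun i x => by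
    rw [← hd', Finset.sum_congr rfl fun σ _ => h.polarForm_comm (marginal (g i x) (P i) σ) (B x σ)]
    exact h.one_sub_le_of_polarForm hψ (hB x) (hE i x)
  have hβP : ∀ i, 1 - ∑ a, polarForm J ψ (P i a) (P i a) ≤ 2 * e i := fun i => by
    refine (h.one_sub_le_sum_marginal hψ (Vs i) (g i) (hg i) (hP i)).trans ?_
    rw [he, Finset.mul_sum]
    exact Finset.sum_le_sum fun x _ => hβE i x
  have hde : ∀ i, ∀ x ∈ Vs i, d i x ≤ e i := fun i x hx => by
    rw [he]
    exact Finset.single_le_sum (f := d i) (fun x _ => hd0 i x) hx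
  have he0 : ∀ i, 0 ≤ e i := fun i => by
    rw [he]
    exact Finset.sum_nonneg fun x _ => hd0 i x
  obtain ⟨S, T, K, i1, i2, i3, ξ, N, θ, hsS, hmod, hT⟩ := h.exists_isTracialModel_close hψ
    (s := {T | ∃ i a, T = P i a} ∪ {T | ∃ x σ, (∃ i, x ∈ Vs i) ∧ T = B x σ}) (by
      rintro _ (⟨i, a, rfl⟩ | ⟨x, σ, -, rfl⟩)
      · exact ⟨(hP i).mem a, star_eq_of_isPositive ((hP i).isPositive a)⟩
      · exact ⟨(hB x).mem σ, star_eq_of_isPositive ((hB x).isPositive σ)⟩) hη (by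
      rintro h0 _ (⟨i, a, rfl⟩ | ⟨x, σ, ⟨i, hx⟩, rfl⟩)
      · refine h.J_apply_eq_of_sum_polarForm hψ (hP i) ?_ a
        linarith [hβP i, hη0 h0 i]
      · refine h.J_apply_eq_of_sum_polarForm hψ (hB x) ?_ σ
        linarith [hβB i x, hde i x hx, hη0 h0 i])
  have hPS : ∀ i a, P i a ∈ S := fun i a => hsS (Or.inl ⟨i, a, rfl⟩)
  have hBS : ∀ i, ∀ x ∈ Vs i, ∀ σ, B x σ ∈ S := fun i x hx σ => hsS (Or.inr ⟨x, σ, ⟨i, hx⟩, rfl⟩)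
  have ht := hmod.isTrace
  set a₀ : ∀ i, α i := fun i => Classical.arbitrary _
  set σ₀ : Sig := Classical.arbitrary _
  have hA' : ∀ i, IsPOVM N (completion θ (a₀ i) (P i)) := fun i =>
    hmod.isPOVM_completion _ (hPS i) (hP i).isPositive (hP i).sum_eq_one
  have hB' : ∀ i, ∀ x ∈ Vs i, IsPOVM N (completion θ σ₀ (B x)) := fun i x hx =>
    hmod.isPOVM_completion _ (hBS i x hx) (hB x).isPositive (hB x).sum_eq_one
  choose r hr hrA using fun i => ht.exists_isPVM (hA' i)
  have hs : ∀ x, ∃ s : Sig → K →L[ℂ] K, IsPVM N s ∧ ((∃ i, x ∈ Vs i) →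
      1 - 14 * (1 - ∑ σ, tr ξ (completion θ σ₀ (B x) σ * completion θ σ₀ (B x) σ)) ≤
        ∑ σ, tr ξ (s σ * completion θ σ₀ (B x) σ)) := fun x => by
    by_cases hx : ∃ i, x ∈ Vs i
    · obtain ⟨i, hi⟩ := hx
      obtain ⟨s, h1, h2⟩ := ht.exists_isPVM (hB' i x hi)
      exact ⟨s, h1, fun _ => h2⟩
    · obtain ⟨s, h1⟩ := CSGame.exists_isPVM N Sig
      exact ⟨s, h1, fun h => absurd h hx⟩
  choose s hs hsB using hs
  refine ⟨K, i1, i2, i3, ξ, N, r, s, ht, hr, hs, fun i => ⟨he0 i, fun x hx => ?_⟩⟩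
  have hmain := ht.sum_tr_pvm_ge (g i x) (hA' i) (hB' i x hx) (hr i).mem (hr i).star_eq
    (hr i).mul_self (hr i).sum_eq_one (hs x).mem (hs x).star_eq (hs x).mul_self (hs x).sum_eq_one
  have hTB : ∀ σ, ‖J (B x σ ψ) - T (B x σ ψ)‖ ≤
      ‖J (B x σ ψ) - B x σ ψ‖ + 2 * η * ‖B x σ ψ‖ := fun σ =>
    hT _ (Or.inr ⟨x, σ, ⟨i, hx⟩, rfl⟩)
  have hsq : ∀ t, t ≤ 2 * e i → √(4 * t + 8 * η ^ 2) ≤ √(8 * e i + 8 * η ^ 2) := fun t ht =>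
    Real.sqrt_le_sqrt (by linarith)
  have ha : 1 - ∑ a, tr ξ (completion θ (a₀ i) (P i) a * completion θ (a₀ i) (P i) a) ≤
      2 * e i + √(8 * e i + 8 * η ^ 2) := by
    have h1 : ∑ a, (⟪P i a ψ, T (P i a ψ)⟫_ℂ).re ≤
        ∑ a, tr ξ (completion θ (a₀ i) (P i) a * completion θ (a₀ i) (P i) a) :=
      Finset.sum_le_sum fun a _ => hmod.le_tr_completion _ _ (hPS i a) (hPS i a)
        ((hP i).isPositive a) ((hP i).isPositive a)
    have h2 := h.sum_re_inner_ge hψ (hP i) (hP i) (fun a => hT _ (Or.inl ⟨i, a, rfl⟩))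
    linarith [hβP i, hsq _ (hβP i)]
  have hBe : 1 - ∑ σ, polarForm J ψ (B x σ) (B x σ) ≤ 2 * e i := by
    linarith [hβB i x, hde i x hx]
  have hb : 1 - ∑ σ, tr ξ (completion θ σ₀ (B x) σ * completion θ σ₀ (B x) σ) ≤
      2 * e i + √(8 * e i + 8 * η ^ 2) := by
    have h1 : ∑ σ, (⟪B x σ ψ, T (B x σ ψ)⟫_ℂ).re ≤
        ∑ σ, tr ξ (completion θ σ₀ (B x) σ * completion θ σ₀ (B x) σ) :=
      Finset.sum_le_sum fun σ _ => hmod.le_tr_completion _ _ (hBS i x hx σ) (hBS i x hx σ)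
        ((hB x).isPositive σ) ((hB x).isPositive σ)
    have h2 := h.sum_re_inner_ge hψ (hB x) (hB x) hTB
    linarith [hsq _ hBe]
  have hab : 1 - ∑ a, tr ξ (completion θ (a₀ i) (P i) a * completion θ σ₀ (B x) (g i x a)) ≤
      e i + √(8 * e i + 8 * η ^ 2) := by
    have h1 : ∑ a, (⟪P i a ψ, T (B x (g i x a) ψ)⟫_ℂ).re ≤
        ∑ a, tr ξ (completion θ (a₀ i) (P i) a * completion θ σ₀ (B x) (g i x a)) :=
      Finset.sum_le_sum fun a _ => hmod.le_tr_completion _ _ (hPS i a) (hBS i x hx _)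
        ((hP i).isPositive a) ((hB x).isPositive _)
    rw [← sum_re_inner_marginal (g i x) (P i) (fun σ => T (B x σ ψ)) ψ] at h1
    have h2 := h.sum_re_inner_ge hψ (hE i x) (hB x) hTB
    linarith [hsq _ hBe, hd' i x, hde i x hx]
  linarith [hrA i, hsB x ⟨i, hx⟩]

end Rounding

end CSGame

namespace CSGame

open Complex Filter Topology
open scoped InnerProductSpace BoundedContinuousFunction ComplexOrder


section Compression

universe u

variable {H : Type u} [NormedAddCommGroup H] [InnerProductSpace ℂ H] [CompleteSpace H]

/-- The compression of an operator to a closed subspace. -/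
noncomputable def compress (U : Submodule ℂ H) [U.HasOrthogonalProjection] (b : H →L[ℂ] H) :
    U →L[ℂ] U :=
  U.orthogonalProjectionOnto.comp (b.comp U.subtypeL)

section

variable (U : Submodule ℂ H) [U.HasOrthogonalProjection]

lemma inner_compress_right (b : H →L[ℂ] H) (v w : U) : ⟪v, compress U b w⟫_ℂ = ⟪(v : H), b w⟫_ℂ :=
  U.inner_orthogonalProjectionOnto_eq_of_mem_left v _

lemma coe_compress (b : H →L[ℂ] H) (v : U) : (compress U b v : H) = U.starProjection (b v) := rfl

lemma compress_one : compress U 1 = 1 := by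
  ext v
  exact Submodule.starProjection_eq_self_iff.2 v.2

lemma compress_sum {ι : Type*} (s : Finset ι) (b : ι → H →L[ℂ] H) :
    compress U (∑ i ∈ s, b i) = ∑ i ∈ s, compress U (b i) := by
  ext v
  rw [coe_compress, sum_apply, map_sum, sum_apply, AddSubmonoidClass.coe_finsetSum]
  rfl

lemma isPositive_compress [CompleteSpace U] {b : H →L[ℂ] H} (hb : b.IsPositive) :
    (compress U b).IsPositive := by
  rw [ContinuousLinearMap.isPositive_iff_complex]
  intro v
  have e : ⟪compress U b v, v⟫_ℂ = ⟪b v, (v : H)⟫_ℂ :=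
    U.inner_orthogonalProjectionOnto_eq_of_mem_right v _
  rw [e]
  exact (ContinuousLinearMap.isPositive_iff_complex b).1 hb v

lemma star_compress [CompleteSpace U] (b : H →L[ℂ] H) :
    star (compress U b) = compress U (star b) := by
  refine ContinuousLinearMap.ext fun w => ext_inner_left ℂ fun v => ?_
  rw [IsModular.inner_star_apply', inner_compress_right, IsModular.inner_star_apply']
  exact U.inner_orthogonalProjectionOnto_eq_of_mem_right w _

end

/-- The closure of the orbit `M ψ`. -/
noncomputable def cyclicSubspace (M : VonNeumannAlgebra H) (ψ : H) : Submodule ℂ H :=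
  Submodule.topologicalClosure
    { carrier := {x | ∃ a ∈ M, a ψ = x}
      add_mem' := by
        rintro _ _ ⟨a, ha, rfl⟩ ⟨b, hb, rfl⟩
        exact ⟨a + b, add_mem ha hb, rfl⟩
      zero_mem' := ⟨0, zero_mem M, rfl⟩
      smul_mem' := by
        rintro c _ ⟨a, ha, rfl⟩
        exact ⟨c • a, smul_mem_vN M ha c, rfl⟩ }

variable (M : VonNeumannAlgebra H) (ψ : H)

instance : CompleteSpace (cyclicSubspace M ψ) :=
  (Submodule.isClosed_topologicalClosure _).completeSpace_coe

lemma mem_cyclicSubspace_iff {v : H} :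
    v ∈ cyclicSubspace M ψ ↔ v ∈ closure {x | ∃ a ∈ M, a ψ = x} := by
  rw [← SetLike.mem_coe, cyclicSubspace, Submodule.topologicalClosure_coe]
  rfl

lemma apply_mem_cyclicSubspace {a : H →L[ℂ] H} (ha : a ∈ M) : a ψ ∈ cyclicSubspace M ψ :=
  (mem_cyclicSubspace_iff M ψ).2 (subset_closure ⟨a, ha, rfl⟩)

lemma map_cyclicSubspace {a : H →L[ℂ] H} (ha : a ∈ M) {v : H} (hv : v ∈ cyclicSubspace M ψ) :
    a v ∈ cyclicSubspace M ψ := by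
  rw [mem_cyclicSubspace_iff] at hv ⊢
  refine map_mem_closure a.continuous hv ?_
  rintro _ ⟨b, hb, rfl⟩
  exact ⟨a * b, mul_mem ha hb, rfl⟩

lemma starProjection_cyclicSubspace_mem : (cyclicSubspace M ψ).starProjection ∈ M.commutant :=
  starProjection_mem_of_invariant fun x hx v hv => by
    rw [VonNeumannAlgebra.commutant_commutant] at hx
    exact map_cyclicSubspace M ψ hx hv

lemma compress_commute {a b : H →L[ℂ] H} (ha : a ∈ M) (hb : b ∈ M.commutant) :
    compress (cyclicSubspace M ψ) a * compress (cyclicSubspace M ψ) b =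
      compress (cyclicSubspace M ψ) b * compress (cyclicSubspace M ψ) a := by
  have h1 : ∀ x, a ((cyclicSubspace M ψ).starProjection x) =
      (cyclicSubspace M ψ).starProjection (a x) := fun x =>
    DFunLike.congr_fun (commute_of_mem M ha (starProjection_cyclicSubspace_mem M ψ)) x
  have h2 : ∀ x, a (b x) = b (a x) := fun x => DFunLike.congr_fun (commute_of_mem M ha hb) x
  ext v
  rw [mul_apply_eq_comp, mul_apply_eq_comp, coe_compress, coe_compress, coe_compress,
    coe_compress, h1,
    h2, ← h1 v, Submodule.starProjection_eq_self_iff.2 v.2,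
    Submodule.starProjection_eq_self_iff.2 (Submodule.starProjection_apply_mem _ _)]

/-- Cutting down to the cyclic subspace of `M`. -/
theorem exists_compression (hψ : ‖ψ‖ = 1) : ∃ (K : Type u) (_ : NormedAddCommGroup K)
    (_ : InnerProductSpace ℂ K) (_ : CompleteSpace K) (ξ : K) (N : VonNeumannAlgebra K)
    (κ : (H →L[ℂ] H) → (K →L[ℂ] K)), ‖ξ‖ = 1 ∧ Dense {x | ∃ a ∈ N, a ξ = x} ∧
      (Dense {x | ∃ b ∈ M.commutant, b ψ = x} → Dense {x | ∃ b ∈ N.commutant, b ξ = x}) ∧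
      (∀ a ∈ M, κ a ∈ N) ∧ (∀ b ∈ M.commutant, κ b ∈ N.commutant) ∧
      (∀ b, b.IsPositive → (κ b).IsPositive) ∧ κ 1 = 1 ∧
      (∀ {ι : Type} (s : Finset ι) (b : ι → H →L[ℂ] H), κ (∑ i ∈ s, b i) = ∑ i ∈ s, κ (b i)) ∧
      ∀ a ∈ M, ∀ b, ⟪κ a ξ, κ b ξ⟫_ℂ = ⟪a ψ, b ψ⟫_ℂ := by
  set U := cyclicSubspace M ψ with hU
  have hψU : ψ ∈ U := apply_mem_cyclicSubspace M ψ (one_mem M)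
  have hNs : ∀ a ∈ compress U '' M.commutant, star a ∈ compress U '' M.commutant := by
    rintro _ ⟨b, hb, rfl⟩
    exact ⟨star b, star_mem (S := VonNeumannAlgebra H) hb, (star_compress U b).symm⟩
  have hM : ∀ a ∈ M, compress U a ∈ commutantVN _ hNs := fun a ha => by
    rw [mem_commutantVN]
    rintro _ ⟨b, hb, rfl⟩
    exact (compress_commute M ψ ha hb).symm
  have hM' : ∀ b ∈ M.commutant, compress U b ∈ (commutantVN _ hNs).commutant := fun b hb => by
    refine mem_of_commute _ fun x hx => ?_
    rw [VonNeumannAlgebra.commutant_commutant, mem_commutantVN] at hx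
    exact (hx _ ⟨b, hb, rfl⟩).symm
  have hMψ : ∀ a ∈ M, (compress U a ⟨ψ, hψU⟩ : H) = a ψ := fun a ha =>
    Submodule.starProjection_eq_self_iff.2 (apply_mem_cyclicSubspace M ψ ha)
  refine ⟨U, inferInstance, inferInstance, inferInstance, ⟨ψ, hψU⟩, commutantVN _ hNs, compress U,
    hψ, fun v => ?_, fun hd v => ?_, hM, hM', fun b hb => isPositive_compress U hb, compress_one U,
    compress_sum U, fun a ha b => ?_⟩
  · have hv := (mem_cyclicSubspace_iff M ψ).1 v.2
    rw [closure_subtype]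
    refine closure_mono ?_ hv
    rintro _ ⟨a, ha, rfl⟩
    exact ⟨compress U a ⟨ψ, hψU⟩, ⟨_, hM a ha, rfl⟩, hMψ a ha⟩
  · have h1 := map_mem_closure U.orthogonalProjectionOnto.continuous (hd v)
      (t := {x | ∃ b ∈ (commutantVN _ hNs).commutant, b ⟨ψ, hψU⟩ = x}) (by
        rintro _ ⟨b, hb, rfl⟩
        exact ⟨compress U b, hM' b hb, rfl⟩)
    rwa [U.orthogonalProjectionOnto_mem_subspace_eq_self] at h1
  · rw [inner_compress_right, hMψ a ha]

/-- Every commuting strategy can be put in standard form. -/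
theorem exists_standard_form (hψ : ‖ψ‖ = 1) {I X : Type*} {α : I → Type} {β : Type}
    [∀ i, Fintype (α i)] [Fintype β] {P : ∀ i, α i → H →L[ℂ] H} {Q : X → β → H →L[ℂ] H}
    (hP : ∀ i, IsPOVM M (P i)) (hQ : ∀ x, IsPOVM M.commutant (Q x)) :
    ∃ (K : Type u) (_ : NormedAddCommGroup K) (_ : InnerProductSpace ℂ K) (_ : CompleteSpace K)
      (ξ : K) (N : VonNeumannAlgebra K) (P' : ∀ i, α i → K →L[ℂ] K) (Q' : X → β → K →L[ℂ] K),
      ‖ξ‖ = 1 ∧ Dense {x | ∃ a ∈ N, a ξ = x} ∧ Dense {x | ∃ b ∈ N.commutant, b ξ = x} ∧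
      (∀ i, IsPOVM N (P' i)) ∧ (∀ x, IsPOVM N.commutant (Q' x)) ∧
      ∀ i x a b, ⟪P' i a ξ, Q' x b ξ⟫_ℂ = ⟪P i a ψ, Q x b ψ⟫_ℂ := by
  obtain ⟨K₁, _, _, _, ξ₁, N₁, κ₁, h1, hd1, -, hκ1, hκ1', hp1, ho1, hs1, hi1⟩ :=
    exists_compression M ψ hψ
  obtain ⟨K₂, _, _, _, ξ₂, N₂, κ₂, h2, hd2, hd2', hκ2, hκ2', hp2, ho2, hs2, hi2⟩ :=
    exists_compression N₁.commutant ξ₁ h1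
  rw [VonNeumannAlgebra.commutant_commutant] at hd2' hκ2'
  refine ⟨K₂, inferInstance, inferInstance, inferInstance, ξ₂, N₂.commutant,
    fun i a => κ₂ (κ₁ (P i a)), fun x b => κ₂ (κ₁ (Q x b)), h2, hd2' hd1, ?_, fun i => ?_,
      fun x => ?_,
    fun i x a b => ?_⟩
  · rwa [VonNeumannAlgebra.commutant_commutant]
  · refine ⟨fun a => hκ2' _ (hκ1 _ ((hP i).mem a)), fun a => hp2 _ (hp1 _ ((hP i).isPositive a)),
      ?_⟩
    rw [← hs2, ← hs1, (hP i).sum_eq_one, ho1, ho2]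
  · rw [VonNeumannAlgebra.commutant_commutant]
    refine ⟨fun a => hκ2 _ (hκ1' _ ((hQ x).mem a)), fun a => hp2 _ (hp1 _ ((hQ x).isPositive a)),
      ?_⟩
    rw [← hs2, ← hs1, (hQ x).sum_eq_one, ho1, ho2]
  · rw [← inner_conj_symm, hi2 _ (hκ1' _ ((hQ x).mem b)), inner_conj_symm, hi1 _ ((hP i).mem a)]

end Compression

end CSGame

namespace CSGame

open Complex Filter Topology
open scoped InnerProductSpace BoundedContinuousFunction


section Assembly

lemma sum_mul_one_sub_sqrt_ge {ι : Type*} [Fintype ι] {p e : ι → ℝ} (hp : ∀ i, 0 < p i)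
    (hp1 : ∑ i, p i = 1) (he : ∀ i, 0 ≤ e i) {t : ℝ} (ht : ∑ i, p i * e i ≤ t) :
    1 - (171 * t + 348 * √t) ≤ ∑ i, p i * (1 - (171 * e i + 87 * √(8 * e i + 8 * t))) := by
  have ht0 : 0 ≤ t := (Finset.sum_nonneg fun i _ => mul_nonneg (hp i).le (he i)).trans ht
  have h1 : ∑ i, p i * √(8 * e i + 8 * t) ≤ √(16 * t) := by
    refine (Real.strictConcaveOn_sqrt.concaveOn.le_map_sum (t := Finset.univ) (w := p)
      (p := fun i => 8 * e i + 8 * t) (fun i _ => (hp i).le) hp1 fun i _ => ?_).trans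
      (Real.sqrt_le_sqrt ?_)
    · have := he i
      simp only [Set.mem_Ici]; positivity
    · simp only [smul_eq_mul, mul_add, Finset.sum_add_distrib, ← Finset.sum_mul, hp1]
      have : ∑ i, p i * (8 * e i) = 8 * ∑ i, p i * e i := by
        rw [Finset.mul_sum]; exact Finset.sum_congr rfl fun i _ => by ring
      linarith
  have h2 : √(16 * t) = 4 * √t := by
    rw [Real.sqrt_mul (by norm_num), show (16 : ℝ) = 4 ^ 2 by norm_num, Real.sqrt_sq (by norm_num)]
  have h3 : ∑ i, p i * (1 - (171 * e i + 87 * √(8 * e i + 8 * t))) =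
      ∑ i, p i - 171 * ∑ i, p i * e i - 87 * ∑ i, p i * √(8 * e i + 8 * t) := by
    rw [Finset.mul_sum, Finset.mul_sum, ← Finset.sum_sub_distrib, ← Finset.sum_sub_distrib]
    exact Finset.sum_congr rfl fun i _ => by ring
  rw [h3, hp1]
  linarith

lemma one_sub_rpow_le {t w : ℝ} (ht : 0 ≤ t) (hw0 : 0 ≤ w) (hw : 1 - (171 * t + 348 * √t) ≤ w) :
    1 - 148 * t ^ ((1 : ℝ) / 4) ≤ w := by
  set s := t ^ ((1 : ℝ) / 4) with hs
  have hs0 : 0 ≤ s := Real.rpow_nonneg ht _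
  have h4 : s ^ 4 = t := by
    rw [hs, ← Real.rpow_natCast, ← Real.rpow_mul ht]; norm_num
  have h2 : √t = s ^ 2 := by
    rw [← h4, show s ^ 4 = (s ^ 2) ^ 2 by ring, Real.sqrt_sq (sq_nonneg s)]
  rcases le_total 1 (148 * s) with h | h
  · linarith
  · rw [h2, ← h4] at hw
    nlinarith [mul_nonneg hs0 hs0, mul_nonneg hs0 (sub_nonneg.2 h),
      mul_nonneg (mul_nonneg hs0 hs0) (mul_nonneg hs0 (sub_nonneg.2 h)),
      mul_nonneg (mul_nonneg hs0 hs0) (sub_nonneg.2 h)]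

/-- Rounding of a commuting operator strategy to a tracial strategy. Here `e i` is the total losing
probability over the variables of the constraint `i`. -/
theorem exists_tracial_strategy {H : Type} [NormedAddCommGroup H] [InnerProductSpace ℂ H]
    [CompleteSpace H] {I X Sig : Type} [Fintype Sig] [Nonempty Sig] {α : I → Type}
    [∀ i, Fintype (α i)] [∀ i, Nonempty (α i)] (Vs : I → Finset X) (g : ∀ i, X → α i → Sig)
    (hg : ∀ i a a', a ≠ a' → ∃ x ∈ Vs i, g i x a ≠ g i x a')
    {P : ∀ i, α i → H →L[ℂ] H} {Q : X → Sig → H →L[ℂ] H}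
    (hP : ∀ i a, (P i a).IsPositive) (hPsum : ∀ i, ∑ a, P i a = 1)
    (hQ : ∀ x σ, (Q x σ).IsPositive) (hQsum : ∀ x, ∑ σ, Q x σ = 1)
    (hcomm : ∀ i x a σ, P i a * Q x σ = Q x σ * P i a) {ψ : H} (hψ : ‖ψ‖ = 1) {e : I → ℝ}
    (he : ∀ i, e i = ∑ x ∈ Vs i, (1 - ∑ a, (⟪ψ, (P i a * Q x (g i x a)) ψ⟫_ℂ).re)) :
    (∀ i, 0 ≤ e i) ∧ ∀ η : ℝ, 0 ≤ η → (η = 0 → ∀ i, e i = 0) →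
    ∃ (K : Type) (_ : NormedAddCommGroup K) (_ : InnerProductSpace ℂ K) (_ : CompleteSpace K)
      (ξ : K) (N : VonNeumannAlgebra K) (r : ∀ i, α i → K →L[ℂ] K) (s : X → Sig → K →L[ℂ] K),
      IsTrace N ξ ∧ (∀ i, IsPVM N (r i)) ∧ (∀ x, IsPVM N (s x)) ∧
      ∀ i, ∀ x ∈ Vs i, 1 - (171 * e i + 87 * √(8 * e i + 8 * η ^ 2)) ≤
        ∑ a, tr ξ (r i a * s x (g i x a)) := by
  set M := commutantVN {T | ∃ x σ, T = Q x σ} (by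
    rintro _ ⟨x, σ, rfl⟩
    exact ⟨x, σ, star_eq_of_isPositive (hQ x σ)⟩) with hM
  have hPM : ∀ i, IsPOVM M (P i) := fun i => by
    refine ⟨fun a => ?_, hP i, hPsum i⟩
    rw [hM, mem_commutantVN]
    rintro _ ⟨x, σ, rfl⟩
    exact (hcomm i x a σ).symm
  have hQM : ∀ x, IsPOVM M.commutant (Q x) := fun x => by
    refine ⟨fun σ => ?_, hQ x, hQsum x⟩
    rw [VonNeumannAlgebra.mem_commutant_iff]
    intro a ha
    rw [hM, mem_commutantVN] at ha
    exact (ha _ ⟨x, σ, rfl⟩).symm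
  obtain ⟨K, _, _, _, ξ, N, P', Q', h1, hd, hd', hP', hQ', hi⟩ :=
    exists_standard_form M ψ hψ hPM hQM
  obtain ⟨R, D, hRD⟩ := exists_isModular h1 hd hd'
  obtain ⟨Φ, J, hT⟩ := hRD.exists_isTomita
  have he' : ∀ i, e i = ∑ x ∈ Vs i, (1 - ∑ a, (⟪P' i a ξ, Q' x (g i x a) ξ⟫_ℂ).re) := by
    intro i
    rw [he i]
    refine Finset.sum_congr rfl fun x _ => ?_
    congr 1
    refine Finset.sum_congr rfl fun a _ => ?_
    rw [hi, mul_apply_eq_comp, ← (hP i a).isSymmetric.apply_clm]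
  have key := fun η => hT.exists_tracial_strategy h1 Vs g hg hP' hQ' he' (η := η)
  obtain ⟨_, _, _, _, _, _, _, _, _, _, _, h0⟩ := key 1 zero_le_one fun h => absurd h one_ne_zero
  refine ⟨fun i => (h0 i).1, fun η hη hη0 => ?_⟩
  obtain ⟨L, i₁, i₂, i₃, ζ, N', r, s, ht, hr, hs, hrs⟩ := key η hη hη0
  exact ⟨L, i₁, i₂, i₃, ζ, N', r, s, ht, hr, hs, fun i => (hrs i).2⟩

lemma IsTrace.ofReal_tr_mul {K : Type*} [NormedAddCommGroup K] [InnerProductSpace ℂ K]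
    [CompleteSpace K] {N : VonNeumannAlgebra K} {ξ : K} (h : IsTrace N ξ) {u v : K →L[ℂ] K}
    (hu : u ∈ N) (hv : v ∈ N) (hus : star u = u) (hvs : star v = v) :
    ((tr ξ (u * v) : ℝ) : ℂ) = ⟪ξ, (u * v) ξ⟫_ℂ := by
  rw [tr]
  refine conj_eq_iff_re.1 ?_
  rw [inner_conj_symm, ← ContinuousLinearMap.adjoint_inner_right,
    ← ContinuousLinearMap.star_eq_adjoint,
    star_mul, hus, hvs, h.mul_comm v hv u hu]

end Assembly

end CSGame

open CSGame Complex in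
open scoped InnerProductSpace in
/-- Let `S = (X, {(Vᵢ, Cᵢ)})` be a constraint system over a finite
alphabet `Σ`, `π` a strictly positive distribution on `[m]`, and `G(S,π)` the
constraint-variable CS game.  If `c` is a commuting operator correlation with
`w(c) ≥ 1 - ε`, then there is a tracial correlation `c'` (in GNS form) with
`w(c') ≥ 1 - 148 (L ε)^{1/4}`, where `L = maxᵢ |Vᵢ|`. -/
theorem cs_game_almost_perfect_commuting_operator_near_tracial
    {X : Type} [Fintype X] [Nonempty X]
    {Sig : Type} [Fintype Sig] [Nonempty Sig]
    {m : ℕ} (hm : 0 < m)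
    (Vs : Fin m → Finset X) (hVs : ∀ i, (Vs i).Nonempty)
    (C : ∀ i : Fin m, Finset ({x // x ∈ Vs i} → Sig)) (hC : ∀ i, (C i).Nonempty)
    (π : Fin m → ℝ) (hπ : ∀ i, 0 < π i) (hπ1 : ∑ i, π i = 1)
    -- `c` is a commuting operator correlation for `G(S,π)`
    {H : Type} [NormedAddCommGroup H] [InnerProductSpace ℂ H] [CompleteSpace H]
    (P : ∀ i : Fin m, {f // f ∈ C i} → H →L[ℂ] H)
    (Q : X → Sig → H →L[ℂ] H)
    (hP : ∀ i φ, (P i φ).IsPositive) (hPsum : ∀ i, ∑ φ, P i φ = 1)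
    (hQ : ∀ x σ, (Q x σ).IsPositive) (hQsum : ∀ x, ∑ σ, Q x σ = 1)
    (hcomm : ∀ i x φ σ, P i φ * Q x σ = Q x σ * P i φ)
    (ψ : H) (hψ : ‖ψ‖ = 1)
    (c : ∀ (i : Fin m) (x : X), {f // f ∈ C i} → Sig → ℝ)
    (hc : ∀ i x φ σ, (c i x φ σ : ℂ) = @inner ℂ H _ ψ ((P i φ * Q x σ) ψ))
    -- the strategy wins with probability at least `1 - ε`
    (ε : ℝ)
    (hw : 1 - ε ≤ ∑ i, ∑ x ∈ (Vs i).attach,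
      (π i / (Vs i).card) * ∑ φ : {f // f ∈ C i}, c i x.1 φ (φ.1 x)) :
    ∃ (K : Type) (_ : NormedAddCommGroup K) (_ : InnerProductSpace ℂ K)
      (_ : CompleteSpace K) (ξ : K)
      (r : ∀ i : Fin m, {f // f ∈ C i} → K →L[ℂ] K)
      (s : X → Sig → K →L[ℂ] K)
      (c' : ∀ (i : Fin m) (x : X), {f // f ∈ C i} → Sig → ℝ),
      ‖ξ‖ = 1 ∧
      (∀ i φ, IsSelfAdjoint (r i φ) ∧ r i φ * r i φ = r i φ) ∧ (∀ i, ∑ φ, r i φ = 1) ∧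
      (∀ x σ, IsSelfAdjoint (s x σ) ∧ s x σ * s x σ = s x σ) ∧ (∀ x, ∑ σ, s x σ = 1) ∧
      (∀ u v : K →L[ℂ] K,
        u ∈ StarAlgebra.adjoin ℂ ({T | ∃ i φ, T = r i φ} ∪ {T | ∃ x σ, T = s x σ}) →
        v ∈ StarAlgebra.adjoin ℂ ({T | ∃ i φ, T = r i φ} ∪ {T | ∃ x σ, T = s x σ}) →
        @inner ℂ K _ ξ ((u * v) ξ) = @inner ℂ K _ ξ ((v * u) ξ)) ∧
      (∀ i x φ σ, (c' i x φ σ : ℂ) = @inner ℂ K _ ξ ((r i φ * s x σ) ξ)) ∧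
      1 - 148 * ((Finset.univ.sup fun i => (Vs i).card : ℕ) * ε) ^ ((1 : ℝ)/4)
        ≤ ∑ i, ∑ x ∈ (Vs i).attach,
            (π i / (Vs i).card) * ∑ φ : {f // f ∈ C i}, c' i x.1 φ (φ.1 x) := by
  classical
  obtain ⟨σ₀⟩ := ‹Nonempty Sig›
  have : ∀ i, Nonempty {f // f ∈ C i} := fun i => (hC i).to_subtype
  let g : ∀ i, X → {f // f ∈ C i} → Sig := fun i x φ => if hx : x ∈ Vs i then φ.1 ⟨x, hx⟩ else σ₀
  have hgx : ∀ i (x : {x // x ∈ Vs i}) (φ : {f // f ∈ C i}), g i x.1 φ = φ.1 x :=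
    fun i x φ => dif_pos x.2
  have hg : ∀ i φ φ', φ ≠ φ' → ∃ x ∈ Vs i, g i x φ ≠ g i x φ' := by
    intro i φ φ' hne
    obtain ⟨x, hx⟩ := Function.ne_iff.1 (fun h => hne (Subtype.ext h))
    exact ⟨x.1, x.2, by rwa [hgx, hgx]⟩
  have hval : ∀ d : ∀ (i : Fin m) (x : X), {f // f ∈ C i} → Sig → ℝ,
      ∑ i, ∑ x ∈ (Vs i).attach, (π i / (Vs i).card) * ∑ φ : {f // f ∈ C i}, d i x.1 φ (φ.1 x) =
        ∑ i, (π i / (Vs i).card) * ∑ x ∈ Vs i, ∑ φ : {f // f ∈ C i}, d i x φ (g i x φ) := by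
    intro d
    refine Finset.sum_congr rfl fun i _ => ?_
    rw [Finset.mul_sum, ← Finset.sum_attach (Vs i)]
    refine Finset.sum_congr rfl fun x _ => ?_
    simp only [hgx]
  obtain ⟨e, he⟩ : ∃ e : Fin m → ℝ, ∀ i, e i =
      ∑ x ∈ Vs i, (1 - ∑ φ, (⟪ψ, (P i φ * Q x (g i x φ)) ψ⟫_ℂ).re) := ⟨_, fun _ => rfl⟩
  obtain ⟨he0, key⟩ := exists_tracial_strategy Vs g hg hP hPsum hQ hQsum hcomm hψ he
  have hcard : ∀ i, (0 : ℝ) < (Vs i).card := fun i => by exact_mod_cast (hVs i).card_pos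
  have hεsum : ∑ i, (π i / (Vs i).card) * e i ≤ ε := by
    rw [hval] at hw
    have h1 : ∀ i, (π i / (Vs i).card) * e i = π i -
        (π i / (Vs i).card) * ∑ x ∈ Vs i, ∑ φ : {f // f ∈ C i}, c i x φ (g i x φ) := by
      intro i
      have h2 : e i = (Vs i).card - ∑ x ∈ Vs i, ∑ φ : {f // f ∈ C i}, c i x φ (g i x φ) := by
        rw [he, Finset.sum_sub_distrib]
        simp only [← hc, ofReal_re, Finset.sum_const, nsmul_eq_mul, mul_one]
      rw [h2, mul_sub, div_mul_cancel₀ _ (hcard i).ne']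
    simp only [h1, Finset.sum_sub_distrib, hπ1]
    linarith
  set L : ℕ := Finset.univ.sup fun i => (Vs i).card with hL
  have ht : ∑ i, π i * e i ≤ L * ε := by
    refine le_trans ?_ (mul_le_mul_of_nonneg_left hεsum (Nat.cast_nonneg L))
    rw [Finset.mul_sum]
    refine Finset.sum_le_sum fun i _ => ?_
    have h1 : ((Vs i).card : ℝ) ≤ L := by
      exact_mod_cast Finset.le_sup (f := fun i => (Vs i).card) (Finset.mem_univ i)
    have h2 : 0 ≤ (π i / (Vs i).card) * e i :=
      mul_nonneg (div_nonneg (hπ i).le (hcard i).le) (he0 i)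
    calc π i * e i = (Vs i).card * ((π i / (Vs i).card) * e i) := by
          rw [← mul_assoc, mul_div_cancel₀ _ (hcard i).ne']
      _ ≤ _ := mul_le_mul_of_nonneg_right h1 h2
  have ht1 : 0 ≤ ∑ i, π i * e i := Finset.sum_nonneg fun i _ => mul_nonneg (hπ i).le (he0 i)
  have ht0 : 0 ≤ L * ε := ht1.trans ht
  obtain ⟨K, i₁, i₂, i₃, ξ, N, r, s, hN, hr, hs, hrs⟩ := key (√(L * ε)) (Real.sqrt_nonneg _) (by
    intro h i
    rw [Real.sqrt_eq_zero ht0] at h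
    rw [h] at ht
    have h1 := (Finset.sum_eq_zero_iff_of_nonneg fun i _ => mul_nonneg (hπ i).le (he0 i)).1
      (le_antisymm ht ht1) i (Finset.mem_univ i)
    exact (mul_eq_zero.1 h1).resolve_left (hπ i).ne')
  rw [Real.sq_sqrt ht0] at hrs
  have hsub : StarAlgebra.adjoin ℂ ({T | ∃ i φ, T = r i φ} ∪ {T | ∃ x σ, T = s x σ}) ≤
      N.toStarSubalgebra := by
    refine StarAlgebra.adjoin_le ?_
    rintro _ (⟨i, φ, rfl⟩ | ⟨x, σ, rfl⟩)
    · exact (hr i).mem φ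
    · exact (hs x).mem σ
  refine ⟨K, i₁, i₂, i₃, ξ, r, s, fun i x φ σ => tr ξ (r i φ * s x σ), hN.norm_eq_one,
    fun i φ => ⟨(hr i).star_eq φ, (hr i).mul_self φ⟩, fun i => (hr i).sum_eq_one,
    fun x σ => ⟨(hs x).star_eq σ, (hs x).mul_self σ⟩, fun x => (hs x).sum_eq_one,
    fun u v hu hv => hN.mul_comm u (hsub hu) v (hsub hv), fun i x φ σ => hN.ofReal_tr_mul
      ((hr i).mem φ) ((hs x).mem σ) ((hr i).star_eq φ) ((hs x).star_eq σ), ?_⟩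
  rw [hval fun i x φ σ => tr ξ (r i φ * s x σ)]
  refine one_sub_rpow_le ht0 ?_ ((sum_mul_one_sub_sqrt_ge hπ hπ1 he0 ht).trans ?_)
  · refine Finset.sum_nonneg fun i _ => mul_nonneg (div_nonneg (hπ i).le (hcard i).le)
      (Finset.sum_nonneg fun x _ => Finset.sum_nonneg fun φ _ => ?_)
    exact hN.tr_mul_nonneg ((hr i).mem _) ((hs x).mem _)
      (isPositive_of_star_mul_self ((hr i).star_eq _) ((hr i).mul_self _))
      (isPositive_of_star_mul_self ((hs x).star_eq _) ((hs x).mul_self _))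
  · refine Finset.sum_le_sum fun i _ => ?_
    rw [div_mul_eq_mul_div, mul_div_assoc]
    refine mul_le_mul_of_nonneg_left ?_ (hπ i).le
    rw [le_div_iff₀ (hcard i), mul_comm, ← nsmul_eq_mul]
    exact Finset.card_nsmul_le_sum _ _ _ fun x hx => hrs i x hx
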